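/- Let n ≥ 1, let Ω ⊂ ℝⁿ be a domain, let 0 < r₁ < r₂, let D = {x ∈ ℝⁿ : r₁ < |x| < r₂} satisfy D ⊂⊂ Ω, and let ω ⊂⊂ D. Assume the standing hypotheses on f and V with any exponent p > 1, assume V(x) ≥ c₀ for all x ∈ D and some c₀ > 0, and assume that V and u are radially symmetric (V(x) depends only on |x| and u(t,x) only on t and |x|). Let T > 0 and let u be a nonnegative classical solution of u_t = Δu + V(x)f(u) on (0,T)×Ω such that u(t,x) ≤ M(T−t)^{−α} for all (t,x) ∈ (T/4,T)×D and some M > 0. Then for each ε > 0 there exists a constant C_ε > 0 such that |∂_t u(t,x) − V(x)f(u(t,x))| ≤ ε·u(t,x)^p + C_ε for all (t,x) ∈ [T/2,T)×ω. -/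

import Mathlib

open Set Metric Filter

noncomputable def lap {n : ℕ} (g : EuclideanSpace ℝ (Fin n) → ℝ)
    (x : EuclideanSpace ℝ (Fin n)) : ℝ :=
  ∑ i : Fin n, fderiv ℝ (fun y => fderiv ℝ g y (EuclideanSpace.single i 1)) x
    (EuclideanSpace.single i 1)

noncomputable def gam (r x : ℝ) : ℝ := (√(4*Real.pi*r))⁻¹ * Real.exp (-x^2/(4*r))
noncomputable def g1 (r x : ℝ) : ℝ := -(x/(2*r)) * gam r x
noncomputable def g2 (r x : ℝ) : ℝ := (x^2/(4*r^2) - 1/(2*r)) * gam r x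
noncomputable def g3 (r x : ℝ) : ℝ := (-(x^3/(8*r^3)) + 3*x/(4*r^2)) * gam r x
noncomputable def g4 (r x : ℝ) : ℝ := (x^4/(16*r^4) - 3*x^2/(4*r^3) + 3/(4*r^2)) * gam r x

lemma gam_dx {r : ℝ} (hr : 0 < r) (x : ℝ) : HasDerivAt (gam r) (g1 r x) x := by
  have h : HasDerivAt (fun x : ℝ => -x^2/(4*r)) (-(2*x)/(4*r)) x :=
    ((((hasDerivAt_id x).pow 2).neg).div_const (4*r)).congr_deriv (by simp)
  refine (h.exp.const_mul (√(4*Real.pi*r))⁻¹).congr_deriv ?_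
  unfold g1 gam
  field_simp; ring

lemma gam_dr {r : ℝ} (hr : 0 < r) (x : ℝ) : HasDerivAt (fun r => gam r x) (g2 r x) r := by
  have hpi := Real.pi_pos
  have h1 : HasDerivAt (fun r : ℝ => √(4*Real.pi*r)) ((4*Real.pi)/(2*√(4*Real.pi*r))) r :=
    (((hasDerivAt_id r).const_mul (4*Real.pi)).sqrt (by simp; exact hr.ne')).congr_deriv (by simp)
  have hs : 0 < √(4*Real.pi*r) := Real.sqrt_pos.2 (by positivity)
  have h2 := h1.inv hs.ne'
  have h3 : HasDerivAt (fun r : ℝ => -x^2/(4*r)) (x^2/(4*r^2)) r := by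
    refine ((((hasDerivAt_id r).const_mul 4).inv (by simp; exact hr.ne')).const_mul (-x^2)).congr_deriv ?_
    simp; field_simp
  refine (h2.mul h3.exp).congr_deriv ?_
  unfold g2 gam
  have hq : √(4*Real.pi*r)^2 = 4*Real.pi*r := Real.sq_sqrt (by positivity)
  simp only [Pi.inv_apply]
  generalize √(4*Real.pi*r) = s at *
  have : (4*Real.pi) / (2*s) = s/(2*r) := by
    field_simp; nlinarith
  rw [this]
  field_simp; ring

lemma g1_dx {r : ℝ} (hr : 0 < r) (x : ℝ) : HasDerivAt (g1 r) (g2 r x) x := by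
  have h : HasDerivAt (fun x : ℝ => -(x/(2*r))) (-(1/(2*r))) x := ((hasDerivAt_id x).div_const (2*r)).neg
  refine (h.mul (gam_dx hr x)).congr_deriv ?_
  unfold g2 g1; field_simp; ring
lemma g2_dx {r : ℝ} (hr : 0 < r) (x : ℝ) : HasDerivAt (g2 r) (g3 r x) x := by
  have h : HasDerivAt (fun x : ℝ => (x^2/(4*r^2) - 1/(2*r))) (2*x/(4*r^2)) x :=
    ((((hasDerivAt_id x).pow 2).div_const (4*r^2)).sub_const (1/(2*r))).congr_deriv (by simp)
  refine (h.mul (gam_dx hr x)).congr_deriv ?_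
  unfold g3 g1; field_simp; ring
lemma g3_dx {r : ℝ} (hr : 0 < r) (x : ℝ) : HasDerivAt (g3 r) (g4 r x) x := by
  have h : HasDerivAt (fun x : ℝ => (-(x^3/(8*r^3)) + 3*x/(4*r^2))) (-(3*x^2/(8*r^3)) + 3/(4*r^2)) x := by
    have a := (((hasDerivAt_id x).pow 3).div_const (8*r^3)).neg
    have b := ((hasDerivAt_id x).const_mul 3).div_const (4*r^2)
    exact (a.add b).congr_deriv (by simp)
  refine (h.mul (gam_dx hr x)).congr_deriv ?_
  unfold g4 g1; field_simp; ring
lemma g1_dr {r : ℝ} (hr : 0 < r) (x : ℝ) : HasDerivAt (fun r => g1 r x) (g3 r x) r := by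
  have h : HasDerivAt (fun r : ℝ => -(x/(2*r))) (x/(2*r^2)) r := by
    refine ((((hasDerivAt_id r).const_mul 2).inv (by simp; exact hr.ne')).const_mul (x)).neg.congr_deriv ?_
    simp; field_simp
  refine (h.mul (gam_dr hr x)).congr_deriv ?_
  unfold g3 g2; field_simp; ring
lemma g2_dr {r : ℝ} (hr : 0 < r) (x : ℝ) : HasDerivAt (fun r => g2 r x) (g4 r x) r := by
  have h : HasDerivAt (fun r : ℝ => (x^2/(4*r^2) - 1/(2*r))) (-(x^2/(2*r^3)) + 1/(2*r^2)) r := by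
    have a := (((hasDerivAt_id r).const_mul 2).inv (by simp; exact hr.ne')).const_mul 1
    have b := ((((hasDerivAt_id r).pow 2).const_mul 4).inv (by simp; exact hr.ne')).const_mul (x^2)
    refine (b.sub a).congr_deriv ?_
    simp; field_simp; ring
  refine (h.mul (gam_dr hr x)).congr_deriv ?_
  unfold g4 g2; field_simp; ring

lemma gam_cd (r : ℝ) : ContDiff ℝ (⊤ : ℕ∞) (gam r) := by
  unfold gam; fun_prop
lemma gam_nonneg (r x : ℝ) : 0 ≤ gam r x := by unfold gam; positivity
lemma gam_int {r : ℝ} (hr : 0 < r) : ∫ x, gam r x = 1 := by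
  unfold gam
  rw [MeasureTheory.integral_const_mul]
  have : ∀ x : ℝ, -x^2/(4*r) = -(1/(4*r))*x^2 := fun x => by ring
  simp_rw [this]
  rw [integral_gaussian]
  have hpi := Real.pi_pos
  have : Real.pi / (1/(4*r)) = 4*Real.pi*r := by field_simp
  rw [this, inv_mul_cancel₀]
  exact (Real.sqrt_pos.2 (by positivity)).ne'
lemma gam_integrable {r : ℝ} (hr : 0 < r) : MeasureTheory.Integrable (gam r) := by
  by_contra h
  have := MeasureTheory.integral_undef h
  rw [gam_int hr] at this; norm_num at this

lemma exp_pow_bound (k : ℕ) (y : ℝ) (hy : 0 ≤ y) : (1+y)^k * Real.exp (-y^2/8) ≤ k.factorial * Real.exp 3 := by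
  have h1 := Real.pow_div_factorial_le_exp (1+y) (by linarith) k
  have h2 : Real.exp (1+y) ≤ Real.exp 3 * Real.exp (y^2/8) := by
    rw [← Real.exp_add]; apply Real.exp_le_exp.2; nlinarith [sq_nonneg (y-4)]
  have h3 : (0:ℝ) < k.factorial := by positivity
  rw [div_le_iff₀ h3] at h1
  have h4 : Real.exp (-y^2/8) = (Real.exp (y^2/8))⁻¹ := by rw [← Real.exp_neg]; ring_nf
  rw [h4, ← div_eq_mul_inv, div_le_iff₀ (Real.exp_pos _)]
  nlinarith

/-- the main Gaussian comparison -/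
lemma gam_comp {q x : ℝ} (hq : 0 < q) : (1+|x|/q)^5 * gam (q^2) x ≤ 2*(120*Real.exp 3) * gam (2*q^2) x := by
  have h := exp_pow_bound 5 (|x|/q) (by positivity)
  have hpi := Real.pi_pos
  have e1 : gam (q^2) x = √2 * (gam (2*q^2) x * Real.exp (-(|x|/q)^2/8)) := by
    unfold gam
    have : √(4*Real.pi*(2*q^2)) = √2 * √(4*Real.pi*q^2) := by
      rw [← Real.sqrt_mul (by norm_num)]; ring_nf
    rw [this]
    have e : -x^2/(4*q^2) = -x^2/(4*(2*q^2)) + -(|x|/q)^2/8 := by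
      rw [div_pow, sq_abs]; field_simp; ring
    rw [e, Real.exp_add]
    have : 0 < √(4*Real.pi*q^2) := Real.sqrt_pos.2 (by positivity)
    have : 0 < √(2:ℝ) := Real.sqrt_pos.2 (by norm_num)
    field_simp
  rw [e1]
  have h2 : √(2:ℝ) ≤ 2 := by rw [Real.sqrt_le_left (by norm_num)]; norm_num
  have hg := gam_nonneg (2*q^2) x
  have hf : ((5:ℕ).factorial : ℝ) = 120 := by norm_num [Nat.factorial]
  rw [hf] at h
  calc _ = √2 * (((1+|x|/q)^5 * Real.exp (-(|x|/q)^2/8)) * gam (2*q^2) x) := by ring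
    _ ≤ 2 * ((120*Real.exp 3) * gam (2*q^2) x) := by
      apply mul_le_mul h2 _ (by positivity) (by norm_num)
      exact mul_le_mul_of_nonneg_right h hg
    _ = _ := by ring

/-- bound of gam away from zero or in general -/
lemma gam_pt {q x : ℝ} (hq : 0 < q) : gam (q^2) x ≤ q⁻¹ * Real.exp (-(|x|/q)^2/8) := by
  unfold gam
  have hpi := Real.pi_gt_three
  have h1 : q ≤ √(4*Real.pi*q^2) := by
    apply Real.le_sqrt_of_sq_le; nlinarith [sq_nonneg q]
  apply mul_le_mul
  · exact inv_anti₀ hq h1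
  · apply Real.exp_le_exp.2
    rw [div_pow, sq_abs, neg_div, neg_div, neg_le_neg_iff, div_div, div_le_div_iff₀ (by positivity) (by positivity)]
    nlinarith [mul_nonneg (sq_nonneg x) (sq_nonneg q)]
  · positivity
  · positivity

lemma g_poly {q x : ℝ} (hq : 0 < q) :
    |g1 (q^2) x| ≤ (1+|x|/q)^4 * q⁻¹^1 * gam (q^2) x ∧ |g2 (q^2) x| ≤ (1+|x|/q)^4 * q⁻¹^2 * gam (q^2) x ∧
    |g3 (q^2) x| ≤ (1+|x|/q)^4 * q⁻¹^3 * gam (q^2) x ∧ |g4 (q^2) x| ≤ (1+|x|/q)^4 * q⁻¹^4 * gam (q^2) x ∧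
    gam (q^2) x ≤ (1+|x|/q)^4 * gam (q^2) x := by
  have hg := gam_nonneg (q^2) x
  set y := |x|/q with hy
  have hy0 : 0 ≤ y := by positivity
  have hx : |x| = y*q := by rw [hy]; field_simp
  have hx' : x = y*q ∨ x = -(y*q) := by
    rw [← hx]; rcases abs_cases x with h | h <;> [left; right] <;> linarith [h.1]
  have e4 : (1+y)^4 = 1+4*y+6*y^2+4*y^3+y^4 := by ring
  have p2 : 0 ≤ y^2 := by positivity
  have p3 : 0 ≤ y^3 := by positivity
  have p4 : 0 ≤ y^4 := by positivity
  have key : ∀ (k : ℕ) (P : ℝ), |P| ≤ (1+y)^4 → |P * q⁻¹^k * gam (q^2) x| ≤ (1+y)^4 * q⁻¹^k * gam (q^2) x := by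
    intro k P hP
    rw [abs_mul, abs_mul, abs_of_nonneg hg, abs_of_nonneg (by positivity : (0:ℝ) ≤ q⁻¹^k)]
    gcongr
  refine ⟨?_, ?_, ?_, ?_, ?_⟩
  · have : ∃ P, g1 (q^2) x = P * q⁻¹^1 * gam (q^2) x ∧ |P| ≤ (1+y)^4 := by
      rcases hx' with h | h
      · refine ⟨-(y/2), ?_, ?_⟩
        · unfold g1; rw [h]; field_simp
        · rw [abs_le]; constructor <;> rw [e4] <;> linarith
      · refine ⟨y/2, ?_, ?_⟩
        · unfold g1; rw [h]; field_simp; try ring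
        · rw [abs_le]; constructor <;> rw [e4] <;> linarith
    obtain ⟨P, h1, h2⟩ := this
    rw [h1]; exact key _ _ h2
  · have : g2 (q^2) x = (y^2/4-1/2) * q⁻¹^2 * gam (q^2) x := by
      unfold g2; rw [← sq_abs x, hx]; field_simp
    rw [this]; apply key; rw [abs_le]; constructor <;> rw [e4] <;> linarith
  · have : ∃ P, g3 (q^2) x = P * q⁻¹^3 * gam (q^2) x ∧ |P| ≤ (1+y)^4 := by
      rcases hx' with h | h
      · refine ⟨-(y^3/8)+3*y/4, ?_, ?_⟩
        · unfold g3; rw [h]; field_simp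
        · rw [abs_le]; constructor <;> rw [e4] <;> linarith
      · refine ⟨(y^3/8)-3*y/4, ?_, ?_⟩
        · unfold g3; rw [h]; field_simp; ring
        · rw [abs_le]; constructor <;> rw [e4] <;> linarith
    obtain ⟨P, h1, h2⟩ := this
    rw [h1]; exact key _ _ h2
  · have : g4 (q^2) x = (y^4/16-3*y^2/4+3/4) * q⁻¹^4 * gam (q^2) x := by
      unfold g4
      have : x^4 = (|x|^2)^2 := by rw [sq_abs]; ring
      rw [this, ← sq_abs x, hx]; field_simp
    rw [this]; apply key; rw [abs_le]; constructor <;> rw [e4] <;> linarith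
  · have : 1 ≤ (1+y)^4 := by rw [e4]; linarith
    nlinarith

structure Ker (ρ C : ℝ) (E R : ℕ → ℝ → ℝ → ℝ) : Prop where
  Cpos : 0 < C
  dx : ∀ i r, 0 < r → ∀ x, HasDerivAt (E i r) (E (i+1) r x) x
  dr : ∀ i, i ≤ 2 → ∀ r, 0 < r → ∀ x, HasDerivAt (fun r => E i r x) (E (i+2) r x + R i r x) r
  sE : ∀ i r x, ρ < |x| → E i r x = 0
  sR : ∀ i, i ≤ 2 → ∀ r x, ρ < |x| → R i r x = 0
  mR : ∀ i, i ≤ 2 → ∀ r, 0 < r → Continuous (R i r)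
  bR : ∀ i, i ≤ 2 → ∀ r, 0 < r → r ≤ 1 → ∀ x, |R i r x| ≤ C
  bE : ∀ i, i ≤ 4 → ∀ r, 0 < r → r ≤ 1 → ∀ x, |E i r x| ≤ C * (√r)⁻¹^(i+1)
  iE : ∀ i, i ≤ 4 → ∀ r, 0 < r → r ≤ 1 → ∫ x, |E i r x| ≤ C * (√r)⁻¹^i
  hE : ∀ β : ℝ, 0 < β → β ≤ 1 → ∀ r, 0 < r → r ≤ 1 → ∫ x, |E 2 r x| * |x|^β ≤ C * (√r)^(β-2)
  nE : ∀ r x, 0 ≤ E 0 r x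
  mE : ∀ r, 0 < r → r ≤ 1 → |(∫ x, E 0 r x) - 1| ≤ C * √r
  lE : ∀ r, 0 < r → r ≤ 1 → ∫ x, E 0 r x * |x| ≤ C * √r

lemma hasDerivAt_iteratedDeriv {f : ℝ → ℝ} (hf : ContDiff ℝ (⊤ : ℕ∞) f) (i : ℕ) (x : ℝ) :
    HasDerivAt (iteratedDeriv i f) (iteratedDeriv (i+1) f x) x := by
  rw [iteratedDeriv_succ]
  apply DifferentiableAt.hasDerivAt
  exact (hf.differentiable_iteratedDeriv i (by exact_mod_cast WithTop.coe_lt_top _)).differentiableAt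

lemma iteratedDeriv_zero_off {f : ℝ → ℝ} {s : Set ℝ} (hs : IsOpen s) (c : ℝ) (hf : ∀ x ∈ s, f x = c) (i : ℕ) (hi : i ≠ 0 ∨ c = 0) :
    ∀ x ∈ s, iteratedDeriv i f x = 0 := by
  induction i with
  | zero => intro x hx; simp at hi; simp [hf x hx, hi]
  | succ k ih =>
    intro x hx
    rw [iteratedDeriv_succ]
    have : iteratedDeriv k f =ᶠ[nhds x] fun _ => (if k = 0 then c else 0) := by
      filter_upwards [hs.mem_nhds hx] with y hy
      split_ifs with h
      · subst h; simp [hf y hy]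
      · exact ih (Or.inl h) y hy
    rw [this.deriv_eq]; simp

lemma chi_exists (ρ : ℝ) (hρ : 0 < ρ) : ∃ X : ℕ → ℝ → ℝ, ∃ A : ℝ, 0 < A ∧ ContDiff ℝ (⊤ : ℕ∞) (X 0) ∧
    (∀ i x, HasDerivAt (X i) (X (i+1) x) x) ∧ (∀ i x, ρ < |x| → X i x = 0) ∧ (∀ i, i ≠ 0 → ∀ x, |x| < ρ/2 → X i x = 0) ∧
    (∀ x, |x| < ρ/2 → X 0 x = 1) ∧ (∀ x, 0 ≤ X 0 x ∧ X 0 x ≤ 1) ∧ (∀ i, i ≤ 4 → ∀ x, |X i x| ≤ A) := by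
  let b : ContDiffBump (0:ℝ) := ⟨ρ/2, ρ, by linarith, by linarith⟩
  have hb : ContDiff ℝ (⊤ : ℕ∞) (b : ℝ → ℝ) := b.contDiff
  have hd := fun i x => hasDerivAt_iteratedDeriv hb i x
  have h0 : ∀ i x, ρ < |x| → iteratedDeriv i (b : ℝ → ℝ) x = 0 := by
    intro i x hx
    refine iteratedDeriv_zero_off (s := {x | ρ < |x|}) (isOpen_lt continuous_const continuous_abs) 0 ?_ i (Or.inr rfl) x hx
    intro y hy
    apply b.zero_of_le_dist; simp [b]; exact le_of_lt hy
  have h1 : ∀ x, |x| < ρ/2 → b x = 1 := by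
    intro x hx; apply b.one_of_mem_closedBall; simp [b]; exact hx.le
  have hB : ∀ i, ∃ A, ∀ x, |iteratedDeriv i (b : ℝ → ℝ) x| ≤ A := by
    intro i
    have hc : HasCompactSupport (iteratedDeriv i (b : ℝ → ℝ)) := by
      apply HasCompactSupport.intro (isCompact_Icc (a := -ρ) (b := ρ))
      intro x hx
      apply h0
      by_contra h
      exact hx (abs_le.1 (not_lt.1 h))
    have hcont : Continuous (iteratedDeriv i (b : ℝ → ℝ)) :=
      continuous_iff_continuousAt.2 fun x => (hd i x).continuousAt
    obtain ⟨A, hA⟩ := hc.exists_bound_of_continuous hcont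
    exact ⟨A, hA⟩
  choose A hA using hB
  refine ⟨fun i => iteratedDeriv i (b : ℝ → ℝ), 1 + ∑ i ∈ Finset.range 5, |A i|, by positivity, by simpa using hb, hd, h0, ?_, by simpa using h1,
    fun x => by simpa using ⟨b.nonneg, b.le_one⟩, ?_⟩
  · intro i hi x hx
    exact iteratedDeriv_zero_off (s := {x | |x| < ρ/2}) (isOpen_lt continuous_abs continuous_const) 1 h1 i (Or.inl hi) x hx
  · intro i hi x
    have := Finset.single_le_sum (f := fun i => |A i|) (fun i _ => abs_nonneg _) (Finset.mem_range.2 (by omega : i < 5))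
    have h2 := hA i x
    have h3 := le_abs_self (A i)
    dsimp only at this ⊢
    linarith

set_option maxHeartbeats 2000000 in
lemma Ker_exists (ρ : ℝ) (hρ : 0 < ρ) : ∃ C E R, Ker ρ C E R := by
  obtain ⟨X, A, hA, hXc, hX, hX0, hX1, hXone, hX01, hXA⟩ := chi_exists ρ hρ
  have hEc : ∀ r, ContDiff ℝ (⊤ : ℕ∞) (fun x => X 0 x * gam r x) := fun r => hXc.mul (gam_cd r)
  set E : ℕ → ℝ → ℝ → ℝ := fun i r => iteratedDeriv i (fun x => X 0 x * gam r x) with hE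
  let R : ℕ → ℝ → ℝ → ℝ := fun i r x => match i with
    | 0 => -(X 2 x * gam r x + 2 * X 1 x * g1 r x)
    | 1 => -(X 3 x * gam r x + 3 * X 2 x * g1 r x + 2 * X 1 x * g2 r x)
    | 2 => -(X 4 x * gam r x + 4 * X 3 x * g1 r x + 5 * X 2 x * g2 r x + 2 * X 1 x * g3 r x)
    | _ => 0
  have hEd : ∀ i r x, HasDerivAt (E i r) (E (i+1) r x) x := fun i r x => hasDerivAt_iteratedDeriv (hEc r) i x
  have e0 : ∀ r, E 0 r = fun x => X 0 x * gam r x := by intro r; simp [hE]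
  have e1 : ∀ r, 0 < r → E 1 r = fun x => X 1 x * gam r x + X 0 x * g1 r x := by
    intro r hr; funext x
    refine (hEd 0 r x).unique ?_
    rw [e0]
    exact (hX 0 x).mul (gam_dx hr x)
  have e2 : ∀ r, 0 < r → E 2 r = fun x => X 2 x * gam r x + 2 * X 1 x * g1 r x + X 0 x * g2 r x := by
    intro r hr; funext x
    refine (hEd 1 r x).unique ?_
    rw [e1 r hr]
    exact (((hX 1 x).mul (gam_dx hr x)).add ((hX 0 x).mul (g1_dx hr x))).congr_deriv (by ring)
  have e3 : ∀ r, 0 < r → E 3 r = fun x => X 3 x * gam r x + 3 * X 2 x * g1 r x + 3 * X 1 x * g2 r x + X 0 x * g3 r x := by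
    intro r hr; funext x
    refine (hEd 2 r x).unique ?_
    rw [e2 r hr]
    exact ((((hX 2 x).mul (gam_dx hr x)).add (((hX 1 x).const_mul 2).mul (g1_dx hr x))).add
      ((hX 0 x).mul (g2_dx hr x))).congr_deriv (by ring)
  have e4 : ∀ r, 0 < r → E 4 r = fun x => X 4 x * gam r x + 4 * X 3 x * g1 r x + 6 * X 2 x * g2 r x + 4 * X 1 x * g3 r x + X 0 x * g4 r x := by
    intro r hr; funext x
    refine (hEd 3 r x).unique ?_
    rw [e3 r hr]
    exact (((((hX 3 x).mul (gam_dx hr x)).add (((hX 2 x).const_mul 3).mul (g1_dx hr x))).add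
      (((hX 1 x).const_mul 3).mul (g2_dx hr x))).add ((hX 0 x).mul (g3_dx hr x))).congr_deriv (by ring)
  have cX : ∀ i, Continuous (X i) := fun i => continuous_iff_continuousAt.2 fun x => (hX i x).continuousAt
  have c0 : ∀ r, 0 < r → Continuous (gam r) := fun r hr => continuous_iff_continuousAt.2 fun x => (gam_dx hr x).continuousAt
  have c1 : ∀ r, 0 < r → Continuous (g1 r) := fun r hr => continuous_iff_continuousAt.2 fun x => (g1_dx hr x).continuousAt
  have c2 : ∀ r, 0 < r → Continuous (g2 r) := fun r hr => continuous_iff_continuousAt.2 fun x => (g2_dx hr x).continuousAt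
  have c3 : ∀ r, 0 < r → Continuous (g3 r) := fun r hr => continuous_iff_continuousAt.2 fun x => (g3_dx hr x).continuousAt
  have cE : ∀ i r, Continuous (E i r) := fun i r => continuous_iff_continuousAt.2 fun x => (hEd i r x).continuousAt
  set C1 : ℝ := 16 * A * (2*(120*Real.exp 3)) with hC1
  have C1pos : 0 < C1 := by positivity
  -- main pointwise bound
  have main : ∀ i, i ≤ 4 → ∀ q, 0 < q → q ≤ 1 → ∀ x, |E i (q^2) x| * (1+|x|/q) ≤ C1 * q⁻¹^i * gam (2*q^2) x := by
    intro i hi q hq hq1 x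
    have hy : 0 ≤ |x|/q := by positivity
    have hg := gam_nonneg (q^2) x
    obtain ⟨b1, b2, b3, b4, b0⟩ := g_poly (x := x) hq
    have hinv : 1 ≤ q⁻¹ := (one_le_inv₀ hq).2 hq1
    set Y := (1+|x|/q)^4 * gam (q^2) x with hY
    have hY0 : 0 ≤ Y := by positivity
    have hm : ∀ a b : ℕ, a ≤ b → q⁻¹^a ≤ q⁻¹^b := fun a b hab => pow_le_pow_right₀ hinv hab
    have key : |E i (q^2) x| ≤ 16 * A * q⁻¹^i * Y := by
      have bb : ∀ (j : ℕ) (w g : ℝ) (a : ℕ), a ≤ i → j ≤ 4 → |g| ≤ q⁻¹^a * Y → 0 ≤ w → |w * X j x * g| ≤ w * (A * q⁻¹^i * Y) := by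
        intro j w g a ha hj hgg hw
        rw [abs_mul, abs_mul, abs_of_nonneg hw, mul_assoc]
        apply mul_le_mul_of_nonneg_left _ hw
        have h1 := hXA j hj x
        have h2 := hm a i ha
        calc |X j x| * |g| ≤ A * (q⁻¹^i * Y) := by
              apply mul_le_mul h1 (hgg.trans _) (abs_nonneg _) hA.le
              gcongr
          _ = _ := by ring
      have b0' : |gam (q^2) x| ≤ q⁻¹^0 * Y := by rw [abs_of_nonneg hg]; simpa using b0
      have b1' : |g1 (q^2) x| ≤ q⁻¹^1 * Y := b1.trans (le_of_eq (by rw [hY]; ring))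
      have b2' : |g2 (q^2) x| ≤ q⁻¹^2 * Y := b2.trans (le_of_eq (by rw [hY]; ring))
      have b3' : |g3 (q^2) x| ≤ q⁻¹^3 * Y := b3.trans (le_of_eq (by rw [hY]; ring))
      have b4' : |g4 (q^2) x| ≤ q⁻¹^4 * Y := b4.trans (le_of_eq (by rw [hY]; ring))
      have hZ : 0 ≤ A * q⁻¹^i * Y := by positivity
      have hr : 0 < q^2 := by positivity
      interval_cases i
      · rw [e0]
        have := bb 0 1 _ 0 (by norm_num) (by norm_num) b0' (by norm_num)
        rw [one_mul] at this; dsimp only; linarith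
      · rw [e1 _ hr]
        have a1 := bb 1 1 _ 0 (by norm_num) (by norm_num) b0' (by norm_num)
        have a2 := bb 0 1 _ 1 (by norm_num) (by norm_num) b1' (by norm_num)
        rw [one_mul] at a1 a2
        have := abs_add_le (X 1 x * gam (q^2) x) (X 0 x * g1 (q^2) x)
        dsimp only; linarith
      · rw [e2 _ hr]
        have a1 := bb 2 1 _ 0 (by norm_num) (by norm_num) b0' (by norm_num)
        have a2 := bb 1 2 _ 1 (by norm_num) (by norm_num) b1' (by norm_num)
        have a3 := bb 0 1 _ 2 (by norm_num) (by norm_num) b2' (by norm_num)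
        rw [one_mul] at a1 a3
        have := abs_add_three (X 2 x * gam (q^2) x) (2 * X 1 x * g1 (q^2) x) (X 0 x * g2 (q^2) x)
        dsimp only; linarith
      · rw [e3 _ hr]
        have a1 := bb 3 1 _ 0 (by norm_num) (by norm_num) b0' (by norm_num)
        have a2 := bb 2 3 _ 1 (by norm_num) (by norm_num) b1' (by norm_num)
        have a3 := bb 1 3 _ 2 (by norm_num) (by norm_num) b2' (by norm_num)
        have a4 := bb 0 1 _ 3 (by norm_num) (by norm_num) b3' (by norm_num)
        rw [one_mul] at a1 a4
        have := abs_add_three (X 3 x * gam (q^2) x) (3 * X 2 x * g1 (q^2) x) (3 * X 1 x * g2 (q^2) x)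
        have := abs_add_le (X 3 x * gam (q^2) x + 3 * X 2 x * g1 (q^2) x + 3 * X 1 x * g2 (q^2) x) (X 0 x * g3 (q^2) x)
        dsimp only; linarith
      · rw [e4 _ hr]
        have a1 := bb 4 1 _ 0 (by norm_num) (by norm_num) b0' (by norm_num)
        have a2 := bb 3 4 _ 1 (by norm_num) (by norm_num) b1' (by norm_num)
        have a3 := bb 2 6 _ 2 (by norm_num) (by norm_num) b2' (by norm_num)
        have a4 := bb 1 4 _ 3 (by norm_num) (by norm_num) b3' (by norm_num)
        have a5 := bb 0 1 _ 4 (by norm_num) (by norm_num) b4' (by norm_num)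
        rw [one_mul] at a1 a5
        have := abs_add_three (X 4 x * gam (q^2) x) (4 * X 3 x * g1 (q^2) x) (6 * X 2 x * g2 (q^2) x)
        have := abs_add_three (X 4 x * gam (q^2) x + 4 * X 3 x * g1 (q^2) x + 6 * X 2 x * g2 (q^2) x) (4 * X 1 x * g3 (q^2) x) (X 0 x * g4 (q^2) x)
        dsimp only; linarith
    calc _ ≤ 16 * A * q⁻¹^i * Y * (1+|x|/q) := by gcongr
      _ = 16 * A * q⁻¹^i * ((1+|x|/q)^5 * gam (q^2) x) := by rw [hY]; ring
      _ ≤ 16 * A * q⁻¹^i * (2*(120*Real.exp 3) * gam (2*q^2) x) := by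
          exact mul_le_mul_of_nonneg_left (gam_comp hq) (by positivity)
      _ = _ := by rw [hC1]; ring
  have mainI : ∀ i, i ≤ 4 → ∀ q, 0 < q → q ≤ 1 → ∀ φ : ℝ → ℝ, ∀ D : ℝ, 0 ≤ D → (∀ x, 0 ≤ φ x ∧ φ x ≤ D * (1+|x|/q)) →
      ∫ x, |E i (q^2) x| * φ x ≤ C1 * q⁻¹^i * D := by
    intro i hi q hq hq1 φ D hD hφ
    have hI : MeasureTheory.Integrable (fun x => D * (C1 * q⁻¹^i * gam (2*q^2) x)) :=
      ((gam_integrable (by positivity)).const_mul _).const_mul _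
    calc _ ≤ ∫ x, D * (C1 * q⁻¹^i * gam (2*q^2) x) := by
          apply MeasureTheory.integral_mono_of_nonneg (MeasureTheory.ae_of_all _ fun x => mul_nonneg (abs_nonneg _) (hφ x).1) hI
          refine MeasureTheory.ae_of_all _ fun x => ?_
          have := main i hi q hq hq1 x
          calc |E i (q^2) x| * φ x ≤ |E i (q^2) x| * (D * (1+|x|/q)) := by gcongr; exact (hφ x).2
            _ = D * (|E i (q^2) x| * (1+|x|/q)) := by ring
            _ ≤ _ := mul_le_mul_of_nonneg_left this hD
      _ = C1 * q⁻¹^i * D := by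
          rw [MeasureTheory.integral_const_mul, MeasureTheory.integral_const_mul, gam_int (by positivity)]; ring
  have sq' : ∀ r : ℝ, 0 < r → (√r)^2 = r := fun r hr => Real.sq_sqrt hr.le
  have hsq1 : ∀ r : ℝ, r ≤ 1 → √r ≤ 1 := fun r h => by rw [Real.sqrt_le_one]; exact h
  -- the R bound
  set C2 : ℝ := 12 * A * ((max 1 (2/ρ))^4 * (40320 * Real.exp 3)) with hC2
  have hm1 : 1 ≤ max 1 (2/ρ) := le_max_left _ _
  have hRb : ∀ i, i ≤ 2 → ∀ r, 0 < r → r ≤ 1 → ∀ x, |R i r x| ≤ C2 := by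
    intro i hi r hr hr1 x
    by_cases hx : |x| < ρ/2
    · have z := fun i hi => hX1 i hi x hx
      have : R i r x = 0 := by
        interval_cases i <;> simp [R, z]
      rw [this]; simp; positivity
    push Not at hx
    obtain ⟨q, hq, hqr⟩ : ∃ q, 0 < q ∧ q^2 = r := ⟨√r, Real.sqrt_pos.2 hr, sq' r hr⟩
    have hq1 : q ≤ 1 := by nlinarith
    subst hqr
    obtain ⟨b1, b2, b3, -, b0⟩ := g_poly (x := x) hq
    set y := |x|/q with hy
    have hy0 : 0 ≤ y := by positivity
    set m := max 1 (2/ρ) with hm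
    have hqi : q⁻¹ ≤ m * (1+y) := by
      have h1 : 2/ρ ≤ m := le_max_right _ _
      have h2 : q⁻¹ ≤ 2/ρ * y := by
        rw [hy]; field_simp; linarith
      calc q⁻¹ ≤ 2/ρ*y := h2
        _ ≤ m * (1+y) := by gcongr; linarith
    set B := m^4 * (40320 * Real.exp 3) with hB
    have hg := gam_pt (x := x) hq
    have gb : ∀ k : ℕ, k ≤ 3 → (1+y)^4 * q⁻¹^k * gam (q^2) x ≤ B := by
      intro k hk
      have h8 := exp_pow_bound 8 y hy0
      have : ((8:ℕ).factorial : ℝ) = 40320 := by norm_num [Nat.factorial]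
      rw [this] at h8
      calc (1+y)^4 * q⁻¹^k * gam (q^2) x ≤ (1+y)^4 * q⁻¹^k * (q⁻¹ * Real.exp (-y^2/8)) := by gcongr
        _ = (1+y)^4 * q⁻¹^(k+1) * Real.exp (-y^2/8) := by ring
        _ ≤ (1+y)^4 * (m*(1+y))^(k+1) * Real.exp (-y^2/8) := by gcongr
        _ ≤ (1+y)^4 * (m*(1+y))^4 * Real.exp (-y^2/8) := by
            gcongr
            · nlinarith
            · omega
        _ = m^4 * ((1+y)^8 * Real.exp (-y^2/8)) := by ring
        _ ≤ _ := by rw [hB]; gcongr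
    have b0' : |gam (q^2) x| ≤ B := by
      rw [abs_of_nonneg (gam_nonneg _ _)]; exact b0.trans (by simpa using gb 0 (by norm_num))
    have b1' := b1.trans (gb 1 (by norm_num))
    have b2' := b2.trans (gb 2 (by norm_num))
    have b3' := b3.trans (gb 3 (by norm_num))
    have hB0 : 0 ≤ B := by positivity
    have bb : ∀ (j : ℕ) (w g : ℝ), j ≤ 4 → |g| ≤ B → 0 ≤ w → |w * X j x * g| ≤ w * (A * B) := by
      intro j w g hj hgg hw
      rw [abs_mul, abs_mul, abs_of_nonneg hw, mul_assoc]
      apply mul_le_mul_of_nonneg_left _ hw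
      exact mul_le_mul (hXA j hj x) hgg (abs_nonneg _) hA.le
    have hAB : 0 ≤ A * B := by positivity
    have hfin : 12 * (A*B) = C2 := by rw [hC2]; ring
    rw [← hfin]
    interval_cases i
    · simp only [R]; rw [abs_neg]
      have a1 := bb 2 1 _ (by norm_num) b0' (by norm_num)
      have a2 := bb 1 2 _ (by norm_num) b1' (by norm_num)
      rw [one_mul] at a1
      have := abs_add_le (X 2 x * gam (q^2) x) (2 * X 1 x * g1 (q^2) x)
      linarith
    · simp only [R]; rw [abs_neg]
      have a1 := bb 3 1 _ (by norm_num) b0' (by norm_num)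
      have a2 := bb 2 3 _ (by norm_num) b1' (by norm_num)
      have a3 := bb 1 2 _ (by norm_num) b2' (by norm_num)
      rw [one_mul] at a1
      have := abs_add_three (X 3 x * gam (q^2) x) (3 * X 2 x * g1 (q^2) x) (2 * X 1 x * g2 (q^2) x)
      linarith
    · simp only [R]; rw [abs_neg]
      have a1 := bb 4 1 _ (by norm_num) b0' (by norm_num)
      have a2 := bb 3 4 _ (by norm_num) b1' (by norm_num)
      have a3 := bb 2 5 _ (by norm_num) b2' (by norm_num)
      have a4 := bb 1 2 _ (by norm_num) b3' (by norm_num)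
      rw [one_mul] at a1
      have := abs_add_three (X 4 x * gam (q^2) x) (4 * X 3 x * g1 (q^2) x) (5 * X 2 x * g2 (q^2) x)
      have := abs_add_le (X 4 x * gam (q^2) x + 4 * X 3 x * g1 (q^2) x + 5 * X 2 x * g2 (q^2) x) (2 * X 1 x * g3 (q^2) x)
      linarith
  set C3 := (2/ρ) * (2*(120*Real.exp 3)) with hC3
  have C2pos : 0 < C2 := by positivity
  have C3pos : 0 < C3 := by positivity
  have le1 : C1 ≤ C1 + C2 + C3 := by linarith
  refine ⟨C1 + C2 + C3, E, R, ⟨by positivity, fun i r _ x => hEd i r x, ?_, ?_, ?_, ?_, ?_, ?_, ?_, ?_, ?_, ?_, ?_⟩⟩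
  · intro i hi r hr x
    have hev : ∀ᶠ r' in nhds r, 0 < r' := lt_mem_nhds hr
    interval_cases i
    · refine HasDerivAt.congr_deriv ((gam_dr hr x).const_mul (X 0 x) |>.congr_of_eventuallyEq ?_) ?_
      · filter_upwards [hev] with r' hr'; rw [e0]
      · simp only [R]; rw [show E (0+2) = E 2 from rfl, e2 r hr]; ring
    · refine HasDerivAt.congr_deriv ((((gam_dr hr x).const_mul (X 1 x)).add ((g1_dr hr x).const_mul (X 0 x))) |>.congr_of_eventuallyEq ?_) ?_
      · filter_upwards [hev] with r' hr'; rw [e1 _ hr']; rfl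
      · simp only [R]; rw [show E (1+2) = E 3 from rfl, e3 r hr]; ring
    · refine HasDerivAt.congr_deriv (((((gam_dr hr x).const_mul (X 2 x)).add ((g1_dr hr x).const_mul (2 * X 1 x))).add ((g2_dr hr x).const_mul (X 0 x))) |>.congr_of_eventuallyEq ?_) ?_
      · filter_upwards [hev] with r' hr'; rw [e2 _ hr']; rfl
      · simp only [R]; rw [show E (2+2) = E 4 from rfl, e4 r hr]; ring
  · intro i r x hx
    refine iteratedDeriv_zero_off (s := {x | ρ < |x|}) (isOpen_lt continuous_const continuous_abs) 0 ?_ i (Or.inr rfl) x hx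
    intro y hy; rw [hX0 0 y hy]; simp
  · intro i hi r x hx
    have z := fun i => hX0 i x hx
    interval_cases i <;> simp [R, z]
  · intro i hi r hr
    have d0 := c0 r hr
    have d1 := c1 r hr
    have d2 := c2 r hr
    have d3 := c3 r hr
    have f1 := cX 1
    have f2 := cX 2
    have f3 := cX 3
    have f4 := cX 4
    interval_cases i <;> simp only [R] <;> fun_prop
  · intro i hi r hr hr1 x
    have := hRb i hi r hr hr1 x
    linarith
  · intro i hi r hr hr1 x
    have hq : 0 < √r := Real.sqrt_pos.2 hr
    have h := main i hi (√r) hq (hsq1 r hr1) x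
    rw [sq' r hr] at h
    have hg : gam (2*r) x ≤ (√r)⁻¹ := by
      have := gam_pt (q := √(2*r)) (x := x) (Real.sqrt_pos.2 (by positivity))
      rw [Real.sq_sqrt (by positivity)] at this
      have h1 : √r ≤ √(2*r) := Real.sqrt_le_sqrt (by linarith)
      have h2 := inv_anti₀ hq h1
      have h3 : Real.exp (-(|x|/√(2*r))^2/8) ≤ 1 := by
        apply Real.exp_le_one_iff.2
        have : 0 ≤ (|x|/√(2*r))^2 := by positivity
        linarith
      have h4 : (√(2*r))⁻¹ * Real.exp (-(|x|/√(2*r))^2/8) ≤ (√r)⁻¹ * 1 := by gcongr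
      linarith
    have h1 : |E i r x| ≤ |E i r x| * (1 + |x|/√r) := by
      have : 0 ≤ |E i r x| * (|x|/√r) := by positivity
      linarith
    calc |E i r x| ≤ C1 * (√r)⁻¹^i * gam (2*r) x := h1.trans h
      _ ≤ C1 * (√r)⁻¹^i * (√r)⁻¹ := by gcongr
      _ = C1 * (√r)⁻¹^(i+1) := by ring
      _ ≤ _ := by gcongr
  · intro i hi r hr hr1
    have hq : 0 < √r := Real.sqrt_pos.2 hr
    have h := mainI i hi (√r) hq (hsq1 r hr1) (fun _ => 1) 1 zero_le_one (fun x => ⟨zero_le_one, by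
      have : 0 ≤ |x|/√r := by positivity
      linarith⟩)
    rw [sq' r hr] at h
    simp only [mul_one] at h
    exact h.trans (by gcongr)
  · intro β hβ hβ1 r hr hr1
    have hq : 0 < √r := Real.sqrt_pos.2 hr
    have h := mainI 2 (by norm_num) (√r) hq (hsq1 r hr1) (fun x => |x|^β) ((√r)^β) (by positivity) (fun x => ⟨by positivity, by
      have hy : 0 ≤ |x|/√r := by positivity
      have e : |x| = √r * (|x|/√r) := by field_simp
      have : (|x|/√r)^β ≤ 1 + |x|/√r := by
        calc (|x|/√r)^β ≤ (1+|x|/√r)^β := by gcongr; linarith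
          _ ≤ (1+|x|/√r)^(1:ℝ) := by
            apply Real.rpow_le_rpow_of_exponent_le _ hβ1; linarith
          _ = _ := by simp
      calc |x|^β = (√r)^β * (|x|/√r)^β := by
            rw [← Real.mul_rpow hq.le hy, ← e]
        _ ≤ _ := by gcongr⟩)
    rw [sq' r hr] at h
    refine h.trans ?_
    have : (√r)⁻¹^2 * (√r)^β = (√r)^(β-2) := by
      rw [Real.rpow_sub hq, Real.rpow_two]; field_simp
    rw [mul_assoc, this]
    gcongr
  · intro r x
    rw [e0]; exact mul_nonneg (hX01 x).1 (gam_nonneg _ _)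
  · intro r hr hr1
    obtain ⟨q, hq, hqr⟩ : ∃ q, 0 < q ∧ q^2 = r := ⟨√r, Real.sqrt_pos.2 hr, sq' r hr⟩
    have hsq : √r = q := by rw [← hqr]; exact Real.sqrt_sq hq.le
    rw [hsq]
    have hi : MeasureTheory.Integrable (E 0 r) := by
      rw [e0]
      refine (gam_integrable hr).mono' ((cX 0).mul (c0 r hr)).aestronglyMeasurable (MeasureTheory.ae_of_all _ fun x => ?_)
      rw [Real.norm_eq_abs, abs_of_nonneg (mul_nonneg (hX01 x).1 (gam_nonneg _ _))]
      exact mul_le_of_le_one_left (gam_nonneg _ _) (hX01 x).2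
    have hb : ∀ x, |E 0 r x - gam r x| ≤ C3 * q * gam (2*r) x := by
      intro x
      have hg0 := gam_nonneg r x
      have hg2 := gam_nonneg (2*r) x
      rw [e0]
      by_cases hx : |x| < ρ/2
      · simp only [hXone x hx, one_mul, sub_self, abs_zero]; positivity
      · push Not at hx
        have h1 : |X 0 x * gam r x - gam r x| ≤ gam r x := by
          rw [abs_le]; constructor <;> nlinarith [hX01 x]
        have h2 := gam_comp (x := x) hq
        rw [hqr] at h2
        have hy : 0 ≤ |x|/q := by positivity
        have h3 : |x|/q ≤ (1+|x|/q)^5 := by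
          calc |x|/q ≤ (1+|x|/q)^1 := by linarith
            _ ≤ _ := by apply pow_le_pow_right₀; linarith; norm_num
        have h4 : 1 ≤ (2/ρ) * q * (|x|/q) := by
          field_simp; linarith
        calc _ ≤ gam r x := h1
          _ ≤ ((2/ρ) * q * (|x|/q)) * gam r x := by nlinarith
          _ ≤ ((2/ρ) * q * ((1+|x|/q)^5)) * gam r x := by gcongr
          _ = (2/ρ) * q * ((1+|x|/q)^5 * gam r x) := by ring
          _ ≤ (2/ρ) * q * (2*(120*Real.exp 3) * gam (2*r) x) := by gcongr
          _ = _ := by rw [hC3]; ring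
    have hgi := gam_integrable hr
    rw [← gam_int hr, ← MeasureTheory.integral_sub hi hgi]
    calc |∫ x, E 0 r x - gam r x| ≤ ∫ x, |E 0 r x - gam r x| := MeasureTheory.abs_integral_le_integral_abs
      _ ≤ ∫ x, C3 * q * gam (2*r) x := by
          apply MeasureTheory.integral_mono (hi.sub hgi).abs ((gam_integrable (by positivity)).const_mul _) hb
      _ = C3 * q := by rw [MeasureTheory.integral_const_mul, gam_int (by positivity), mul_one]
      _ ≤ _ := by gcongr; linarith
  · intro r hr hr1
    have hq : 0 < √r := Real.sqrt_pos.2 hr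
    have h := mainI 0 (by norm_num) (√r) hq (hsq1 r hr1) (fun x => |x|) (√r) hq.le (fun x => ⟨abs_nonneg _, by
      have e : |x| = √r * (|x|/√r) := by field_simp
      nlinarith⟩)
    rw [sq' r hr] at h
    have e : ∀ x, |E 0 r x| = E 0 r x := fun x => abs_of_nonneg (by
      rw [e0]; exact mul_nonneg (hX01 x).1 (gam_nonneg _ _))
    simp only [e] at h
    refine h.trans ?_
    rw [pow_zero, mul_one]; gcongr

section
open MeasureTheory

structure TF (ψ : ℕ → ℝ → ℝ) (c d : ℝ) : Prop where
  der : ∀ i y, HasDerivAt (ψ i) (ψ (i+1) y) y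
  z : ∀ i y, y ∉ Icc c d → ψ i y = 0

lemma TF.cont {ψ c d} (h : TF ψ c d) (i : ℕ) : Continuous (ψ i) :=
  continuous_iff_continuousAt.2 fun x => (h.der i x).continuousAt

def Weak (u h : ℝ → ℝ → ℝ) (t0 t1 x0 x1 : ℝ) : Prop :=
  ∀ ψ c d, TF ψ c d → x0 < c → d < x1 → ∀ t ∈ Ioo t0 t1,
    HasDerivAt (fun s => ∫ y, u s y * ψ 0 y) (∫ y, (u t y * ψ 2 y + h t y * ψ 0 y)) t

structure WS (u h : ℝ → ℝ → ℝ) (t0 t1 x0 x1 K H : ℝ) : Prop where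
  mu : ∀ t ∈ Ioo t0 t1, Measurable (u t)
  bu : ∀ t ∈ Ioo t0 t1, ∀ y, |u t y| ≤ K
  cu : ∀ y, ContinuousOn (fun t => u t y) (Ioo t0 t1)
  mh : ∀ t ∈ Ioo t0 t1, Measurable (h t)
  bh : ∀ t ∈ Ioo t0 t1, ∀ y, |h t y| ≤ H
  w : Weak u h t0 t1 x0 x1

lemma cs_integrable {ψ : ℝ → ℝ} {c d : ℝ} (hψ : Continuous ψ) (hz : ∀ y, y ∉ Icc c d → ψ y = 0) : Integrable ψ :=
  hψ.integrable_of_hasCompactSupport (HasCompactSupport.intro isCompact_Icc hz)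

lemma bm_integrable {f ψ : ℝ → ℝ} {K : ℝ} (hf : Measurable f) (hb : ∀ y, |f y| ≤ K) (hψ : Integrable ψ) :
    Integrable (fun y => f y * ψ y) := by
  exact hψ.bdd_mul hf.aestronglyMeasurable (c := K) (ae_of_all _ hb)

lemma bm_bound {f ψ : ℝ → ℝ} {K : ℝ} (hb : ∀ y, |f y| ≤ K) (hψ : Integrable ψ) :
    |∫ y, f y * ψ y| ≤ K * ∫ y, |ψ y| := by
  rw [← integral_const_mul]
  refine abs_integral_le_integral_abs.trans ?_
  apply integral_mono_of_nonneg (ae_of_all _ fun _ => abs_nonneg _) (hψ.abs.const_mul K)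
  refine ae_of_all _ fun y => ?_
  simp only [abs_mul]
  exact mul_le_mul_of_nonneg_right (hb y) (abs_nonneg _)

lemma pair {u h : ℝ → ℝ → ℝ} {t0 t1 x0 x1 K H : ℝ} (W : WS u h t0 t1 x0 x1 K H)
    {Ψ Ψσ : ℝ → ℝ → ℝ} {ψ : ℕ → ℝ → ℝ} {c d σ0 δ B : ℝ} (hσ0 : σ0 ∈ Ioo t0 t1) (hψ : TF ψ c d) (hc : x0 < c) (hd : d < x1)
    (hΨ0 : Ψ σ0 = ψ 0) (hδ : 0 < δ)
    (hΨ : ∀ σ ∈ Ioo (σ0-δ) (σ0+δ), Continuous (Ψ σ) ∧ ∀ y, HasDerivAt (fun s => Ψ s y) (Ψσ σ y) σ ∧ |Ψσ σ y| ≤ B ∧ (y ∉ Icc c d → Ψ σ y = 0)) :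
    HasDerivAt (fun σ => ∫ y, u σ y * Ψ σ y) ((∫ y, u σ0 y * Ψσ σ0 y) + ∫ y, (u σ0 y * ψ 2 y + h σ0 y * ψ 0 y)) σ0 := by
  have hσm : σ0 ∈ Ioo (σ0-δ) (σ0+δ) := ⟨by linarith, by linarith⟩
  have hK : 0 ≤ K := (abs_nonneg _).trans (W.bu σ0 hσ0 0)
  have hB : 0 ≤ B := (abs_nonneg _).trans ((hΨ σ0 hσm).2 0).2.1
  have hW := W.w ψ c d hψ hc hd σ0 hσ0
  have hev : ∀ᶠ σ in nhds σ0, σ ∈ Ioo t0 t1 ∧ σ ∈ Ioo (σ0-δ) (σ0+δ) :=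
    Filter.inter_mem (Ioo_mem_nhds hσ0.1 hσ0.2) (Ioo_mem_nhds hσm.1 hσm.2)
  have hintg : ∀ σ ∈ Ioo t0 t1, ∀ σ' ∈ Ioo (σ0-δ) (σ0+δ), Integrable (fun y => u σ y * Ψ σ' y) := by
    intro σ hσ σ' hσ'
    exact bm_integrable (W.mu σ hσ) (W.bu σ hσ) (cs_integrable (hΨ σ' hσ').1 fun y hy => ((hΨ σ' hσ').2 y).2.2 hy)
  have h1 : HasDerivAt (fun σ => ∫ y, u σ y * (Ψ σ y - Ψ σ0 y)) (∫ y, u σ0 y * Ψσ σ0 y) σ0 := by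
    rw [hasDerivAt_iff_tendsto_slope]
    have e : ∀ σ, slope (fun σ => ∫ y, u σ y * (Ψ σ y - Ψ σ0 y)) σ0 σ = ∫ y, u σ y * ((σ-σ0)⁻¹ * (Ψ σ y - Ψ σ0 y)) := by
      intro σ
      rw [slope_def_field]
      simp only [sub_self, mul_zero, integral_zero, sub_zero]
      rw [div_eq_inv_mul, ← integral_const_mul]
      congr 1; ext y; ring
    rw [show slope (fun σ => ∫ y, u σ y * (Ψ σ y - Ψ σ0 y)) σ0 = fun σ => ∫ y, u σ y * ((σ-σ0)⁻¹ * (Ψ σ y - Ψ σ0 y)) from funext e]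
    have hev' : ∀ᶠ σ in nhdsWithin σ0 {σ0}ᶜ, (σ ∈ Ioo t0 t1 ∧ σ ∈ Ioo (σ0-δ) (σ0+δ)) ∧ σ ≠ σ0 :=
      (hev.filter_mono nhdsWithin_le_nhds).and self_mem_nhdsWithin
    refine tendsto_integral_filter_of_dominated_convergence (fun y => (Icc c d).indicator (fun _ => K*B) y) ?_ ?_ ?_ ?_
    · filter_upwards [hev'] with σ hσ
      have := ((hΨ σ hσ.1.2).1.sub (hΨ σ0 hσm).1).measurable
      exact ((W.mu σ hσ.1.1).mul (this.const_mul (σ-σ0)⁻¹)).aestronglyMeasurable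
    · filter_upwards [hev'] with σ hσ
      refine ae_of_all _ fun y => ?_
      by_cases hy : y ∈ Icc c d
      · rw [indicator_of_mem hy, Real.norm_eq_abs, abs_mul]
        apply mul_le_mul (W.bu σ hσ.1.1 y) _ (abs_nonneg _) hK
        have := (convex_Ioo (σ0-δ) (σ0+δ)).norm_image_sub_le_of_norm_hasDerivWithin_le (f := fun s => Ψ s y) (f' := fun s => Ψσ s y) (C := B)
          (fun s hs => ((hΨ s hs).2 y).1.hasDerivWithinAt) (fun s hs => ((hΨ s hs).2 y).2.1) hσm hσ.1.2
        rw [abs_mul, abs_inv]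
        have hpos : 0 < |σ-σ0| := abs_pos.2 (sub_ne_zero.2 hσ.2)
        rw [inv_mul_le_iff₀ hpos, mul_comm]
        exact this
      · rw [indicator_of_notMem hy, ((hΨ σ hσ.1.2).2 y).2.2 hy, ((hΨ σ0 hσm).2 y).2.2 hy]; simp
    · rw [integrable_indicator_iff measurableSet_Icc]
      exact continuous_const.integrableOn_Icc
    · refine ae_of_all _ fun y => ?_
      refine Tendsto.mul ?_ ?_
      · exact ((W.cu y).continuousAt (isOpen_Ioo.mem_nhds hσ0)).tendsto.mono_left nhdsWithin_le_nhds
      · have := (((hΨ σ0 hσm).2 y).1).tendsto_slope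
        refine this.congr fun σ => ?_
        rw [slope_def_field]; ring
  refine (h1.add hW).congr_of_eventuallyEq ?_
  filter_upwards [hev] with σ hσ
  have e2 := integral_sub (hintg σ hσ.1 σ hσ.2) (hintg σ hσ.1 σ0 hσm)
  simp only [Pi.add_apply, mul_sub]
  rw [e2, hΨ0]; ring

/-- kernel potentials -/
noncomputable def J (E : ℕ → ℝ → ℝ → ℝ) (u : ℝ → ℝ → ℝ) (i : ℕ) (s x σ : ℝ) : ℝ := ∫ y, u σ y * E i (s-σ) (x-y)

variable {ρ C : ℝ} {E R : ℕ → ℝ → ℝ → ℝ}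

lemma notIcc {x y ρ : ℝ} (hy : y ∉ Icc (x-ρ) (x+ρ)) : ρ < |x-y| := by
  by_contra hcon
  push Not at hcon
  rw [abs_le] at hcon
  exact hy ⟨by linarith, by linarith⟩

lemma Ker.tf (k : Ker ρ C E R) (i : ℕ) {r : ℝ} (hr : 0 < r) (x : ℝ) :
    TF (fun j y => (-1)^j * E (i+j) r (x-y)) (x-ρ) (x+ρ) where
  der := by
    intro j y
    have h1 : HasDerivAt (fun y => x-y) (-1) y := by simpa using (hasDerivAt_id y).const_sub x
    have h2 := ((k.dx (i+j) r hr (x-y)).comp y h1).const_mul ((-1)^j)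
    exact h2.congr_deriv (by rw [pow_succ]; ring_nf)
  z := by
    intro j y hy
    rw [k.sE _ r _ (notIcc hy)]; simp

lemma Ker.cont (k : Ker ρ C E R) (i : ℕ) {r : ℝ} (hr : 0 < r) : Continuous (E i r) :=
  continuous_iff_continuousAt.2 fun x => (k.dx i r hr x).continuousAt

lemma Ker.contx (k : Ker ρ C E R) (i : ℕ) {r : ℝ} (hr : 0 < r) (x : ℝ) : Continuous (fun y => E i r (x-y)) :=
  (k.cont i hr).comp (by fun_prop)

lemma Ker.int (k : Ker ρ C E R) (i : ℕ) {r : ℝ} (hr : 0 < r) (x : ℝ) : Integrable (fun y => E i r (x-y)) :=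
  cs_integrable (c := x-ρ) (d := x+ρ) (k.contx i hr x) fun y hy => k.sE i r _ (notIcc hy)

lemma Ker.intR (k : Ker ρ C E R) {i : ℕ} (hi : i ≤ 2) {r : ℝ} (hr : 0 < r) (x : ℝ) : Integrable (fun y => R i r (x-y)) :=
  cs_integrable (c := x-ρ) (d := x+ρ) ((k.mR i hi r hr).comp (by fun_prop : Continuous fun y => x - y))
    fun y hy => k.sR i hi r _ (notIcc hy)

lemma Ker.iE' (k : Ker ρ C E R) {i : ℕ} (hi : i ≤ 4) {r : ℝ} (hr : 0 < r) (hr1 : r ≤ 1) (x : ℝ) :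
    ∫ y, |E i r (x-y)| ≤ C * (√r)⁻¹^i := by
  rw [integral_sub_left_eq_self (fun y => |E i r y|)]; exact k.iE i hi r hr hr1

lemma Ker.iR (k : Ker ρ C E R) (hρ : 0 < ρ) {i : ℕ} (hi : i ≤ 2) {r : ℝ} (hr : 0 < r) (hr1 : r ≤ 1) (x : ℝ) :
    ∫ y, |R i r (x-y)| ≤ 2*ρ*C := by
  have h : ∀ y, |R i r (x-y)| ≤ (Icc (x-ρ) (x+ρ)).indicator (fun _ => C) y := by
    intro y
    by_cases hy : y ∈ Icc (x-ρ) (x+ρ)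
    · rw [indicator_of_mem hy]; exact k.bR i hi r hr hr1 _
    · rw [indicator_of_notMem hy, k.sR i hi r _ (notIcc hy)]; simp
  calc _ ≤ ∫ y, (Icc (x-ρ) (x+ρ)).indicator (fun _ => C) y := by
        apply integral_mono_of_nonneg (ae_of_all _ fun _ => abs_nonneg _) _ (ae_of_all _ h)
        rw [integrable_indicator_iff measurableSet_Icc]
        exact continuous_const.integrableOn_Icc
    _ = _ := by
        rw [integral_indicator measurableSet_Icc]
        simp only [integral_const, MeasurableSet.univ, measureReal_restrict_apply, univ_inter, Real.volume_real_Icc, smul_eq_mul]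
        rw [max_eq_left (by linarith)]; ring

lemma J_deriv (k : Ker ρ C E R) {u h : ℝ → ℝ → ℝ} {t0 t1 x0 x1 K H : ℝ} (W : WS u h t0 t1 x0 x1 K H)
    {i : ℕ} (hi : i ≤ 2) {s x σ : ℝ} (hσ : σ ∈ Ioo t0 t1) (hs : σ < s) (hs1 : s - σ < 1) (hx0 : x0 < x-ρ) (hx1 : x+ρ < x1) :
    HasDerivAt (J E u i s x) ((∫ y, h σ y * E i (s-σ) (x-y)) - ∫ y, u σ y * R i (s-σ) (x-y)) σ := by
  set δ := min ((s-σ)/2) (1-(s-σ)) with hδ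
  have hδ0 : 0 < δ := lt_min (by linarith) (by linarith)
  have hδ1 : δ ≤ (s-σ)/2 := min_le_left _ _
  have hδ2 : δ ≤ 1-(s-σ) := min_le_right _ _
  have hr : 0 < s-σ := by linarith
  set a := (s-σ)/2 with ha
  have ha0 : 0 < a := by positivity
  have hP := pair W (Ψ := fun σ y => E i (s-σ) (x-y)) (Ψσ := fun σ y => -(E (i+2) (s-σ) (x-y) + R i (s-σ) (x-y)))
    (B := C * (√a)⁻¹^(i+2+1) + C) hσ (k.tf i hr x) hx0 hx1 (by funext y; simp) hδ0 (by
      intro σ' hσ'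
      have hr' : 0 < s-σ' := by linarith [hσ'.2]
      have hr1 : s-σ' ≤ 1 := by linarith [hσ'.1]
      refine ⟨k.contx i hr' x, fun y => ⟨?_, ?_, fun hy => k.sE i _ _ (notIcc hy)⟩⟩
      · have h1 : HasDerivAt (fun σ => s-σ) (-1) σ' := by simpa using (hasDerivAt_id σ').const_sub s
        exact ((k.dr i hi (s-σ') hr' (x-y)).comp σ' h1).congr_deriv (by ring)
      · rw [abs_neg]
        refine (abs_add_le _ _).trans (add_le_add ?_ (k.bR i hi _ hr' hr1 _))
        refine (k.bE (i+2) (by omega) _ hr' hr1 _).trans ?_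
        have hC := k.Cpos
        have : √a ≤ √(s-σ') := Real.sqrt_le_sqrt (by linarith [hσ'.2])
        have h0 : 0 < √a := Real.sqrt_pos.2 ha0
        gcongr)
  refine hP.congr_deriv ?_
  have i1 := bm_integrable (W.mu σ hσ) (W.bu σ hσ) (k.int (i+2) hr x)
  have i2 := bm_integrable (W.mu σ hσ) (W.bu σ hσ) (k.intR hi hr x)
  have i3 := bm_integrable (W.mh σ hσ) (W.bh σ hσ) (k.int i hr x)
  simp only [mul_neg, mul_add, pow_zero, one_mul, add_zero, even_two, Even.neg_pow, one_pow]
  rw [integral_neg, integral_add i1 i2, integral_add i1 i3]; ring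

/-- derivative in x -/
lemma J_dx (k : Ker ρ C E R) {v : ℝ → ℝ} {K : ℝ} (hm : Measurable v) (hb : ∀ y, |v y| ≤ K) {i : ℕ} (hi : i ≤ 3)
    {r : ℝ} (hr : 0 < r) (hr1 : r ≤ 1) (x : ℝ) :
    HasDerivAt (fun x => ∫ y, v y * E i r (x-y)) (∫ y, v y * E (i+1) r (x-y)) x := by
  have hK : 0 ≤ K := (abs_nonneg _).trans (hb 0)
  have hC := k.Cpos
  refine (hasDerivAt_integral_of_dominated_loc_of_deriv_le (F := fun x y => v y * E i r (x-y)) (F' := fun x y => v y * E (i+1) r (x-y)) (x₀ := x)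
    (s := ball x 1) (bound := fun y => (Icc (x-ρ-1) (x+ρ+1)).indicator (fun _ => K * (C * (√r)⁻¹^(i+1+1))) y)
    (ball_mem_nhds x one_pos) ?_ ?_ ?_ ?_ ?_ ?_).2
  · exact Eventually.of_forall fun x' => (hm.mul (k.contx i hr x').measurable).aestronglyMeasurable
  · exact bm_integrable hm hb (k.int i hr x)
  · exact (hm.mul (k.contx (i+1) hr x).measurable).aestronglyMeasurable
  · refine ae_of_all _ fun y x' hx' => ?_
    rw [mem_ball, Real.dist_eq, abs_lt] at hx'
    by_cases hy : y ∈ Icc (x-ρ-1) (x+ρ+1)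
    · rw [indicator_of_mem hy, Real.norm_eq_abs, abs_mul]
      exact mul_le_mul (hb y) (k.bE (i+1) (by omega) r hr hr1 _) (abs_nonneg _) hK
    · rw [indicator_of_notMem hy, k.sE (i+1) r]
      · simp
      · apply notIcc
        intro hy'
        exact hy ⟨by linarith [hy'.1], by linarith [hy'.2]⟩
  · rw [integrable_indicator_iff measurableSet_Icc]
    exact continuous_const.integrableOn_Icc
  · refine ae_of_all _ fun y x' hx' => ?_
    have h1 : HasDerivAt (fun x => x-y) 1 x' := by simpa using (hasDerivAt_id x').sub_const y
    exact (((k.dx i r hr (x'-y)).comp x' h1).const_mul (v y)).congr_deriv (by ring)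

/-- approximate identity -/
lemma J_lim (k : Ker ρ C E R) {v : ℝ → ℝ} {K x : ℝ} (hm : Measurable v) (hb : ∀ y, |v y| ≤ K) (hc : ContinuousAt v x) :
    Tendsto (fun r => ∫ y, v y * E 0 r (x-y)) (nhdsWithin 0 (Ioi 0)) (nhds (v x)) := by
  have hK : 0 ≤ K := (abs_nonneg _).trans (hb 0)
  have hC := k.Cpos
  rw [Metric.tendsto_nhds]
  intro ε hε
  obtain ⟨δ, hδ, hv⟩ := Metric.continuousAt_iff.1 hc (ε/(4*C)) (by positivity)
  have hq : Tendsto (fun r : ℝ => (2*K/δ*C + K*C) * √r) (nhdsWithin 0 (Ioi 0)) (nhds 0) := by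
    have : ContinuousAt (fun r : ℝ => (2*K/δ*C + K*C) * √r) 0 := by fun_prop
    have h2 := this.tendsto
    simp only [Real.sqrt_zero, mul_zero] at h2
    exact h2.mono_left nhdsWithin_le_nhds
  filter_upwards [self_mem_nhdsWithin, nhdsWithin_le_nhds (gt_mem_nhds (zero_lt_one' ℝ)), hq (gt_mem_nhds (half_pos hε))] with r hr hr1 hr2
  simp only [mem_Ioi] at hr
  have hr1 : r < 1 := hr1
  have hr2 : (2*K/δ*C + K*C) * √r < ε/2 := hr2
  have hi0 := k.int 0 hr x
  have hmass : ∫ y, E 0 r (x-y) = ∫ y, E 0 r y := integral_sub_left_eq_self (fun y => E 0 r y) volume x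
  have e : (∫ y, v y * E 0 r (x-y)) - v x = (∫ y, (v y - v x) * E 0 r (x-y)) + v x * ((∫ y, E 0 r y) - 1) := by
    have : (∫ y, (v y - v x) * E 0 r (x-y)) = (∫ y, v y * E 0 r (x-y)) - v x * ∫ y, E 0 r y := by
      rw [← hmass, ← integral_const_mul, ← integral_sub (bm_integrable hm hb hi0) (hi0.const_mul _)]
      congr 1; ext y; ring
    rw [this]; ring
  rw [Real.dist_eq, e]
  have hptw : ∀ y, |(v y - v x) * E 0 r (x-y)| ≤ ε/(4*C) * |E 0 r (x-y)| + 2*K/δ * (E 0 r (x-y) * |x-y|) := by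
    intro y
    have hn := k.nE r (x-y)
    rw [abs_mul, abs_of_nonneg hn]
    by_cases hy : |x-y| < δ
    · have := hv (x := y) (by rw [Real.dist_eq, abs_sub_comm]; exact hy)
      rw [Real.dist_eq] at this
      have h2 : 0 ≤ 2*K/δ * (E 0 r (x-y) * |x-y|) := by positivity
      nlinarith
    · push Not at hy
      have h1 : |v y - v x| ≤ 2*K := by
        have := abs_sub (v y) (v x)
        linarith [hb y, hb x]
      have h2 : 2*K ≤ 2*K/δ*|x-y| := by
        rw [div_mul_eq_mul_div, le_div_iff₀ hδ]; gcongr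
      have h3 : 0 ≤ ε/(4*C) * E 0 r (x-y) := by positivity
      nlinarith
  have hi1 : Integrable (fun y => E 0 r (x-y) * |x-y|) :=
    cs_integrable (c := x-ρ) (d := x+ρ) ((k.contx 0 hr x).mul (by fun_prop)) fun y hy => by
      rw [k.sE 0 r _ (notIcc hy)]; simp
  have hl : ∫ y, E 0 r (x-y) * |x-y| ≤ C * √r := by
    rw [integral_sub_left_eq_self (fun y => E 0 r y * |y|)]; exact k.lE r hr hr1.le
  have h1 : |∫ y, (v y - v x) * E 0 r (x-y)| ≤ ε/4 + 2*K/δ*(C*√r) := by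
    calc _ ≤ ∫ y, |(v y - v x) * E 0 r (x-y)| := abs_integral_le_integral_abs
      _ ≤ ∫ y, (ε/(4*C) * |E 0 r (x-y)| + 2*K/δ * (E 0 r (x-y) * |x-y|)) := by
          apply integral_mono_of_nonneg (ae_of_all _ fun _ => abs_nonneg _) _ (ae_of_all _ hptw)
          exact (hi0.abs.const_mul _).add (hi1.const_mul _)
      _ = ε/(4*C) * (∫ y, |E 0 r (x-y)|) + 2*K/δ * ∫ y, E 0 r (x-y) * |x-y| := by
          rw [integral_add (hi0.abs.const_mul _) (hi1.const_mul _), integral_const_mul, integral_const_mul]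
      _ ≤ ε/(4*C) * C + 2*K/δ*(C*√r) := by
          have := k.iE' (i := 0) (by norm_num) hr hr1.le x
          simp only [pow_zero, mul_one] at this
          gcongr
      _ = _ := by field_simp
  have h2 : |v x * ((∫ y, E 0 r y) - 1)| ≤ K * (C*√r) := by
    rw [abs_mul]; exact mul_le_mul (hb x) (k.mE r hr hr1.le) (abs_nonneg _) hK
  calc _ ≤ |∫ y, (v y - v x) * E 0 r (x-y)| + |v x * ((∫ y, E 0 r y) - 1)| := abs_add_le _ _
    _ ≤ ε/4 + (2*K/δ*C + K*C) * √r := by linarith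
    _ < ε := by linarith

/-- integration by parts against a test function -/
lemma ibp {ψ : ℕ → ℝ → ℝ} {c d x0 x1 : ℝ} (hψ : TF ψ c d) (hc : x0 < c) (hd : d < x1) (i : ℕ) {v v1 : ℝ → ℝ}
    (hv : ∀ x ∈ Ioo x0 x1, HasDerivAt v (v1 x) x) (hv1 : ContinuousOn v1 (Ioo x0 x1)) :
    ∫ y, v y * ψ (i+1) y = - ∫ y, v1 y * ψ i y := by
  have hcont : ∀ (f : ℝ → ℝ) (j : ℕ), ContinuousOn f (Ioo x0 x1) → Integrable (fun y => f y * ψ j y) := by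
    intro f j hf
    refine cs_integrable (c := c) (d := d) ?_ fun y hy => by rw [hψ.z j y hy]; simp
    rw [continuous_iff_continuousAt]
    intro y
    by_cases hy : y ∈ Ioo x0 x1
    · exact (hf.continuousAt (isOpen_Ioo.mem_nhds hy)).mul (hψ.cont j).continuousAt
    · have hy' : y ∉ Icc c d := fun h => hy ⟨by linarith [h.1], by linarith [h.2]⟩
      have : (fun y => f y * ψ j y) =ᶠ[nhds y] fun _ => 0 := by
        filter_upwards [isClosed_Icc.isOpen_compl.mem_nhds hy'] with z hz
        rw [hψ.z j z hz]; simp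
      exact continuousAt_const.congr this.symm
  have h1 := hcont v (i+1) (fun x hx => (hv x hx).continuousAt.continuousWithinAt)
  have h2 := hcont v1 i hv1
  have h3 := hcont v i (fun x hx => (hv x hx).continuousAt.continuousWithinAt)
  have : ∫ y, (v1 y * ψ i y + v y * ψ (i+1) y) = 0 := by
    refine integral_eq_zero_of_hasDerivAt_of_integrable (f := fun y => v y * ψ i y) ?_ (h2.add h1) h3
    intro y
    by_cases hy : y ∈ Ioo x0 x1
    · exact (hv y hy).mul (hψ.der i y)
    · have hy' : y ∉ Icc c d := fun h => hy ⟨by linarith [h.1], by linarith [h.2]⟩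
      have : (fun y => v y * ψ i y) =ᶠ[nhds y] fun _ => 0 := by
        filter_upwards [isClosed_Icc.isOpen_compl.mem_nhds hy'] with z hz
        rw [hψ.z i z hz]; simp
      refine ((hasDerivAt_const y (0:ℝ)).congr_of_eventuallyEq this).congr_deriv ?_
      rw [hψ.z i y hy', hψ.z (i+1) y hy']; simp
  rw [integral_add h2 h1] at this
  linarith

lemma growth {φ φ' B B' : ℝ → ℝ} {a b : ℝ} (hab : a ≤ b) (h1 : ∀ x ∈ Icc a b, HasDerivAt φ (φ' x) x)
    (h2 : ∀ x ∈ Icc a b, HasDerivAt B (B' x) x) (h3 : ∀ x ∈ Icc a b, |φ' x| ≤ B' x) : |φ b - φ a| ≤ B b - B a := by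
  have ha : a ∈ Icc a b := left_mem_Icc.2 hab
  have hb : b ∈ Icc a b := right_mem_Icc.2 hab
  have m1 : MonotoneOn (B - φ) (Icc a b) := by
    apply monotoneOn_of_deriv_nonneg (convex_Icc a b)
    · exact fun x hx => ((h2 x hx).sub (h1 x hx)).continuousAt.continuousWithinAt
    · intro x hx; exact ((h2 x (interior_subset hx)).sub (h1 x (interior_subset hx))).differentiableAt.differentiableWithinAt
    · intro x hx
      rw [((h2 x (interior_subset hx)).sub (h1 x (interior_subset hx))).deriv]
      linarith [(abs_le.1 (h3 x (interior_subset hx))).2]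
  have m2 : MonotoneOn (B + φ) (Icc a b) := by
    apply monotoneOn_of_deriv_nonneg (convex_Icc a b)
    · exact fun x hx => ((h2 x hx).add (h1 x hx)).continuousAt.continuousWithinAt
    · intro x hx; exact ((h2 x (interior_subset hx)).add (h1 x (interior_subset hx))).differentiableAt.differentiableWithinAt
    · intro x hx
      rw [((h2 x (interior_subset hx)).add (h1 x (interior_subset hx))).deriv]
      linarith [(abs_le.1 (h3 x (interior_subset hx))).1]
  have a1 := m1 ha hb hab
  have a2 := m2 ha hb hab
  simp only [Pi.sub_apply, Pi.add_apply] at a1 a2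
  rw [abs_le]; constructor <;> linarith
end

section
open MeasureTheory
variable {ρ C : ℝ} {E R : ℕ → ℝ → ℝ → ℝ}

lemma ind_meas {f : ℝ → ℝ} {s : Set ℝ} (hf : ContinuousOn f s) (hs : MeasurableSet s) : Measurable (s.indicator f) := by
  classical
  rw [← Set.piecewise_eq_indicator]
  exact hf.measurable_piecewise (g := 0) continuousOn_const hs

lemma J_lim_loc (k : Ker ρ C E R) (hρ : 0 < ρ) {v : ℝ → ℝ} {x0 x1 x : ℝ} (hv : ContinuousOn v (Ioo x0 x1)) (h0 : x0 < x-ρ) (h1 : x+ρ < x1) :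
    Tendsto (fun r => ∫ y, v y * E 0 r (x-y)) (nhdsWithin 0 (Ioi 0)) (nhds (v x)) := by
  have hsub : Icc (x-ρ) (x+ρ) ⊆ Ioo x0 x1 := fun y hy => ⟨by linarith [hy.1], by linarith [hy.2]⟩
  have hvI := hv.mono hsub
  obtain ⟨K, hK⟩ := isCompact_Icc.exists_bound_of_continuousOn hvI
  set w := (Icc (x-ρ) (x+ρ)).indicator v with hw
  have hwx : w x = v x := indicator_of_mem (show x ∈ Icc (x-ρ) (x+ρ) from ⟨by linarith, by linarith⟩) v
  have hm : Measurable w := ind_meas hvI measurableSet_Icc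
  have hb : ∀ y, |w y| ≤ |K| := by
    intro y
    by_cases hy : y ∈ Icc (x-ρ) (x+ρ)
    · rw [hw, indicator_of_mem hy]; exact (hK y hy).trans (le_abs_self K)
    · rw [hw, indicator_of_notMem hy]; simp
  have hc : ContinuousAt w x := by
    have : v =ᶠ[nhds x] w := by
      filter_upwards [Icc_mem_nhds (show x-ρ < x by linarith) (show x < x+ρ by linarith)] with y hy
      rw [hw, indicator_of_mem hy]
    exact (hv.continuousAt (Ioo_mem_nhds (by linarith) (by linarith))).congr this
  have := J_lim k hm hb hc
  rw [hwx] at this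
  refine this.congr fun r => ?_
  congr 1; ext y
  by_cases hy : y ∈ Icc (x-ρ) (x+ρ)
  · rw [hw, indicator_of_mem hy]
  · rw [k.sE 0 r _ (notIcc hy)]; simp

lemma J0_growth (k : Ker ρ C E R) (hρ : 0 < ρ) {u h : ℝ → ℝ → ℝ} {t0 t1 x0 x1 K H : ℝ} (W : WS u h t0 t1 x0 x1 K H)
    {s x a b : ℝ} (ha : t0 < a) (hab : a ≤ b) (hb : b < t1) (hbs : b < s) (hs1 : s - a < 1) (hx0 : x0 < x-ρ) (hx1 : x+ρ < x1) :
    |J E u 0 s x b - J E u 0 s x a| ≤ C * (H + 2*ρ*K) * (b-a) := by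
  have h := growth (B := fun σ => C * (H + 2*ρ*K) * σ) (B' := fun _ => C * (H+2*ρ*K)) hab
    (fun σ hσ => J_deriv k W (s := s) (x := x) (i := 0) (by norm_num) ⟨by linarith [hσ.1], by linarith [hσ.2]⟩ (by linarith [hσ.2]) (by linarith [hσ.1]) hx0 hx1)
    (fun σ hσ => by simpa using (hasDerivAt_id σ).const_mul (C * (H+2*ρ*K))) ?_
  · calc _ ≤ _ := h
      _ = _ := by ring
  · intro σ hσ
    have hσ' : σ ∈ Ioo t0 t1 := ⟨by linarith [hσ.1], by linarith [hσ.2]⟩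
    have hr : 0 < s-σ := by linarith [hσ.2]
    have hr1 : s-σ ≤ 1 := by linarith [hσ.1]
    have hH : 0 ≤ H := (abs_nonneg _).trans (W.bh σ hσ' 0)
    have hK : 0 ≤ K := (abs_nonneg _).trans (W.bu σ hσ' 0)
    have a1 := bm_bound (W.bh σ hσ') (k.int 0 hr x)
    have a2 := bm_bound (W.bu σ hσ') (k.intR (i := 0) (by norm_num) hr x)
    have a3 := k.iE' (i := 0) (by norm_num) hr hr1 x
    have a4 := k.iR hρ (i := 0) (by norm_num) hr hr1 x
    rw [pow_zero, mul_one] at a3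
    have a5 := mul_le_mul_of_nonneg_left a3 hH
    have a6 := mul_le_mul_of_nonneg_left a4 hK
    refine (abs_sub _ _).trans ?_
    linarith

lemma J1_bound (k : Ker ρ C E R) (hρ : 0 < ρ) {u h : ℝ → ℝ → ℝ} {t0 t1 x0 x1 K H : ℝ} (W : WS u h t0 t1 x0 x1 K H)
    {s x a b : ℝ} (ha : t0 < a) (hab : a ≤ b) (hb : b < t1) (hbs : b < s) (hs1 : s - a < 1) (hx0 : x0 < x-ρ) (hx1 : x+ρ < x1) :
    |J E u 1 s x b| ≤ C * (K / √(s-a) + 2 * H * √(s-a) + 2*ρ*K*(s-a)) := by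
  have hC := k.Cpos
  have ha' : a ∈ Ioo t0 t1 := ⟨ha, by linarith⟩
  have hH : 0 ≤ H := (abs_nonneg _).trans (W.bh a ha' 0)
  have hK : 0 ≤ K := (abs_nonneg _).trans (W.bu a ha' 0)
  have h := growth (B := fun σ => 2 * (H*C) * (-√(s-σ)) + K*(2*ρ*C) * σ) (B' := fun σ => (H*C) * (√(s-σ))⁻¹ + K*(2*ρ*C)) hab
    (fun σ hσ => J_deriv k W (s := s) (x := x) (i := 1) (by norm_num) ⟨by linarith [hσ.1], by linarith [hσ.2]⟩ (by linarith [hσ.2]) (by linarith [hσ.1]) hx0 hx1)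
    (fun σ hσ => by
      have hr : 0 < s-σ := by linarith [hσ.2]
      have h1 : HasDerivAt (fun σ => s-σ) (-1) σ := by simpa using (hasDerivAt_id σ).const_sub s
      have h2 := ((h1.sqrt hr.ne').neg.const_mul (2*(H*C))).add ((hasDerivAt_id σ).const_mul (K*(2*ρ*C)))
      refine h2.congr_deriv ?_
      have := Real.sqrt_pos.2 hr
      field_simp) ?_
  · have hr : 0 < s-a := by linarith
    have i1 : |J E u 1 s x a| ≤ K * (C * (√(s-a))⁻¹) := by
      refine (bm_bound (W.bu a ha') (k.int 1 hr x)).trans ?_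
      have := k.iE' (i := 1) (by norm_num) hr hs1.le x
      rw [pow_one] at this
      gcongr
    have i2 : |J E u 1 s x b| ≤ |J E u 1 s x a| + |J E u 1 s x b - J E u 1 s x a| := by
      have := abs_add_le (J E u 1 s x a) (J E u 1 s x b - J E u 1 s x a)
      simpa using this
    have i3 : 0 ≤ 2*(H*C)*√(s-b) := by positivity
    have i4 : K*(2*ρ*C)*(b-a) ≤ K*(2*ρ*C)*(s-a) := by gcongr
    have e : C * (K / √(s-a) + 2 * H * √(s-a) + 2*ρ*K*(s-a)) = K * (C * (√(s-a))⁻¹) + 2*(H*C)*√(s-a) + K*(2*ρ*C)*(s-a) := by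
      ring
    rw [e]
    linarith
  · intro σ hσ
    have hσ' : σ ∈ Ioo t0 t1 := ⟨by linarith [hσ.1], by linarith [hσ.2]⟩
    have hr : 0 < s-σ := by linarith [hσ.2]
    have hr1 : s-σ ≤ 1 := by linarith [hσ.1]
    have a1 := bm_bound (W.bh σ hσ') (k.int 1 hr x)
    have a2 := bm_bound (W.bu σ hσ') (k.intR (i := 1) (by norm_num) hr x)
    have a3 := k.iE' (i := 1) (by norm_num) hr hr1 x
    have a4 := k.iR hρ (i := 1) (by norm_num) hr hr1 x
    rw [pow_one] at a3
    have a5 := mul_le_mul_of_nonneg_left a3 hH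
    have a6 := mul_le_mul_of_nonneg_left a4 hK
    refine (abs_sub _ _).trans ?_
    linarith

lemma intE_zero (k : Ker ρ C E R) (i : ℕ) {r : ℝ} (hr : 0 < r) (x : ℝ) : ∫ y, E (i+1) r (x-y) = 0 := by
  have := integral_eq_zero_of_hasDerivAt_of_integrable (f := fun y => E i r y) (f' := fun y => E (i+1) r y) (fun y => k.dx i r hr y)
    (by simpa using (k.int (i+1) hr 0).comp_neg) (by simpa using (k.int i hr 0).comp_neg)
  rw [integral_sub_left_eq_self (fun y => E (i+1) r y)]; exact this

lemma J2_bound (k : Ker ρ C E R) (hρ : 0 < ρ) {u h : ℝ → ℝ → ℝ} {t0 t1 x0 x1 K H : ℝ} (W : WS u h t0 t1 x0 x1 K H)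
    {s x a b ν Λ β : ℝ} (ha : t0 < a) (hab : a ≤ b) (hb : b < t1) (hbs : b < s) (hs1 : s - a < 1) (hx0 : x0 < x-ρ) (hx1 : x+ρ < x1)
    (hβ : 0 < β) (hβ1 : β ≤ 1) (hν : ∀ y, |x-y| ≤ ρ → |u a y - u a x| ≤ ν)
    (hΛ : ∀ σ ∈ Icc a b, ∀ y, |x-y| ≤ ρ → |h σ y - h σ x| ≤ Λ * |x-y|^β) :
    |J E u 2 s x b| ≤ C * (ν / (s-a) + (2/β) * Λ * (s-a)^(β/2) + 2*ρ*K*(s-a)) := by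
  have hC := k.Cpos
  have ha' : a ∈ Ioo t0 t1 := ⟨ha, by linarith⟩
  have hK : 0 ≤ K := (abs_nonneg _).trans (W.bu a ha' 0)
  have hΛ0 : 0 ≤ Λ := by
    have := (abs_nonneg _).trans (hΛ a (left_mem_Icc.2 hab) (x-ρ) (by simp [abs_of_pos hρ]))
    simp only [sub_sub_cancel] at this
    have h2 : 0 < |ρ|^β := Real.rpow_pos_of_pos (by positivity) _
    exact nonneg_of_mul_nonneg_left this h2
  have hν0 : 0 ≤ ν := (abs_nonneg _).trans (hν x (by simpa using hρ.le))
  have h := growth (B := fun σ => (Λ*C) * (-(2/β) * (s-σ)^(β/2)) + K*(2*ρ*C) * σ) (B' := fun σ => (Λ*C) * (s-σ)^(β/2-1) + K*(2*ρ*C)) hab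
    (fun σ hσ => J_deriv k W (s := s) (x := x) (i := 2) (by norm_num) ⟨by linarith [hσ.1], by linarith [hσ.2]⟩ (by linarith [hσ.2]) (by linarith [hσ.1]) hx0 hx1)
    (fun σ hσ => by
      have hr : 0 < s-σ := by linarith [hσ.2]
      have h1 : HasDerivAt (fun σ => s-σ) (-1) σ := by simpa using (hasDerivAt_id σ).const_sub s
      have h2 := (((h1.rpow_const (p := β/2) (Or.inl hr.ne')).const_mul (-(2/β))).const_mul (Λ*C)).add ((hasDerivAt_id σ).const_mul (K*(2*ρ*C)))
      refine h2.congr_deriv ?_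
      field_simp) ?_
  · have hr : 0 < s-a := by linarith
    have i1 : |J E u 2 s x a| ≤ ν * (C * (s-a)⁻¹) := by
      have e : J E u 2 s x a = ∫ y, (u a y - u a x) * E 2 (s-a) (x-y) := by
        have h1 := bm_integrable (W.mu a ha') (W.bu a ha') (k.int 2 hr x)
        have h2 := (k.int 2 hr x).const_mul (u a x)
        have := integral_sub h1 h2
        simp only [← sub_mul] at this
        rw [this, integral_const_mul, intE_zero k 1 hr x]; simp [J]
      rw [e]
      have e2 : ∀ y, (u a y - u a x) * E 2 (s-a) (x-y) = (if |x-y| ≤ ρ then (u a y - u a x) else 0) * E 2 (s-a) (x-y) := by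
        intro y
        split_ifs with hy
        · rfl
        · rw [k.sE 2 _ _ (not_le.1 hy)]; simp
      simp_rw [e2]
      refine (bm_bound (K := ν) ?_ (k.int 2 hr x)).trans ?_
      · intro y; split_ifs with hy
        · exact hν y hy
        · simpa using hν0
      · have := k.iE' (i := 2) (by norm_num) hr hs1.le x
        rw [inv_pow, Real.sq_sqrt hr.le] at this
        gcongr
    have i2 : |J E u 2 s x b| ≤ |J E u 2 s x a| + |J E u 2 s x b - J E u 2 s x a| := by
      have := abs_add_le (J E u 2 s x a) (J E u 2 s x b - J E u 2 s x a)
      simpa using this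
    have hsb : 0 < s - b := by linarith
    have i3 : 0 ≤ (Λ*C)*((2/β)*(s-b)^(β/2)) := by positivity
    have i4 : K*(2*ρ*C)*(b-a) ≤ K*(2*ρ*C)*(s-a) := by gcongr
    have e : C * (ν / (s-a) + (2/β) * Λ * (s-a)^(β/2) + 2*ρ*K*(s-a)) = ν * (C * (s-a)⁻¹) + (Λ*C)*((2/β)*(s-a)^(β/2)) + K*(2*ρ*C)*(s-a) := by
      ring
    rw [e]
    linarith
  · intro σ hσ
    have hσ' : σ ∈ Ioo t0 t1 := ⟨by linarith [hσ.1], by linarith [hσ.2]⟩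
    have hr : 0 < s-σ := by linarith [hσ.2]
    have hr1 : s-σ ≤ 1 := by linarith [hσ.1]
    have a2 := bm_bound (W.bu σ hσ') (k.intR (i := 2) (by norm_num) hr x)
    have a4 := k.iR hρ (i := 2) (by norm_num) hr hr1 x
    have a6 := mul_le_mul_of_nonneg_left a4 hK
    have e : ∫ y, h σ y * E 2 (s-σ) (x-y) = ∫ y, (h σ y - h σ x) * E 2 (s-σ) (x-y) := by
      have h1 := bm_integrable (W.mh σ hσ') (W.bh σ hσ') (k.int 2 hr x)
      have h2 := (k.int 2 hr x).const_mul (h σ x)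
      have := integral_sub h1 h2
      simp only [← sub_mul] at this
      rw [this, integral_const_mul, intE_zero k 1 hr x]; simp
    have a1 : |∫ y, h σ y * E 2 (s-σ) (x-y)| ≤ Λ * (C * (s-σ)^(β/2-1)) := by
      rw [e]
      have hi : Integrable (fun y => |E 2 (s-σ) (x-y)| * |x-y|^β) := by
        refine cs_integrable (c := x-ρ) (d := x+ρ) ?_ fun y hy => by rw [k.sE 2 _ _ (notIcc hy)]; simp
        refine (k.contx 2 hr x).abs.mul ?_
        exact (by fun_prop : Continuous fun y => |x-y|).rpow_const fun y => Or.inr hβ.le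
      calc _ ≤ ∫ y, |(h σ y - h σ x) * E 2 (s-σ) (x-y)| := abs_integral_le_integral_abs
        _ ≤ ∫ y, Λ * (|E 2 (s-σ) (x-y)| * |x-y|^β) := by
            apply integral_mono_of_nonneg (ae_of_all _ fun _ => abs_nonneg _) (hi.const_mul _)
            refine ae_of_all _ fun y => ?_
            simp only [abs_mul]
            by_cases hy : |x-y| ≤ ρ
            · have := mul_le_mul_of_nonneg_right (hΛ σ hσ y hy) (abs_nonneg (E 2 (s-σ) (x-y)))
              linarith
            · rw [k.sE 2 _ _ (not_le.1 hy)]; simp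
        _ ≤ _ := by
            rw [integral_const_mul, integral_sub_left_eq_self (fun y => |E 2 (s-σ) y| * |y|^β)]
            have := k.hE β hβ hβ1 (s-σ) hr hr1
            rw [Real.sqrt_eq_rpow, ← Real.rpow_mul hr.le] at this
            have e2 : (1/2:ℝ)*(β-2) = β/2-1 := by ring
            rw [e2] at this
            gcongr
    refine (abs_sub _ _).trans ?_
    linarith

/-- uniform Lipschitz estimate -/
lemma ws_lip (k : Ker ρ C E R) (hρ : 0 < ρ) {u h : ℝ → ℝ → ℝ} {t0 t1 x0 x1 K H : ℝ} (W : WS u h t0 t1 x0 x1 K H)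
    {s τ x x' : ℝ} (hτ : 0 < τ) (hτ1 : τ < 1) (hs0 : t0 < s - τ) (hs1 : s < t1) (hx : x ∈ Ioo (x0+ρ) (x1-ρ)) (hx' : x' ∈ Ioo (x0+ρ) (x1-ρ))
    (hc : ContinuousOn (u s) (Ioo x0 x1)) :
    |u s x - u s x'| ≤ C * (K/√τ + 4*H*√τ + 8*ρ*K*τ) * |x-x'| := by
  have hC := k.Cpos
  have hs : s ∈ Ioo t0 t1 := ⟨by linarith, hs1⟩
  have hH : 0 ≤ H := (abs_nonneg _).trans (W.bh s hs 0)
  have hK : 0 ≤ K := (abs_nonneg _).trans (W.bu s hs 0)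
  have l1 := J_lim_loc k hρ hc (x := x) (by linarith [hx.1]) (by linarith [hx.2])
  have l2 := J_lim_loc k hρ hc (x := x') (by linarith [hx'.1]) (by linarith [hx'.2])
  refine le_of_tendsto (l1.sub l2).abs ?_
  have hmin : 0 < min (3*τ) (1-τ) := lt_min (by linarith) (by linarith)
  filter_upwards [self_mem_nhdsWithin, nhdsWithin_le_nhds (gt_mem_nhds hmin)] with r hr hr1
  simp only [mem_Ioi] at hr
  have hr1 : r < min (3*τ) (1-τ) := hr1
  have hr2 := hr1.trans_le (min_le_left _ _)
  have hr3 := hr1.trans_le (min_le_right _ _)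
  have := (convex_Ioo (x0+ρ) (x1-ρ)).norm_image_sub_le_of_norm_hasDerivWithin_le (f := fun x => ∫ y, u s y * E 0 r (x-y))
    (f' := fun x => ∫ y, u s y * E 1 r (x-y)) (C := C * (K/√τ + 4*H*√τ + 8*ρ*K*τ))
    (fun z _ => (J_dx k (W.mu s hs) (W.bu s hs) (i := 0) (by norm_num) hr (by linarith) z).hasDerivWithinAt) ?_ hx' hx
  · exact this
  · intro z hz
    have h := J1_bound k hρ W (s := s+r) (x := z) (a := s-τ) (b := s) hs0 (by linarith) hs1 (by linarith) (by linarith) (by linarith [hz.1]) (by linarith [hz.2])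
    unfold J at h
    rw [add_sub_cancel_left] at h
    refine h.trans ?_
    have e : s+r-(s-τ) = τ+r := by ring
    rw [e]
    have q1 : √τ ≤ √(τ+r) := Real.sqrt_le_sqrt (by linarith)
    have q2 : √(τ+r) ≤ 2*√τ := by
      rw [show (2:ℝ) = √4 by rw [show (4:ℝ) = 2^2 by norm_num]; simp, ← Real.sqrt_mul (by norm_num)]
      exact Real.sqrt_le_sqrt (by linarith)
    have q0 := Real.sqrt_pos.2 hτ
    have t1 : K/√(τ+r) ≤ K/√τ := by gcongr
    have t2 : 2*H*√(τ+r) ≤ 2*H*(2*√τ) := by gcongr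
    have t3 : 2*ρ*K*(τ+r) ≤ 2*ρ*K*(4*τ) := by gcongr; linarith
    exact mul_le_mul_of_nonneg_left (by linarith) hC.le

/-- second derivative estimate -/
lemma ws_c2 (k : Ker ρ C E R) (hρ : 0 < ρ) {u h : ℝ → ℝ → ℝ} {t0 t1 x0 x1 K H : ℝ} (W : WS u h t0 t1 x0 x1 K H)
    {s τ x ν Λ β : ℝ} {v1 v2 : ℝ → ℝ} (hτ : 0 < τ) (hτ1 : τ < 1) (hs0 : t0 < s - τ) (hs1 : s < t1) (hx : x ∈ Ioo (x0+ρ) (x1-ρ))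
    (hv1 : ∀ y ∈ Ioo x0 x1, HasDerivAt (u s) (v1 y) y) (hv2 : ∀ y ∈ Ioo x0 x1, HasDerivAt v1 (v2 y) y) (hc : ContinuousOn v2 (Ioo x0 x1))
    (hβ : 0 < β) (hβ1 : β ≤ 1) (hν : ∀ y, |x-y| ≤ ρ → |u (s-τ) y - u (s-τ) x| ≤ ν)
    (hΛ : ∀ σ ∈ Icc (s-τ) s, ∀ y, |x-y| ≤ ρ → |h σ y - h σ x| ≤ Λ * |x-y|^β) :
    |v2 x| ≤ C * (ν/τ + (4/β) * Λ * τ^(β/2) + 8*ρ*K*τ) := by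
  have hC := k.Cpos
  have hs : s ∈ Ioo t0 t1 := ⟨by linarith, hs1⟩
  have hK : 0 ≤ K := (abs_nonneg _).trans (W.bu s hs 0)
  have hΛ0 : 0 ≤ Λ := by
    have := (abs_nonneg _).trans (hΛ s ⟨by linarith, le_rfl⟩ (x-ρ) (by simp [abs_of_pos hρ]))
    simp only [sub_sub_cancel] at this
    have h2 : 0 < |ρ|^β := Real.rpow_pos_of_pos (by positivity) _
    exact nonneg_of_mul_nonneg_left this h2
  have hν0 : 0 ≤ ν := (abs_nonneg _).trans (hν x (by simpa using hρ.le))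
  have l1 := J_lim_loc k hρ hc (x := x) (by linarith [hx.1]) (by linarith [hx.2])
  refine le_of_tendsto l1.abs ?_
  have hmin : 0 < min (3*τ) (1-τ) := lt_min (by linarith) (by linarith)
  filter_upwards [self_mem_nhdsWithin, nhdsWithin_le_nhds (gt_mem_nhds hmin)] with r hr hr1
  simp only [mem_Ioi] at hr
  have hr1 : r < min (3*τ) (1-τ) := hr1
  have hr2 := hr1.trans_le (min_le_left _ _)
  have hr3 := hr1.trans_le (min_le_right _ _)
  have tf := k.tf 0 hr x
  have ib1 := ibp tf (by linarith [hx.1] : x0 < x-ρ) (by linarith [hx.2] : x+ρ < x1) 1 hv1 (fun y hy => (hv2 y hy).continuousAt.continuousWithinAt)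
  have ib2 := ibp tf (by linarith [hx.1] : x0 < x-ρ) (by linarith [hx.2] : x+ρ < x1) 0 hv2 hc
  have e : ∫ y, v2 y * E 0 r (x-y) = ∫ y, u s y * E 2 r (x-y) := by
    simp only [zero_add, pow_zero, one_mul, one_add_one_eq_two, even_two, Even.neg_pow, one_pow] at ib1 ib2
    rw [ib1, ib2, neg_neg]
  rw [e]
  have h := J2_bound k hρ W (s := s+r) (x := x) (a := s-τ) (b := s) hs0 (by linarith) hs1 (by linarith) (by linarith) (by linarith [hx.1]) (by linarith [hx.2]) hβ hβ1 hν hΛ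
  unfold J at h
  rw [add_sub_cancel_left] at h
  refine h.trans ?_
  have e : s+r-(s-τ) = τ+r := by ring
  rw [e]
  have t1 : ν/(τ+r) ≤ ν/τ := by gcongr; linarith
  have q : (τ+r)^(β/2) ≤ 2*τ^(β/2) := by
    calc (τ+r)^(β/2) ≤ (4*τ)^(β/2) := by gcongr; linarith
      _ = 4^(β/2) * τ^(β/2) := Real.mul_rpow (by norm_num) hτ.le
      _ ≤ 2*τ^(β/2) := by
        gcongr
        calc (4:ℝ)^(β/2) ≤ 4^(1/2:ℝ) := by
              apply Real.rpow_le_rpow_of_exponent_le (by norm_num); linarith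
          _ = 2 := by
              rw [← Real.sqrt_eq_rpow, show (4:ℝ) = 2^2 by norm_num]; simp
  have t2 : 2/β*Λ*(τ+r)^(β/2) ≤ 2/β*Λ*(2*τ^(β/2)) := by gcongr
  have t3 : 2*ρ*K*(τ+r) ≤ 2*ρ*K*(4*τ) := by gcongr; linarith
  have t4 : 2/β*Λ*(2*τ^(β/2)) = 4/β*Λ*τ^(β/2) := by ring
  apply mul_le_mul_of_nonneg_left _ hC.le
  linarith
end

section
open MeasureTheory
variable {ρ C : ℝ} {E R : ℕ → ℝ → ℝ → ℝ}

lemma dct {ι : Type*} {l : Filter ι} [l.IsCountablyGenerated] {F : ι → ℝ → ℝ} {g : ℝ → ℝ} {c d K : ℝ}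
    (hm : ∀ᶠ s in l, ContinuousOn (F s) (Icc c d)) (hz : ∀ᶠ s in l, ∀ y, y ∉ Icc c d → F s y = 0) (hzg : ∀ y, y ∉ Icc c d → g y = 0)
    (hb : ∀ᶠ s in l, ∀ y ∈ Icc c d, |F s y| ≤ K) (hl : ∀ y ∈ Icc c d, Tendsto (fun s => F s y) l (nhds (g y))) :
    Tendsto (fun s => ∫ y, F s y) l (nhds (∫ y, g y)) := by
  apply tendsto_integral_filter_of_dominated_convergence ((Icc c d).indicator fun _ => K)
  · filter_upwards [hm, hz] with s h1 h2
    have : F s = (Icc c d).indicator (F s) := by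
      ext y
      by_cases hy : y ∈ Icc c d
      · rw [indicator_of_mem hy]
      · rw [indicator_of_notMem hy, h2 y hy]
    rw [this]
    exact (ind_meas h1 measurableSet_Icc).aestronglyMeasurable
  · filter_upwards [hb, hz] with s h1 h2
    refine ae_of_all _ fun y => ?_
    by_cases hy : y ∈ Icc c d
    · rw [indicator_of_mem hy]; exact h1 y hy
    · rw [indicator_of_notMem hy, h2 y hy]; simp
  · exact (integrable_indicator_iff measurableSet_Icc).2 (by simp)
  · refine ae_of_all _ fun y => ?_
    by_cases hy : y ∈ Icc c d
    · exact hl y hy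
    · rw [hzg y hy]
      refine tendsto_const_nhds.congr' ?_
      filter_upwards [hz] with s h2
      exact (h2 y hy).symm

lemma TF.bdd {ψ c d} (h : TF ψ c d) (i : ℕ) : ∃ B, 0 ≤ B ∧ ∀ y, |ψ i y| ≤ B := by
  obtain ⟨B, hB⟩ := (isCompact_Icc (a := c) (b := d)).exists_bound_of_continuousOn (h.cont i).continuousOn
  refine ⟨|B|, abs_nonneg _, fun y => ?_⟩
  by_cases hy : y ∈ Icc c d
  · exact (hB y hy).trans (le_abs_self B)
  · rw [h.z i y hy]; simp

lemma ws_of_weak {u h : ℝ → ℝ → ℝ} {t0 t1 x0 x1 K H : ℝ} (hw : Weak u h t0 t1 x0 x1) (hK : 0 ≤ K) (hH : 0 ≤ H)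
    (cu : ∀ t ∈ Ioo t0 t1, ContinuousOn (u t) (Ioo x0 x1)) (ch : ∀ t ∈ Ioo t0 t1, ContinuousOn (h t) (Ioo x0 x1))
    (ct : ∀ x ∈ Ioo x0 x1, ContinuousOn (fun t => u t x) (Ioo t0 t1))
    (bu : ∀ t ∈ Ioo t0 t1, ∀ x ∈ Ioo x0 x1, |u t x| ≤ K) (bh : ∀ t ∈ Ioo t0 t1, ∀ x ∈ Ioo x0 x1, |h t x| ≤ H) :
    WS (fun t => (Ioo x0 x1).indicator (u t)) (fun t => (Ioo x0 x1).indicator (h t)) t0 t1 x0 x1 K H where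
  mu t ht := ind_meas (cu t ht) measurableSet_Ioo
  mh t ht := ind_meas (ch t ht) measurableSet_Ioo
  bu t ht y := by
    by_cases hy : y ∈ Ioo x0 x1
    · simp only [indicator_of_mem hy]; exact bu t ht y hy
    · simp only [indicator_of_notMem hy]; simpa using hK
  bh t ht y := by
    by_cases hy : y ∈ Ioo x0 x1
    · simp only [indicator_of_mem hy]; exact bh t ht y hy
    · simp only [indicator_of_notMem hy]; simpa using hH
  cu y := by
    by_cases hy : y ∈ Ioo x0 x1
    · simp only [indicator_of_mem hy]; exact ct y hy
    · simp only [indicator_of_notMem hy]; exact continuousOn_const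
  w := by
    intro ψ c d hψ hc hd t ht
    have key : ∀ (f : ℝ → ℝ) i y, (Ioo x0 x1).indicator f y * ψ i y = f y * ψ i y := by
      intro f i y
      by_cases hy : y ∈ Ioo x0 x1
      · rw [indicator_of_mem hy]
      · rw [hψ.z i y fun h' => hy ⟨by linarith [h'.1], by linarith [h'.2]⟩]; simp
    simp only [key]
    exact hw ψ c d hψ hc hd t ht

structure PS (u u1 u2 h : ℝ → ℝ → ℝ) (t0 t1 x0 x1 K H : ℝ) : Prop where
  ht : ∀ t ∈ Ioo t0 t1, ∀ x ∈ Ioo x0 x1, HasDerivAt (fun s => u s x) (u2 t x + h t x) t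
  hx : ∀ t ∈ Ioo t0 t1, ∀ x ∈ Ioo x0 x1, HasDerivAt (u t) (u1 t x) x
  hxx : ∀ t ∈ Ioo t0 t1, ∀ x ∈ Ioo x0 x1, HasDerivAt (u1 t) (u2 t x) x
  cxx : ∀ t ∈ Ioo t0 t1, ContinuousOn (u2 t) (Ioo x0 x1)
  hhx : ∀ t ∈ Ioo t0 t1, ContinuousOn (h t) (Ioo x0 x1)
  hht : ∀ x ∈ Ioo x0 x1, ContinuousOn (fun t => h t x) (Ioo t0 t1)
  bu : ∀ t ∈ Ioo t0 t1, ∀ x ∈ Ioo x0 x1, |u t x| ≤ K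
  bh : ∀ t ∈ Ioo t0 t1, ∀ x ∈ Ioo x0 x1, |h t x| ≤ H

variable {u u1 u2 h : ℝ → ℝ → ℝ} {t0 t1 x0 x1 K H : ℝ}

lemma PS.cx (P : PS u u1 u2 h t0 t1 x0 x1 K H) : ∀ t ∈ Ioo t0 t1, ContinuousOn (u t) (Ioo x0 x1) :=
  fun t ht x hx => (P.hx t ht x hx).continuousAt.continuousWithinAt
lemma PS.cx1 (P : PS u u1 u2 h t0 t1 x0 x1 K H) : ∀ t ∈ Ioo t0 t1, ContinuousOn (u1 t) (Ioo x0 x1) :=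
  fun t ht x hx => (P.hxx t ht x hx).continuousAt.continuousWithinAt
lemma PS.ct (P : PS u u1 u2 h t0 t1 x0 x1 K H) : ∀ x ∈ Ioo x0 x1, ContinuousOn (fun t => u t x) (Ioo t0 t1) :=
  fun x hx t ht => (P.ht t ht x hx).continuousAt.continuousWithinAt

lemma PS.ibp2 (P : PS u u1 u2 h t0 t1 x0 x1 K H) {ψ : ℕ → ℝ → ℝ} {c d t : ℝ} (hψ : TF ψ c d) (hc : x0 < c) (hd : d < x1) (ht : t ∈ Ioo t0 t1) :
    ∫ y, u t y * ψ 2 y = ∫ y, u2 t y * ψ 0 y := by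
  have ib1 := ibp hψ hc hd 1 (P.hx t ht) (P.cx1 t ht)
  have ib2 := ibp hψ hc hd 0 (P.hxx t ht) (P.cxx t ht)
  simp only [zero_add, one_add_one_eq_two] at ib1 ib2
  rw [ib1, ib2, neg_neg]

lemma loc_int {f : ℝ → ℝ} {ψ : ℕ → ℝ → ℝ} {c d : ℝ} (hf : ContinuousOn f (Ioo x0 x1)) (hψ : TF ψ c d) (hc : x0 < c) (hd : d < x1) (i : ℕ) :
    Integrable (fun y => f y * ψ i y) := by
  have hsub : Icc c d ⊆ Ioo x0 x1 := fun y hy => ⟨by linarith [hy.1], by linarith [hy.2]⟩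
  obtain ⟨B, hB⟩ := isCompact_Icc.exists_bound_of_continuousOn (hf.mono hsub)
  have := bm_integrable (K := |B|) (ind_meas (hf.mono hsub) measurableSet_Icc) (fun y => by
    by_cases hy : y ∈ Icc c d
    · rw [indicator_of_mem hy]; exact (hB y hy).trans (le_abs_self B)
    · rw [indicator_of_notMem hy]; simp) (cs_integrable (hψ.cont i) (hψ.z i))
  refine this.congr (ae_of_all _ fun y => ?_)
  by_cases hy : y ∈ Icc c d
  · simp only [indicator_of_mem hy]
  · simp only [hψ.z i y hy]; simp

lemma cont_pair {f : ℝ → ℝ → ℝ} {ψ : ℕ → ℝ → ℝ} {c d B : ℝ} (hψ : TF ψ c d) (hc : x0 < c) (hd : d < x1) (i : ℕ)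
    (cx : ∀ t ∈ Ioo t0 t1, ContinuousOn (f t) (Ioo x0 x1)) (ct : ∀ x ∈ Ioo x0 x1, ContinuousOn (fun t => f t x) (Ioo t0 t1))
    (bf : ∀ t ∈ Ioo t0 t1, ∀ x ∈ Ioo x0 x1, |f t x| ≤ B) : ContinuousOn (fun t => ∫ y, f t y * ψ i y) (Ioo t0 t1) := by
  have hsub : Icc c d ⊆ Ioo x0 x1 := fun y hy => ⟨by linarith [hy.1], by linarith [hy.2]⟩
  obtain ⟨B', hB0, hB⟩ := hψ.bdd i
  intro t ht
  refine dct (c := c) (d := d) (K := B * B') ?_ ?_ ?_ ?_ ?_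
  · filter_upwards [self_mem_nhdsWithin] with s hs
    exact ((cx s hs).mono hsub).mul (hψ.cont i).continuousOn
  · filter_upwards with s y hy
    rw [hψ.z i y hy]; simp
  · intro y hy; rw [hψ.z i y hy]; simp
  · filter_upwards [self_mem_nhdsWithin] with s hs y hy
    rw [abs_mul]
    exact mul_le_mul (bf s hs y (hsub hy)) (hB y) (abs_nonneg _) ((abs_nonneg _).trans (bf s hs y (hsub hy)))
  · intro y hy
    exact ((ct y (hsub hy)) t ht).tendsto.mul tendsto_const_nhds

lemma gap (P : PS u u1 u2 h t0 t1 x0 x1 K H) (k : Ker ρ C E R) (hρ : 0 < ρ) {a b c' d' κ : ℝ} (ha : t0 < a) (hb : b ≤ t1)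
    (hba : b - a < 1) (hc' : x0 ≤ c') (hd' : d' ≤ x1) (hw : Weak u h a b c' d') (hκ : ∀ y ∈ Ioo c' d', |u2 a y| ≤ κ) :
    ∀ s ∈ Ioo a b, ∀ x ∈ Ioo (c'+ρ) (d'-ρ), |u s x - u a x| ≤ C * ((H+κ) + 2*ρ*(2*K)) * (s-a) := by
  intro s hs x hx
  have hIx : Ioo c' d' ⊆ Ioo x0 x1 := Ioo_subset_Ioo hc' hd'
  have hIt : Ioo a b ⊆ Ioo t0 t1 := Ioo_subset_Ioo ha.le hb
  have ha' : a ∈ Ioo t0 t1 := ⟨ha, by linarith [hs.1, hs.2]⟩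
  have hxI : x ∈ Ioo c' d' := ⟨by linarith [hx.1], by linarith [hx.2]⟩
  have hK : 0 ≤ K := (abs_nonneg _).trans (P.bu a ha' x (hIx hxI))
  have hH : 0 ≤ H := (abs_nonneg _).trans (P.bh a ha' x (hIx hxI))
  have hκ0 : 0 ≤ κ := (abs_nonneg _).trans (hκ x hxI)
  have hC := k.Cpos
  have W : WS (fun t => (Ioo c' d').indicator (fun y => u t y - u a y)) (fun t => (Ioo c' d').indicator (fun y => h t y + u2 a y)) a b c' d' (2*K) (H+κ) := by
    apply ws_of_weak
    · intro ψ c d hψ hc hd t ht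
      have h1 := hw ψ c d hψ hc hd t ht
      have i1 : ∀ t ∈ Ioo t0 t1, ∀ i, Integrable (fun y => u t y * ψ i y) := fun t ht i => loc_int (P.cx t ht) hψ (by linarith) (by linarith) i
      have i2 : Integrable (fun y => h t y * ψ 0 y) := loc_int (P.hhx t (hIt ht)) hψ (by linarith) (by linarith) 0
      have i3 : Integrable (fun y => u2 a y * ψ 0 y) := loc_int (P.cxx a ha') hψ (by linarith) (by linarith) 0
      have h2 := (h1.sub_const (∫ y, u a y * ψ 0 y))
      have e1 : ∀ᶠ s in nhds t, ∫ y, (u s y - u a y) * ψ 0 y = (∫ y, u s y * ψ 0 y) - ∫ y, u a y * ψ 0 y := by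
        filter_upwards [Ioo_mem_nhds ht.1 ht.2] with s hs
        simp only [sub_mul]
        exact integral_sub (i1 s (hIt hs) 0) (i1 a ha' 0)
      refine (h2.congr_of_eventuallyEq e1).congr_deriv ?_
      rw [integral_add (i1 t (hIt ht) 2) i2]
      have e2 : ∀ y, (u t y - u a y) * ψ 2 y + (h t y + u2 a y) * ψ 0 y = (u t y * ψ 2 y - u a y * ψ 2 y) + (h t y * ψ 0 y + u2 a y * ψ 0 y) := fun y => by ring
      simp only [e2]
      have e3 := integral_add ((i1 t (hIt ht) 2).sub (i1 a ha' 2)) (i2.add i3)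
      have e4 := integral_sub (i1 t (hIt ht) 2) (i1 a ha' 2)
      have e5 := integral_add i2 i3
      have e6 := P.ibp2 hψ (by linarith) (by linarith) ha'
      simp only [Pi.add_apply, Pi.sub_apply] at e3 e4 e5
      linarith
    · positivity
    · positivity
    · exact fun t ht => ((P.cx t (hIt ht)).sub (P.cx a ha')).mono hIx
    · exact fun t ht => ((P.hhx t (hIt ht)).add (P.cxx a ha')).mono hIx
    · exact fun y hy => ((P.ct y (hIx hy)).mono hIt).sub continuousOn_const
    · intro t ht y hy
      have h1 := P.bu t (hIt ht) y (hIx hy)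
      have h2 := P.bu a ha' y (hIx hy)
      refine (abs_sub _ _).trans ?_
      linarith
    · intro t ht y hy
      have h1 := P.bh t (hIt ht) y (hIx hy)
      have h2 := hκ y hy
      refine (abs_add_le _ _).trans ?_
      linarith
  set D : ℝ → ℝ → ℝ := fun t => (Ioo c' d').indicator (fun y => u t y - u a y) with hD
  have hJ : ∀ r, 0 < r → r < 1 - (b-a) → |∫ y, D s y * E 0 r (x-y)| ≤ C * ((H+κ) + 2*ρ*(2*K)) * (s-a) := by
    intro r hr hr1
    have l0 : Tendsto (fun σ => J E D 0 (s+r) x σ) (nhdsWithin a (Ioi a)) (nhds (∫ _ : ℝ, (0:ℝ))) := by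
      have hsub : Icc (x-ρ) (x+ρ) ⊆ Ioo c' d' := fun y hy => ⟨by linarith [hy.1, hx.1], by linarith [hy.2, hx.2]⟩
      refine dct (c := x-ρ) (d := x+ρ) (K := 2*K*(C*(√r)⁻¹)) ?_ ?_ ?_ ?_ ?_
      · filter_upwards [Ioo_mem_nhdsGT hs.1] with σ hσ
        have hσ' : σ ∈ Ioo a b := ⟨hσ.1, hσ.2.trans hs.2⟩
        refine ContinuousOn.mul ?_ (k.contx 0 (by linarith [hσ.2]) x).continuousOn
        refine ContinuousOn.congr (f := fun y => u σ y - u a y) ?_ fun y hy => indicator_of_mem (hsub hy) _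
        exact ((P.cx σ (hIt hσ')).sub (P.cx a ha')).mono (hsub.trans hIx)
      · filter_upwards with σ y hy
        rw [k.sE 0 _ _ (notIcc hy)]; simp
      · simp
      · filter_upwards [Ioo_mem_nhdsGT hs.1] with σ hσ y hy
        have hσ' : σ ∈ Ioo a b := ⟨hσ.1, hσ.2.trans hs.2⟩
        rw [abs_mul]
        have h1 := W.bu σ hσ' y
        have h2 := k.bE 0 (by norm_num) (s+r-σ) (by linarith [hσ.2]) (by linarith [hσ.1, hs.2]) (x-y)
        have h3 : (√(s+r-σ))⁻¹ ≤ (√r)⁻¹ := by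
          apply inv_anti₀ (Real.sqrt_pos.2 hr)
          exact Real.sqrt_le_sqrt (by linarith [hσ.2])
        rw [zero_add, pow_one] at h2
        exact mul_le_mul h1 (h2.trans (mul_le_mul_of_nonneg_left h3 hC.le)) (abs_nonneg _) (by positivity)
      · intro y hy
        have hc0 : Tendsto (fun σ => D σ y) (nhdsWithin a (Ioi a)) (nhds 0) := by
          have := (P.ht a ha' y (hIx (hsub hy))).continuousAt.tendsto.sub_const (u a y)
          rw [sub_self] at this
          refine (this.mono_left nhdsWithin_le_nhds).congr fun σ => ?_
          simp only [hD, indicator_of_mem (hsub hy)]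
        have hb1 : ∀ᶠ σ in nhdsWithin a (Ioi a), ‖E 0 (s+r-σ) (x-y)‖ ≤ C*(√r)⁻¹ := by
          filter_upwards [Ioo_mem_nhdsGT hs.1] with σ hσ
          have h2 := k.bE 0 (by norm_num) (s+r-σ) (by linarith [hσ.2]) (by linarith [hσ.1, hs.2]) (x-y)
          have h3 : (√(s+r-σ))⁻¹ ≤ (√r)⁻¹ := by
            apply inv_anti₀ (Real.sqrt_pos.2 hr)
            exact Real.sqrt_le_sqrt (by linarith [hσ.2])
          rw [zero_add, pow_one] at h2
          exact h2.trans (mul_le_mul_of_nonneg_left h3 hC.le)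
        exact hc0.zero_mul_isBoundedUnder_le ⟨_, eventually_map.2 hb1⟩
    rw [integral_zero] at l0
    have l1 := (tendsto_const_nhds (x := J E D 0 (s+r) x s)).sub l0
    rw [sub_zero] at l1
    have e : J E D 0 (s+r) x s = ∫ y, D s y * E 0 r (x-y) := by simp [J]
    rw [← e]
    refine le_of_tendsto l1.abs ?_
    filter_upwards [Ioo_mem_nhdsGT hs.1] with σ hσ
    have := J0_growth k hρ W (s := s+r) (x := x) (a := σ) (b := s) hσ.1 hσ.2.le hs.2 (by linarith) (by linarith [hσ.1, hs.2]) (by linarith [hx.1]) (by linarith [hx.2])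
    refine this.trans ?_
    apply mul_le_mul_of_nonneg_left (by linarith [hσ.1]) (by positivity)
  have hcont : ContinuousOn (D s) (Ioo c' d') := by
    refine ContinuousOn.congr (f := fun y => u s y - u a y) ?_ fun y hy => indicator_of_mem hy _
    exact ((P.cx s (hIt hs)).sub (P.cx a ha')).mono hIx
  have l := J_lim_loc k hρ hcont (x := x) (by linarith [hx.1]) (by linarith [hx.2])
  have eD : D s x = u s x - u a x := indicator_of_mem hxI _
  rw [eD] at l
  refine le_of_tendsto l.abs ?_
  filter_upwards [Ioo_mem_nhdsGT (show (0:ℝ) < 1-(b-a) by linarith)] with r hr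
  exact hJ r hr.1 hr.2

lemma sup_arg {y : ℝ → ℝ} {B : Set ℝ} {t s1 L : ℝ} (hts : t ≤ s1) (hy : ContinuousOn y (Icc t s1)) (hB : IsClosed (B ∩ Icc t s1)) (htB : t ∈ B)
    (h1 : ∀ σ ∈ B, σ ∈ Icc t s1 → ∃ y', HasDerivAt y y' σ ∧ |y'| < L)
    (h2 : ∀ a ∈ B, a ∈ Icc t s1 → ∀ s ∈ Icc t s1, a < s → (∀ σ ∈ Ioc a s, σ ∉ B) → |y s - y a| ≤ L*(s-a)) :
    |y s1 - y t| ≤ L * (s1-t) := by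
  by_contra hcon
  push Not at hcon
  set bad : Set ℝ := {s | s ∈ Icc t s1 ∧ L*(s-t) < |y s - y t|} with hbad
  have hne : bad.Nonempty := ⟨s1, right_mem_Icc.2 hts, hcon⟩
  have hbb : BddBelow bad := ⟨t, fun s hs => hs.1.1⟩
  set s0 := sInf bad with hs0
  have h0t : t ≤ s0 := le_csInf hne fun s hs => hs.1.1
  have h01 : s0 ≤ s1 := csInf_le hbb ⟨right_mem_Icc.2 hts, hcon⟩
  have hlt : ∀ s ∈ Icc t s1, s < s0 → |y s - y t| ≤ L*(s-t) := by
    intro s hs hs'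
    by_contra hc
    push Not at hc
    exact absurd (csInf_le hbb (⟨hs, hc⟩ : s ∈ bad)) (not_le.2 hs')
  have hle : |y s0 - y t| ≤ L*(s0-t) := by
    rcases h0t.eq_or_lt with h | h
    · rw [← h]; simp
    · have := right_nhdsWithin_Ico_neBot h
      have hc : Tendsto (fun s => |y s - y t| - L*(s-t)) (nhdsWithin s0 (Ico t s0)) (nhds (|y s0 - y t| - L*(s0-t))) := by
        have hc1 : ContinuousOn (fun s => |y s - y t| - L*(s-t)) (Icc t s1) :=
          (hy.sub continuousOn_const).abs.sub (by fun_prop)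
        exact (hc1 s0 ⟨h0t, h01⟩).mono fun s hs => ⟨hs.1, hs.2.le.trans h01⟩
      have := le_of_tendsto hc (b := 0) (by
        filter_upwards [self_mem_nhdsWithin] with s hs
        linarith [hlt s ⟨hs.1, hs.2.le.trans h01⟩ hs.2])
      linarith
  have h01' : s0 < s1 := by
    rcases h01.eq_or_lt with h | h
    · rw [h] at hle; linarith
    · exact h
  have hfin : ∃ b > s0, ∀ s ∈ Ioo s0 b, s ≤ s1 → |y s - y t| ≤ L*(s-t) := by
    by_cases hsB : s0 ∈ B
    · obtain ⟨y', hd, hy'⟩ := h1 s0 hsB ⟨h0t, h01⟩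
      have := (hasDerivAt_iff_isLittleO.1 hd).def (show 0 < L - |y'| by linarith)
      obtain ⟨ε, hε, hb⟩ := Metric.eventually_nhds_iff.1 this
      refine ⟨s0+ε, by linarith, fun s hs _ => ?_⟩
      have h3 := hb (y := s) (by rw [Real.dist_eq, abs_of_pos (by linarith [hs.1])]; linarith [hs.2])
      simp only [smul_eq_mul, Real.norm_eq_abs, abs_of_pos (show 0 < s - s0 by linarith [hs.1])] at h3
      have e : y s - y t = (y s - y s0 - (s-s0)*y') + (s-s0)*y' + (y s0 - y t) := by ring
      rw [e]
      have h4 := abs_add_le ((y s - y s0 - (s-s0)*y') + (s-s0)*y') (y s0 - y t)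
      have h5 := abs_add_le (y s - y s0 - (s-s0)*y') ((s-s0)*y')
      have h6 : |(s-s0)*y'| = (s-s0)*|y'| := by rw [abs_mul, abs_of_pos (by linarith [hs.1])]
      nlinarith
    · have hcpt : IsCompact (B ∩ Icc t s0) := by
        have : B ∩ Icc t s0 = (B ∩ Icc t s1) ∩ Icc t s0 := by
          ext σ; simp only [mem_inter_iff, mem_Icc]; constructor
          · rintro ⟨a, b, c⟩; exact ⟨⟨a, b, c.trans h01⟩, b, c⟩
          · rintro ⟨⟨a, _, _⟩, b, c⟩; exact ⟨a, b, c⟩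
        rw [this]; exact isCompact_Icc.inter_left hB
      have hane : (B ∩ Icc t s0).Nonempty := ⟨t, htB, le_rfl, h0t⟩
      have ham := hcpt.sSup_mem hane
      set a := sSup (B ∩ Icc t s0) with ha
      have has : a < s0 := lt_of_le_of_ne ham.2.2 fun h => hsB (h ▸ ham.1)
      have hev : ∀ᶠ s in nhds s0, s ∉ B ∩ Icc t s1 := hB.isOpen_compl.mem_nhds fun h => hsB h.1
      obtain ⟨ε, hε, hb⟩ := Metric.eventually_nhds_iff.1 hev
      refine ⟨s0+ε, by linarith, fun s hs hss => ?_⟩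
      have hsm : s ∈ Icc t s1 := ⟨by linarith [hs.1], hss⟩
      have ham1 : a ∈ Icc t s1 := ⟨ham.2.1, by linarith⟩
      have h3 := h2 a ham.1 ham1 s hsm (by linarith [hs.1]) (by
        intro σ hσ hσB
        rcases le_or_gt σ s0 with hh | hh
        · have : σ ≤ a := le_csSup hcpt.bddAbove ⟨hσB, by linarith [hσ.1, ham.2.1], hh⟩
          linarith [hσ.1]
        · refine hb (y := σ) ?_ ⟨hσB, by linarith, by linarith [hσ.2]⟩
          rw [Real.dist_eq, abs_of_pos (by linarith)]; linarith [hs.2, hσ.2])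
      have h4 := hlt a ham1 has
      have h5 := abs_add_le (y s - y a) (y a - y t)
      have e : y s - y t = (y s - y a) + (y a - y t) := by ring
      rw [e]; linarith
  obtain ⟨b, hb, hbs⟩ := hfin
  have : b ≤ s0 := by
    apply le_csInf hne
    intro s hs
    by_contra hc
    push Not at hc
    have hs0s : s0 ≤ s := csInf_le hbb hs
    rcases hs0s.eq_or_lt with h | h
    · rw [← h] at hs; linarith [hs.2]
    · linarith [hs.2, hbs s ⟨h, hc⟩ hs.1.2]
  linarith

lemma deriv_of_right {U V : ℝ → ℝ} {a b : ℝ} (hU : ContinuousOn U (Ioo a b)) (hV : ContinuousOn V (Ioo a b))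
    (hr : ∀ t ∈ Ioo a b, HasDerivWithinAt U (V t) (Ici t) t) : ∀ t ∈ Ioo a b, HasDerivAt U (V t) t := by
  intro t ht
  set a' := (a+t)/2
  set b' := (t+b)/2
  have ha' : a < a' ∧ a' < t := ⟨by simp only [a']; linarith [ht.1], by simp only [a']; linarith [ht.1]⟩
  have hb' : t < b' ∧ b' < b := ⟨by simp only [b']; linarith [ht.2], by simp only [b']; linarith [ht.2]⟩
  have hsub : Icc a' b' ⊆ Ioo a b := fun s hs => ⟨by linarith [hs.1], by linarith [hs.2]⟩
  have hI : ∀ s ∈ Ioo a b, HasDerivAt (fun s => ∫ σ in a'..s, V σ) (V s) s := by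
    intro s hs
    have hm : uIcc a' s ⊆ Ioo a b := by
      intro σ hσ
      rw [mem_uIcc] at hσ
      rcases hσ with hσ | hσ
      · exact ⟨by linarith [hσ.1], by linarith [hσ.2, hs.2]⟩
      · exact ⟨by linarith [hσ.1, hs.1], by linarith [hσ.2]⟩
    apply intervalIntegral.integral_hasDerivAt_right (hV.mono hm).intervalIntegrable
    · exact hV.stronglyMeasurableAtFilter isOpen_Ioo s hs
    · exact hV.continuousAt (Ioo_mem_nhds hs.1 hs.2)
  have hc := constant_of_has_deriv_right_zero (f := fun s => U s - ∫ σ in a'..s, V σ) (a := a') (b := b')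
    ((hU.mono hsub).sub fun s hs => (hI s (hsub hs)).continuousAt.continuousWithinAt)
    (fun s hs => ((hr s (hsub ⟨hs.1, hs.2.le⟩)).sub (hI s (hsub ⟨hs.1, hs.2.le⟩)).hasDerivWithinAt).congr_deriv (sub_self _))
  have h1 := (hI t ht).const_add (U a')
  refine h1.congr_of_eventuallyEq ?_
  filter_upwards [Icc_mem_nhds ha'.2 hb'.1] with s hs
  have := hc s hs
  simp at this
  linarith

lemma PS.weak_loc (P : PS u u1 u2 h t0 t1 x0 x1 K H) {c' d' : ℝ} (hc' : x0 < c') (hcd : c' < d') (hd' : d' < x1) : Weak u h t0 t1 c' d' := by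
  set Dt : ℝ → Prop := fun t => ∀ ψ c d, TF ψ c d → c' < c → d < d' → 
    HasDerivAt (fun s => ∫ y, u s y * ψ 0 y) (∫ y, (u t y * ψ 2 y + h t y * ψ 0 y)) t with hDt
  have hIx : Ioo c' d' ⊆ Ioo x0 x1 := Ioo_subset_Ioo hc'.le hd'.le
  suffices hall : ∀ t ∈ Ioo t0 t1, Dt t by
    intro ψ c d hψ hc hd t ht
    exact hall t ht ψ c d hψ hc hd
  by_contra hcon
  push Not at hcon
  obtain ⟨tb, htb, hDtb⟩ := hcon
  set O : Set ℝ := {t | ∀ᶠ s in nhds t, Dt s} with hO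
  have hOo : IsOpen O := by
    rw [isOpen_iff_mem_nhds]
    intro t ht
    exact eventually_eventually_nhds.2 ht
  set B : Set ℝ := Ioo t0 t1 ∩ Oᶜ with hB
  have hBl : IsLocallyClosed B := isOpen_Ioo.isLocallyClosed.inter hOo.isClosed_compl.isLocallyClosed
  have : LocallyCompactSpace B := hBl.locallyCompactSpace
  have htbB : tb ∈ B := ⟨htb, fun hh => hDtb hh.self_of_nhds⟩
  have : Nonempty B := ⟨⟨tb, htbB⟩⟩
  set A : ℕ → Set B := fun k => {t | ∀ ψ c d, TF ψ c d → c' < c → d < d' → |∫ y, u t y * ψ 2 y| ≤ k * ∫ y, |ψ 0 y|} with hA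
  have hcont : ∀ (ψ : ℕ → ℝ → ℝ) (c d : ℝ), TF ψ c d → c' < c → d < d' → ∀ i, ContinuousOn (fun t => ∫ y, u t y * ψ i y) (Ioo t0 t1) :=
    fun ψ c d hψ hc hd i => cont_pair hψ (by linarith) (by linarith) i P.cx P.ct P.bu
  have hAc : ∀ k, IsClosed (A k) := by
    intro k
    simp only [hA, ofPred_forall]
    refine isClosed_iInter fun ψ => isClosed_iInter fun c => isClosed_iInter fun d => isClosed_iInter fun hψ => isClosed_iInter fun hc => isClosed_iInter fun hd => ?_
    refine isClosed_le (Continuous.abs ?_) continuous_const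
    exact (hcont ψ c d hψ hc hd 2).comp_continuous continuous_subtype_val fun t => t.2.1
  have hAu : ⋃ k, A k = univ := by
    rw [eq_univ_iff_forall]
    intro t
    have hsub : Icc c' d' ⊆ Ioo x0 x1 := fun y hy => ⟨by linarith [hy.1], by linarith [hy.2]⟩
    obtain ⟨b, hb⟩ := isCompact_Icc.exists_bound_of_continuousOn ((P.cxx t t.2.1).mono hsub)
    obtain ⟨k, hk⟩ := exists_nat_ge b
    rw [mem_iUnion]
    refine ⟨k, fun ψ c d hψ hc hd => ?_⟩
    rw [P.ibp2 hψ (by linarith) (by linarith) t.2.1]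
    have e : ∀ y, u2 t y * ψ 0 y = (Icc c' d').indicator (u2 t) y * ψ 0 y := by
      intro y
      by_cases hy : y ∈ Icc c' d'
      · rw [indicator_of_mem hy]
      · rw [hψ.z 0 y fun h' => hy ⟨by linarith [h'.1], by linarith [h'.2]⟩]; simp
    simp only [e]
    refine bm_bound (fun y => ?_) (cs_integrable (hψ.cont 0) (hψ.z 0))
    by_cases hy : y ∈ Icc c' d'
    · rw [indicator_of_mem hy]; exact (hb y hy).trans hk
    · rw [indicator_of_notMem hy]; simp
  obtain ⟨m, ts, hts⟩ := nonempty_interior_of_iUnion_of_closed hAc hAu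
  obtain ⟨O', hO', hO'2⟩ := (mem_nhds_subtype B ts (A m)).1 (mem_interior_iff_mem_nhds.1 hts)
  obtain ⟨δ, hδ, hδ1, hδO, hδI⟩ : ∃ δ > 0, δ < 1/4 ∧ Ioo (ts.1-δ) (ts.1+δ) ⊆ O' ∧ Ioo (ts.1-δ) (ts.1+δ) ⊆ Ioo t0 t1 := by
    obtain ⟨ε, hε, hh⟩ := Metric.mem_nhds_iff.1 (Filter.inter_mem hO' (Ioo_mem_nhds ts.2.1.1 ts.2.1.2))
    rw [Real.ball_eq_Ioo] at hh
    have hmm : Ioo (ts.1 - min ε (1/8)) (ts.1 + min ε (1/8)) ⊆ Ioo (ts.1-ε) (ts+ε) := by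
      apply Ioo_subset_Ioo
      · linarith [min_le_left ε (1/8)]
      · linarith [min_le_left ε (1/8)]
    refine ⟨min ε (1/8), lt_min hε (by norm_num), (min_le_right _ _).trans_lt (by norm_num), ?_, ?_⟩
    · exact fun t ht => (hh (hmm ht)).1
    · exact fun t ht => (hh (hmm ht)).2
  have hBA : ∀ t ∈ Ioo (ts.1-δ) (ts.1+δ), t ∈ B → ∀ ψ c d, TF ψ c d → c' < c → d < d' → |∫ y, u t y * ψ 2 y| ≤ m * ∫ y, |ψ 0 y| := by
    intro t ht htB
    exact hO'2 (show (⟨t, htB⟩ : B) ∈ Subtype.val ⁻¹' O' from hδO ht)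
  suffices hJ : ∀ t ∈ Ioo (ts.1-δ) (ts.1+δ), Dt t by
    apply ts.2.2
    show ∀ᶠ s in nhds ts.1, Dt s
    filter_upwards [Ioo_mem_nhds (show ts.1-δ < ts by linarith) (show ts.1 < ts+δ by linarith)] with t ht using hJ t ht
  intro t ht ψ c d hψ hc hd
  set ρ := min (c-c') (d'-d) / 3 with hρd
  have hρ : 0 < ρ := by
    have : 0 < min (c-c') (d'-d) := lt_min (by linarith) (by linarith)
    positivity
  have hρc : c' + 3*ρ ≤ c := by linarith [min_le_left (c-c') (d'-d)]
  have hρdd : d ≤ d' - 3*ρ := by linarith [min_le_right (c-c') (d'-d)]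
  obtain ⟨C, E, R, k⟩ := Ker_exists ρ hρ
  have hC := k.Cpos
  have hmid : (c'+d')/2 ∈ Ioo x0 x1 := hIx ⟨by linarith, by linarith⟩
  have hK : 0 ≤ K := (abs_nonneg _).trans (P.bu tb htb _ hmid)
  have hH : 0 ≤ H := (abs_nonneg _).trans (P.bh tb htb _ hmid)
  have hu2 : ∀ t ∈ Ioo (ts.1-δ) (ts.1+δ), t ∈ B → ∀ y ∈ Ioo (c'+ρ) (d'-ρ), |u2 t y| ≤ m*C := by
    intro t ht htB y hy
    have l := J_lim_loc k hρ (P.cxx t htB.1) (x := y) (by linarith [hy.1]) (by linarith [hy.2])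
    refine le_of_tendsto l.abs ?_
    filter_upwards [Ioo_mem_nhdsGT (show (0:ℝ) < 1 by norm_num)] with r hr
    have h1 := hBA t ht htB _ _ _ (k.tf 0 hr.1 y) (by linarith [hy.1]) (by linarith [hy.2])
    rw [P.ibp2 (k.tf 0 hr.1 y) (by linarith [hy.1]) (by linarith [hy.2]) htB.1] at h1
    simp only [pow_zero, one_mul, add_zero] at h1
    have h2 := k.iE' (i := 0) (by norm_num) hr.1 hr.2.le y
    rw [pow_zero, mul_one] at h2
    exact h1.trans (mul_le_mul_of_nonneg_left h2 (by positivity))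
  set L := C * ((H+m*C) + 2*ρ*(2*K)) + m*C + H + 1 with hL
  have hLip : ∀ t ∈ Ioo (ts.1-δ) (ts.1+δ), t ∈ B → ∀ s ∈ Ioo (ts.1-δ) (ts.1+δ), t ≤ s → ∀ y ∈ Icc c d, |u s y - u t y| ≤ L*(s-t) := by
    intro t ht htB s hs hts y hy
    have hyI : y ∈ Ioo x0 x1 := ⟨by linarith [hy.1], by linarith [hy.2]⟩
    have hIcc : Icc t s ⊆ Ioo (ts.1-δ) (ts.1+δ) := fun σ hσ => ⟨by linarith [hσ.1, ht.1], by linarith [hσ.2, hs.2]⟩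
    refine sup_arg (y := fun s => u s y) (B := B) hts ((P.ct y hyI).mono (hIcc.trans hδI)) ?_ htB ?_ ?_
    · have : B ∩ Icc t s = Oᶜ ∩ Icc t s := by
        ext σ; constructor
        · rintro ⟨a, b⟩; exact ⟨a.2, b⟩
        · rintro ⟨a, b⟩; exact ⟨⟨hδI (hIcc b), a⟩, b⟩
      rw [this]
      exact hOo.isClosed_compl.inter isClosed_Icc
    · intro σ hσB hσ
      refine ⟨_, P.ht σ hσB.1 y hyI, ?_⟩
      have h1 := hu2 σ (hIcc hσ) hσB y ⟨by linarith [hy.1], by linarith [hy.2]⟩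
      have h2 := P.bh σ hσB.1 y hyI
      have h3 := abs_add_le (u2 σ y) (h σ y)
      have h4 : 0 ≤ C * ((H+m*C) + 2*ρ*(2*K)) := by positivity
      linarith
    · intro a haB ha s' hs' has' hno
      -- the interval (a,s'] extended slightly beyond s'
      have hs'O : s' ∈ O := by
        by_contra hh
        exact hno s' ⟨has', le_rfl⟩ ⟨hδI (hIcc hs'), hh⟩
      obtain ⟨ε, hε, hh⟩ := Metric.mem_nhds_iff.1 (Filter.inter_mem (hOo.mem_nhds hs'O) (Ioo_mem_nhds (hIcc hs').1 (hIcc hs').2))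
      rw [Real.ball_eq_Ioo] at hh
      have hb1 : s' + ε/2 ∈ Ioo (ts.1-δ) (ts.1+δ) := (hh (show s'+ε/2 ∈ Ioo (s'-ε) (s'+ε) from ⟨by linarith, by linarith⟩)).2
      have hw : Weak u h a (s'+ε/2) (c'+ρ) (d'-ρ) := by
        intro ψ' c1 d1 hψ' hc1 hd1 σ hσ
        have hσO : σ ∈ O := by
          rcases le_or_gt σ s' with h3 | h3
          · by_contra hh
            exact hno σ ⟨hσ.1, h3⟩ ⟨hδI ⟨by linarith [hσ.1, (hIcc ha).1], by linarith [(hIcc hs').2]⟩, hh⟩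
          · exact (hh (show σ ∈ Ioo (s'-ε) (s'+ε) from ⟨by linarith, by linarith [hσ.2]⟩)).1
        have : Dt σ := (show ∀ᶠ s in nhds σ, Dt s from hσO).self_of_nhds
        exact this ψ' c1 d1 hψ' (by linarith) (by linarith)
      have := gap P k hρ (a := a) (b := s'+ε/2) (c' := c'+ρ) (d' := d'-ρ) (κ := m*C) haB.1.1 (hδI hb1).2.le (by linarith [hb1.2, (hIcc ha).1])
        (by linarith) (by linarith) hw (hu2 a (hIcc ha) haB) s' ⟨has', by linarith⟩ y ⟨by linarith [hy.1], by linarith [hy.2]⟩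
      refine this.trans (mul_le_mul_of_nonneg_right ?_ (by linarith))
      have : 0 ≤ m*C := by positivity
      linarith
  have hsubc : Icc c d ⊆ Ioo x0 x1 := fun y hy => ⟨by linarith [hy.1], by linarith [hy.2]⟩
  obtain ⟨Bψ, hBψ0, hBψ⟩ := hψ.bdd 0
  have hintg : ∀ t ∈ Ioo t0 t1, ∫ y, (u t y * ψ 2 y + h t y * ψ 0 y) = ∫ y, (u2 t y + h t y) * ψ 0 y := by
    intro t ht
    have i1 := loc_int (P.cx t ht) hψ (by linarith) (by linarith) 2
    have i2 := loc_int (P.hhx t ht) hψ (by linarith) (by linarith) 0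
    have i3 := loc_int (P.cxx t ht) hψ (by linarith) (by linarith) 0
    simp only [add_mul]
    rw [integral_add i1 i2, integral_add i3 i2, P.ibp2 hψ (by linarith) (by linarith) ht]
  refine deriv_of_right (U := fun s => ∫ y, u s y * ψ 0 y) (V := fun t => ∫ y, (u t y * ψ 2 y + h t y * ψ 0 y)) 
    ((hcont ψ c d hψ hc hd 0).mono hδI) ?_ ?_ t ht
  · have h1 := ((hcont ψ c d hψ hc hd 2).mono hδI).add ((cont_pair hψ (by linarith) (by linarith) 0 P.hhx P.hht P.bh).mono hδI)
    refine h1.congr fun t ht => ?_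
    exact integral_add (loc_int (P.cx t (hδI ht)) hψ (by linarith) (by linarith) 2) (loc_int (P.hhx t (hδI ht)) hψ (by linarith) (by linarith) 0)
  · intro t ht
    by_cases htB : t ∈ B
    · rw [hintg t htB.1, hasDerivWithinAt_iff_tendsto_slope, Ici_sdiff_left]
      have hev : Ioo t (ts.1+δ) ∈ nhdsWithin t (Ioi t) := Ioo_mem_nhdsGT ht.2
      have hl : Tendsto (fun s => ∫ y, slope (fun s => u s y) t s * ψ 0 y) (nhdsWithin t (Ioi t)) (nhds (∫ y, (u2 t y + h t y) * ψ 0 y)) := by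
        refine dct (c := c) (d := d) (K := L*Bψ) ?_ ?_ ?_ ?_ ?_
        · filter_upwards [hev] with s hs
          have hs' : s ∈ Ioo t0 t1 := hδI ⟨by linarith [hs.1, ht.1], hs.2⟩
          refine ContinuousOn.mul ?_ (hψ.cont 0).continuousOn
          simp only [slope, vsub_eq_sub, smul_eq_mul]
          exact continuousOn_const.mul (((P.cx s hs').sub (P.cx t htB.1)).mono hsubc)
        · filter_upwards with s y hy
          rw [hψ.z 0 y hy]; simp
        · intro y hy; rw [hψ.z 0 y hy]; simp
        · filter_upwards [hev] with s hs y hy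
          have hst : 0 < s - t := by linarith [hs.1]
          have h1 := hLip t ht htB s ⟨by linarith [hs.1, ht.1], hs.2⟩ hs.1.le y hy
          have h2 : |slope (fun s => u s y) t s| ≤ L := by
            simp only [slope, vsub_eq_sub, smul_eq_mul]
            rw [abs_mul, abs_of_pos (inv_pos.2 hst), inv_mul_le_iff₀ hst]
            linarith
          rw [abs_mul]
          exact mul_le_mul h2 (hBψ y) (abs_nonneg _) ((abs_nonneg _).trans h2)
        · intro y hy
          have := hasDerivAt_iff_tendsto_slope.1 (P.ht t htB.1 y (hsubc hy))
          exact (this.mono_left (nhdsWithin_mono _ fun s hs => ne_of_gt hs)).mul tendsto_const_nhds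
      refine hl.congr' ?_
      filter_upwards [hev] with s hs
      have hs' : s ∈ Ioo t0 t1 := hδI ⟨by linarith [hs.1, ht.1], hs.2⟩
      simp only [slope, vsub_eq_sub, smul_eq_mul]
      rw [← integral_sub (loc_int (P.cx s hs') hψ (by linarith) (by linarith) 0) (loc_int (P.cx t htB.1) hψ (by linarith) (by linarith) 0), ← integral_const_mul]
      congr 1; ext y; ring
    · have htO : t ∈ O := by
        by_contra hh
        exact htB ⟨hδI ht, hh⟩
      have : Dt t := (show ∀ᶠ s in nhds t, Dt s from htO).self_of_nhds
      exact (this ψ c d hψ hc hd).hasDerivWithinAt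

lemma PS.weak (P : PS u u1 u2 h t0 t1 x0 x1 K H) : Weak u h t0 t1 x0 x1 := by
  intro ψ c d hψ hc hd t ht
  by_cases hcd : c ≤ d
  · exact P.weak_loc (c' := (x0+c)/2) (d' := (d+x1)/2) (by linarith) (by linarith) (by linarith) ψ c d hψ (by linarith) (by linarith) t ht
  · have hz : ∀ i y, ψ i y = 0 := fun i y => hψ.z i y fun h' => hcd (h'.1.trans h'.2)
    simp only [hz, mul_zero, add_zero, integral_zero]
    exact hasDerivAt_const _ _

lemma PS.ws (P : PS u u1 u2 h t0 t1 x0 x1 K H) (hK : 0 ≤ K) (hH : 0 ≤ H) :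
    WS (fun t => (Ioo x0 x1).indicator (u t)) (fun t => (Ioo x0 x1).indicator (h t)) t0 t1 x0 x1 K H :=
  ws_of_weak P.weak hK hH P.cx P.hhx P.ct P.bu P.bh
end

section
variable {u u1 u2 h : ℝ → ℝ → ℝ} {t0 t1 x0 x1 K H : ℝ}

structure GB (g : ℝ → ℝ → ℝ) (a b K H Λ β : ℝ) : Prop where
  bd : ∀ x ∈ Ioo a b, ∀ z ∈ Icc 0 K, |g x z| ≤ H
  lip : ∀ x ∈ Ioo a b, ∀ x' ∈ Ioo a b, ∀ z ∈ Icc 0 K, ∀ z' ∈ Icc 0 K, |g x z - g x' z'| ≤ Λ * (|x-x'|^β + |z-z'|)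

lemma PS.lip {ρ C : ℝ} {E R : ℕ → ℝ → ℝ → ℝ} (P : PS u u1 u2 h t0 t1 x0 x1 K H) (k : Ker ρ C E R) (hρ : 0 < ρ)
    {s τ : ℝ} (hτ : 0 < τ) (hτ1 : τ < 1) (hs0 : t0 < s - τ) (hs1 : s < t1) :
    ∀ x ∈ Ioo (x0+ρ) (x1-ρ), ∀ x' ∈ Ioo (x0+ρ) (x1-ρ), |u s x - u s x'| ≤ C * (K/√τ + 4*H*√τ + 8*ρ*K*τ) * |x-x'| := by
  intro x hx x' hx'
  have hs : s ∈ Ioo t0 t1 := ⟨by linarith, hs1⟩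
  have hI : Ioo (x0+ρ) (x1-ρ) ⊆ Ioo x0 x1 := Ioo_subset_Ioo (by linarith) (by linarith)
  have hK : 0 ≤ K := (abs_nonneg _).trans (P.bu s hs x (hI hx))
  have hH : 0 ≤ H := (abs_nonneg _).trans (P.bh s hs x (hI hx))
  have := ws_lip k hρ (P.ws hK hH) hτ hτ1 hs0 hs1 hx hx' ((P.cx s hs).congr fun y hy => indicator_of_mem hy _)
  simpa only [indicator_of_mem (hI hx), indicator_of_mem (hI hx')] using this

lemma PS.c2 {ρ C : ℝ} {E R : ℕ → ℝ → ℝ → ℝ} (P : PS u u1 u2 h t0 t1 x0 x1 K H) (k : Ker ρ C E R) (hρ : 0 < ρ)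
    {s τ x ν Λ β : ℝ} (hτ : 0 < τ) (hτ1 : τ < 1) (hs0 : t0 < s - τ) (hs1 : s < t1) (hx : x ∈ Ioo (x0+ρ) (x1-ρ))
    (hβ : 0 < β) (hβ1 : β ≤ 1) (hν : ∀ y, |x-y| ≤ ρ → |u (s-τ) y - u (s-τ) x| ≤ ν)
    (hΛ : ∀ σ ∈ Icc (s-τ) s, ∀ y, |x-y| ≤ ρ → |h σ y - h σ x| ≤ Λ * |x-y|^β) :
    |u2 s x| ≤ C * (ν/τ + (4/β) * Λ * τ^(β/2) + 8*ρ*K*τ) := by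
  have hs : s ∈ Ioo t0 t1 := ⟨by linarith, hs1⟩
  have hI : Ioo (x0+ρ) (x1-ρ) ⊆ Ioo x0 x1 := Ioo_subset_Ioo (by linarith) (by linarith)
  have hK : 0 ≤ K := (abs_nonneg _).trans (P.bu s hs x (hI hx))
  have hH : 0 ≤ H := (abs_nonneg _).trans (P.bh s hs x (hI hx))
  have hy : ∀ y, |x-y| ≤ ρ → y ∈ Ioo x0 x1 := by
    intro y hy
    rw [abs_le] at hy
    exact ⟨by linarith [hx.1], by linarith [hx.2]⟩
  refine ws_c2 k hρ (P.ws hK hH) hτ hτ1 hs0 hs1 hx (v1 := u1 s) (v2 := u2 s) ?_ (P.hxx s hs) (P.cxx s hs) hβ hβ1 ?_ ?_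
  · intro y hy
    refine (P.hx s hs y hy).congr_of_eventuallyEq ?_
    filter_upwards [Ioo_mem_nhds hy.1 hy.2] with z hz using indicator_of_mem hz _
  · intro y hxy
    simp only [indicator_of_mem (hI hx), indicator_of_mem (hy y hxy)]
    exact hν y hxy
  · intro σ hσ y hxy
    simp only [indicator_of_mem (hI hx), indicator_of_mem (hy y hxy)]
    exact hΛ σ hσ y hxy

lemma reg (β K H Λ ρ τ0 : ℝ) (hβ : 0 < β) (hβ1 : β ≤ 1) (hK : 0 ≤ K) (hH : 0 ≤ H) (hΛ : 0 ≤ Λ) (hρ : 0 < ρ) (hρ1 : ρ ≤ 1) (hτ0 : 0 < τ0) (hτ1 : τ0 < 1) :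
    ∃ C > 0, ∀ (g u u1 u2 : ℝ → ℝ → ℝ) (t0 t1 x0 x1 : ℝ), GB g x0 x1 K H Λ β → PS u u1 u2 (fun t x => g x (u t x)) t0 t1 x0 x1 K H →
      (∀ t ∈ Ioo t0 t1, ∀ x ∈ Ioo x0 x1, 0 ≤ u t x) →
      (∀ s ∈ Ioo (t0+τ0) t1, ∀ x ∈ Ioo (x0+ρ) (x1-ρ), ∀ x' ∈ Ioo (x0+ρ) (x1-ρ), |u s x - u s x'| ≤ C * |x-x'|) ∧
      (∀ s τ x ν, 0 < τ → τ < 1 → t0+τ0 < s-τ → s < t1 → x ∈ Ioo (x0+2*ρ) (x1-2*ρ) → (∀ y, |x-y| ≤ ρ → |u (s-τ) y - u (s-τ) x| ≤ ν) →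
        |u2 s x| ≤ C * (ν/τ + τ^(β/2))) ∧
      (∀ s ∈ Ioo (t0+2*τ0) t1, ∀ x ∈ Ioo (x0+2*ρ) (x1-2*ρ), |u2 s x| ≤ C) := by
  obtain ⟨C0, E, R, k⟩ := Ker_exists ρ hρ
  have hC0 := k.Cpos
  set L := C0 * (K/√τ0 + 4*H*√τ0 + 8*ρ*K*τ0) with hL
  have hL0 : 0 ≤ L := by positivity
  set C1 := C0 * (1 + (4/β) * (Λ*(1+L)) + 8*ρ*K) with hC1
  have hC10 : 0 ≤ C1 := by positivity
  set C2 := C1 * (2*K/τ0 + τ0^(β/2)) with hC2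
  have hC20 : 0 ≤ C2 := by positivity
  refine ⟨L + C1 + C2 + 1, by positivity, ?_⟩
  intro g u u1 u2 t0 t1 x0 x1 G P hpos
  have hI : Ioo (x0+ρ) (x1-ρ) ⊆ Ioo x0 x1 := Ioo_subset_Ioo (by linarith) (by linarith)
  have hlip : ∀ s ∈ Ioo (t0+τ0) t1, ∀ x ∈ Ioo (x0+ρ) (x1-ρ), ∀ x' ∈ Ioo (x0+ρ) (x1-ρ), |u s x - u s x'| ≤ L * |x-x'| :=
    fun s hs x hx x' hx' => P.lip k hρ hτ0 hτ1 (by linarith [hs.1]) hs.2 x hx x' hx'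
  have hc2 : ∀ s τ x ν, 0 < τ → τ < 1 → t0+τ0 < s-τ → s < t1 → x ∈ Ioo (x0+2*ρ) (x1-2*ρ) → (∀ y, |x-y| ≤ ρ → |u (s-τ) y - u (s-τ) x| ≤ ν) →
        |u2 s x| ≤ C1 * (ν/τ + τ^(β/2)) := by
    intro s τ x ν hτ hτ1 hs0 hs1 hx hν
    have hν0 : 0 ≤ ν := (abs_nonneg _).trans (hν x (by simpa using hρ.le))
    have h1 := P.c2 k hρ (s := s) (τ := τ) (x := x) (ν := ν) (Λ := Λ*(1+L)) (β := β) hτ hτ1 (by linarith) hs1 ⟨by linarith [hx.1], by linarith [hx.2]⟩ hβ hβ1 hν (by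
      intro σ hσ y hy
      have hσ' : σ ∈ Ioo (t0+τ0) t1 := ⟨by linarith [hσ.1], by linarith [hσ.2]⟩
      have hσ'' : σ ∈ Ioo t0 t1 := ⟨by linarith [hσ.1], by linarith [hσ.2]⟩
      have hyy := abs_le.1 hy
      have hx1 : x ∈ Ioo (x0+ρ) (x1-ρ) := ⟨by linarith [hx.1], by linarith [hx.2]⟩
      have hy1 : y ∈ Ioo (x0+ρ) (x1-ρ) := ⟨by linarith [hx.1], by linarith [hx.2]⟩
      have hz : ∀ y ∈ Ioo x0 x1, u σ y ∈ Icc 0 K := fun y hy => ⟨hpos σ hσ'' y hy, (le_abs_self _).trans (P.bu σ hσ'' y hy)⟩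
      have g1 := G.lip y (hI hy1) x (hI hx1) _ (hz y (hI hy1)) _ (hz x (hI hx1))
      have g2 := hlip σ hσ' y hy1 x hx1
      have g3 : |x-y| ≤ |x-y|^β := by
        rcases (abs_nonneg (x-y)).eq_or_lt with h0 | h0
        · rw [← h0, Real.zero_rpow hβ.ne']
        · calc |x-y| = |x-y|^(1:ℝ) := (Real.rpow_one _).symm
            _ ≤ _ := Real.rpow_le_rpow_of_exponent_ge h0 (hy.trans hρ1) hβ1
      rw [abs_sub_comm y x] at g1 g2
      calc _ ≤ _ := g1
        _ ≤ Λ * (|x-y|^β + L * |x-y|^β) := by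
          apply mul_le_mul_of_nonneg_left _ hΛ
          have := mul_le_mul_of_nonneg_left g3 hL0
          linarith
        _ = _ := by ring)
    refine h1.trans ?_
    have q1 : τ ≤ τ^(β/2) := by
      calc τ = τ^(1:ℝ) := (Real.rpow_one _).symm
        _ ≤ _ := Real.rpow_le_rpow_of_exponent_ge hτ hτ1.le (by linarith)
    have q2 : 0 ≤ ν/τ := by positivity
    have q3 : 0 ≤ τ^(β/2) := by positivity
    have q4 : 0 ≤ (4/β) * (Λ*(1+L)) + 8*ρ*K := by positivity
    have q5 := mul_le_mul_of_nonneg_left q1 (show 0 ≤ 8*ρ*K by positivity)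
    have q6 := mul_nonneg q4 q2
    have e : C1 * (ν/τ + τ^(β/2)) = C0 * ((1 + (4/β) * (Λ*(1+L)) + 8*ρ*K) * (ν/τ + τ^(β/2))) := by rw [hC1]; ring
    rw [e]
    apply mul_le_mul_of_nonneg_left _ hC0.le
    linarith
  refine ⟨fun s hs x hx x' hx' => (hlip s hs x hx x' hx').trans ?_, ?_, ?_⟩
  · exact mul_le_mul_of_nonneg_right (by linarith) (abs_nonneg _)
  · intro s τ x ν hτ hτ1 hs0 hs1 hx hν
    refine (hc2 s τ x ν hτ hτ1 hs0 hs1 hx hν).trans ?_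
    have hν0 : 0 ≤ ν := (abs_nonneg _).trans (hν x (by simpa using hρ.le))
    have : 0 ≤ ν/τ + τ^(β/2) := by positivity
    exact mul_le_mul_of_nonneg_right (by linarith) this
  · intro s hs x hx
    have := hc2 s τ0 x (2*K) hτ0 hτ1 (by linarith [hs.1]) hs.2 hx (by
      intro y hy
      have hyy := abs_le.1 hy
      have hs' : s-τ0 ∈ Ioo t0 t1 := ⟨by linarith [hs.1], by linarith [hs.2]⟩
      have a1 := P.bu (s-τ0) hs' y ⟨by linarith [hx.1], by linarith [hx.2]⟩
      have a2 := P.bu (s-τ0) hs' x ⟨by linarith [hx.1], by linarith [hx.2]⟩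
      refine (abs_sub _ _).trans ?_
      linarith)
    linarith
end

section
open MeasureTheory
variable {ρ C : ℝ} {E R : ℕ → ℝ → ℝ → ℝ}

lemma J1_growth (k : Ker ρ C E R) (hρ : 0 < ρ) {u h : ℝ → ℝ → ℝ} {t0 t1 x0 x1 K H : ℝ} (W : WS u h t0 t1 x0 x1 K H)
    {s x a b : ℝ} (ha : t0 < a) (hab : a ≤ b) (hb : b < t1) (hbs : b < s) (hs1 : s - a < 1) (hx0 : x0 < x-ρ) (hx1 : x+ρ < x1) :
    |J E u 1 s x b - J E u 1 s x a| ≤ C * (2 * H * √(s-a) + 2*ρ*K*(s-a)) := by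
  have hC := k.Cpos
  have ha' : a ∈ Ioo t0 t1 := ⟨ha, by linarith⟩
  have hH : 0 ≤ H := (abs_nonneg _).trans (W.bh a ha' 0)
  have hK : 0 ≤ K := (abs_nonneg _).trans (W.bu a ha' 0)
  have h := growth (B := fun σ => 2 * (H*C) * (-√(s-σ)) + K*(2*ρ*C) * σ) (B' := fun σ => (H*C) * (√(s-σ))⁻¹ + K*(2*ρ*C)) hab
    (fun σ hσ => J_deriv k W (s := s) (x := x) (i := 1) (by norm_num) ⟨by linarith [hσ.1], by linarith [hσ.2]⟩ (by linarith [hσ.2]) (by linarith [hσ.1]) hx0 hx1)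
    (fun σ hσ => by
      have hr : 0 < s-σ := by linarith [hσ.2]
      have h1 : HasDerivAt (fun σ => s-σ) (-1) σ := by simpa using (hasDerivAt_id σ).const_sub s
      have h2 := ((h1.sqrt hr.ne').neg.const_mul (2*(H*C))).add ((hasDerivAt_id σ).const_mul (K*(2*ρ*C)))
      refine h2.congr_deriv ?_
      have := Real.sqrt_pos.2 hr
      field_simp) ?_
  · have hr : 0 < s-a := by linarith
    have i3 : 0 ≤ 2*(H*C)*√(s-b) := by positivity
    have i4 : K*(2*ρ*C)*(b-a) ≤ K*(2*ρ*C)*(s-a) := by gcongr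
    have e : C * (2 * H * √(s-a) + 2*ρ*K*(s-a)) = 2*(H*C)*√(s-a) + K*(2*ρ*C)*(s-a) := by
      ring
    rw [e]
    linarith
  · intro σ hσ
    have hσ' : σ ∈ Ioo t0 t1 := ⟨by linarith [hσ.1], by linarith [hσ.2]⟩
    have hr : 0 < s-σ := by linarith [hσ.2]
    have hr1 : s-σ ≤ 1 := by linarith [hσ.1]
    have a1 := bm_bound (W.bh σ hσ') (k.int 1 hr x)
    have a2 := bm_bound (W.bu σ hσ') (k.intR (i := 1) (by norm_num) hr x)
    have a3 := k.iE' (i := 1) (by norm_num) hr hr1 x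
    have a4 := k.iR hρ (i := 1) (by norm_num) hr hr1 x
    rw [pow_one] at a3
    have a5 := mul_le_mul_of_nonneg_left a3 hH
    have a6 := mul_le_mul_of_nonneg_left a4 hK
    refine (abs_sub _ _).trans ?_
    linarith

/-- change of the kernel time for the first derivative -/
lemma J1_rdiff (k : Ker ρ C E R) (hρ : 0 < ρ) {v : ℝ → ℝ} {K : ℝ} (hm : Measurable v) (hb : ∀ y, |v y| ≤ K) {τ r r' : ℝ} (hτ : 0 < τ) (hr : τ ≤ r) (hr' : τ ≤ r') (hr1 : r ≤ 1) (hr1' : r' ≤ 1) (x : ℝ) :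
    |(∫ y, v y * E 1 r (x-y)) - ∫ y, v y * E 1 r' (x-y)| ≤ K * (2*ρ*((C*(√τ)⁻¹^4 + C) * |r-r'|)) := by
  have hC := k.Cpos
  have hK : 0 ≤ K := (abs_nonneg _).trans (hb 0)
  have h0 : 0 < r := by linarith
  have h0' : 0 < r' := by linarith
  have i1 := bm_integrable hm hb (k.int 1 h0 x)
  have i2 := bm_integrable hm hb (k.int 1 h0' x)
  rw [← integral_sub i1 i2]
  have e : ∀ y, v y * E 1 r (x-y) - v y * E 1 r' (x-y) = v y * (E 1 r (x-y) - E 1 r' (x-y)) := fun y => by ring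
  simp only [e]
  refine (bm_bound hb ((k.int 1 h0 x).sub (k.int 1 h0' x))).trans ?_
  apply mul_le_mul_of_nonneg_left _ hK
  have hpt : ∀ z, |E 1 r z - E 1 r' z| ≤ (C*(√τ)⁻¹^4 + C) * |r-r'| := by
    intro z
    have := (convex_Icc τ 1).norm_image_sub_le_of_norm_hasDerivWithin_le (f := fun r => E 1 r z)
      (f' := fun r => E 3 r z + R 1 r z) (C := C*(√τ)⁻¹^4 + C) (fun r hr => (k.dr 1 (by norm_num) r (by linarith [hr.1]) z).hasDerivWithinAt) (by
        intro r hr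
        have hr0 : 0 < r := by linarith [hr.1]
        refine (abs_add_le _ _).trans (add_le_add ?_ (k.bR 1 (by norm_num) r hr0 hr.2 z))
        refine (k.bE 3 (by norm_num) r hr0 hr.2 z).trans ?_
        have : (√r)⁻¹ ≤ (√τ)⁻¹ := inv_anti₀ (Real.sqrt_pos.2 hτ) (Real.sqrt_le_sqrt hr.1)
        have h2 : 0 ≤ (√r)⁻¹ := by positivity
        gcongr) (show r' ∈ Icc τ 1 from ⟨hr', hr1'⟩) (show r ∈ Icc τ 1 from ⟨hr, hr1⟩)
    exact this
  have h : ∀ y, |E 1 r (x-y) - E 1 r' (x-y)| ≤ (Icc (x-ρ) (x+ρ)).indicator (fun _ => (C*(√τ)⁻¹^4 + C) * |r-r'|) y := by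
    intro y
    by_cases hy : y ∈ Icc (x-ρ) (x+ρ)
    · rw [indicator_of_mem hy]; exact hpt _
    · rw [indicator_of_notMem hy, k.sE 1 r _ (notIcc hy), k.sE 1 r' _ (notIcc hy)]; simp
  calc _ ≤ ∫ y, (Icc (x-ρ) (x+ρ)).indicator (fun _ => (C*(√τ)⁻¹^4 + C) * |r-r'|) y := by
        apply integral_mono_of_nonneg (ae_of_all _ fun _ => abs_nonneg _) _ (ae_of_all _ h)
        exact (integrable_indicator_iff measurableSet_Icc).2 continuous_const.integrableOn_Icc
    _ = _ := by
        rw [integral_indicator measurableSet_Icc]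
        simp only [integral_const, MeasurableSet.univ, measureReal_restrict_apply, univ_inter, Real.volume_real_Icc, smul_eq_mul]
        rw [max_eq_left (by linarith)]; ring

variable {u h : ℝ → ℝ → ℝ} {t0 t1 x0 x1 : ℝ}

def JC (u : ℝ → ℝ → ℝ) (t0 t1 x0 x1 : ℝ) : Prop := ContinuousOn (fun q : ℝ × ℝ => u q.1 q.2) (Ioo t0 t1 ×ˢ Ioo x0 x1)

lemma JC.x (hu : JC u t0 t1 x0 x1) : ∀ t ∈ Ioo t0 t1, ContinuousOn (u t) (Ioo x0 x1) := by
  intro t ht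
  exact hu.comp (f := fun y => (t, y)) (by fun_prop) fun y hy => ⟨ht, hy⟩
lemma JC.t (hu : JC u t0 t1 x0 x1) : ∀ x ∈ Ioo x0 x1, ContinuousOn (fun t => u t x) (Ioo t0 t1) := by
  intro x hx
  exact hu.comp (f := fun t => (t, x)) (by fun_prop) fun t ht => ⟨ht, hx⟩

lemma Weak.mono {a b c d : ℝ} (hw : Weak u h t0 t1 x0 x1) (h1 : t0 ≤ a) (h2 : b ≤ t1) (h3 : x0 ≤ c) (h4 : d ≤ x1) : Weak u h a b c d :=
  fun ψ c' d' hψ hc hd t ht => hw ψ c' d' hψ (by linarith) (by linarith) t ⟨by linarith [ht.1], by linarith [ht.2]⟩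

lemma smooth_step (cu : JC u t0 t1 x0 x1) (ch : JC h t0 t1 x0 x1) (hw : Weak u h t0 t1 x0 x1) :
    JC (fun t => deriv (u t)) t0 t1 x0 x1 ∧ ∀ t ∈ Ioo t0 t1, ∀ x ∈ Ioo x0 x1, HasDerivAt (u t) (deriv (u t) x) x := by
  suffices hloc : ∀ q ∈ Ioo t0 t1 ×ˢ Ioo x0 x1, ContinuousAt (fun q : ℝ × ℝ => deriv (u q.1) q.2) q ∧ HasDerivAt (u q.1) (deriv (u q.1) q.2) q.2 by
    exact ⟨fun q hq => (hloc q hq).1.continuousWithinAt, fun t ht x hx => (hloc (t,x) ⟨ht, hx⟩).2⟩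
  rintro ⟨ts, xs⟩ ⟨hts, hxs⟩
  simp only at hts hxs
  obtain ⟨δ, hδ, hδ1, hδt0, hδt1, hδx0, hδx1⟩ : ∃ δ > 0, δ < 1/8 ∧ t0 < ts - 2*δ ∧ ts + 2*δ < t1 ∧ x0 < xs - 4*δ ∧ xs + 4*δ < x1 := by
    have hm : 0 < min (min (ts-t0) (t1-ts)) (min (xs-x0) (x1-xs)) := lt_min (lt_min (by linarith [hts.1]) (by linarith [hts.2])) (lt_min (by linarith [hxs.1]) (by linarith [hxs.2]))
    set m := min (min (ts-t0) (t1-ts)) (min (xs-x0) (x1-xs))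
    have m1 : m ≤ ts - t0 := (min_le_left _ _).trans (min_le_left _ _)
    have m2 : m ≤ t1 - ts := (min_le_left _ _).trans (min_le_right _ _)
    have m3 : m ≤ xs - x0 := (min_le_right _ _).trans (min_le_left _ _)
    have m4 : m ≤ x1 - xs := (min_le_right _ _).trans (min_le_right _ _)
    have hq : 0 < min m 1 := lt_min hm (by norm_num)
    have q1 := min_le_left m 1
    have q2 := min_le_right m 1
    exact ⟨min m 1/9, by positivity, by linarith, by linarith, by linarith, by linarith, by linarith⟩
  -- compact rectangle
  have hsub : Icc (ts-2*δ) (ts+2*δ) ×ˢ Icc (xs-4*δ) (xs+4*δ) ⊆ Ioo t0 t1 ×ˢ Ioo x0 x1 := by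
    rintro ⟨a, b⟩ ⟨ha, hb⟩
    exact ⟨⟨by linarith [ha.1], by linarith [ha.2]⟩, ⟨by linarith [hb.1], by linarith [hb.2]⟩⟩
  obtain ⟨K, hK⟩ := (isCompact_Icc.prod isCompact_Icc).exists_bound_of_continuousOn (cu.mono hsub)
  obtain ⟨H, hH⟩ := (isCompact_Icc.prod isCompact_Icc).exists_bound_of_continuousOn (ch.mono hsub)
  have cu' : JC u (ts-2*δ) (ts+2*δ) (xs-4*δ) (xs+4*δ) := cu.mono ((Set.prod_mono Ioo_subset_Icc_self Ioo_subset_Icc_self).trans hsub)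
  have ch' : JC h (ts-2*δ) (ts+2*δ) (xs-4*δ) (xs+4*δ) := ch.mono ((Set.prod_mono Ioo_subset_Icc_self Ioo_subset_Icc_self).trans hsub)
  have hW := ws_of_weak (K := |K|) (H := |H|) (hw.mono hδt0.le hδt1.le hδx0.le hδx1.le) (abs_nonneg _) (abs_nonneg _) cu'.x ch'.x cu'.t
    (fun t ht x hx => (hK (t,x) ⟨Ioo_subset_Icc_self ht, Ioo_subset_Icc_self hx⟩).trans (le_abs_self K))
    (fun t ht x hx => (hH (t,x) ⟨Ioo_subset_Icc_self ht, Ioo_subset_Icc_self hx⟩).trans (le_abs_self H))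
  set v : ℝ → ℝ → ℝ := fun t => (Ioo (xs-4*δ) (xs+4*δ)).indicator (u t) with hv
  set K' := |K|
  set H' := |H|
  have hK' : 0 ≤ K' := abs_nonneg _
  have hH' : 0 ≤ H' := abs_nonneg _
  obtain ⟨C, E, R, k⟩ := Ker_exists δ hδ
  have hC := k.Cpos
  set S : Set (ℝ × ℝ) := Ioo (ts-δ) (ts+δ) ×ˢ Ioo (xs-2*δ) (xs+2*δ) with hS
  have hSo : IsOpen S := isOpen_Ioo.prod isOpen_Ioo
  set G : ℝ → ℝ × ℝ → ℝ := fun r q => ∫ y, v q.1 y * E 1 r (q.2-y) with hG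
  have hcau : UniformCauchySeqOn G (nhdsWithin 0 (Ioi 0)) S := by
    intro U hU
    obtain ⟨ε, hε, hεU⟩ := Metric.mem_uniformity_dist.1 hU
    obtain ⟨τ, hτ, hτδ, hτε⟩ : ∃ τ > 0, τ < δ ∧ C * (2 * H' * √(2*τ) + 2*δ*K'*(2*τ)) < ε/4 := by
      have hcq : ContinuousAt (fun τ => C * (2 * H' * √(2*τ) + 2*δ*K'*(2*τ))) 0 := by fun_prop
      have h2 := hcq.tendsto
      simp only [mul_zero, Real.sqrt_zero, add_zero] at h2
      have h3 := (h2.mono_left (nhdsWithin_le_nhds (s := Ioi 0))).eventually_lt_const (by positivity : 0 < ε/4)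
      have h4 : ∀ᶠ τ in nhdsWithin (0:ℝ) (Ioi 0), τ < δ := nhdsWithin_le_nhds (gt_mem_nhds hδ)
      obtain ⟨τ, h5, h6, h7⟩ := (h3.and (h4.and self_mem_nhdsWithin)).exists
      exact ⟨τ, h7, h6, h5⟩
    obtain ⟨D, hD, hDr⟩ : ∃ D > 0, K' * (2*δ*((C*(√τ)⁻¹^4 + C) * D)) < ε/4 := by
      have hcq : ContinuousAt (fun D => K' * (2*δ*((C*(√τ)⁻¹^4 + C) * D))) 0 := by fun_prop
      have h2 := hcq.tendsto
      simp only [mul_zero] at h2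
      have h3 := (h2.mono_left (nhdsWithin_le_nhds (s := Ioi 0))).eventually_lt_const (by positivity : 0 < ε/4)
      obtain ⟨D, h5, h7⟩ := (h3.and self_mem_nhdsWithin).exists
      exact ⟨D, h7, h5⟩
    have hev : ∀ᶠ r in nhdsWithin (0:ℝ) (Ioi 0), 0 < r ∧ r < min τ D := by
      filter_upwards [self_mem_nhdsWithin, nhdsWithin_le_nhds (gt_mem_nhds (lt_min hτ hD))] with r h1 h2
      exact ⟨h1, h2⟩
    filter_upwards [hev.prod_mk hev]
    rintro ⟨r, r'⟩ ⟨⟨hr, hr1⟩, ⟨hr', hr1'⟩⟩ ⟨s, x⟩ ⟨hs, hx⟩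
    apply hεU
    simp only at hr hr1 hr' hr1' hs hx ⊢
    have key : ∀ r, 0 < r → r < min τ D → |G r (s,x) - ∫ y, v (s-τ) y * E 1 (τ+r) (x-y)| < ε/4 := by
      intro r hr hr1
      have hr2 := hr1.trans_le (min_le_left _ _)
      have hJ := J1_growth k hδ hW (s := s+r) (x := x) (a := s-τ) (b := s) (by linarith [hs.1]) (by linarith) (by linarith [hs.2])
        (by linarith) (by linarith) (by linarith [hx.1]) (by linarith [hx.2])
      simp only [J] at hJ
      rw [show s+r-s = r by ring, show s+r-(s-τ) = τ+r by ring] at hJ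
      refine hJ.trans_lt (lt_of_le_of_lt ?_ hτε)
      have : √(τ+r) ≤ √(2*τ) := Real.sqrt_le_sqrt (by linarith)
      have : τ + r ≤ 2*τ := by linarith
      gcongr
    have k1 := key r hr hr1
    have k2 := key r' hr' hr1'
    have hr2 := hr1.trans_le (min_le_left _ _)
    have hr2' := hr1'.trans_le (min_le_left _ _)
    have hr3 := hr1.trans_le (min_le_right _ _)
    have hr3' := hr1'.trans_le (min_le_right _ _)
    have hsm : s - τ ∈ Ioo (ts-2*δ) (ts+2*δ) := ⟨by linarith [hs.1], by linarith [hs.2]⟩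
    have k3 := J1_rdiff k hδ (hW.mu _ hsm) (hW.bu _ hsm) hτ (by linarith : τ ≤ τ+r) (by linarith : τ ≤ τ+r') (by linarith) (by linarith) x
    have hrr : |τ+r-(τ+r')| ≤ D := by rw [abs_le]; constructor <;> linarith
    have k4 : K' * (2*δ*((C*(√τ)⁻¹^4 + C) * |τ+r-(τ+r')|)) ≤ K' * (2*δ*((C*(√τ)⁻¹^4 + C) * D)) := by gcongr
    rw [Real.dist_eq]
    rw [abs_lt] at k1 k2 ⊢
    have k5 := abs_le.1 (k3.trans (k4.trans hDr.le))
    constructor <;> linarith [k5.1, k5.2]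
  obtain ⟨g, hg⟩ : ∃ g : ℝ × ℝ → ℝ, ∀ q ∈ S, Tendsto (fun r => G r q) (nhdsWithin 0 (Ioi 0)) (nhds (g q)) := by
    have : ∀ q, ∃ y, q ∈ S → Tendsto (fun r => G r q) (nhdsWithin 0 (Ioi 0)) (nhds y) := by
      intro q
      by_cases hq : q ∈ S
      · obtain ⟨y, hy⟩ := cauchy_map_iff_exists_tendsto.1 (hcau.cauchy_map hq)
        exact ⟨y, fun _ => hy⟩
      · exact ⟨0, fun h => absurd h hq⟩
    choose g hg using this
    exact ⟨g, hg⟩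
  have hun : TendstoUniformlyOn G g (nhdsWithin 0 (Ioi 0)) S := hcau.tendstoUniformlyOn_of_tendsto hg
  have hev1 : ∀ᶠ r in nhdsWithin (0:ℝ) (Ioi 0), 0 < r ∧ r < 1 := by
    filter_upwards [self_mem_nhdsWithin, nhdsWithin_le_nhds (gt_mem_nhds one_pos)] with r h1 h2
    exact ⟨h1, h2⟩
  have hsubI : Icc (xs-3*δ) (xs+3*δ) ⊆ Ioo (xs-4*δ) (xs+4*δ) := fun y hy => ⟨by linarith [hy.1], by linarith [hy.2]⟩
  have hGc : ∀ᶠ r in nhdsWithin (0:ℝ) (Ioi 0), ContinuousOn (G r) S := by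
    filter_upwards [hev1]
    rintro r ⟨hr, hr1⟩ ⟨s0, y0⟩ hq
    have hz : ∀ q ∈ S, ∀ y, y ∉ Icc (xs-3*δ) (xs+3*δ) → v q.1 y * E 1 r (q.2-y) = 0 := by
      intro q hq y hy
      have : y ∉ Icc (q.2-δ) (q.2+δ) := fun h => hy ⟨by linarith [h.1, hq.2.1], by linarith [h.2, hq.2.2]⟩
      rw [k.sE 1 r _ (notIcc this), mul_zero]
    refine dct (c := xs-3*δ) (d := xs+3*δ) (K := K' * (C*(√r)⁻¹^(1+1))) ?_ ?_ ?_ ?_ ?_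
    · filter_upwards [self_mem_nhdsWithin] with q hq
      have hq1 : q.1 ∈ Ioo (ts-2*δ) (ts+2*δ) := ⟨by linarith [hq.1.1], by linarith [hq.1.2]⟩
      refine ContinuousOn.mul ?_ (k.contx 1 hr q.2).continuousOn
      refine ((cu'.x _ hq1).mono hsubI).congr fun y hy => ?_
      simp only [hv, indicator_of_mem (hsubI hy)]
    · filter_upwards [self_mem_nhdsWithin] with q hq y hy using hz q hq y hy
    · exact fun y hy => hz _ hq y hy
    · filter_upwards [self_mem_nhdsWithin] with q hq y hy
      have hq1 : q.1 ∈ Ioo (ts-2*δ) (ts+2*δ) := ⟨by linarith [hq.1.1], by linarith [hq.1.2]⟩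
      rw [abs_mul]
      exact mul_le_mul (hW.bu _ hq1 y) (k.bE 1 (by norm_num) r hr hr1.le _) (abs_nonneg _) hK'
    · intro y hy
      have h1 : ContinuousWithinAt (fun q : ℝ × ℝ => v q.1 y) S (s0, y0) := by
        simp only [hv, indicator_of_mem (hsubI hy)]
        have hq1 : s0 ∈ Ioo (ts-2*δ) (ts+2*δ) := ⟨by linarith [hq.1.1], by linarith [hq.1.2]⟩
        have := (cu'.t y (hsubI hy) s0 hq1).continuousAt (Ioo_mem_nhds hq1.1 hq1.2)
        exact (ContinuousAt.comp (x := (s0,y0)) (f := Prod.fst) (g := fun t => u t y) this continuousAt_fst).continuousWithinAt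
      have h2 : Continuous (fun q : ℝ × ℝ => E 1 r (q.2-y)) := (k.cont 1 hr).comp (by fun_prop)
      exact h1.mul h2.continuousWithinAt
  have hgc : ContinuousOn g S := hun.continuousOn hGc.frequently
  have hder : ∀ q ∈ S, HasDerivAt (u q.1) (g q) q.2 := by
    rintro ⟨s, x⟩ hq
    have hs : s ∈ Ioo (ts-2*δ) (ts+2*δ) := ⟨by linarith [hq.1.1], by linarith [hq.1.2]⟩
    have hun2 : TendstoUniformlyOn (fun r x => G r (s,x)) (fun x => g (s,x)) (nhdsWithin 0 (Ioi 0)) (Ioo (xs-2*δ) (xs+2*δ)) :=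
      (hun.comp (fun x => (s, x))).mono fun x hx => ⟨hq.1, hx⟩
    refine hasDerivAt_of_tendstoUniformlyOn (f := fun r x => ∫ y, v s y * E 0 r (x-y)) isOpen_Ioo hun2 ?_ ?_ hq.2
    · filter_upwards [hev1] with r hr x hx
      exact J_dx k (hW.mu s hs) (hW.bu s hs) (i := 0) (by norm_num) hr.1 hr.2.le x
    · intro x hx
      have hx' : x ∈ Ioo (xs-4*δ) (xs+4*δ) := ⟨by linarith [hx.1], by linarith [hx.2]⟩
      have := J_lim_loc k hδ (v := v s) (x0 := xs-4*δ) (x1 := xs+4*δ) (x := x) ((cu'.x s hs).congr fun y hy => by simp only [hv, indicator_of_mem hy]) (by linarith [hx.1]) (by linarith [hx.2])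
      simpa only [hv, indicator_of_mem hx'] using this
  have hmem : ((ts, xs) : ℝ × ℝ) ∈ S := ⟨⟨by linarith, by linarith⟩, ⟨by linarith, by linarith⟩⟩
  have heq : ∀ q ∈ S, deriv (u q.1) q.2 = g q := fun q hq => (hder q hq).deriv
  refine ⟨?_, (hder _ hmem).differentiableAt.hasDerivAt⟩
  have hn := hSo.mem_nhds hmem
  refine (hgc.continuousAt hn).congr ?_
  filter_upwards [hn] with q hq using (heq q hq).symm
end

section
open MeasureTheory
variable {ρ C : ℝ} {E R : ℕ → ℝ → ℝ → ℝ}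
variable {u h : ℝ → ℝ → ℝ} {t0 t1 x0 x1 : ℝ}

lemma JC.mono {a b c d : ℝ} (hu : JC u t0 t1 x0 x1) (h1 : t0 ≤ a) (h2 : b ≤ t1) (h3 : x0 ≤ c) (h4 : d ≤ x1) : JC u a b c d :=
  ContinuousOn.mono hu (Set.prod_mono (Ioo_subset_Ioo h1 h2) (Ioo_subset_Ioo h3 h4))

lemma TF.shift {ψ : ℕ → ℝ → ℝ} {c d : ℝ} (h : TF ψ c d) : TF (fun i => ψ (i+1)) c d := ⟨fun i y => h.der (i+1) y, fun i y hy => h.z (i+1) y hy⟩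

lemma weak_deriv {u1 h1 : ℝ → ℝ → ℝ} (hw : Weak u h t0 t1 x0 x1) 
    (hu : ∀ t ∈ Ioo t0 t1, ∀ x ∈ Ioo x0 x1, HasDerivAt (u t) (u1 t x) x) (cu : JC u1 t0 t1 x0 x1)
    (hh : ∀ t ∈ Ioo t0 t1, ∀ x ∈ Ioo x0 x1, HasDerivAt (h t) (h1 t x) x) (ch : JC h1 t0 t1 x0 x1) : Weak u1 h1 t0 t1 x0 x1 := by
  intro ψ c d hψ hc hd t ht
  have hW := (hw _ c d hψ.shift hc hd t ht).neg
  have e0 : ∀ s ∈ Ioo t0 t1, ∫ y, u1 s y * ψ 0 y = - ∫ y, u s y * ψ (0+1) y := by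
    intro s hs
    rw [ibp hψ hc hd 0 (hu s hs) (cu.x s hs), neg_neg]
  have cu0 : ContinuousOn (u t) (Ioo x0 x1) := fun x hx => (hu t ht x hx).continuousAt.continuousWithinAt
  have ch0 : ContinuousOn (h t) (Ioo x0 x1) := fun x hx => (hh t ht x hx).continuousAt.continuousWithinAt
  have hW2 : HasDerivAt (fun s => - ∫ y, u s y * ψ (0+1) y) (∫ y, (u1 t y * ψ 2 y + h1 t y * ψ 0 y)) t := by
    refine hW.congr_deriv ?_
    rw [integral_add (loc_int cu0 hψ hc hd 3) (loc_int ch0 hψ hc hd 1), integral_add (loc_int (cu.x t ht) hψ hc hd 2) (loc_int (ch.x t ht) hψ hc hd 0)]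
    have := ibp hψ hc hd 2 (hu t ht) (cu.x t ht)
    have h2 := ibp hψ hc hd 0 (hh t ht) (ch.x t ht)
    simp only [Nat.reduceAdd] at this h2
    rw [this, h2]; ring
  refine hW2.congr_of_eventuallyEq ?_
  filter_upwards [Ioo_mem_nhds ht.1 ht.2] with s hs using e0 s hs

lemma time_deriv {u1 u2 : ℝ → ℝ → ℝ} (hw : Weak u h t0 t1 x0 x1) 
    (hu : ∀ t ∈ Ioo t0 t1, ∀ x ∈ Ioo x0 x1, HasDerivAt (u t) (u1 t x) x)
    (hu1 : ∀ t ∈ Ioo t0 t1, ∀ x ∈ Ioo x0 x1, HasDerivAt (u1 t) (u2 t x) x) (cu : JC u2 t0 t1 x0 x1) (ch : JC h t0 t1 x0 x1) :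
    ∀ t ∈ Ioo t0 t1, ∀ x ∈ Ioo x0 x1, HasDerivAt (fun s => u s x) (u2 t x + h t x) t := by
  intro t ht x hx
  have cu0 : ∀ t ∈ Ioo t0 t1, ContinuousOn (u t) (Ioo x0 x1) := fun t ht x hx => (hu t ht x hx).continuousAt.continuousWithinAt
  have cu1 : ∀ t ∈ Ioo t0 t1, ContinuousOn (u1 t) (Ioo x0 x1) := fun t ht x hx => (hu1 t ht x hx).continuousAt.continuousWithinAt
  set c := u2 t x + h t x with hc
  have hcf : ContinuousAt (fun q : ℝ × ℝ => u2 q.1 q.2 + h q.1 q.2) (t,x) := (cu.add ch).continuousAt ((isOpen_Ioo.prod isOpen_Ioo).mem_nhds ⟨ht, hx⟩)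
  have key : ∀ ε > 0, ∃ δ > 0, ∀ a b, t-δ < a → a ≤ b → b < t+δ → |u b x - u a x - c * (b-a)| ≤ ε * (b-a) := by
    intro ε hε
    obtain ⟨δ0, hδ0, hf⟩ := Metric.continuousAt_iff.1 hcf ε hε
    obtain ⟨δ, hδ, d0, d1, d2, d3, d4⟩ : ∃ δ > 0, δ < δ0 ∧ t0 < t-δ ∧ t+δ<t1 ∧ x0 < x-δ ∧ x+δ < x1 := by
      have h0 : ∀ᶠ δ in nhdsWithin (0:ℝ) (Ioi 0), δ < min δ0 (min (min (t-t0) (t1-t)) (min (x-x0) (x1-x))) :=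
        nhdsWithin_le_nhds (gt_mem_nhds (lt_min hδ0 (lt_min (lt_min (by linarith [ht.1]) (by linarith [ht.2])) (lt_min (by linarith [hx.1]) (by linarith [hx.2])))))
      obtain ⟨δ, h5, h7⟩ := (h0.and self_mem_nhdsWithin).exists
      simp only [lt_min_iff] at h5
      exact ⟨δ, h7, h5.1, by linarith [h5.2.1.1], by linarith [h5.2.1.2], by linarith [h5.2.2.1], by linarith [h5.2.2.2]⟩
    refine ⟨δ, hδ, fun a b ha hab hb => ?_⟩
    obtain ⟨C, E, R, k⟩ := Ker_exists δ hδ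
    have am : a ∈ Ioo t0 t1 := ⟨by linarith, by linarith⟩
    have bm : b ∈ Ioo t0 t1 := ⟨by linarith, by linarith⟩
    have la := J_lim_loc k hδ (cu0 a am) d3 d4
    have lb := J_lim_loc k hδ (cu0 b bm) d3 d4
    have l1 := J_lim_loc k hδ (v := fun _ => (1:ℝ)) continuousOn_const d3 d4
    simp only [one_mul] at l1
    have lim1 := ((lb.sub la).sub ((l1.const_mul c).mul_const (b-a))).abs
    have lim2 := (l1.const_mul ε).mul_const (b-a)
    rw [mul_one] at lim1 lim2
    refine le_of_tendsto_of_tendsto lim1 lim2 ?_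
    filter_upwards [self_mem_nhdsWithin] with r hr
    simp only [mem_Ioi] at hr
    have tf := k.tf 0 hr x
    have etf : ∀ y, (fun j y => (-1)^j * E (0+j) r (x-y)) 0 y = E 0 r (x-y) := fun y => by simp
    set ψ : ℕ → ℝ → ℝ := (fun j y => (-1)^j * E (0+j) r (x-y)) with hψ
    set m := ∫ y, E 0 r (x-y) with hm
    have hder : ∀ σ ∈ Icc a b, HasDerivAt (fun σ => (∫ y, u σ y * E 0 r (x-y)) - c * m * σ) (∫ y, (u2 σ y + h σ y - c) * E 0 r (x-y)) σ := by
      intro σ hσ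
      have hσ' : σ ∈ Ioo t0 t1 := ⟨by linarith [hσ.1], by linarith [hσ.2]⟩
      have h1 := hw _ _ _ tf d3 d4 σ hσ'
      simp only [etf] at h1
      have h2 := h1.sub ((hasDerivAt_id σ).const_mul (c*m))
      refine h2.congr_deriv ?_
      have i1 := loc_int (cu0 σ hσ') tf d3 d4 2
      have i2 := loc_int (ch.x σ hσ') tf d3 d4 0
      have i3 := loc_int (cu.x σ hσ') tf d3 d4 0
      have b1 := ibp tf d3 d4 1 (hu σ hσ') (cu1 σ hσ')
      have b2 := ibp tf d3 d4 0 (hu1 σ hσ') (cu.x σ hσ')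
      simp only [Nat.reduceAdd, etf] at b1 b2 i2 i3
      rw [integral_add i1 i2, b1, b2]
      have e : ∀ y, (u2 σ y + h σ y - c) * E 0 r (x-y) = u2 σ y * E 0 r (x-y) + h σ y * E 0 r (x-y) - c * E 0 r (x-y) := fun y => by ring
      simp only [e]
      have e1 := integral_sub (i3.add i2) ((k.int 0 hr x).const_mul c)
      have e2 := integral_add i3 i2
      simp only [Pi.add_apply] at e1
      rw [e1, e2, integral_const_mul, neg_neg, mul_one]
    have hB : ∀ σ ∈ Icc a b, HasDerivAt (fun σ => ε * m * σ) (ε * m) σ := fun σ _ => by simpa using (hasDerivAt_id σ).const_mul (ε*m)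
    have hg := growth hab hder hB ?_
    · calc _ = _ := by congr 1; ring
        _ ≤ _ := hg
        _ = _ := by ring
    · intro σ hσ
      have hb2 : ∀ y, |(u2 σ y + h σ y - c) * E 0 r (x-y)| ≤ ε * E 0 r (x-y) := by
        intro y
        by_cases hy : y ∈ Icc (x-δ) (x+δ)
        · rw [abs_mul, abs_of_nonneg (k.nE r _)]
          apply mul_le_mul_of_nonneg_right _ (k.nE r _)
          have := @hf (σ, y) (by
            rw [Prod.dist_eq, max_lt_iff, Real.dist_eq, Real.dist_eq, abs_lt, abs_lt]
            refine ⟨⟨by linarith [hσ.1], by linarith [hσ.2]⟩, by linarith [hy.1], by linarith [hy.2]⟩)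
          rw [Real.dist_eq] at this
          exact this.le
        · rw [k.sE 0 r _ (notIcc hy)]; simp
      calc _ ≤ ∫ y, |(u2 σ y + h σ y - c) * E 0 r (x-y)| := abs_integral_le_integral_abs
        _ ≤ ∫ y, ε * E 0 r (x-y) := integral_mono_of_nonneg (ae_of_all _ fun _ => abs_nonneg _) ((k.int 0 hr x).const_mul ε) (ae_of_all _ hb2)
        _ = _ := by rw [integral_const_mul]
  rw [hasDerivAt_iff_isLittleO, Asymptotics.isLittleO_iff]
  intro ε hε
  obtain ⟨δ, hδ, hk⟩ := key ε hε
  filter_upwards [Ioo_mem_nhds (by linarith : t-δ < t) (by linarith : t < t+δ)] with s hs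
  simp only [Real.norm_eq_abs, smul_eq_mul]
  rcases le_total s t with hst | hst
  · have := hk s t hs.1 hst (by linarith)
    rw [abs_of_nonpos (by linarith : s - t ≤ 0)]
    calc _ = |u t x - u s x - c * (t-s)| := by rw [← abs_neg]; congr 1; ring
      _ ≤ _ := this
      _ = _ := by ring
  · have := hk t s (by linarith) hst hs.2
    rw [abs_of_nonneg (by linarith : 0 ≤ s - t)]
    calc _ = |u s x - u t x - c * (s-t)| := by congr 1; ring
      _ ≤ _ := this

lemma weak_lip (K H : ℝ) (hK : 0 ≤ K) (hH : 0 ≤ H) : ∃ L ≥ 0, ∀ u h : ℝ → ℝ → ℝ, ∀ t0 t1 x0 x1, Weak u h t0 t1 x0 x1 → JC u t0 t1 x0 x1 → JC h t0 t1 x0 x1 →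
    (∀ t ∈ Ioo t0 t1, ∀ x ∈ Ioo x0 x1, |u t x| ≤ K) → (∀ t ∈ Ioo t0 t1, ∀ x ∈ Ioo x0 x1, |h t x| ≤ H) →
    ∀ s ∈ Ioo (t0+1/2) t1, ∀ x ∈ Ioo (x0+1) (x1-1), |deriv (u s) x| ≤ L := by
  obtain ⟨C, E, R, k⟩ := Ker_exists 1 one_pos
  have hC := k.Cpos
  refine ⟨C * (K/√(1/2) + 4*H*√(1/2) + 8*1*K*(1/2)), by positivity, ?_⟩
  intro u h t0 t1 x0 x1 hw cu ch bu bh s hs x hx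
  have hW := ws_of_weak hw hK hH cu.x ch.x cu.t bu bh
  have hs' : s ∈ Ioo t0 t1 := ⟨by linarith [hs.1], hs.2⟩
  refine norm_deriv_le_of_lip' (f := u s) (by positivity) ?_
  filter_upwards [Ioo_mem_nhds hx.1 hx.2] with x' hx'
  have := ws_lip k one_pos hW (s := s) (τ := 1/2) (by norm_num) (by norm_num) (by linarith [hs.1]) hs.2 hx' hx ((cu.x s hs').congr fun y hy => by simp only [indicator_of_mem hy])
  have e1 : x' ∈ Ioo x0 x1 := ⟨by linarith [hx'.1], by linarith [hx'.2]⟩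
  have e2 : x ∈ Ioo x0 x1 := ⟨by linarith [hx.1], by linarith [hx.2]⟩
  simp only [indicator_of_mem e1, indicator_of_mem e2] at this
  exact this
end

section
variable {t0 t1 x0 x1 A p : ℝ} {w : ℝ → ℝ → ℝ}

noncomputable def D1 (w : ℝ → ℝ → ℝ) : ℝ → ℝ → ℝ := fun t => deriv (w t)

lemma chain1 (hp : 1 < p) (cw : JC w t0 t1 x0 x1) (hw : Weak w (fun t x => A * w t x ^ p) t0 t1 x0 x1) :
    JC (D1 w) t0 t1 x0 x1 ∧ (∀ t ∈ Ioo t0 t1, ∀ x ∈ Ioo x0 x1, HasDerivAt (w t) (D1 w t x) x) ∧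
    JC (fun t x => A * (p * w t x ^ (p-1) * D1 w t x)) t0 t1 x0 x1 ∧
    Weak (D1 w) (fun t x => A * (p * w t x ^ (p-1) * D1 w t x)) t0 t1 x0 x1 ∧
    JC (D1 (D1 w)) t0 t1 x0 x1 ∧ (∀ t ∈ Ioo t0 t1, ∀ x ∈ Ioo x0 x1, HasDerivAt (D1 w t) (D1 (D1 w) t x) x) ∧
    (∀ t ∈ Ioo t0 t1, ∀ x ∈ Ioo x0 x1, HasDerivAt (fun s => w s x) (D1 (D1 w) t x + A * w t x ^ p) t) := by
  have ch : JC (fun t x => A * w t x ^ p) t0 t1 x0 x1 := continuousOn_const.mul (ContinuousOn.rpow_const cw fun q _ => Or.inr (by linarith))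
  obtain ⟨c1, d1⟩ := smooth_step cw ch hw
  have c1 : JC (D1 w) t0 t1 x0 x1 := c1
  have ch1 : JC (fun t x => A * (p * w t x ^ (p-1) * D1 w t x)) t0 t1 x0 x1 := 
    continuousOn_const.mul ((continuousOn_const.mul (ContinuousOn.rpow_const cw fun q _ => Or.inr (by linarith))).mul c1)
  have hw1 := weak_deriv (u1 := D1 w) (h1 := fun t x => A * (p * w t x ^ (p-1) * D1 w t x)) hw d1 c1 (fun t ht x hx => by
    have := ((d1 t ht x hx).rpow_const (p := p) (Or.inr hp.le)).const_mul A
    exact this.congr_deriv (by simp only [D1]; ring)) ch1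
  obtain ⟨c2, d2⟩ := smooth_step c1 ch1 hw1
  exact ⟨c1, d1, ch1, hw1, c2, d2, time_deriv hw d1 d2 c2 ch⟩

lemma chain2 (hp : 1 < p) (cw : JC w t0 t1 x0 x1) (hw : Weak w (fun t x => A * w t x ^ p) t0 t1 x0 x1) (pos : ∀ t ∈ Ioo t0 t1, ∀ x ∈ Ioo x0 x1, 0 < w t x) :
    (∀ t ∈ Ioo t0 t1, ∀ x ∈ Ioo x0 x1, HasDerivAt (D1 (D1 w) t) (D1 (D1 (D1 w)) t x) x) ∧
    (∀ t ∈ Ioo t0 t1, ∀ x ∈ Ioo x0 x1, HasDerivAt (D1 (D1 (D1 w)) t) (D1 (D1 (D1 (D1 w))) t x) x) ∧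
    (∀ t ∈ Ioo t0 t1, ∀ x ∈ Ioo x0 x1, HasDerivAt (fun s => D1 w s x) (D1 (D1 (D1 w)) t x + A * (p * w t x ^ (p-1) * D1 w t x)) t) ∧
    (∀ t ∈ Ioo t0 t1, ∀ x ∈ Ioo x0 x1, HasDerivAt (fun s => D1 (D1 w) s x) (D1 (D1 (D1 (D1 w))) t x + 
      A * (p * (p-1) * w t x ^ (p-2) * D1 w t x ^ 2 + p * w t x ^ (p-1) * D1 (D1 w) t x)) t) := by
  obtain ⟨c1, d1, ch1, hw1, c2, d2, dt⟩ := chain1 hp cw hw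
  have cr : ∀ a : ℝ, JC (fun t x => w t x ^ a) t0 t1 x0 x1 := fun a => ContinuousOn.rpow_const cw fun q hq => Or.inl (pos q.1 hq.1 q.2 hq.2).ne'
  have dr : ∀ a : ℝ, ∀ t ∈ Ioo t0 t1, ∀ x ∈ Ioo x0 x1, HasDerivAt (fun x => w t x ^ a) (D1 w t x * a * w t x ^ (a-1)) x := fun a t ht x hx =>
    (d1 t ht x hx).rpow_const (Or.inl (pos t ht x hx).ne')
  have ch2 : JC (fun t x => A * (p * (p-1) * w t x ^ (p-2) * D1 w t x ^ 2 + p * w t x ^ (p-1) * D1 (D1 w) t x)) t0 t1 x0 x1 := 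
    continuousOn_const.mul ((((continuousOn_const.mul (cr _))).mul (ContinuousOn.pow c1 2)).add ((continuousOn_const.mul (cr _)).mul c2))
  have hw2 := weak_deriv (u1 := D1 (D1 w)) (h1 := fun t x => A * (p * (p-1) * w t x ^ (p-2) * D1 w t x ^ 2 + p * w t x ^ (p-1) * D1 (D1 w) t x)) hw1 d2 c2 (fun t ht x hx => by
    have := ((((dr (p-1) t ht x hx).const_mul p).mul (d2 t ht x hx))).const_mul A
    refine this.congr_deriv ?_
    rw [show p - 1 - 1 = p-2 by ring]; ring) ch2
  obtain ⟨c3, d3⟩ := smooth_step c2 ch2 hw2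
  have c3 : JC (D1 (D1 (D1 w))) t0 t1 x0 x1 := c3
  have d3 : ∀ t ∈ Ioo t0 t1, ∀ x ∈ Ioo x0 x1, HasDerivAt (D1 (D1 w) t) (D1 (D1 (D1 w)) t x) x := d3
  have ch3 : JC (fun t x => A * (p * (p-1) * ((p-2) * w t x ^ (p-3) * D1 w t x ^ 3 + 2 * w t x ^ (p-2) * D1 w t x * D1 (D1 w) t x) 
      + p * ((p-1) * w t x ^ (p-2) * D1 w t x * D1 (D1 w) t x + w t x ^ (p-1) * D1 (D1 (D1 w)) t x))) t0 t1 x0 x1 := by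
    have c1' : ContinuousOn (fun q : ℝ × ℝ => D1 w q.1 q.2) (Ioo t0 t1 ×ˢ Ioo x0 x1) := c1
    have c2' : ContinuousOn (fun q : ℝ × ℝ => D1 (D1 w) q.1 q.2) (Ioo t0 t1 ×ˢ Ioo x0 x1) := c2
    have c3' : ContinuousOn (fun q : ℝ × ℝ => D1 (D1 (D1 w)) q.1 q.2) (Ioo t0 t1 ×ˢ Ioo x0 x1) := c3
    have r1 : ContinuousOn (fun q : ℝ × ℝ => w q.1 q.2 ^ (p-1)) (Ioo t0 t1 ×ˢ Ioo x0 x1) := cr _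
    have r2 : ContinuousOn (fun q : ℝ × ℝ => w q.1 q.2 ^ (p-2)) (Ioo t0 t1 ×ˢ Ioo x0 x1) := cr _
    have r3 : ContinuousOn (fun q : ℝ × ℝ => w q.1 q.2 ^ (p-3)) (Ioo t0 t1 ×ˢ Ioo x0 x1) := cr _
    unfold JC
    fun_prop
  have hw3 := weak_deriv (u1 := D1 (D1 (D1 w))) hw2 d3 c3 (fun t ht x hx => by
    have := ((((dr (p-2) t ht x hx).const_mul (p*(p-1))).mul ((d2 t ht x hx).pow 2)).add (((dr (p-1) t ht x hx).const_mul p).mul (d3 t ht x hx))).const_mul A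
    refine this.congr_deriv ?_
    rw [show p - 1 - 1 = p-2 by ring, show p - 2 - 1 = p-3 by ring]
    show _ = A * (p * (p-1) * ((p-2) * w t x ^ (p-3) * D1 w t x ^ 3 + 2 * w t x ^ (p-2) * D1 w t x * D1 (D1 w) t x) 
      + p * ((p-1) * w t x ^ (p-2) * D1 w t x * D1 (D1 w) t x + w t x ^ (p-1) * D1 (D1 (D1 w)) t x))
    simp only [Pi.pow_apply]
    push_cast
    ring) ch3
  obtain ⟨c4, d4⟩ := smooth_step c3 ch3 hw3
  exact ⟨d3, d4, time_deriv hw1 d2 d3 c3 ch1, time_deriv hw2 d3 d4 c4 ch2⟩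

/-- ancient bounded solutions -/
structure Anc (A p M t1 : ℝ) (w : ℝ → ℝ → ℝ) : Prop where
  cw : ContinuousOn (fun q : ℝ × ℝ => w q.1 q.2) (Iio t1 ×ˢ univ)
  nn : ∀ t < t1, ∀ x, 0 ≤ w t x
  le : ∀ t < t1, ∀ x, w t x ≤ M
  wk : ∀ N, Weak w (fun t x => A * w t x ^ p) (-N) t1 (-N) N

variable {M : ℝ}

lemma Anc.jc (a : Anc A p M t1 w) (N : ℝ) : JC w (-N) t1 (-N) N := a.cw.mono fun _ hq => ⟨hq.1.2, trivial⟩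

lemma big (t x : ℝ) : ∃ N, -N + 2 < t ∧ -N+2 < x ∧ x < N-2 := ⟨|t|+|x|+3, by linarith [neg_abs_le t, abs_nonneg x], by linarith [neg_abs_le x, abs_nonneg t], by linarith [le_abs_self x, abs_nonneg t]⟩

lemma Anc.d1 (a : Anc A p M t1 w) (hp : 1 < p) : ∀ t < t1, ∀ x, HasDerivAt (w t) (D1 w t x) x := by
  intro t ht x
  obtain ⟨N, h1, h2, h3⟩ := big t x
  exact (chain1 hp (a.jc N) (a.wk N)).2.1 t ⟨by linarith, ht⟩ x ⟨by linarith, by linarith⟩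
lemma Anc.d2 (a : Anc A p M t1 w) (hp : 1 < p) : ∀ t < t1, ∀ x, HasDerivAt (D1 w t) (D1 (D1 w) t x) x := by
  intro t ht x
  obtain ⟨N, h1, h2, h3⟩ := big t x
  exact (chain1 hp (a.jc N) (a.wk N)).2.2.2.2.2.1 t ⟨by linarith, ht⟩ x ⟨by linarith, by linarith⟩
lemma Anc.dt (a : Anc A p M t1 w) (hp : 1 < p) : ∀ t < t1, ∀ x, HasDerivAt (fun s => w s x) (D1 (D1 w) t x + A * w t x ^ p) t := by
  intro t ht x
  obtain ⟨N, h1, h2, h3⟩ := big t x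
  exact (chain1 hp (a.jc N) (a.wk N)).2.2.2.2.2.2 t ⟨by linarith, ht⟩ x ⟨by linarith, by linarith⟩
lemma Anc.c1 (a : Anc A p M t1 w) (hp : 1 < p) : ∀ t < t1, ∀ x, ContinuousAt (fun q : ℝ × ℝ => D1 w q.1 q.2) (t,x) := by
  intro t ht x
  obtain ⟨N, h1, h2, h3⟩ := big t x
  exact ContinuousOn.continuousAt (chain1 hp (a.jc N) (a.wk N)).1 ((isOpen_Ioo.prod isOpen_Ioo).mem_nhds ⟨⟨by linarith, ht⟩, ⟨by linarith, by linarith⟩⟩)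
lemma Anc.c2 (a : Anc A p M t1 w) (hp : 1 < p) : ∀ t < t1, ∀ x, ContinuousAt (fun q : ℝ × ℝ => D1 (D1 w) q.1 q.2) (t,x) := by
  intro t ht x
  obtain ⟨N, h1, h2, h3⟩ := big t x
  exact ContinuousOn.continuousAt (chain1 hp (a.jc N) (a.wk N)).2.2.2.2.1 ((isOpen_Ioo.prod isOpen_Ioo).mem_nhds ⟨⟨by linarith, ht⟩, ⟨by linarith, by linarith⟩⟩)

lemma Anc.bd (a : Anc A p M t1 w) (hp : 1 < p) (hA : 0 ≤ A) (hM : 0 ≤ M) : ∃ L ≥ 0, ∀ t < t1, ∀ x, |D1 w t x| ≤ L ∧ |D1 (D1 w) t x| ≤ L := by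
  have b0 : ∀ t < t1, ∀ x, |w t x| ≤ M := fun t ht x => by rw [abs_of_nonneg (a.nn t ht x)]; exact a.le t ht x
  have br : ∀ q : ℝ, q ≥ 0 → ∀ t < t1, ∀ x, |w t x ^ q| ≤ M ^ q := fun q hq t ht x => by
    rw [abs_of_nonneg (Real.rpow_nonneg (a.nn t ht x) _)]; exact Real.rpow_le_rpow (a.nn t ht x) (a.le t ht x) hq
  obtain ⟨L, hL, h1⟩ := weak_lip M (A * M^p) hM (by positivity)
  have b1 : ∀ t < t1, ∀ x, |D1 w t x| ≤ L := by
    intro t ht x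
    obtain ⟨N, n1, n2, n3⟩ := big t x
    have ch : JC (fun t x => A * w t x ^ p) (-N) t1 (-N) N := continuousOn_const.mul (ContinuousOn.rpow_const (a.jc N) fun q _ => Or.inr (by linarith))
    refine h1 w _ (-N) t1 (-N) N (a.wk N) (a.jc N) ch (fun t ht x hx => b0 t ht.2 x) (fun t ht x hx => ?_) t ⟨by linarith, ht⟩ x ⟨by linarith, by linarith⟩
    rw [abs_mul, abs_of_nonneg hA]
    exact mul_le_mul_of_nonneg_left (br p (by linarith) t ht.2 x) hA
  obtain ⟨L', hL', h2⟩ := weak_lip L (A * (p * M^(p-1) * L)) hL (by positivity)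
  refine ⟨max L L', hL.le.trans (le_max_left _ _), fun t ht x => ⟨(b1 t ht x).trans (le_max_left _ _), le_trans ?_ (le_max_right _ _)⟩⟩
  obtain ⟨N, n1, n2, n3⟩ := big t x
  obtain ⟨c1, d1, ch1, hw1, -⟩ := chain1 hp (a.jc N) (a.wk N)
  refine h2 _ _ (-N) t1 (-N) N hw1 c1 ch1 (fun t ht x hx => b1 t ht.2 x) (fun t ht x hx => ?_) t ⟨by linarith, ht⟩ x ⟨by linarith, by linarith⟩
  rw [abs_mul, abs_of_nonneg hA, abs_mul, abs_mul, abs_of_nonneg (by linarith : 0 ≤ p)]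
  have i1 := br (p-1) (by linarith) t ht.2 x
  have i2 := b1 t ht.2 x
  gcongr

lemma Anc.d4 (a : Anc A p M t1 w) (hp : 1 < p) (pos : ∀ t < t1, ∀ x, 0 < w t x) : ∀ t < t1, ∀ x, 
    HasDerivAt (D1 (D1 w) t) (D1 (D1 (D1 w)) t x) x ∧ HasDerivAt (D1 (D1 (D1 w)) t) (D1 (D1 (D1 (D1 w))) t x) x ∧
    HasDerivAt (fun s => D1 w s x) (D1 (D1 (D1 w)) t x + A * (p * w t x ^ (p-1) * D1 w t x)) t ∧
    HasDerivAt (fun s => D1 (D1 w) s x) (D1 (D1 (D1 (D1 w))) t x + 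
      A * (p * (p-1) * w t x ^ (p-2) * D1 w t x ^ 2 + p * w t x ^ (p-1) * D1 (D1 w) t x)) t := by
  intro t ht x
  obtain ⟨N, h1, h2, h3⟩ := big t x
  obtain ⟨q1, q2, q3, q4⟩ := chain2 hp (a.jc N) (a.wk N) fun t ht x _ => pos t ht.2 x
  have i1 : t ∈ Ioo (-N) t1 := ⟨by linarith, ht⟩
  have i2 : x ∈ Ioo (-N) N := ⟨by linarith, by linarith⟩
  exact ⟨q1 t i1 x i2, q2 t i1 x i2, q3 t i1 x i2, q4 t i1 x i2⟩
end

section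

lemma second_min {f f1 : ℝ → ℝ} {f2 y : ℝ} (hm : IsLocalMin f y) (h1 : ∀ᶠ x in nhds y, HasDerivAt f (f1 x) x) (h2 : HasDerivAt f1 f2 y) : 0 ≤ f2 := by
  by_contra hneg
  push Not at hneg
  have e1 : deriv f =ᶠ[nhds y] f1 := h1.mono fun x hx => hx.deriv
  have h0 : f1 y = 0 := hm.hasDerivAt_eq_zero h1.self_of_nhds
  have hd : HasDerivAt (deriv f) f2 y := h2.congr_of_eventuallyEq e1
  have hmax := isLocalMax_of_deriv_deriv_neg (f := f) (x₀ := y) (by rw [hd.deriv]; exact hneg) (by rw [e1.self_of_nhds, h0]) h1.self_of_nhds.continuousAt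
  have hc : f =ᶠ[nhds y] fun _ => f y := by
    filter_upwards [hm, hmax] with x a b using le_antisymm b a
  have h3 : f1 =ᶠ[nhds y] fun _ => (0:ℝ) := by
    filter_upwards [hc.eventuallyEq_nhds, h1] with x a b
    exact b.unique ((hasDerivAt_const x (f y)).congr_of_eventuallyEq a)
  have := h2.unique ((hasDerivAt_const y (0:ℝ)).congr_of_eventuallyEq h3)
  linarith

lemma time_min {f : ℝ → ℝ} {d a s : ℝ} (has : a < s) (hm : ∀ σ ∈ Icc a s, f s ≤ f σ) (h : HasDerivAt f d s) : d ≤ 0 := by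
  by_contra hneg
  push Not at hneg
  have h1 := (hasDerivAt_iff_tendsto_slope.1 h).eventually_const_lt hneg
  have h2 : ∀ᶠ σ in nhdsWithin s (Iio s), 0 < slope f s σ := h1.filter_mono (nhdsWithin_mono _ fun x hx => ne_of_lt hx)
  have h3 : ∀ᶠ σ in nhdsWithin s (Iio s), a < σ := nhdsWithin_le_nhds (lt_mem_nhds has)
  obtain ⟨σ, q1, q2, q3⟩ := (h2.and (h3.and self_mem_nhdsWithin)).exists
  have q3 : σ < s := q3
  rw [slope_def_field] at q1
  have q4 := hm σ ⟨q2.le, q3.le⟩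
  have : (f σ - f s)/(σ - s) ≤ 0 := div_nonpos_of_nonneg_of_nonpos (by linarith) (by linarith)
  linarith

lemma par_min {Y Ys Y1 Y2 : ℝ → ℝ → ℝ} {a b c d : ℝ} (hc : ContinuousOn (fun q : ℝ × ℝ => Y q.1 q.2) (Icc a b ×ˢ Icc c d))
    (h0 : ∀ y ∈ Icc c d, 0 ≤ Y a y) (hl : ∀ s ∈ Icc a b, 0 ≤ Y s c) (hr : ∀ s ∈ Icc a b, 0 ≤ Y s d)
    (ds : ∀ s ∈ Ioc a b, ∀ y ∈ Ioo c d, HasDerivAt (fun σ => Y σ y) (Ys s y) s)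
    (d1 : ∀ s ∈ Ioc a b, ∀ y ∈ Ioo c d, HasDerivAt (Y s) (Y1 s y) y)
    (d2 : ∀ s ∈ Ioc a b, ∀ y ∈ Ioo c d, HasDerivAt (Y1 s) (Y2 s y) y)
    (hno : ∀ s ∈ Ioc a b, ∀ y ∈ Ioo c d, Y s y < 0 → Ys s y ≤ 0 → Y1 s y = 0 → 0 ≤ Y2 s y → False) :
    ∀ s ∈ Icc a b, ∀ y ∈ Icc c d, 0 ≤ Y s y := by
  intro s hs y hy
  by_contra hneg
  push Not at hneg
  obtain ⟨⟨s0, y0⟩, hq, hmin⟩ := (isCompact_Icc.prod isCompact_Icc).exists_isMinOn ⟨(s,y), ⟨hs, hy⟩⟩ hc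
  have hm : ∀ s ∈ Icc a b, ∀ y ∈ Icc c d, Y s0 y0 ≤ Y s y := fun s hs y hy => hmin (⟨hs, hy⟩ : (s,y) ∈ Icc a b ×ˢ Icc c d)
  have hlt : Y s0 y0 < 0 := (hm s hs y hy).trans_lt hneg
  obtain ⟨hs0, hy0⟩ := hq
  simp only at hs0 hy0
  have i1 : s0 ∈ Ioc a b := ⟨lt_of_le_of_ne hs0.1 fun h => by rw [← h] at hlt; linarith [h0 y0 hy0], hs0.2⟩
  have i2 : y0 ∈ Ioo c d := ⟨lt_of_le_of_ne hy0.1 fun h => by rw [← h] at hlt; linarith [hl s0 hs0], lt_of_le_of_ne hy0.2 fun h => by rw [h] at hlt; linarith [hr s0 hs0]⟩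
  have lm : IsLocalMin (Y s0) y0 := by
    filter_upwards [Icc_mem_nhds i2.1 i2.2] with x hx using hm s0 hs0 x hx
  refine hno s0 i1 y0 i2 hlt ?_ (lm.hasDerivAt_eq_zero (d1 s0 i1 y0 i2)) (second_min lm ?_ (d2 s0 i1 y0 i2))
  · exact time_min i1.1 (fun σ hσ => hm σ ⟨hσ.1, hσ.2.trans hs0.2⟩ y0 hy0) (ds s0 i1 y0 i2)
  · filter_upwards [Ioo_mem_nhds i2.1 i2.2] with x hx using d1 s0 i1 x hx

lemma mp_line {Z Zs Z1 Z2 β : ℝ → ℝ → ℝ} {a b K0 K1 Kb : ℝ} (hc : ContinuousOn (fun q : ℝ × ℝ => Z q.1 q.2) (Icc a b ×ˢ univ))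
    (h0 : ∀ y, 0 ≤ Z a y) (hb : ∀ s ∈ Icc a b, ∀ y, -K0 ≤ Z s y)
    (ds : ∀ s ∈ Ioc a b, ∀ y, HasDerivAt (fun σ => Z σ y) (Zs s y) s)
    (d1 : ∀ s ∈ Ioc a b, ∀ y, HasDerivAt (Z s) (Z1 s y) y)
    (d2 : ∀ s ∈ Ioc a b, ∀ y, HasDerivAt (Z1 s) (Z2 s y) y)
    (hβ : ∀ s ∈ Ioc a b, ∀ y, |β s y| ≤ Kb)
    (hin : ∀ s ∈ Ioc a b, ∀ y, Z s y < 0 → Z2 s y + β s y * Z1 s y + K1 * Z s y ≤ Zs s y) :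
    ∀ s ∈ Icc a b, ∀ y, 0 ≤ Z s y := by
  intro s hs y
  have key : ∀ δ > 0, 0 ≤ Real.exp (-K1*(s-a)) * Z s y + δ * Real.exp ((3+Kb)*(s-a)) * (1+y^2) := by
    intro δ hδ
    -- large radius
    set Q := |K0| * Real.exp (|K1| * (b-a)) / δ with hQ
    have hQ0 : 0 ≤ Q := by positivity
    set R := |y| + Q + 1 with hR
    have hR1 : 1 ≤ R := by have := abs_nonneg y; linarith
    have hbd : ∀ σ ∈ Icc a b, ∀ x : ℝ, x^2 = R^2 → 0 ≤ Real.exp (-K1*(σ-a)) * Z σ x + δ * Real.exp ((3+Kb)*(σ-a)) * (1+x^2) := by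
      intro σ hσ x hx
      rcases lt_or_ge b a with hba | hba
      · linarith [hσ.1, hσ.2]
      by_cases hab' : a = b
      · have : σ = a := le_antisymm (by linarith [hσ.2]) hσ.1
        rw [this]
        have := h0 x
        positivity
      have hlt : a < b := lt_of_le_of_ne hba hab'
      have hKb : 0 ≤ Kb := (abs_nonneg _).trans (hβ b ⟨hlt, le_rfl⟩ 0)
      have h1 : Real.exp (-K1*(σ-a)) ≤ Real.exp (|K1| * (b-a)) := by
        apply Real.exp_le_exp.2
        have : -K1 ≤ |K1| := neg_le_abs K1
        have h3 : 0 ≤ σ - a := by linarith [hσ.1]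
        calc _ ≤ |K1| * (σ-a) := mul_le_mul_of_nonneg_right this h3
          _ ≤ _ := mul_le_mul_of_nonneg_left (by linarith [hσ.2]) (abs_nonneg _)
      have h2 : -|K0| * Real.exp (|K1| * (b-a)) ≤ Real.exp (-K1*(σ-a)) * Z σ x := by
        have hz : -|K0| ≤ Z σ x := le_trans (by linarith [le_abs_self K0]) (hb σ hσ x)
        have e1 : Real.exp (-K1*(σ-a)) * (-|K0|) ≤ Real.exp (-K1*(σ-a)) * Z σ x := mul_le_mul_of_nonneg_left hz (Real.exp_pos _).le
        have e2 := mul_le_mul_of_nonneg_right h1 (abs_nonneg K0)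
        linarith
      have h3 : 1 ≤ Real.exp ((3+Kb)*(σ-a)) := Real.one_le_exp (mul_nonneg (by linarith) (by linarith [hσ.1]))
      have h4 : |K0| * Real.exp (|K1| * (b-a)) = δ * Q := by rw [hQ]; field_simp
      have h5 : Q ≤ 1 + x^2 := by rw [hx]; nlinarith [abs_nonneg y]
      have h6 : δ * Q ≤ δ * Real.exp ((3+Kb)*(σ-a)) * (1+x^2) := by
        rw [mul_assoc]
        apply mul_le_mul_of_nonneg_left _ hδ.le
        nlinarith [sq_nonneg x]
      linarith
    have hcon : ContinuousOn (fun q : ℝ × ℝ => Real.exp (-K1*(q.1-a)) * Z q.1 q.2 + δ * Real.exp ((3+Kb)*(q.1-a)) * (1+q.2^2)) (Icc a b ×ˢ Icc (-R) R) := by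
      have := hc.mono (Set.prod_mono (le_refl (Icc a b)) (subset_univ (Icc (-R) R)))
      exact (ContinuousOn.mul (by fun_prop) this).add (by fun_prop)
    refine par_min (Y := fun s y => Real.exp (-K1*(s-a)) * Z s y + δ * Real.exp ((3+Kb)*(s-a)) * (1+y^2)) 
      (Ys := fun s y => Real.exp (-K1*(s-a)) * (Zs s y - K1 * Z s y) + δ * ((3+Kb) * Real.exp ((3+Kb)*(s-a))) * (1+y^2))
      (Y1 := fun s y => Real.exp (-K1*(s-a)) * Z1 s y + δ * Real.exp ((3+Kb)*(s-a)) * (2*y))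
      (Y2 := fun s y => Real.exp (-K1*(s-a)) * Z2 s y + δ * Real.exp ((3+Kb)*(s-a)) * 2) hcon ?_ ?_ ?_ ?_ ?_ ?_ ?_ s hs y ?_
    · intro x hx
      have := h0 x
      positivity
    · intro σ hσ; exact hbd σ hσ (-R) (by ring)
    · intro σ hσ; exact hbd σ hσ R (by ring)
    · intro σ hσ x hx
      have e1 : ∀ k : ℝ, HasDerivAt (fun s => Real.exp (k*(s-a))) (k * Real.exp (k*(σ-a))) σ := by
        intro k
        have := (((hasDerivAt_id σ).sub_const a).const_mul k).exp
        exact this.congr_deriv (by simp; ring)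
      have := ((e1 (-K1)).mul (ds σ hσ x)).add (((e1 (3+Kb)).const_mul δ).mul_const (1+x^2))
      exact this.congr_deriv (by ring)
    · intro σ hσ x hx
      have := ((d1 σ hσ x).const_mul (Real.exp (-K1*(σ-a)))).add ((((hasDerivAt_id x).pow 2).const_add 1).const_mul (δ * Real.exp ((3+Kb)*(σ-a))))
      exact this.congr_deriv (by simp)
    · intro σ hσ x hx
      have := ((d2 σ hσ x).const_mul (Real.exp (-K1*(σ-a)))).add ((((hasDerivAt_id x).const_mul 2)).const_mul (δ * Real.exp ((3+Kb)*(σ-a))))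
      exact this.congr_deriv (by simp)
    · intro σ hσ x hx hlt hs1 hy1 hy2
      have P1 := Real.exp_pos (-K1*(σ-a))
      have P2 := Real.exp_pos ((3+Kb)*(σ-a))
      set e1 := Real.exp (-K1*(σ-a))
      set e2 := Real.exp ((3+Kb)*(σ-a))
      have hZ : Z σ x < 0 := by
        by_contra hz
        push Not at hz
        have : 0 ≤ e1 * Z σ x := by positivity
        have : 0 ≤ δ * e2 * (1+x^2) := by positivity
        linarith
      have hi := hin σ hσ x hZ
      have hi2 := mul_le_mul_of_nonneg_left hi P1.le
      have hb' := hβ σ hσ x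
      set k := β σ x
      have hk := abs_le.1 hb'
      have h3 : 0 < (3+Kb)*(1+x^2) - 2 - 2*k*x := by
        have : |2*k*x| ≤ Kb*(1+x^2) := by
          rw [abs_mul, abs_mul, abs_two]
          have : 2*|x| ≤ 1+x^2 := by nlinarith [sq_nonneg (|x|-1), sq_abs x]
          nlinarith [abs_nonneg x, abs_nonneg k]
        have := (abs_le.1 this).2
        nlinarith [sq_nonneg x]
      have h4 : 0 < δ * e2 * ((3+Kb)*(1+x^2) - 2 - 2*k*x) := by positivity
      have h5 : e1 * (k * Z1 σ x) = - (δ * e2 * (2*x)) * k := by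
        have : e1 * Z1 σ x = - (δ * e2 * (2*x)) := by linarith
        rw [← this]; ring
      nlinarith
    · exact ⟨by linarith [neg_abs_le y], by linarith [le_abs_self y]⟩
  have hlim : Tendsto (fun δ : ℝ => Real.exp (-K1*(s-a)) * Z s y + δ * Real.exp ((3+Kb)*(s-a)) * (1+y^2)) (nhdsWithin 0 (Ioi 0)) (nhds (Real.exp (-K1*(s-a)) * Z s y + 0 * Real.exp ((3+Kb)*(s-a)) * (1+y^2))) :=
    (Continuous.tendsto (by fun_prop) 0).mono_left nhdsWithin_le_nhds
  have := ge_of_tendsto hlim (by filter_upwards [self_mem_nhdsWithin] with δ hδ using key δ hδ)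
  rw [zero_mul, zero_mul, add_zero] at this
  exact nonneg_of_mul_nonneg_right this (Real.exp_pos _)
end

section
variable {A p M t1 : ℝ} {w : ℝ → ℝ → ℝ}

lemma pl_arith {r m K x Y : ℝ} (hr0 : 0 < r) (hx : 0 < x) (hK1 : 96*r^2*K = (3*m+30)^2 + 96*r^2) (hR : r^2 ≤ x + Y) :
    -K * x^3 + 3*m*x^2 - (24*x*Y - 6*x^2) < 0 := by
  have hx2 : 0 < x^2 := by positivity
  have hr2 : 0 < r^2 := by positivity
  have h1 : 96*r^2*(-K * x^2 + (3*m+30)*x - 24*(x+Y)) < 0 := by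
    have e : 96*r^2*(-K * x^2 + (3*m+30)*x - 24*(x+Y)) = -(96*r^2*K)*x^2 + 96*r^2*(3*m+30)*x - 24*96*(r^2*(x+Y)) := by ring
    rw [e, hK1]
    have := mul_le_mul_of_nonneg_left hR hr2.le
    have := mul_pos hr2 hx2
    linarith [sq_nonneg ((3*m+30)*x - 48*r^2), show ((3*m+30)*x - 48*r^2)^2 = (3*m+30)^2*x^2 - 96*r^2*(3*m+30)*x + 48^2*(r^2*r^2) by ring]
  have h2 : -K * x^2 + (3*m+30)*x - 24*(x+Y) < 0 := by
    by_contra hc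
    push Not at hc
    have := mul_nonneg (by positivity : 0 ≤ 96*r^2) hc
    linarith
  have h3 := mul_neg_of_pos_of_neg hx h2
  linarith [show x * (-K * x^2 + (3*m+30)*x - 24*(x+Y)) = -K * x^3 + 3*m*x^2 - (24*x*Y - 6*x^2) by ring]

lemma pl_fin {d h k P Q : ℝ} (hk : 0 < k) (hw : 0 ≤ h) (h1 : d + h - k * P ≤ 0) (h2 : 0 ≤ d - k * Q) (hf : P - Q < 0) : False := by
  have := mul_neg_of_pos_of_neg hk hf
  linarith [show k * (P - Q) = k*P - k*Q by ring]

set_option maxHeartbeats 1000000 in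
lemma pos_later (a : Anc A p M t1 w) (hp : 1 < p) (hA : 0 ≤ A) {s1 y1 s0 y0 : ℝ} (hs : s1 < s0) (h0 : s0 < t1) (hpos : 0 < w s1 y1) : 0 < w s0 y0 := by
  have hc1 : ContinuousAt (w s1) y1 := (a.d1 hp s1 (by linarith) y1).continuousAt
  obtain ⟨r, hr, hwr⟩ := Metric.continuousAt_iff.1 hc1 (w s1 y1/2) (by linarith)
  -- radius r/2
  obtain ⟨r', hr'⟩ : ∃ z : ℝ, z = r/2 := ⟨_, rfl⟩
  have hr0 : 0 < r' := by rw [hr']; positivity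
  have hlow : ∀ y, |y-y1| ≤ r' → w s1 y1/2 ≤ w s1 y := by
    intro y hy
    have := @hwr y (by rw [Real.dist_eq]; linarith)
    rw [Real.dist_eq, abs_lt] at this
    linarith [this.1]
  obtain ⟨m, hm⟩ : ∃ z : ℝ, z = (y0-y1)^2/(s0-s1) := ⟨_, rfl⟩
  have hm0 : 0 ≤ m := by have : 0 < s0-s1 := by linarith
                         rw [hm]; positivity
  obtain ⟨K, hK⟩ : ∃ z : ℝ, z = (3*m+30)^2/(96*r'^2) + 1 := ⟨_, rfl⟩
  obtain ⟨κ, hκ⟩ : ∃ z : ℝ, z = w s1 y1/2/(r'^2)^3 := ⟨_, rfl⟩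
  have hκ0 : 0 < κ := by rw [hκ]; positivity
  obtain ⟨X, hX⟩ : ∃ z : ℝ, z = |y0-y1| + r' + m*(s0-s1) + 1 := ⟨_, rfl⟩
  have hms : 0 ≤ m*(s0-s1) := mul_nonneg hm0 (by linarith)
  have hmm : m*(s0-s1) = (y0-y1)^2 := by rw [hm]; field_simp [show s0 - s1 ≠ 0 by linarith]
  have hX1 : 1 ≤ X := by have := abs_nonneg (y0-y1); linarith
  set ρ : ℝ → ℝ → ℝ := fun s y => r'^2 + m*(s-s1) - (y-y1)^2 with hρ
  have hcube : ∀ x : ℝ, x ≤ 0 → x^3 ≤ 0 := fun x hx => by nlinarith [sq_nonneg x]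
  have hbd : ∀ σ ∈ Icc s1 s0, ∀ y, (y-y1)^2 = X^2 → 0 ≤ w σ y - κ * Real.exp (-K*(σ-s1)) * ρ σ y ^ 3 := by
    intro σ hσ y hy
    have h1 : ρ σ y ≤ 0 := by
      have : m*(σ-s1) ≤ m*(s0-s1) := mul_le_mul_of_nonneg_left (by linarith [hσ.2]) hm0
      simp only [hρ]; rw [hy]
      nlinarith [abs_nonneg (y0-y1)]
    have h2 := hcube _ h1
    have h3 := a.nn σ (by linarith [hσ.2]) y
    have h4 := Real.exp_pos (-K*(σ-s1))
    have : 0 ≤ κ * Real.exp (-K*(σ-s1)) * (-ρ σ y ^ 3) := mul_nonneg (by positivity) (by linarith)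
    linarith
  have key := par_min (Y := fun s y => w s y - κ * Real.exp (-K*(s-s1)) * ρ s y ^ 3)
    (Ys := fun s y => (D1 (D1 w) s y + A * w s y ^ p) - κ * Real.exp (-K*(s-s1)) * (-K * ρ s y ^ 3 + 3 * m * ρ s y ^ 2))
    (Y1 := fun s y => D1 w s y - κ * Real.exp (-K*(s-s1)) * (3 * ρ s y ^ 2 * (-2*(y-y1))))
    (Y2 := fun s y => D1 (D1 w) s y - κ * Real.exp (-K*(s-s1)) * (24 * ρ s y * (y-y1)^2 - 6 * ρ s y ^ 2))
    (a := s1) (b := s0) (c := y1-X) (d := y1+X) ?_ ?_ ?_ ?_ ?_ ?_ ?_ ?_ s0 ⟨hs.le, le_rfl⟩ y0 ?_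
  · have hρ0 : 0 < ρ s0 y0 := by simp only [hρ]; rw [hmm]; nlinarith
    have := Real.exp_pos (-K*(s0-s1))
    have : 0 < κ * Real.exp (-K*(s0-s1)) * ρ s0 y0 ^ 3 := by positivity
    linarith
  · refine (a.cw.mono fun q hq => ⟨lt_of_le_of_lt hq.1.2 h0, trivial⟩).sub (Continuous.continuousOn ?_)
    simp only [hρ]; fun_prop
  · intro y hy
    simp only [sub_self, mul_zero, Real.exp_zero, mul_one]
    by_cases hyr : |y-y1| ≤ r'
    · have h1 := hlow y hyr
      have h2 : ρ s1 y ≤ r'^2 := by simp only [hρ]; nlinarith [sq_nonneg (y-y1)]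
      have h2' : 0 ≤ ρ s1 y := by
        simp only [hρ]
        have := sq_le_sq' (by linarith [abs_nonneg (y-y1)]) hyr
        rw [sq_abs] at this
        linarith
      have h3 : κ * ρ s1 y ^ 3 ≤ κ * (r'^2)^3 := by gcongr
      have h4 : κ * (r'^2)^3 = w s1 y1/2 := by rw [hκ]; field_simp
      linarith
    · push Not at hyr
      have h1 : ρ s1 y ≤ 0 := by
        simp only [hρ]
        have := sq_lt_sq' (by linarith) hyr
        rw [sq_abs] at this
        linarith
      have h2 := hcube _ h1
      have h3 := a.nn s1 (by linarith) y
      have : 0 ≤ κ * (-ρ s1 y ^ 3) := mul_nonneg hκ0.le (by linarith)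
      linarith
  · intro σ hσ; exact hbd σ hσ _ (by ring)
  · intro σ hσ; exact hbd σ hσ _ (by ring)
  · intro σ hσ y hy
    have e1 : HasDerivAt (fun s => Real.exp (-K*(s-s1))) (-K * Real.exp (-K*(σ-s1))) σ := by
      have := (((hasDerivAt_id σ).sub_const s1).const_mul (-K)).exp
      exact this.congr_deriv (by simp; ring)
    have e2 : HasDerivAt (fun s => ρ s y) m σ := by
      have := ((((hasDerivAt_id σ).sub_const s1).const_mul m).const_add (r'^2)).sub_const ((y-y1)^2)
      exact this.congr_deriv (by simp)
    have := (a.dt hp σ (by linarith [hσ.2]) y).sub ((e1.const_mul κ).mul (e2.pow 3))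
    exact this.congr_deriv (by simp only [Pi.pow_apply]; push_cast; ring)
  · intro σ hσ y hy
    have e2 : HasDerivAt (ρ σ) (-2*(y-y1)) y := by
      have := (((hasDerivAt_id y).sub_const y1).pow 2).const_sub (r'^2 + m*(σ-s1))
      exact this.congr_deriv (by simp)
    have := (a.d1 hp σ (by linarith [hσ.2]) y).sub ((e2.pow 3).const_mul (κ * Real.exp (-K*(σ-s1))))
    exact this.congr_deriv (by push_cast; ring)
  · intro σ hσ y hy
    have e2 : HasDerivAt (ρ σ) (-2*(y-y1)) y := by
      have := (((hasDerivAt_id y).sub_const y1).pow 2).const_sub (r'^2 + m*(σ-s1))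
      exact this.congr_deriv (by simp)
    have e3 : HasDerivAt (fun y => -2*(y-y1)) (-2) y := by simpa using ((hasDerivAt_id y).sub_const y1).const_mul (-2)
    have := (a.d2 hp σ (by linarith [hσ.2]) y).sub ((((e2.pow 2).const_mul 3).mul e3).const_mul (κ * Real.exp (-K*(σ-s1))))
    exact this.congr_deriv (by simp only [Pi.pow_apply]; push_cast; ring)
  · intro σ hσ y hy hlt hs1 hy1 hy2
    have hw0 := a.nn σ (by linarith [hσ.2]) y
    have P1 := Real.exp_pos (-K*(σ-s1))
    have hρp : 0 < ρ σ y := by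
      by_contra hcon
      push Not at hcon
      have h2 := hcube _ hcon
      have : 0 ≤ κ * Real.exp (-K*(σ-s1)) * (-ρ σ y ^ 3) := mul_nonneg (by positivity) (by linarith)
      linarith
    have hwp : 0 ≤ A * w σ y ^ p := mul_nonneg hA (Real.rpow_nonneg hw0 _)
    have hρe : ρ σ y = r'^2 + m*(σ-s1) - (y-y1)^2 := rfl
    set x := ρ σ y
    set Y := (y-y1)^2
    have hR : r'^2 ≤ x + Y := by
      have : 0 ≤ m*(σ-s1) := mul_nonneg hm0 (by linarith [hσ.1])
      linarith
    have hK1 : 96*r'^2*K = (3*m+30)^2 + 96*r'^2 := by rw [hK]; field_simp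
    have hfin := pl_arith hr0 hρp hK1 hR
    have h9 : 0 < κ * Real.exp (-K*(σ-s1)) := mul_pos hκ0 P1
    exact pl_fin h9 hwp hs1 hy2 hfin
  · have := abs_le.1 (show |y0-y1| ≤ X by linarith)
    exact ⟨by linarith [this.1], by linarith [this.2]⟩

lemma Anc.dichotomy (a : Anc A p M t1 w) (hp : 1 < p) (hA : 0 ≤ A) : (∀ t < t1, ∀ x, w t x = 0) ∨ (∀ t < t1, ∀ x, 0 < w t x) := by
  by_cases hall : ∀ t < t1, ∀ x, 0 < w t x
  · exact Or.inr hall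
  left
  push Not at hall
  obtain ⟨s0, hs0, y0, hy0⟩ := hall
  have hbefore : ∀ s < s0, ∀ y, w s y = 0 := by
    intro s hs y
    by_contra hne
    have := pos_later a hp hA hs hs0 (y0 := y0) (lt_of_le_of_ne (a.nn s (by linarith) y) (Ne.symm hne))
    linarith
  have hM : 0 ≤ M := (a.nn s0 hs0 0).trans (a.le s0 hs0 0)
  intro t ht x
  rcases lt_or_ge t s0 with h | h
  · exact hbefore t h x
  have := mp_line (Z := fun s y => -w s y) (Zs := fun s y => -(D1 (D1 w) s y + A * w s y ^ p)) (Z1 := fun s y => -D1 w s y) (Z2 := fun s y => -D1 (D1 w) s y)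
    (β := fun _ _ => 0) (a := s0-1) (b := t) (K0 := M) (K1 := A * M^(p-1)) (Kb := 0) 
    ((a.cw.mono fun q hq => ⟨lt_of_le_of_lt hq.1.2 ht, trivial⟩).neg) (fun y => by rw [hbefore (s0-1) (by linarith) y]; simp)
    (fun s hs y => by linarith [a.le s (by linarith [hs.2]) y]) (fun s hs y => (a.dt hp s (by linarith [hs.2]) y).neg)
    (fun s hs y => (a.d1 hp s (by linarith [hs.2]) y).neg) (fun s hs y => (a.d2 hp s (by linarith [hs.2]) y).neg) (fun s hs y => by simp)
    (fun s hs y hlt => by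
      have hwp : 0 < w s y := by linarith
      have e : w s y ^ p = w s y ^ (p-1) * w s y := by rw [← Real.rpow_add_one hwp.ne']; congr 1; ring
      have e2 : w s y ^ (p-1) ≤ M^(p-1) := Real.rpow_le_rpow hwp.le (a.le s (by linarith [hs.2]) y) (by linarith)
      have e3 : A * (w s y ^ (p-1) * w s y) ≤ A * (M^(p-1) * w s y) := by gcongr
      rw [e]; linarith) t ⟨by linarith, le_rfl⟩ x
  exact le_antisymm (by linarith) (a.nn t ht x)
end

section

noncomputable def Q0 (A p ε w : ℝ) : ℝ := A*w^p/(w+ε)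
noncomputable def Q1 (A p ε w : ℝ) : ℝ := A*(p*w^(p-1) - w^p/(w+ε))
noncomputable def Q2 (A p ε w : ℝ) : ℝ := A*(p*(p-1)*w^(p-2)*(w+ε) - p*w^(p-1) + w^p/(w+ε))

lemma pw {w : ℝ} (p : ℝ) (hw : 0 < w) : w^p = w^(p-2)*w^2 ∧ w^(p-1) = w^(p-2)*w := by
  constructor
  · rw [← Real.rpow_natCast w 2, ← Real.rpow_add hw]; congr 1; push_cast; ring
  · rw [← Real.rpow_add_one hw.ne']; congr 1; ring

lemma dQ0 {A p ε d x : ℝ} {a : ℝ → ℝ} (hε : 0 < ε) (ha : 0 < a x) (h : HasDerivAt a d x) :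
    HasDerivAt (fun y => Q0 A p ε (a y)) (Q1 A p ε (a x) * (d/(a x+ε))) x := by
  have h1 := (((h.rpow_const (p := p) (Or.inl ha.ne')).const_mul A).div (h.add_const ε) (by positivity))
  refine h1.congr_deriv ?_
  have hz : a x + ε ≠ 0 := by positivity
  unfold Q1
  rw [(pw p ha).1, (pw p ha).2]
  field_simp

lemma dQ1 {A p ε d x : ℝ} {a : ℝ → ℝ} (hε : 0 < ε) (ha : 0 < a x) (h : HasDerivAt a d x) :
    HasDerivAt (fun y => Q1 A p ε (a y)) (Q2 A p ε (a x) * (d/(a x+ε))) x := by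
  have h1 := ((((h.rpow_const (p := p-1) (Or.inl ha.ne')).const_mul p).sub ((h.rpow_const (p := p) (Or.inl ha.ne')).div (h.add_const ε) (by positivity))).const_mul A)
  refine h1.congr_deriv ?_
  have hz : a x + ε ≠ 0 := by positivity
  unfold Q2
  have e : p-1-1 = p-2 := by ring
  rw [e, (pw p ha).1, (pw p ha).2]
  field_simp
  ring

lemma dl1 {ε d d1 x : ℝ} {a b : ℝ → ℝ} (hz : a x + ε ≠ 0) (h : HasDerivAt a d x) (hb : HasDerivAt b d1 x) :
    HasDerivAt (fun y => b y/(a y+ε)) (d1/(a x+ε) - b x*d/(a x+ε)^2) x := by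
  refine (hb.div (h.add_const ε) hz).congr_deriv ?_
  field_simp

lemma dl0 {ε d x : ℝ} {a : ℝ → ℝ} (hz : a x + ε ≠ 0) (h : HasDerivAt a d x) :
    HasDerivAt (fun y => Real.log (a y+ε)) (d/(a x+ε)) x := (h.add_const ε).log hz

lemma dl2 {ε d d1 d2 x : ℝ} {a b c : ℝ → ℝ} (hz : a x + ε ≠ 0) (h : HasDerivAt a d x) (hb : HasDerivAt b d1 x) (hc : HasDerivAt c d2 x) :
    HasDerivAt (fun y => c y/(a y+ε) - (b y/(a y+ε))^2) (d2/(a x+ε) - c x*d/(a x+ε)^2 - 2*(b x/(a x+ε))*(d1/(a x+ε) - b x*d/(a x+ε)^2)) x := by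
  refine ((dl1 hz h hc).sub ((dl1 hz h hb).pow 2)).congr_deriv ?_
  push_cast; ring

lemma Q_low {A p ε w : ℝ} (hA : 0 ≤ A) (hp : 1 < p) (hε : 0 < ε) (hw : 0 < w) :
    (p-1)*Q0 A p ε w ≤ Q1 A p ε w ∧ 0 ≤ Q0 A p ε w ∧ Q1 A p ε w ≤ p*A*w^(p-1) := by
  have hz : 0 < w + ε := by positivity
  have h1 : Q1 A p ε w - (p-1)*Q0 A p ε w = p*A*(w^(p-1)*ε/(w+ε)) := by
    unfold Q1 Q0; rw [(pw p hw).1, (pw p hw).2]; field_simp; ring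
  have h2 : 0 ≤ p*A*(w^(p-1)*ε/(w+ε)) := by positivity
  refine ⟨by linarith, by unfold Q0; positivity, ?_⟩
  unfold Q1
  have : 0 ≤ A*(w^p/(w+ε)) := by positivity
  linarith

lemma Q_up {A p ε w e : ℝ} (hA : 0 ≤ A) (hp : 1 < p) (hε : 0 < ε) (hw : 0 < w) (he : p*A*(w^(p-1)*ε/(w+ε)) ≤ e) :
    Q1 A p ε w ≤ (p-1)*Q0 A p ε w + e ∧ (p-1)*Q1 A p ε w - e ≤ Q2 A p ε w := by
  have hz : 0 < w + ε := by positivity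
  have h1 : Q1 A p ε w - (p-1)*Q0 A p ε w = p*A*(w^(p-1)*ε/(w+ε)) := by
    unfold Q1 Q0; rw [(pw p hw).1, (pw p hw).2]; field_simp; ring
  have h3 : Q2 A p ε w - (p-1)*Q1 A p ε w = A*(p*(p-1)*w^(p-2)*ε) - p*A*(w^(p-1)*ε/(w+ε)) := by
    unfold Q1 Q2; rw [(pw p hw).1, (pw p hw).2]; field_simp; ring
  have h4 : 0 ≤ A*(p*(p-1)*w^(p-2)*ε) := by
    have : 0 < p-1 := by linarith
    positivity
  exact ⟨by linarith, by linarith⟩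

lemma e_bound {p ε w M : ℝ} (hp : 1 < p) (hε : 0 < ε) (hw : 0 < w) (hM : w ≤ M) :
    w^(p-1)*ε/(w+ε) ≤ (√ε)^(p-1) + M^(p-1)*√ε := by
  have hs : 0 < √ε := Real.sqrt_pos.2 hε
  have hss : √ε*√ε = ε := Real.mul_self_sqrt hε.le
  have hp1 : 0 < p-1 := by linarith
  have hz : 0 < w + ε := by positivity
  have hM0 : 0 < M := by linarith
  rcases le_or_gt w (√ε) with h | h
  · have h1 : w^(p-1) ≤ (√ε)^(p-1) := Real.rpow_le_rpow hw.le h hp1.le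
    have h2 : w^(p-1)*ε/(w+ε) ≤ w^(p-1) := by
      rw [div_le_iff₀ hz]
      have : 0 ≤ w^(p-1)*w := by positivity
      linarith
    have : 0 ≤ M^(p-1)*√ε := by positivity
    linarith
  · have h1 : w^(p-1) ≤ M^(p-1) := Real.rpow_le_rpow hw.le hM hp1.le
    have h2 : ε/(w+ε) ≤ √ε := by
      rw [div_le_iff₀ hz]
      nlinarith
    have h3 : w^(p-1)*(ε/(w+ε)) ≤ M^(p-1)*√ε := mul_le_mul h1 h2 (by positivity) (by positivity)
    have : 0 ≤ (√ε)^(p-1) := by positivity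
    rw [mul_div_assoc]; linarith

set_option maxHeartbeats 1000000 in
lemma alg_core {p β c δ B κ f fp η q R1 R2 G l2 e K1 : ℝ} (hp : 1 < p) (hβ : 0 ≤ β) (hc : 0 ≤ c) (hc1 : c ≤ 1) (hδ : 0 < δ) (hB : 0 < B)
    (hBδ : B ≤ (p-1)*δ) (hκ : 0 < κ) (hκ1 : κ ≤ δ/2) (hκ2 : κ*(4*β+1) ≤ B) (ha : 0 ≤ p-1-β-c*p)
    (hf : 0 ≤ f) (hη : 1 ≤ η) (hfp : -(κ/2)*f^2 ≤ fp) (he : 0 ≤ e) (hfe : 2*e ≤ κ*f) (hfB : 2*e ≤ B*f)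
    (hq : 0 ≤ q) (hG : 0 ≤ G) (hR1 : (p-1)*q ≤ R1) (hR1' : R1 ≤ (p-1)*q+e) (hR2 : (p-1)*R1 - e ≤ R2)
    (hK : R1 + 2*(1+β)*(l2 + β*G) ≤ K1) (hF : l2 - β*G + c*q + f*η < 0)
    (hP : 0 ≤ 2*(1+β)*(1-δ)*(f*η+c*q-β*G)^2 - (p-1)*(1+δ)*(q*(f*η)) + (p-1)*(p-1-β-c*p)*(q*G)) :
    K1*(l2 - β*G + c*q + f*η) ≤ 2*(1+β)*l2^2 + R1*l2 + G*((1-c)*R2-(2*β+c)*R1) + c*R1*q + fp*η + f*B*(G-q) := by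
  set g := f*η with hg
  have hg0 : 0 ≤ g := mul_nonneg hf (by linarith)
  have hgf : f ≤ g := le_mul_of_one_le_right hf hη
  set Ψ := g + c*q - β*G with hΨ
  set F := l2 - β*G + c*q + g with hFd
  have hl2 : l2 = F - Ψ := by rw [hFd, hΨ]; ring
  have ident : 2*(1+β)*l2^2 + R1*l2 + G*((1-c)*R2-(2*β+c)*R1) + c*R1*q + fp*η + f*B*(G-q)
      = (2*(1+β)*Ψ^2 - R1*g + G*((1-c)*R2-(β+c)*R1) + fp*η + f*B*(G-q)) + F*(R1+2*(1+β)*(l2-Ψ)) := by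
    rw [hFd, hΨ]; ring
  have hFK : K1*F ≤ F*(R1+2*(1+β)*(l2-Ψ)) := by
    have h0 : 0 ≤ c*q := mul_nonneg hc hq
    have h1 : (1+β)*(l2-Ψ) ≤ (1+β)*(l2+β*G) := mul_le_mul_of_nonneg_left (by linarith) (by linarith)
    have h2 : R1+2*(1+β)*(l2-Ψ) ≤ K1 := by linarith
    have := mul_le_mul_of_nonpos_left h2 hF.le
    linarith
  have s1 : -R1*g ≥ -((p-1)*q+e)*g := by
    have := mul_le_mul_of_nonneg_right hR1' hg0
    linarith
  have s2 : G*((1-c)*R2-(β+c)*R1) ≥ G*((p-1-β-c*p)*((p-1)*q) - e) := by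
    apply mul_le_mul_of_nonneg_left _ hG
    have h1 := mul_le_mul_of_nonneg_left hR2 (by linarith : 0 ≤ 1-c)
    have h2 := mul_le_mul_of_nonneg_left hR1 ha
    have h3 : 0 ≤ c*e := mul_nonneg hc he
    linarith [show (1-c)*((p-1)*R1-e) - (β+c)*R1 = (p-1-β-c*p)*R1 - e + c*e by ring]
  have s3 : f*B*q ≤ (p-1)*δ*(q*g) := by
    have h1 : B*(q*f) ≤ (p-1)*δ*(q*g) := mul_le_mul hBδ (mul_le_mul_of_nonneg_left hgf hq) (by positivity) (hB.le.trans hBδ)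
    linarith
  have s4 : fp*η ≥ -(κ/2)*(f*g) := by
    have := mul_le_mul_of_nonneg_right hfp (by linarith : 0 ≤ η)
    have e1 : -(κ/2)*f^2*η = -(κ/2)*(f*g) := by rw [hg]; ring
    linarith
  have s5 : 2*(e*g) ≤ κ*(f*g) := by
    have := mul_le_mul_of_nonneg_right hfe hg0
    linarith
  have s6 : 2*(e*G) ≤ B*(f*G) := by
    have := mul_le_mul_of_nonneg_right hfB hG
    linarith
  have hfg : 0 ≤ f*g := mul_nonneg hf hg0
  have hfG : 0 ≤ B*(f*G) := by positivity
  have rest : 0 ≤ 2*(1+β)*δ*Ψ^2 + B*(f*G) - e*G - e*g + fp*η := by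
    rcases le_or_gt (β*G) (g/2) with h | h
    · have hΨg : g/2 ≤ Ψ := by
        have : 0 ≤ c*q := mul_nonneg hc hq
        rw [hΨ]; linarith
      have h1 : g^2/4 ≤ Ψ^2 := by
        have := mul_self_le_mul_self (by linarith : 0 ≤ g/2) hΨg
        rw [show g^2/4 = g/2*(g/2) by ring, show Ψ^2 = Ψ*Ψ by ring]; exact this
      have h2 : δ*(g^2/4) ≤ δ*Ψ^2 := mul_le_mul_of_nonneg_left h1 hδ.le
      have h3 : 0 ≤ β*δ*Ψ^2 := by positivity
      have h4 : κ*g^2 ≤ δ/2*g^2 := mul_le_mul_of_nonneg_right hκ1 (sq_nonneg g)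
      have h5 : κ*(f*g) ≤ κ*g^2 := mul_le_mul_of_nonneg_left (by rw [sq]; exact mul_le_mul_of_nonneg_right hgf hg0) hκ.le
      linarith
    · have h1 : κ*(f*g) ≤ B*(f*G)/2 := by
        have h2 : f*g ≤ f*(2*(β*G)) := mul_le_mul_of_nonneg_left (by linarith) hf
        have h3 : κ*(f*g) ≤ κ*(f*(2*(β*G))) := mul_le_mul_of_nonneg_left h2 hκ.le
        have h4 : κ*(4*β+1)*(f*G) ≤ B*(f*G) := mul_le_mul_of_nonneg_right hκ2 (mul_nonneg hf hG)
        have h5 : 0 ≤ κ*(f*G) := by positivity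
        linarith
      have : 0 ≤ 2*(1+β)*δ*Ψ^2 := by positivity
      linarith
  have comb : 0 ≤ 2*(1+β)*Ψ^2 - R1*g + G*((1-c)*R2-(β+c)*R1) + fp*η + f*B*(G-q) := by
    linarith [show 2*(1+β)*(1-δ)*Ψ^2 = 2*(1+β)*Ψ^2 - 2*(1+β)*δ*Ψ^2 by ring,
      show (p-1)*(1+δ)*(q*g) = (p-1)*q*g + (p-1)*δ*(q*g) by ring, show G*((p-1-β-c*p)*((p-1)*q) - e) = (p-1)*(p-1-β-c*p)*(q*G) - e*G by ring]
  rw [ident]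
  linarith
end

section

noncomputable def L1 (ε w w1 : ℝ) : ℝ := w1/(w+ε)
noncomputable def L2 (ε w w1 w2 : ℝ) : ℝ := w2/(w+ε) - (w1/(w+ε))^2
noncomputable def L3 (ε w w1 w2 w3 : ℝ) : ℝ := w3/(w+ε) - w2*w1/(w+ε)^2 - 2*(L1 ε w w1 * L2 ε w w1 w2)
noncomputable def L4 (ε w w1 w2 w3 w4 : ℝ) : ℝ := w4/(w+ε) - w3*w1/(w+ε)^2 - ((w3*w1+w2^2)/(w+ε)^2 - 2*w2*w1^2/(w+ε)^3)
  - 2*(L2 ε w w1 w2^2 + L1 ε w w1 * L3 ε w w1 w2 w3)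

variable {A p ε x e : ℝ} {a b c d : ℝ → ℝ}

lemma yL1 (hz : a x + ε ≠ 0) (ha : HasDerivAt a (b x) x) (hb : HasDerivAt b (c x) x) :
    HasDerivAt (fun y => L1 ε (a y) (b y)) (L2 ε (a x) (b x) (c x)) x := by
  refine (dl1 hz ha hb).congr_deriv ?_
  unfold L2; field_simp

lemma yL2 (hz : a x + ε ≠ 0) (ha : HasDerivAt a (b x) x) (hb : HasDerivAt b (c x) x) (hc : HasDerivAt c (d x) x) :
    HasDerivAt (fun y => L2 ε (a y) (b y) (c y)) (L3 ε (a x) (b x) (c x) (d x)) x := by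
  refine (dl2 hz ha hb hc).congr_deriv ?_
  unfold L3 L1 L2; field_simp

lemma yL3 (hz : a x + ε ≠ 0) (ha : HasDerivAt a (b x) x) (hb : HasDerivAt b (c x) x) (hc : HasDerivAt c (d x) x) (hd : HasDerivAt d e x) :
    HasDerivAt (fun y => L3 ε (a y) (b y) (c y) (d y)) (L4 ε (a x) (b x) (c x) (d x) e) x := by
  have h1 := (dl1 hz ha hd)
  have h2 := (hc.mul hb).div ((ha.add_const ε).pow 2) (pow_ne_zero 2 hz)
  have h3 := ((yL1 hz ha hb).mul (yL2 hz ha hb hc)).const_mul 2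
  refine ((h1.sub h2).sub h3).congr_deriv ?_
  unfold L4
  rw [show (2:ℝ) * (L2 ε (a x) (b x) (c x) * L2 ε (a x) (b x) (c x) + L1 ε (a x) (b x) * L3 ε (a x) (b x) (c x) (d x)) = 2*(L2 ε (a x) (b x) (c x)^2 + L1 ε (a x) (b x) * L3 ε (a x) (b x) (c x) (d x)) by ring]
  congr 1
  simp only [Pi.mul_apply, Pi.pow_apply]
  push_cast
  field_simp

variable {w0 w1 w2 w3 w4 : ℝ}
lemma tL0 (hz : a x + ε ≠ 0) (ha : HasDerivAt a (w2 + A * a x ^ p) x) :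
    HasDerivAt (fun s => Real.log (a s + ε)) (L2 ε (a x) w1 w2 + L1 ε (a x) w1^2 + Q0 A p ε (a x)) x := by
  refine (dl0 hz ha).congr_deriv ?_
  unfold L2 L1 Q0; field_simp; ring

lemma tL1 (hz : a x + ε ≠ 0) (h0 : 0 < a x) (ha : HasDerivAt a (w2 + A * a x ^ p) x) (hb : HasDerivAt b (w3 + A*(p*a x^(p-1)*b x)) x) :
    HasDerivAt (fun s => L1 ε (a s) (b s)) (L3 ε (a x) (b x) w2 w3 + 2*L1 ε (a x) (b x)*L2 ε (a x) (b x) w2 + Q1 A p ε (a x) * L1 ε (a x) (b x)) x := by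
  refine (dl1 hz ha hb).congr_deriv ?_
  unfold L3 L2 L1 Q1
  rw [(pw p h0).1, (pw p h0).2]
  field_simp; ring

lemma tL2 (hz : a x + ε ≠ 0) (h0 : 0 < a x) (ha : HasDerivAt a (c x + A * a x ^ p) x) (hb : HasDerivAt b (w3 + A*(p*a x^(p-1)*b x)) x)
    (hc : HasDerivAt c (w4 + A * (p * (p-1) * a x ^ (p-2) * b x ^ 2 + p * a x ^ (p-1) * c x)) x) :
    HasDerivAt (fun s => L2 ε (a s) (b s) (c s)) (L4 ε (a x) (b x) (c x) w3 w4 + 2*L2 ε (a x) (b x) (c x)^2 + 2*L1 ε (a x) (b x)*L3 ε (a x) (b x) (c x) w3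
     + Q2 A p ε (a x) * L1 ε (a x) (b x)^2 + Q1 A p ε (a x) * L2 ε (a x) (b x) (c x)) x := by
  refine (dl2 hz ha hb hc).congr_deriv ?_
  unfold L4 L3 L2 L1 Q1 Q2
  rw [(pw p h0).1, (pw p h0).2]
  field_simp; ring

end

section
variable {A p M t1 : ℝ} {w : ℝ → ℝ → ℝ}

noncomputable def PD (p β c δ g q G : ℝ) : ℝ := 2*(1+β)*(1-δ)*(g+c*q-β*G)^2 - (p-1)*(1+δ)*(q*g) + (p-1)*(p-1-β-c*p)*(q*G)

lemma fder {κ θ a φ s : ℝ} (hκ : 0 < κ) (h : 0 < s - a + θ) :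
    HasDerivAt (fun s => 2/(κ*(s-a+θ)) + φ) (-(2/(κ*(s-a+θ)^2))) s := by
  have h1 : HasDerivAt (fun s => κ*(s-a+θ)) κ s := by
    simpa using ((((hasDerivAt_id s).sub_const a).add_const θ).const_mul κ)
  have h2 := ((hasDerivAt_const s (2:ℝ)).div h1 (by positivity)).add_const φ
  refine h2.congr_deriv ?_
  field_simp
  ring

lemma Lbound {ε w w1 w2 Lb : ℝ} (hε : 0 < ε) (hw : 0 < w) (h1 : |w1| ≤ Lb) (h2 : |w2| ≤ Lb) :
    |L1 ε w w1| ≤ Lb/ε ∧ |L2 ε w w1 w2| ≤ Lb/ε + (Lb/ε)^2 ∧ L1 ε w w1^2 ≤ (Lb/ε)^2 := by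
  have hL : 0 ≤ Lb := (abs_nonneg _).trans h1
  have key : ∀ v : ℝ, |v| ≤ Lb → |v/(w+ε)| ≤ Lb/ε := by
    intro v hv
    rw [abs_div, abs_of_pos (by positivity : 0 < w+ε)]
    exact div_le_div₀ hL hv hε (by linarith)
  have k1 := key _ h1
  have k3 : (w1/(w+ε))^2 ≤ (Lb/ε)^2 := by rw [← sq_abs]; gcongr
  refine ⟨k1, ?_, k3⟩
  unfold L2
  have := abs_sub (w2/(w+ε)) ((w1/(w+ε))^2)
  rw [abs_of_nonneg (sq_nonneg (w1/(w+ε)))] at this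
  linarith [key _ h2]

set_option maxHeartbeats 2000000 in
lemma liou_eps (h : Anc A p M t1 w) (hp : 1 < p) (hA : 0 ≤ A) (pos : ∀ t < t1, ∀ x, 0 < w t x)
    {β c δ B κ ε e : ℝ} (hβ : 0 ≤ β) (hc : 0 ≤ c) (hc1 : c ≤ 1) (hδ : 0 < δ) (hB : 0 < B)
    (hBδ : B ≤ (p-1)*δ) (hκ : 0 < κ) (hκ1 : κ ≤ δ/2) (hκ2 : κ*(4*β+1) ≤ B) (ha : 0 ≤ p-1-β-c*p)
    (hε : 0 < ε) (hε1 : ε ≤ 1) (he0 : 0 ≤ e) (he : ∀ t < t1, ∀ x, p*A*(w t x^(p-1)*ε/(w t x+ε)) ≤ e)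
    (hyp : ∀ t < t1, ∀ x, ∀ g, 0 ≤ g → L2 ε (w t x) (D1 w t x) (D1 (D1 w) t x) - β * L1 ε (w t x) (D1 w t x)^2 + c * Q0 A p ε (w t x) + g ≤ 0 →
      0 ≤ PD p β c δ g (Q0 A p ε (w t x)) (L1 ε (w t x) (D1 w t x)^2))
    {a0 t x : ℝ} (hat : a0 < t) (ht : t < t1) :
    0 ≤ L2 ε (w t x) (D1 w t x) (D1 (D1 w) t x) - β * L1 ε (w t x) (D1 w t x)^2 + c * Q0 A p ε (w t x) 
      + (2/(κ*(t-a0)) + (2*e/κ+2*e/B)) * (1+B*(Real.log (M+1) - Real.log (w t x + ε))) := by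
  have hM : 0 < M := (pos t ht 0).trans_le (h.le t ht 0)
  obtain ⟨Lb, hL, hLb⟩ := h.bd hp hA hM.le
  set Λ := Lb/ε with hΛ
  have hΛ0 : 0 ≤ Λ := by positivity
  set K0 := Λ + Λ^2 + β*Λ^2 with hK0
  have hK00 : 0 ≤ K0 := by positivity
  set θ := 2/(κ*(K0+1)) with hθ
  have hθ0 : 0 < θ := by positivity
  set φ := 2*e/κ+2*e/B with hφ
  have hφ0 : 0 ≤ φ := by positivity
  set f : ℝ → ℝ := fun s => 2/(κ*(s-a0+θ)) + φ with hf
  have hfpos : ∀ s ∈ Icc a0 t, 0 ≤ f s := by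
    intro s hs
    have : 0 < s-a0+θ := by linarith [hs.1]
    simp only [hf]; positivity
  have hz : ∀ s ≤ t, ∀ y, 0 < w s y + ε := fun s hs y => by linarith [pos s (by linarith) y]
  have hη : ∀ s ≤ t, ∀ y, 1 ≤ 1+B*(Real.log (M+1) - Real.log (w s y + ε)) := by
    intro s hs y
    have := Real.log_le_log (hz s hs y) (show w s y + ε ≤ M+1 by linarith [h.le s (by linarith) y])
    have := mul_nonneg hB.le (sub_nonneg.2 this)
    linarith
  have hlow : ∀ s ≤ t, ∀ y, -K0 ≤ L2 ε (w s y) (D1 w s y) (D1 (D1 w) s y) - β * L1 ε (w s y) (D1 w s y)^2 + c * Q0 A p ε (w s y) := by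
    intro s hs y
    obtain ⟨b1, b2, b3⟩ := Lbound hε (pos s (by linarith) y) (hLb s (by linarith) y).1 (hLb s (by linarith) y).2
    have b4 := mul_le_mul_of_nonneg_left b3 hβ
    have b5 := mul_nonneg hc (Q_low hA hp hε (pos s (by linarith) y)).2.1
    rw [hK0]
    linarith [(abs_le.1 b2).1]
  have key := mp_line (a := a0) (b := t) (K0 := K0) (Kb := 2*Λ) (K1 := p*A*M^(p-1) + 2*(1+β)*(Λ+Λ^2+β*Λ^2))
    (Z := fun s y => L2 ε (w s y) (D1 w s y) (D1 (D1 w) s y) - β * L1 ε (w s y) (D1 w s y)^2 + c * Q0 A p ε (w s y) 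
      + f s * (1+B*(Real.log (M+1) - Real.log (w s y + ε))))
    (Zs := fun s y => 
      (L4 ε (w s y) (D1 w s y) (D1 (D1 w) s y) (D1 (D1 (D1 w)) s y) (D1 (D1 (D1 (D1 w))) s y) + 2*L2 ε (w s y) (D1 w s y) (D1 (D1 w) s y)^2
        + 2*L1 ε (w s y) (D1 w s y)*L3 ε (w s y) (D1 w s y) (D1 (D1 w) s y) (D1 (D1 (D1 w)) s y)
        + Q2 A p ε (w s y) * L1 ε (w s y) (D1 w s y)^2 + Q1 A p ε (w s y) * L2 ε (w s y) (D1 w s y) (D1 (D1 w) s y))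
      - β * (2 * L1 ε (w s y) (D1 w s y) * (L3 ε (w s y) (D1 w s y) (D1 (D1 w) s y) (D1 (D1 (D1 w)) s y) + 2*L1 ε (w s y) (D1 w s y)*L2 ε (w s y) (D1 w s y) (D1 (D1 w) s y) + Q1 A p ε (w s y) * L1 ε (w s y) (D1 w s y)))
      + c * (Q1 A p ε (w s y) * (L2 ε (w s y) (D1 w s y) (D1 (D1 w) s y) + L1 ε (w s y) (D1 w s y)^2 + Q0 A p ε (w s y)))
      + (-(2/(κ*(s-a0+θ)^2)) * (1+B*(Real.log (M+1) - Real.log (w s y + ε))) + f s * (B * (-(L2 ε (w s y) (D1 w s y) (D1 (D1 w) s y) + L1 ε (w s y) (D1 w s y)^2 + Q0 A p ε (w s y))))))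
    (Z1 := fun s y => L3 ε (w s y) (D1 w s y) (D1 (D1 w) s y) (D1 (D1 (D1 w)) s y) - β * (2 * (L1 ε (w s y) (D1 w s y) * L2 ε (w s y) (D1 w s y) (D1 (D1 w) s y)))
      + c * (Q1 A p ε (w s y) * L1 ε (w s y) (D1 w s y)) + f s * (B * (-L1 ε (w s y) (D1 w s y))))
    (Z2 := fun s y => L4 ε (w s y) (D1 w s y) (D1 (D1 w) s y) (D1 (D1 (D1 w)) s y) (D1 (D1 (D1 (D1 w))) s y)
      - β * (2 * (L2 ε (w s y) (D1 w s y) (D1 (D1 w) s y) * L2 ε (w s y) (D1 w s y) (D1 (D1 w) s y) + L1 ε (w s y) (D1 w s y) * L3 ε (w s y) (D1 w s y) (D1 (D1 w) s y) (D1 (D1 (D1 w)) s y)))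
      + c * (Q2 A p ε (w s y) * L1 ε (w s y) (D1 w s y) * L1 ε (w s y) (D1 w s y) + Q1 A p ε (w s y) * L2 ε (w s y) (D1 w s y) (D1 (D1 w) s y)) + f s * (B * (-L2 ε (w s y) (D1 w s y) (D1 (D1 w) s y))))
    (β := fun s y => 2 * L1 ε (w s y) (D1 w s y)) ?_ ?_ ?_ ?_ ?_ ?_ ?_ ?_ t ⟨hat.le, le_rfl⟩ x
  · have hfl : f t ≤ 2/(κ*(t-a0)) + φ := by
      simp only [hf]
      have : 0 < t - a0 := by linarith
      gcongr; linarith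
    have := mul_le_mul_of_nonneg_right hfl (by linarith [hη t le_rfl x] : 0 ≤ 1+B*(Real.log (M+1) - Real.log (w t x + ε)))
    linarith
  · -- continuity
    rintro ⟨s, y⟩ hq
    have hs : s ≤ t := hq.1.2
    have hs1 : s < t1 := by linarith
    have hw0 := pos s hs1 y
    have hz0 := hz s hs y
    have cw : ContinuousAt (fun q : ℝ × ℝ => w q.1 q.2) (s,y) := h.cw.continuousAt ((isOpen_Iio.prod isOpen_univ).mem_nhds ⟨hs1, trivial⟩)
    have c1 := h.c1 hp s hs1 y
    have c2 := h.c2 hp s hs1 y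
    have cz : ContinuousAt (fun q : ℝ × ℝ => w q.1 q.2 + ε) (s,y) := cw.add continuousAt_const
    have hsa : 0 < s - a0 + θ := by linarith [hq.1.1]
    have cf : ContinuousAt (fun q : ℝ × ℝ => f q.1) (s,y) := 
      ContinuousAt.comp (f := fun q : ℝ × ℝ => q.1) (g := f) (fder hκ hsa).continuousAt continuousAt_fst
    apply ContinuousAt.continuousWithinAt
    unfold L2 L1 Q0
    have cp : ContinuousAt (fun q : ℝ × ℝ => w q.1 q.2 ^ p) (s,y) := cw.rpow_const (Or.inl hw0.ne')
    exact ((((c2.div cz hz0.ne').sub ((c1.div cz hz0.ne').pow 2)).sub (continuousAt_const.mul ((c1.div cz hz0.ne').pow 2))).add (continuousAt_const.mul ((continuousAt_const.mul cp).div cz hz0.ne'))).add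
      (cf.mul (continuousAt_const.add (continuousAt_const.mul (continuousAt_const.sub (cz.log hz0.ne')))))
  · intro y
    have h1 := hlow a0 hat.le y
    have h2 : K0 ≤ f a0 := by
      have : 2/(κ*(a0-a0+θ)) = K0+1 := by rw [hθ]; field_simp; ring
      simp only [hf]; rw [this]; linarith
    have h3 : f a0 ≤ f a0 * (1+B*(Real.log (M+1) - Real.log (w a0 y + ε))) := le_mul_of_one_le_right (by linarith) (hη a0 hat.le y)
    linarith
  · intro s hs y
    have h1 := hlow s hs.2 y
    have h3 := mul_nonneg (hfpos s hs) (by linarith [hη s hs.2 y] : 0 ≤ 1+B*(Real.log (M+1) - Real.log (w s y + ε)))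
    linarith
  · intro s hs y
    have hs1 : s < t1 := by linarith [hs.2]
    obtain ⟨g1, g2, g3, g4⟩ := h.d4 hp pos s hs1 y
    have g0 := h.dt hp s hs1 y
    have hz0 := (hz s hs.2 y).ne'
    have hw0 := pos s hs1 y
    have k2 := tL2 (a := fun s => w s y) (b := fun s => D1 w s y) (c := fun s => D1 (D1 w) s y) hz0 hw0 g0 g3 g4
    have k1 := tL1 (a := fun s => w s y) (b := fun s => D1 w s y) hz0 hw0 g0 g3
    have k0 := tL0 (a := fun s => w s y) (w1 := D1 w s y) hz0 g0
    have kQ := dQ0 (A := A) (p := p) (a := fun s => w s y) hε hw0 g0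
    have kf := fder (φ := φ) hκ (by linarith [hs.1] : 0 < s - a0 + θ)
    have tot := ((k2.sub ((k1.pow 2).const_mul β)).add (kQ.const_mul c)).add (kf.mul (((k0.const_sub (Real.log (M+1))).const_mul B).const_add 1))
    refine tot.congr_deriv ?_
    have e1 : (D1 (D1 w) s y + A * w s y ^ p)/(w s y + ε) = L2 ε (w s y) (D1 w s y) (D1 (D1 w) s y) + L1 ε (w s y) (D1 w s y)^2 + Q0 A p ε (w s y) := by
      unfold L2 L1 Q0; field_simp; ring
    rw [e1]
    push_cast
    ring
  · intro s hs y
    have hs1 : s < t1 := by linarith [hs.2]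
    obtain ⟨g1, g2, g3, g4⟩ := h.d4 hp pos s hs1 y
    have hz0 := (hz s hs.2 y).ne'
    have hw0 := pos s hs1 y
    have f1 := h.d1 hp s hs1 y
    have f2 := h.d2 hp s hs1 y
    have k2 := yL2 hz0 f1 f2 g1
    have k1 := yL1 hz0 f1 f2
    have k0 := dl0 hz0 f1
    have kQ := dQ0 (A := A) (p := p) hε hw0 f1
    have tot := ((k2.sub ((k1.pow 2).const_mul β)).add (kQ.const_mul c)).add ((((k0.const_sub (Real.log (M+1))).const_mul B).const_add 1).const_mul (f s))
    refine tot.congr_deriv ?_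
    unfold L1
    push_cast
    ring
  · intro s hs y
    have hs1 : s < t1 := by linarith [hs.2]
    obtain ⟨g1, g2, g3, g4⟩ := h.d4 hp pos s hs1 y
    have hz0 := (hz s hs.2 y).ne'
    have hw0 := pos s hs1 y
    have f1 := h.d1 hp s hs1 y
    have f2 := h.d2 hp s hs1 y
    have k3 := yL3 hz0 f1 f2 g1 g2
    have k2 := yL2 hz0 f1 f2 g1
    have k1 := yL1 hz0 f1 f2
    have kQ := dQ1 (A := A) (p := p) hε hw0 f1
    have tot := ((k3.sub (((k1.mul k2).const_mul 2).const_mul β)).add ((kQ.mul k1).const_mul c)).add ((k1.neg.const_mul B).const_mul (f s))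
    refine tot.congr_deriv ?_
    unfold L1
    ring
  · intro s hs y
    have hs1 : s < t1 := by linarith [hs.2]
    obtain ⟨b1, b2, b3⟩ := Lbound hε (pos s hs1 y) (hLb s hs1 y).1 (hLb s hs1 y).2
    rw [abs_mul, abs_two]; linarith
  · intro s hs y hneg
    have hs1 : s < t1 := by linarith [hs.2]
    have hs' : s ∈ Icc a0 t := ⟨hs.1.le, hs.2⟩
    obtain ⟨b1, b2, b3⟩ := Lbound hε (pos s hs1 y) (hLb s hs1 y).1 (hLb s hs1 y).2
    obtain ⟨q1, q2, q3⟩ := Q_low hA hp hε (pos s hs1 y)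
    obtain ⟨q4, q5⟩ := Q_up hA hp hε (pos s hs1 y) (he s hs1 y)
    have hg := mul_nonneg (hfpos s hs') (by linarith [hη s hs.2 y] : 0 ≤ 1+B*(Real.log (M+1) - Real.log (w s y + ε)))
    have hPD := hyp s hs1 y _ hg hneg.le
    have hsp : 0 < s - a0 + θ := by linarith [hs.1]
    have hfφ : φ ≤ f s := by
      have : 0 ≤ 2/(κ*(s-a0+θ)) := by positivity
      simp only [hf]; linarith
    have hMp : w s y ^(p-1) ≤ M^(p-1) := Real.rpow_le_rpow (pos s hs1 y).le (h.le s hs1 y) (by linarith)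
    have hfe : 2*e ≤ κ*f s := by
      have h1 : 2*e/κ ≤ φ := by
        have : 0 ≤ 2*e/B := by positivity
        linarith
      have h2 := mul_le_mul_of_nonneg_left (h1.trans hfφ) hκ.le
      have : κ*(2*e/κ) = 2*e := by field_simp
      linarith
    have hfB : 2*e ≤ B*f s := by
      have h1 : 2*e/B ≤ φ := by
        have : 0 ≤ 2*e/κ := by positivity
        linarith
      have h2 := mul_le_mul_of_nonneg_left (h1.trans hfφ) hB.le
      have : B*(2*e/B) = 2*e := by field_simp
      linarith
    have hfp : -(κ/2)*f s^2 ≤ -(2/(κ*(s-a0+θ)^2)) := by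
      have h1 : (2/(κ*(s-a0+θ)))^2 ≤ f s^2 := by
        have : 0 ≤ 2/(κ*(s-a0+θ)) := by positivity
        exact pow_le_pow_left₀ this (by simp only [hf]; linarith) 2
      have h2 := mul_le_mul_of_nonneg_left h1 (by positivity : 0 ≤ κ/2)
      have h3 : κ/2*(2/(κ*(s-a0+θ)))^2 = 2/(κ*(s-a0+θ)^2) := by field_simp
      linarith
    have hK : Q1 A p ε (w s y) + 2*(1+β)*(L2 ε (w s y) (D1 w s y) (D1 (D1 w) s y) + β*L1 ε (w s y) (D1 w s y)^2) ≤ p*A*M^(p-1) + 2*(1+β)*(Λ+Λ^2+β*Λ^2) := by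
      have h1 : p*A*w s y^(p-1) ≤ p*A*M^(p-1) := mul_le_mul_of_nonneg_left hMp (by positivity)
      have h2 := mul_le_mul_of_nonneg_left b3 hβ
      have h3 : 2*(1+β)*(L2 ε (w s y) (D1 w s y) (D1 (D1 w) s y) + β*L1 ε (w s y) (D1 w s y)^2) ≤ 2*(1+β)*(Λ+Λ^2+β*Λ^2) :=
        mul_le_mul_of_nonneg_left (by linarith [(abs_le.1 b2).2]) (by positivity)
      linarith
    have fin := alg_core (K1 := p*A*M^(p-1) + 2*(1+β)*(Λ+Λ^2+β*Λ^2)) hp hβ hc hc1 hδ hB hBδ hκ hκ1 hκ2 ha (hfpos s hs') (hη s hs.2 y) hfp he0 hfe hfB q2 (sq_nonneg _) q1 q4 q5 hK hneg hPD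
    refine le_trans (add_le_add_right fin _) (le_of_eq ?_)
    ring
end

section
variable {A p M t1 : ℝ} {w : ℝ → ℝ → ℝ}

lemma liou_lim (h : Anc A p M t1 w) (hp : 1 < p) (hA : 0 ≤ A) (pos : ∀ t < t1, ∀ x, 0 < w t x)
    {β c δ : ℝ} (hβ : 0 ≤ β) (hc : 0 ≤ c) (hc1 : c ≤ 1) (hδ : 0 < δ) (ha : 0 ≤ p-1-β-c*p)
    (hyp : ∀ ε > 0, ∀ t < t1, ∀ x, ∀ g, 0 ≤ g → L2 ε (w t x) (D1 w t x) (D1 (D1 w) t x) - β * L1 ε (w t x) (D1 w t x)^2 + c * Q0 A p ε (w t x) + g ≤ 0 →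
      0 ≤ PD p β c δ g (Q0 A p ε (w t x)) (L1 ε (w t x) (D1 w t x)^2)) :
    ∀ t < t1, ∀ x, 0 ≤ L2 0 (w t x) (D1 w t x) (D1 (D1 w) t x) - β * L1 0 (w t x) (D1 w t x)^2 + c * Q0 A p 0 (w t x) := by
  intro t ht x
  have hM : 0 < M := (pos t ht 0).trans_le (h.le t ht 0)
  have hw := pos t ht x
  set B := (p-1)*δ with hB
  have hB0 : 0 < B := mul_pos (by linarith) hδ
  set κ := min (δ/2) (B/(4*β+1)) with hκ
  have hκ0 : 0 < κ := lt_min (by linarith) (by positivity)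
  have hκ2 : κ*(4*β+1) ≤ B := by
    rw [← le_div_iff₀ (by positivity)]; exact min_le_right _ _
  set E : ℝ → ℝ := fun ε => p*A*((√ε)^(p-1)+M^(p-1)*√ε) with hE
  set Φ : ℝ → ℝ := fun ε => L2 ε (w t x) (D1 w t x) (D1 (D1 w) t x) - β * L1 ε (w t x) (D1 w t x)^2 + c * Q0 A p ε (w t x) 
      + (2*E ε/κ+2*E ε/B) * (1+B*(Real.log (M+1) - Real.log (w t x + ε))) with hΦ
  have h1 : ∀ ε, 0 < ε → ε ≤ 1 → 0 ≤ Φ ε := by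
    intro ε hε hε1
    have hη : 1 ≤ 1+B*(Real.log (M+1) - Real.log (w t x + ε)) := by
      have := Real.log_le_log (by positivity) (show w t x + ε ≤ M+1 by linarith [h.le t ht x])
      have := mul_nonneg hB0.le (sub_nonneg.2 this)
      linarith
    set η := 1+B*(Real.log (M+1) - Real.log (w t x + ε)) with hηd
    apply le_of_forall_pos_le_add
    intro d hd
    have hη0 : 0 < η := by linarith
    have := liou_eps (e := E ε) h hp hA pos hβ hc hc1 hδ hB0 le_rfl hκ0 (min_le_left _ _) hκ2 ha hε hε1 (by simp only [hE]; positivity)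
      (fun s hs y => mul_le_mul_of_nonneg_left (e_bound hp hε (pos s hs y) (h.le s hs y)) (by positivity)) (hyp ε hε) (a0 := t - 2*η/(κ*d)) (t := t) (x := x)
      (by have : 0 < 2*η/(κ*d) := by positivity
          linarith) ht
    rw [← hηd] at this
    have e1 : 2/(κ*(t-(t - 2*η/(κ*d)))) * η = d := by
      rw [sub_sub_cancel]; field_simp
    rw [add_mul, e1] at this
    simp only [hΦ]
    linarith
  have hs : ContinuousAt (fun ε : ℝ => √ε) 0 := Real.continuous_sqrt.continuousAt
  have cE : ContinuousAt E 0 := continuousAt_const.mul ((hs.rpow_const (Or.inr (by linarith))).add (continuousAt_const.mul hs))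
  have cz : ContinuousAt (fun ε : ℝ => w t x + ε) 0 := continuousAt_const.add continuousAt_id
  have hz : w t x + 0 ≠ 0 := by rw [add_zero]; exact hw.ne'
  have cΦ : ContinuousAt Φ 0 := by
    simp only [hΦ]
    unfold L2 L1 Q0
    have q1 : ContinuousAt (fun ε : ℝ => (D1 w t x/(w t x + ε))^2) 0 := (continuousAt_const.div cz hz).pow 2
    exact ((((continuousAt_const.div cz hz).sub q1).sub (continuousAt_const.mul q1)).add (continuousAt_const.mul (continuousAt_const.div cz hz))).add
      ((((continuousAt_const.mul cE).div_const _).add ((continuousAt_const.mul cE).div_const _)).mul (continuousAt_const.add (continuousAt_const.mul (continuousAt_const.sub (cz.log hz)))))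
  have hE0 : E 0 = 0 := by simp only [hE]; rw [Real.sqrt_zero, Real.zero_rpow (by linarith)]; ring
  have hΦ0 : Φ 0 = L2 0 (w t x) (D1 w t x) (D1 (D1 w) t x) - β * L1 0 (w t x) (D1 w t x)^2 + c * Q0 A p 0 (w t x) := by
    simp only [hΦ]; rw [hE0]; ring
  rw [← hΦ0]
  refine ge_of_tendsto (cΦ.tendsto.mono_left (nhdsWithin_le_nhds (s := Ioi 0))) ?_
  filter_upwards [self_mem_nhdsWithin, nhdsWithin_le_nhds (Iio_mem_nhds (show (0:ℝ) < 1 by norm_num))] with ε a b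
  exact h1 ε a (le_of_lt b)

lemma PD_start (hp : 1 < p) : ∃ β c δ : ℝ, 0 ≤ β ∧ 0 ≤ c ∧ c < 1 ∧ 0 < δ ∧ 0 < p-1-β-c*p ∧ ∀ g q G : ℝ, 0 ≤ q → 0 ≤ g → 0 ≤ G → 0 ≤ PD p β c δ g q G := by
  rcases lt_or_ge p 4 with h | h
  · refine ⟨0, (p-1)/4, 1/3, le_rfl, by linarith, by linarith, by norm_num, by nlinarith, ?_⟩
    intro g q G hq hg hG
    unfold PD
    have h1 : 0 ≤ (p-1)*(p-1-0-(p-1)/4*p)*(q*G) := by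
      have : p-1-0-(p-1)/4*p = (p-1)*(1-p/4) := by ring
      rw [this]
      have : 0 ≤ 1-p/4 := by linarith
      have : 0 ≤ p-1 := by linarith
      positivity
    have := sq_nonneg (g - (p-1)/4*q)
    nlinarith
  · have hp0 : 0 < p := by linarith
    have e1 : p - 1 - (p-3)/4 - (2*p^2+p+3)/(4*p^2)*p = (p-3)/4*(1+1/p) := by field_simp; ring
    have hc : (1:ℝ)/2 ≤ (2*p^2+p+3)/(4*p^2) := by
      rw [le_div_iff₀ (by positivity)]; nlinarith
    refine ⟨(p-3)/4, (2*p^2+p+3)/(4*p^2), 1/p, by linarith, by positivity, ?_, by positivity, ?_, ?_⟩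
    · rw [div_lt_one (by positivity)]; nlinarith
    · rw [e1]
      have : 0 < (p-3)/4 := by linarith
      positivity
    intro g q G hq hg hG
    unfold PD
    rw [e1]
    set c := (2*p^2+p+3)/(4*p^2) with hcd
    have e2 : 2*(1+(p-3)/4)*(1-1/p)*(g+c*q-(p-3)/4*G)^2 - (p-1)*(1+1/p)*(q*g) + (p-1)*((p-3)/4*(1+1/p))*(q*G) 
       = (p+1)*(p-1)/p * (1/2*((g-(p-3)/4*G)+c*q)^2 - q*(g-(p-3)/4*G)) := by field_simp; ring
    rw [e2]
    have : 0 ≤ (p+1)*(p-1)/p := by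
      have : 0 ≤ p-1 := by linarith
      positivity
    refine mul_nonneg this ?_
    set y := g-(p-3)/4*G
    rcases le_total (q*y) 0 with hy | hy
    · linarith [sq_nonneg (y+c*q)]
    · have : q*y ≤ 2*c*(q*y) := le_mul_of_one_le_left hy (by linarith)
      linarith [sq_nonneg (y-c*q), show (y+c*q)^2 = (y-c*q)^2+ 2*(2*c*(q*y)) by ring]

end

section
variable {A p M t1 : ℝ} {w : ℝ → ℝ → ℝ}

lemma shift_of {β c ε w w1 w2 : ℝ} (hβ : 0 ≤ β) (hε : 0 < ε) (hw : 0 < w)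
    (h : 0 ≤ L2 0 w w1 w2 - β * L1 0 w w1^2 + c * Q0 A p 0 w) : 0 ≤ L2 ε w w1 w2 - β * L1 ε w w1^2 + c * Q0 A p ε w := by
  unfold L2 L1 Q0 at *
  have hz : 0 < w + ε := by positivity
  have e1 : w2/(w+ε) - (w1/(w+ε))^2 - β*(w1/(w+ε))^2 + c*(A*w^p/(w+ε)) =
    (w/(w+ε))*(w2/(w+0) - (w1/(w+0))^2 - β*(w1/(w+0))^2 + c*(A*w^p/(w+0))) + (1+β)*(w1^2*ε/(w*(w+ε)^2)) := by
    rw [add_zero]; field_simp; ring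
  rw [e1]
  have : 0 ≤ (1+β)*(w1^2*ε/(w*(w+ε)^2)) := by positivity
  have := mul_nonneg (by positivity : 0 ≤ w/(w+ε)) h
  linarith

lemma PD_dec {β c κ a g q G cs : ℝ} (hp : 1 < p) (hβ : 0 ≤ β) (hcs : 0 < cs) (hc : c = cs - κ) (hκ0 : 0 < κ) (hκ1 : κ ≤ cs/2)
    (hκ2 : κ*(24*(p-1)) ≤ cs^2) (hκ3 : κ*(6*β+1) ≤ a*cs) (ha : 0 < a) (hac : a ≤ p-1-β-c*p) (hg : 0 ≤ g) (hq : 0 ≤ q) (hG : 0 ≤ G) (hgq : g ≤ κ*q) :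
    0 ≤ PD p β c (1/2) g q G := by
  have hp1 : 0 < p-1 := by linarith
  have hc2 : cs/2 ≤ c := by linarith
  have hqG : (p-1)*a*(q*G) ≤ (p-1)*(p-1-β-c*p)*(q*G) := by
    apply mul_le_mul_of_nonneg_right _ (mul_nonneg hq hG)
    exact mul_le_mul_of_nonneg_left hac hp1.le
  have hqg : q*g ≤ κ*q^2 := by
    have := mul_le_mul_of_nonneg_left hgq hq
    linarith
  unfold PD
  rcases le_or_gt (β*G) (c*q/2) with h | h
  · have h1 : cs*q/4 ≤ g+c*q-β*G := by
      have := mul_le_mul_of_nonneg_right hc2 hq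
      linarith
    have h2 : (cs*q/4)^2 ≤ (g+c*q-β*G)^2 := pow_le_pow_left₀ (by positivity) h1 2
    have h3 : 0 ≤ β*(g+c*q-β*G)^2 := by positivity
    have h4 : 0 ≤ (p-1)*a*(q*G) := by positivity
    have h5 := mul_le_mul_of_nonneg_right hκ2 (sq_nonneg q)
    have h6 := mul_le_mul_of_nonneg_left hqg hp1.le
    linarith
  · have h1 : cs*q ≤ 4*(β*G) := by
      have := mul_le_mul_of_nonneg_right hc2 hq
      linarith
    have h2 : 3/2*g ≤ a*G := by
      have h3 : cs*(3/2*g) ≤ cs*(a*G) := by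
        have h4 : cs*g ≤ cs*(κ*q) := mul_le_mul_of_nonneg_left hgq hcs.le
        have h5 : κ*(cs*q) ≤ κ*(4*(β*G)) := mul_le_mul_of_nonneg_left h1 hκ0.le
        have h6 := mul_le_mul_of_nonneg_right hκ3 hG
        have h7 : 0 ≤ κ*G := by positivity
        linarith
      exact le_of_mul_le_mul_left h3 hcs
    have h3 := mul_le_mul_of_nonneg_left h2 (mul_nonneg hp1.le hq)
    have h4 : 0 ≤ 2*(1+β)*(1-1/2)*(g+c*q-β*G)^2 := by
      have : (0:ℝ) ≤ 1-1/2 := by norm_num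
      positivity
    linarith

lemma liou_conv (h : Anc A p M t1 w) (hp : 1 < p) (hA : 0 ≤ A) (pos : ∀ t < t1, ∀ x, 0 < w t x) :
    ∀ t < t1, ∀ x, 0 ≤ D1 (D1 w) t x := by
  obtain ⟨β, c0, δ, hβ, hc0, hc1, hδ, ha, hPD⟩ := PD_start hp
  set S : Set ℝ := {c | 0 ≤ c ∧ c ≤ c0 ∧ ∀ t < t1, ∀ x, 0 ≤ L2 0 (w t x) (D1 w t x) (D1 (D1 w) t x) - β * L1 0 (w t x) (D1 w t x)^2 + c * Q0 A p 0 (w t x)} with hS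
  have hc0S : c0 ∈ S := ⟨hc0, le_rfl, liou_lim h hp hA pos hβ hc0 hc1.le hδ ha.le 
    fun ε hε t ht x g hg _ => hPD _ _ _ (Q_low hA hp hε (pos t ht x)).2.1 hg (sq_nonneg _)⟩
  have hbdd : BddBelow S := ⟨0, fun c hc => hc.1⟩
  have hcl : IsClosed S := by
    have : S = Icc 0 c0 ∩ ⋂ (t : ℝ) (_ : t < t1) (x : ℝ), {c | 0 ≤ L2 0 (w t x) (D1 w t x) (D1 (D1 w) t x) - β * L1 0 (w t x) (D1 w t x)^2 + c * Q0 A p 0 (w t x)} := by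
      ext c; simp only [hS, mem_setOf_eq, mem_inter_iff, mem_Icc, mem_iInter]; tauto
    rw [this]
    refine isClosed_Icc.inter (isClosed_iInter fun t => isClosed_iInter fun _ => isClosed_iInter fun x => ?_)
    exact isClosed_le continuous_const (by fun_prop)
  have hmem := hcl.csInf_mem ⟨c0, hc0S⟩ hbdd
  set cs := sInf S with hcs
  obtain ⟨k1, k2, k3⟩ := hmem
  have hz : cs = 0 := by
    by_contra hne
    have hcp : 0 < cs := lt_of_le_of_ne k1 (Ne.symm hne)
    set a := p-1-β-c0*p with had
    have hp1 : 0 < p-1 := by linarith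
    set κ := min (cs/2) (min (cs^2/(24*(p-1))) (a*cs/(6*β+1))) with hκ
    have hκ0 : 0 < κ := lt_min (by linarith) (lt_min (by positivity) (by positivity))
    have hκ1 : κ ≤ cs/2 := min_le_left _ _
    have hκ2 : κ*(24*(p-1)) ≤ cs^2 := by
      rw [← le_div_iff₀ (by positivity)]; exact (min_le_right _ _).trans (min_le_left _ _)
    have hκ3 : κ*(6*β+1) ≤ a*cs := by
      rw [← le_div_iff₀ (by positivity)]; exact (min_le_right _ _).trans (min_le_right _ _)
    have hac : a ≤ p-1-β-(cs-κ)*p := by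
      have : (cs-κ)*p ≤ c0*p := mul_le_mul_of_nonneg_right (by linarith) (by linarith)
      linarith
    have hin : cs - κ ∈ S := by
      refine ⟨by linarith, by linarith, liou_lim h hp hA pos hβ (by linarith) (by linarith) (by norm_num : (0:ℝ) < 1/2) (by linarith) ?_⟩
      intro ε hε t ht x g hg hle
      have hq := (Q_low hA hp hε (pos t ht x)).2.1
      have hs := shift_of hβ hε (pos t ht x) (k3 t ht x)
      exact PD_dec hp hβ hcp rfl hκ0 hκ1 hκ2 hκ3 ha hac hg hq (sq_nonneg _) (by linarith)
    have := csInf_le hbdd hin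
    linarith
  intro t ht x
  have h1 := k3 t ht x
  rw [hz, zero_mul, add_zero] at h1
  unfold L2 L1 at h1
  rw [add_zero] at h1
  have h2 : 0 ≤ D1 (D1 w) t x / w t x := by
    have : 0 ≤ β*(D1 w t x / w t x)^2 := by positivity
    linarith [sq_nonneg (D1 w t x / w t x)]
  by_contra hneg
  push Not at hneg
  have := div_neg_of_neg_of_pos hneg (pos t ht x)
  linarith

lemma convex_const {f f1 f2 : ℝ → ℝ} {K : ℝ} (h1 : ∀ x, HasDerivAt f (f1 x) x) (h2 : ∀ x, HasDerivAt f1 (f2 x) x) (hn : ∀ x, 0 ≤ f2 x) (hb : ∀ x, |f x| ≤ K) :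
    ∀ x y, f x = f y := by
  have hmono : Monotone f1 := monotone_of_deriv_nonneg (fun x => (h2 x).differentiableAt) (fun x => by rw [(h2 x).deriv]; exact hn x)
  have hK : 0 ≤ K := (abs_nonneg _).trans (hb 0)
  have h0 : ∀ x, f1 x = 0 := by
    intro x
    by_contra hne
    rcases lt_or_gt_of_ne hne with hlt | hgt
    · set y := x - (2*K+1)/(-f1 x) with hy
      have hyx : y < x := by
        have : 0 < (2*K+1)/(-f1 x) := div_pos (by linarith) (by linarith)
        linarith
      obtain ⟨ξ, hξ, hs⟩ := exists_hasDerivAt_eq_slope f f1 hyx (fun z _ => (h1 z).continuousAt.continuousWithinAt) (fun z _ => h1 z)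
      have h3 := hmono hξ.2.le
      rw [hs, div_le_iff₀ (by linarith)] at h3
      have h4 : f1 x * (x-y) = -(2*K+1) := by rw [hy]; field_simp; ring
      have := abs_le.1 (hb x)
      have := abs_le.1 (hb y)
      linarith
    · set y := x + (2*K+1)/(f1 x) with hy
      have hyx : x < y := by
        have : 0 < (2*K+1)/(f1 x) := div_pos (by linarith) (by linarith)
        linarith
      obtain ⟨ξ, hξ, hs⟩ := exists_hasDerivAt_eq_slope f f1 hyx (fun z _ => (h1 z).continuousAt.continuousWithinAt) (fun z _ => h1 z)
      have h3 := hmono hξ.1.le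
      rw [hs, le_div_iff₀ (by linarith)] at h3
      have h4 : f1 x * (y-x) = (2*K+1) := by rw [hy]; field_simp; ring
      have := abs_le.1 (hb x)
      have := abs_le.1 (hb y)
      linarith
  exact is_const_of_deriv_eq_zero (fun x => (h1 x).differentiableAt) (fun x => by rw [(h1 x).deriv]; exact h0 x)

theorem liouville (h : Anc A p M t1 w) (hp : 1 < p) (hA : 0 ≤ A) : ∀ t < t1, ∀ x y, w t x = w t y := by
  rcases h.dichotomy hp hA with h0 | hpos
  · intro t ht x y; rw [h0 t ht x, h0 t ht y]
  intro t ht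
  exact convex_const (K := M) (h.d1 hp t ht) (h.d2 hp t ht) (liou_conv h hp hA hpos t ht) 
    (fun x => abs_le.2 ⟨by linarith [h.nn t ht x, h.le t ht x], h.le t ht x⟩)
end

section
open MeasureTheory

lemma extract {w : ℕ → ℝ → ℝ → ℝ} {N : ℕ → ℝ} {K L T1 : ℝ} (hK : 0 ≤ K) (hL : 0 ≤ L) (hN : Tendsto N atTop atTop)
    (bd : ∀ k, ∀ s ∈ Ioo (-N k) T1, ∀ y ∈ Ioo (-N k) (N k), |w k s y| ≤ K)
    (lip : ∀ k, ∀ s ∈ Ioo (-N k) T1, ∀ s' ∈ Ioo (-N k) T1, ∀ y ∈ Ioo (-N k) (N k), ∀ y' ∈ Ioo (-N k) (N k), |w k s y - w k s' y'| ≤ L * (|s-s'| + |y-y'|)) :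
    ∃ φ : ℕ → ℕ, StrictMono φ ∧ ∃ W : ℝ → ℝ → ℝ, ∀ s < T1, ∀ y, Tendsto (fun k => w (φ k) s y) atTop (nhds (W s y)) := by
  classical
  have hmem : ∀ s < T1, ∀ y, ∀ᶠ k in atTop, s ∈ Ioo (-N k) T1 ∧ y ∈ Ioo (-N k) (N k) := by
    intro s hs y
    filter_upwards [hN.eventually_gt_atTop (|s|+|y|)] with k hk
    have := neg_abs_le s; have := neg_abs_le y; have := le_abs_self y
    have := abs_nonneg s; have := abs_nonneg y
    exact ⟨⟨by linarith, hs⟩, ⟨by linarith, by linarith⟩⟩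
  set F : ℕ → (ℚ × ℚ → ℝ) := fun k r => if |w k r.1 r.2| ≤ K then w k r.1 r.2 else 0 with hF
  have hFm : ∀ k, F k ∈ Set.pi univ (fun _ : ℚ × ℚ => Icc (-K) K) := by
    intro k r _
    simp only [hF]
    split_ifs with h
    · exact abs_le.1 h
    · exact ⟨by linarith, hK⟩
  obtain ⟨f, -, φ, hφ, hf⟩ := (isCompact_univ_pi fun _ : ℚ × ℚ => isCompact_Icc (a := -K) (b := K)).tendsto_subseq hFm
  rw [tendsto_pi_nhds] at hf
  have hrat : ∀ r : ℚ × ℚ, (r.1 : ℝ) < T1 → Tendsto (fun k => w (φ k) r.1 r.2) atTop (nhds (f r)) := by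
    intro r hr
    refine (hf r).congr' ?_
    filter_upwards [hφ.tendsto_atTop.eventually (hmem r.1 hr r.2)] with k hk
    simp only [Function.comp, hF]
    rw [if_pos (bd _ _ hk.1 _ hk.2)]
  have hex : ∀ s < T1, ∀ y, ∃ z, Tendsto (fun k => w (φ k) s y) atTop (nhds z) := by
    intro s hs y
    apply cauchySeq_tendsto_of_complete
    rw [Metric.cauchySeq_iff']
    intro ε hε
    set d := ε/(8*(L+1)) with hd
    have hd0 : 0 < d := by positivity
    obtain ⟨r1, hr1, hr1'⟩ := exists_rat_btwn (show max (s-d) (s-1) < s from max_lt (by linarith) (by linarith))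
    obtain ⟨r2, hr2, hr2'⟩ := exists_rat_btwn (show y-d < y by linarith)
    have hr1d : s - d < r1 := (le_max_left _ _).trans_lt hr1
    have hc := (hrat (r1,r2) (by simp only; linarith)).cauchySeq
    rw [Metric.cauchySeq_iff'] at hc
    obtain ⟨n1, hn1⟩ := hc (ε/8) (by linarith)
    obtain ⟨n2, hn2⟩ := eventually_atTop.1 (hφ.tendsto_atTop.eventually ((hmem s hs y).and (hmem r1 (by linarith) r2)))
    have hclose : ∀ k ≥ n2, |w (φ k) s y - w (φ k) r1 r2| ≤ ε/4 := by
      intro k hk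
      obtain ⟨⟨a1, a2⟩, ⟨a3, a4⟩⟩ := hn2 k hk
      refine (lip _ _ a1 _ a3 _ a2 _ a4).trans ?_
      have b1 : |s - r1| ≤ d := by rw [abs_of_pos (by linarith)]; linarith
      have b2 : |y - r2| ≤ d := by rw [abs_of_pos (by linarith)]; linarith
      have : L*(|s-r1|+|y-r2|) ≤ (L+1)*(d+d) := by gcongr; linarith
      have e : (L+1)*(d+d) = ε/4 := by rw [hd]; field_simp; ring
      linarith
    refine ⟨max n1 n2, fun n hn => ?_⟩
    have q1 := hn1 n (le_trans (le_max_left _ _) hn)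
    have q2 := hn1 (max n1 n2) (le_max_left _ _)
    have q3 := hclose n (le_trans (le_max_right _ _) hn)
    have q4 := hclose (max n1 n2) (le_max_right _ _)
    rw [Real.dist_eq] at q1 q2 ⊢
    simp only at q1 q2
    have := abs_lt.1 q1; have := abs_lt.1 q2; have := abs_le.1 q3; have := abs_le.1 q4
    rw [abs_lt]; constructor <;> linarith
  choose! W hW using hex
  exact ⟨φ, hφ, W, hW⟩


lemma limit_deriv {Φ Ψ : ℕ → ℝ → ℝ} {F G : ℝ → ℝ} {a b C : ℝ} (hC : 0 ≤ C)
    (h1 : ∀ᶠ k in atTop, ∀ s ∈ Ioo a b, HasDerivAt (Φ k) (Ψ k s) s)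
    (h2 : ∀ᶠ k in atTop, ∀ s ∈ Ioo a b, ∀ s' ∈ Ioo a b, |Ψ k s - Ψ k s'| ≤ C * |s-s'|)
    (h3 : ∀ s ∈ Ioo a b, Tendsto (fun k => Φ k s) atTop (nhds (F s)))
    (h4 : ∀ s ∈ Ioo a b, Tendsto (fun k => Ψ k s) atTop (nhds (G s))) :
    ∀ t ∈ Ioo a b, HasDerivAt F (G t) t := by
  intro t ht
  have key : ∀ s ∈ Ioo a b, |F s - F t - (s-t) * G t| ≤ C*|s-t| * |s-t| := by
    intro s hs
    have hl : Tendsto (fun k => |Φ k s - Φ k t - (s-t) * Ψ k t|) atTop (nhds |F s - F t - (s-t) * G t|) :=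
      (((h3 s hs).sub (h3 t ht)).sub ((h4 t ht).const_mul _)).abs
    refine le_of_tendsto hl ?_
    filter_upwards [h1, h2] with k k1 k2
    have hsub : uIcc t s ⊆ Ioo a b := by
      intro x hx
      rcases le_total t s with h | h
      · rw [uIcc_of_le h] at hx; exact ⟨by linarith [hx.1, ht.1], by linarith [hx.2, hs.2]⟩
      · rw [uIcc_of_ge h] at hx; exact ⟨by linarith [hx.1, hs.1], by linarith [hx.2, ht.2]⟩
    have := (convex_uIcc t s).norm_image_sub_le_of_norm_hasDerivWithin_le (f := fun x => Φ k x - x * Ψ k t)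
      (f' := fun x => Ψ k x - 1 * Ψ k t) (C := C*|s-t|)
      (fun x hx => ((k1 x (hsub hx)).sub ((hasDerivAt_id x).mul_const (Ψ k t))).hasDerivWithinAt)
      (fun x hx => by
        rw [Real.norm_eq_abs, one_mul]
        refine (k2 x (hsub hx) t ht).trans ?_
        exact mul_le_mul_of_nonneg_left (by rw [abs_sub_comm s t]; exact (abs_sub_left_of_mem_uIcc hx).trans (by rw [abs_sub_comm])) hC)
      left_mem_uIcc right_mem_uIcc
    rw [Real.norm_eq_abs, Real.norm_eq_abs] at this
    refine le_trans (le_of_eq ?_) this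
    congr 1; ring
  rw [hasDerivAt_iff_isLittleO, Asymptotics.isLittleO_iff]
  intro c hc
  have hc' : 0 < c/(C+1) := by positivity
  filter_upwards [Ioo_mem_nhds ht.1 ht.2, Metric.ball_mem_nhds t hc'] with s hs hs2
  rw [Real.norm_eq_abs, Real.norm_eq_abs, smul_eq_mul]
  refine (key s hs).trans ?_
  rw [Metric.mem_ball, Real.dist_eq, lt_div_iff₀ (by positivity)] at hs2
  refine mul_le_mul_of_nonneg_right ?_ (abs_nonneg _)
  have := abs_nonneg (s-t)
  linarith

end

section
open MeasureTheory

lemma pair_lip {f f' : ℝ → ℝ} {ψ : ℕ → ℝ → ℝ} {c d x0 x1 δ : ℝ} (hf : ContinuousOn f (Ioo x0 x1)) (hf' : ContinuousOn f' (Ioo x0 x1))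
    (hψ : TF ψ c d) (hc : x0 < c) (hd : d < x1) (hδ : 0 ≤ δ) (i : ℕ) (hb : ∀ y ∈ Icc c d, |f y - f' y| ≤ δ) :
    |(∫ y, f y * ψ i y) - ∫ y, f' y * ψ i y| ≤ δ * ∫ y, |ψ i y| := by
  rw [← integral_sub (loc_int hf hψ hc hd i) (loc_int hf' hψ hc hd i)]
  have e : ∀ y, f y * ψ i y - f' y * ψ i y = (Icc c d).indicator (fun y => f y - f' y) y * ψ i y := by
    intro y
    by_cases hy : y ∈ Icc c d
    · rw [indicator_of_mem hy]; ring
    · rw [indicator_of_notMem hy, hψ.z i y hy]; ring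
  simp only [e]
  apply bm_bound _ (cs_integrable (hψ.cont i) (hψ.z i))
  intro y
  by_cases hy : y ∈ Icc c d
  · rw [indicator_of_mem hy]; exact hb y hy
  · rw [indicator_of_notMem hy]; simpa using hδ

lemma flat_weak {w w1 w2 g : ℕ → ℝ → ℝ → ℝ} {N : ℕ → ℝ} {K H Λ β A p L t1 : ℝ} {W : ℝ → ℝ → ℝ}
    (hL : 0 ≤ L) (hΛ : 0 ≤ Λ) (hβ : 0 < β)
    (hN : Tendsto N atTop atTop)
    (hG : ∀ k, GB (g k) (-N k) (N k) K H Λ β)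
    (hP : ∀ k, PS (w k) (w1 k) (w2 k) (fun s y => g k y (w k s y)) (-N k) t1 (-N k) (N k) K H)
    (nn : ∀ k, ∀ s ∈ Ioo (-N k) t1, ∀ y ∈ Ioo (-N k) (N k), 0 ≤ w k s y)
    (lip : ∀ k, ∀ s ∈ Ioo (-N k) t1, ∀ s' ∈ Ioo (-N k) t1, ∀ y ∈ Ioo (-N k) (N k), |w k s y - w k s' y| ≤ L * |s-s'|)
    (hg : ∀ y, ∀ z ∈ Icc 0 K, Tendsto (fun k => g k y z) atTop (nhds (A * z^p)))
    (hW : ∀ s < t1, ∀ y, Tendsto (fun k => w k s y) atTop (nhds (W s y)))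
    (hWb : ∀ s < t1, ∀ y, W s y ∈ Icc 0 K) (n : ℝ) :
    Weak W (fun t x => A * W t x ^ p) (-n) t1 (-n) n := by
  have hgw : ∀ s < t1, ∀ y, Tendsto (fun k => g k y (w k s y)) atTop (nhds (A * W s y ^ p)) := by
    intro s hs y
    have h1 := hg y _ (hWb s hs y)
    have h2 : Tendsto (fun k => g k y (w k s y) - g k y (W s y)) atTop (nhds 0) := by
      have h3 : Tendsto (fun k => Λ * |w k s y - W s y|) atTop (nhds (Λ * |W s y - W s y|)) :=
        (((hW s hs y).sub_const _).abs).const_mul _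
      rw [sub_self, abs_zero, mul_zero] at h3
      refine squeeze_zero_norm' ?_ h3
      filter_upwards [hN.eventually_gt_atTop (|s|+|y|)] with k hk
      have := neg_abs_le s; have := neg_abs_le y; have := le_abs_self y
      have := abs_nonneg s; have := abs_nonneg y
      have hs' : s ∈ Ioo (-N k) t1 := ⟨by linarith, hs⟩
      have hy' : y ∈ Ioo (-N k) (N k) := ⟨by linarith, by linarith⟩
      have := (hG k).lip y hy' y hy' (w k s y) ⟨nn k s hs' y hy', (le_abs_self _).trans ((hP k).bu s hs' y hy')⟩ _ (hWb s hs y)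
      rw [sub_self, abs_zero, Real.zero_rpow hβ.ne', zero_add] at this
      exact this
    have := h2.add h1
    simpa using this
  intro ψ c d hψ hc hd
  obtain ⟨B0, hB0, hB0'⟩ := hψ.bdd 0
  obtain ⟨B2, hB2, hB2'⟩ := hψ.bdd 2
  have hev : ∀ᶠ k in atTop, n ≤ N k := hN.eventually_ge_atTop n
  have hK : 0 ≤ K ∨ ¬ (∃ s, s < t1) := by
    by_cases h : ∃ s, s < t1
    · obtain ⟨s, hs⟩ := h
      exact Or.inl ((hWb s hs 0).1.trans (hWb s hs 0).2)
    · exact Or.inr h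
  rcases hK with hK | hK
  swap
  · exact (hK ⟨t1-1, by linarith⟩).elim
  set I0 := ∫ y, |ψ 0 y|
  set I2 := ∫ y, |ψ 2 y|
  have hI0 : 0 ≤ I0 := integral_nonneg fun _ => abs_nonneg _
  have hI2 : 0 ≤ I2 := integral_nonneg fun _ => abs_nonneg _
  -- integrability helper facts at stage k
  have hintg : ∀ k, n ≤ N k → ∀ s ∈ Ioo (-n) t1, s ∈ Ioo (-N k) t1 := fun k hk s hs => ⟨by linarith [hs.1], hs.2⟩
  have hIcc : ∀ k, n ≤ N k → ∀ y ∈ Icc c d, y ∈ Ioo (-N k) (N k) := fun k hk y hy => ⟨by linarith [hy.1], by linarith [hy.2]⟩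
  refine limit_deriv (Φ := fun k s => ∫ y, w k s y * ψ 0 y) (Ψ := fun k s => (∫ y, w k s y * ψ 2 y) + ∫ y, g k y (w k s y) * ψ 0 y)
    (F := fun s => ∫ y, W s y * ψ 0 y) (G := fun t => ∫ y, (W t y * ψ 2 y + A * W t y ^ p * ψ 0 y)) (C := L * I2 + Λ * L * I0) (by positivity) ?_ ?_ ?_ ?_
  · filter_upwards [hev] with k hk s hs
    have hs' := hintg k hk s hs
    have := (hP k).weak ψ c d hψ (by linarith) (by linarith) s hs'
    refine this.congr_deriv ?_
    exact integral_add (loc_int ((hP k).cx s hs') hψ (by linarith) (by linarith) 2) (loc_int ((hP k).hhx s hs') hψ (by linarith) (by linarith) 0)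
  · filter_upwards [hev] with k hk s hs s' hs'
    have e1 := hintg k hk s hs
    have e2 := hintg k hk s' hs'
    have h1 := pair_lip ((hP k).cx s e1) ((hP k).cx s' e2) hψ (by linarith) (by linarith) (δ := L*|s-s'|) (by positivity) 2
      (fun y hy => lip k s e1 s' e2 y (hIcc k hk y hy))
    have h2 := pair_lip ((hP k).hhx s e1) ((hP k).hhx s' e2) hψ (by linarith) (by linarith) (δ := Λ*(L*|s-s'|)) (by positivity) 0
      (fun y hy => by
        have hy' := hIcc k hk y hy
        have := (hG k).lip y hy' y hy' (w k s y) ⟨nn k s e1 y hy', (le_abs_self _).trans ((hP k).bu s e1 y hy')⟩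
          (w k s' y) ⟨nn k s' e2 y hy', (le_abs_self _).trans ((hP k).bu s' e2 y hy')⟩
        rw [sub_self, abs_zero, Real.zero_rpow hβ.ne', zero_add] at this
        exact this.trans (mul_le_mul_of_nonneg_left (lip k s e1 s' e2 y hy') hΛ))
    have e : (L * I2 + Λ * L * I0) * |s - s'| = L * |s-s'| * I2 + Λ * (L * |s-s'|) * I0 := by ring
    rw [e]
    have := abs_le.1 h1; have := abs_le.1 h2
    rw [abs_le]; constructor <;> linarith
  · intro s hs
    refine dct (c := c) (d := d) (K := K * B0) ?_ ?_ ?_ ?_ ?_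
    · filter_upwards [hev] with k hk
      exact (((hP k).cx s (hintg k hk s hs)).mono (hIcc k hk)).mul (hψ.cont 0).continuousOn
    · exact Eventually.of_forall fun k y hy => by rw [hψ.z 0 y hy, mul_zero]
    · exact fun y hy => by rw [hψ.z 0 y hy, mul_zero]
    · filter_upwards [hev] with k hk y hy
      rw [abs_mul]
      exact mul_le_mul ((hP k).bu s (hintg k hk s hs) y (hIcc k hk y hy)) (hB0' y) (abs_nonneg _) hK
    · exact fun y hy => (hW s hs.2 y).mul_const _
  · intro s hs
    have hH : ∀ k, n ≤ N k → ∀ y ∈ Icc c d, |g k y (w k s y)| ≤ |H| := fun k hk y hy => ((hP k).bh s (hintg k hk s hs) y (hIcc k hk y hy)).trans (le_abs_self H)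
    have : Tendsto (fun k => ∫ y, (w k s y * ψ 2 y + g k y (w k s y) * ψ 0 y)) atTop (nhds (∫ y, (W s y * ψ 2 y + A * W s y ^ p * ψ 0 y))) := by
      refine dct (c := c) (d := d) (K := K * B2 + |H| * B0) ?_ ?_ ?_ ?_ ?_
      · filter_upwards [hev] with k hk
        exact ((((hP k).cx s (hintg k hk s hs)).mono (hIcc k hk)).mul (hψ.cont 2).continuousOn).add
          ((((hP k).hhx s (hintg k hk s hs)).mono (hIcc k hk)).mul (hψ.cont 0).continuousOn)
      · exact Eventually.of_forall fun k y hy => by rw [hψ.z 0 y hy, hψ.z 2 y hy, mul_zero, mul_zero, add_zero]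
      · exact fun y hy => by rw [hψ.z 0 y hy, hψ.z 2 y hy, mul_zero, mul_zero, add_zero]
      · filter_upwards [hev] with k hk y hy
        refine (abs_add_le _ _).trans ?_
        rw [abs_mul, abs_mul]
        exact add_le_add (mul_le_mul ((hP k).bu s (hintg k hk s hs) y (hIcc k hk y hy)) (hB2' y) (abs_nonneg _) hK)
          (mul_le_mul (hH k hk y hy) (hB0' y) (abs_nonneg _) (abs_nonneg _))
      · exact fun y hy => ((hW s hs.2 y).mul_const _).add ((hgw s hs.2 y).mul_const _)
    refine this.congr' ?_
    filter_upwards [hev] with k hk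
    have hs' := hintg k hk s hs
    exact integral_add (loc_int ((hP k).cx s hs') hψ (by linarith) (by linarith) 2) (loc_int ((hP k).hhx s hs') hψ (by linarith) (by linarith) 0)

end

section
open MeasureTheory

lemma GB.mono {g : ℝ → ℝ → ℝ} {a b a' b' K H Λ β : ℝ} (h : GB g a b K H Λ β) (ha : a ≤ a') (hb : b' ≤ b) : GB g a' b' K H Λ β where
  bd := fun x hx => h.bd x (Ioo_subset_Ioo ha hb hx)
  lip := fun x hx x' hx' => h.lip x (Ioo_subset_Ioo ha hb hx) x' (Ioo_subset_Ioo ha hb hx')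

lemma PS.mono {u u1 u2 h : ℝ → ℝ → ℝ} {t0 t1 x0 x1 t0' t1' x0' x1' K H : ℝ} (P : PS u u1 u2 h t0 t1 x0 x1 K H)
    (h1 : t0 ≤ t0') (h2 : t1' ≤ t1) (h3 : x0 ≤ x0') (h4 : x1' ≤ x1) : PS u u1 u2 h t0' t1' x0' x1' K H := by
  have ht := Ioo_subset_Ioo h1 h2
  have hx := Ioo_subset_Ioo h3 h4
  exact ⟨fun t t' x x' => P.ht t (ht t') x (hx x'), fun t t' x x' => P.hx t (ht t') x (hx x'), fun t t' x x' => P.hxx t (ht t') x (hx x'),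
    fun t t' => (P.cxx t (ht t')).mono hx, fun t t' => (P.hhx t (ht t')).mono hx, fun x x' => (P.hht x (hx x')).mono ht,
    fun t t' x x' => P.bu t (ht t') x (hx x'), fun t t' x x' => P.bh t (ht t') x (hx x')⟩

lemma PS.time_lip {u u1 u2 h : ℝ → ℝ → ℝ} {t0 t1 x0 x1 K H C : ℝ} (P : PS u u1 u2 h t0 t1 x0 x1 K H)
    (hC : ∀ s ∈ Ioo t0 t1, ∀ x ∈ Ioo x0 x1, |u2 s x| ≤ C) :
    ∀ s ∈ Ioo t0 t1, ∀ s' ∈ Ioo t0 t1, ∀ x ∈ Ioo x0 x1, |u s x - u s' x| ≤ (C+H) * |s-s'| := by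
  intro s hs s' hs' x hx
  have := (convex_Ioo t0 t1).norm_image_sub_le_of_norm_hasDerivWithin_le (f := fun t => u t x) (f' := fun t => u2 t x + h t x) (C := C+H)
    (fun t ht => (P.ht t ht x hx).hasDerivWithinAt)
    (fun t ht => by
      rw [Real.norm_eq_abs]
      exact (abs_add_le _ _).trans (add_le_add (hC t ht x hx) (P.bh t ht x hx))) hs' hs
  rwa [Real.norm_eq_abs, Real.norm_eq_abs] at this

lemma flat_limit {w w1 w2 g : ℕ → ℝ → ℝ → ℝ} {N : ℕ → ℝ} {K H Λ β A p : ℝ}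
    (hK : 0 ≤ K) (hH : 0 ≤ H) (hΛ : 0 ≤ Λ) (hβ : 0 < β) (hβ1 : β ≤ 1) (hA : 0 ≤ A) (hp : 1 < p)
    (hN : Tendsto N atTop atTop)
    (hG : ∀ k, GB (g k) (-N k) (N k) K H Λ β)
    (hP : ∀ k, PS (w k) (w1 k) (w2 k) (fun s y => g k y (w k s y)) (-N k) (1/2) (-N k) (N k) K H)
    (nn : ∀ k, ∀ s ∈ Ioo (-N k) (1/2), ∀ y ∈ Ioo (-N k) (N k), 0 ≤ w k s y)
    (hg : ∀ y, ∀ z ∈ Icc 0 K, Tendsto (fun k => g k y z) atTop (nhds (A * z^p))) :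
    ∀ ε > 0, ∃ k, |w2 k 0 0| ≤ ε := by
  intro ε hε
  obtain ⟨C, hC, hreg⟩ := reg β K H Λ 1 (1/2) hβ hβ1 hK hH hΛ one_pos le_rfl (by norm_num) (by norm_num)
  set N' : ℕ → ℝ := fun k => N k - 2 with hN'
  have hN't : Tendsto N' atTop atTop := tendsto_atTop_add_const_right _ _ hN
  have hG' : ∀ k, GB (g k) (-N' k) (N' k) K H Λ β := fun k => (hG k).mono (by simp only [hN']; linarith) (by simp only [hN']; linarith)
  have hP' : ∀ k, PS (w k) (w1 k) (w2 k) (fun s y => g k y (w k s y)) (-N' k) (1/2) (-N' k) (N' k) K H := fun k =>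
    (hP k).mono (by simp only [hN']; linarith) le_rfl (by simp only [hN']; linarith) (by simp only [hN']; linarith)
  have nn' : ∀ k, ∀ s ∈ Ioo (-N' k) (1/2), ∀ y ∈ Ioo (-N' k) (N' k), 0 ≤ w k s y := by
    intro k s hs y hy
    simp only [hN', mem_Ioo] at hs hy
    exact nn k s ⟨by linarith [hs.1], hs.2⟩ y ⟨by linarith [hy.1], by linarith [hy.2]⟩
  have hxl : ∀ k, ∀ s ∈ Ioo (-N' k) (1/2), ∀ y ∈ Ioo (-N' k) (N' k), ∀ y' ∈ Ioo (-N' k) (N' k), |w k s y - w k s y'| ≤ C * |y-y'| := by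
    intro k s hs y hy y' hy'
    simp only [hN', mem_Ioo] at hs hy hy'
    exact (hreg _ _ _ _ _ _ _ _ (hG k) (hP k) (nn k)).1 s ⟨by linarith [hs.1], hs.2⟩ y ⟨by linarith [hy.1], by linarith [hy.2]⟩ y' ⟨by linarith [hy'.1], by linarith [hy'.2]⟩
  have h2 : ∀ k, ∀ s ∈ Ioo (-N' k) (1/2), ∀ y ∈ Ioo (-N' k) (N' k), |w2 k s y| ≤ C := by
    intro k s hs y hy
    simp only [hN', mem_Ioo] at hs hy
    exact (hreg _ _ _ _ _ _ _ _ (hG k) (hP k) (nn k)).2.2 s ⟨by linarith [hs.1], hs.2⟩ y ⟨by linarith [hy.1], by linarith [hy.2]⟩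
  have htl := fun k => (hP' k).time_lip (h2 k)
  have hlip : ∀ k, ∀ s ∈ Ioo (-N' k) (1/2), ∀ s' ∈ Ioo (-N' k) (1/2), ∀ y ∈ Ioo (-N' k) (N' k), ∀ y' ∈ Ioo (-N' k) (N' k),
      |w k s y - w k s' y'| ≤ (C+H) * (|s-s'| + |y-y'|) := by
    intro k s hs s' hs' y hy y' hy'
    have a1 := htl k s hs s' hs' y hy
    have a2 := hxl k s' hs' y hy y' hy'
    have a3 : C * |y-y'| ≤ (C+H) * |y-y'| := mul_le_mul_of_nonneg_right (by linarith) (abs_nonneg _)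
    have a4 := abs_sub_le (w k s y) (w k s' y) (w k s' y')
    linarith
  obtain ⟨φ, hφ, W, hW⟩ := extract hK (by linarith : 0 ≤ C+H) hN't (fun k => (hP' k).bu) hlip
  have hNφ : Tendsto (fun k => N' (φ k)) atTop atTop := hN't.comp hφ.tendsto_atTop
  have hmem : ∀ s : ℝ, s < 1/2 → ∀ y : ℝ, ∀ᶠ k in atTop, s ∈ Ioo (-N' (φ k)) (1/2) ∧ y ∈ Ioo (-N' (φ k)) (N' (φ k)) := by
    intro s hs y
    filter_upwards [hNφ.eventually_gt_atTop (|s|+|y|)] with k hk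
    have := neg_abs_le s; have := neg_abs_le y; have := le_abs_self y
    have := abs_nonneg s; have := abs_nonneg y
    exact ⟨⟨by linarith, hs⟩, ⟨by linarith, by linarith⟩⟩
  have hWb : ∀ s < 1/2, ∀ y, W s y ∈ Icc 0 K := by
    intro s hs y
    refine isClosed_Icc.mem_of_tendsto (hW s hs y) ?_
    filter_upwards [hmem s hs y] with k hk
    exact ⟨nn' _ _ hk.1 _ hk.2, (le_abs_self _).trans ((hP' _).bu _ hk.1 _ hk.2)⟩
  have hWl : ∀ s < 1/2, ∀ s' < 1/2, ∀ y y', |W s y - W s' y'| ≤ (C+H) * (|s-s'|+|y-y'|) := by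
    intro s hs s' hs' y y'
    refine le_of_tendsto ((hW s hs y).sub (hW s' hs' y')).abs ?_
    filter_upwards [hmem s hs y, hmem s' hs' y'] with k hk hk'
    exact hlip _ _ hk.1 _ hk'.1 _ hk.2 _ hk'.2
  have hanc : Anc A p K (1/2) W := by
    refine ⟨?_, fun t ht x => (hWb t ht x).1, fun t ht x => (hWb t ht x).2, ?_⟩
    · rintro ⟨s, y⟩ ⟨hs, -⟩
      simp only [mem_Iio] at hs
      have h0 : Tendsto (fun q : ℝ × ℝ => (C+H) * (|q.1 - s| + |q.2-y|)) (nhdsWithin (s,y) (Iio (1/2) ×ˢ univ)) (nhds 0) := by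
        have : Continuous (fun q : ℝ × ℝ => (C+H) * (|q.1 - s| + |q.2-y|)) := by fun_prop
        have := this.tendsto (s,y)
        simp only [sub_self, abs_zero, add_zero, mul_zero] at this
        exact this.mono_left nhdsWithin_le_nhds
      unfold ContinuousWithinAt
      rw [tendsto_iff_dist_tendsto_zero]
      refine squeeze_zero' (Eventually.of_forall fun _ => dist_nonneg) ?_ h0
      filter_upwards [self_mem_nhdsWithin] with q hq
      rw [Real.dist_eq]
      exact hWl _ hq.1 _ hs _ _
    · intro n
      exact flat_weak (w := fun k => w (φ k)) (w1 := fun k => w1 (φ k)) (w2 := fun k => w2 (φ k)) (g := fun k => g (φ k)) (N := fun k => N' (φ k)) (by linarith : 0 ≤ C+H) hΛ hβ hNφ (fun k => hG' _) (fun k => hP' _) (fun k => nn' _)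
        (fun k => htl _) (fun y z hz => (hg y z hz).comp hφ.tendsto_atTop) hW hWb n
  have hflat := liouville hanc hp hA
  -- choose τ
  obtain ⟨τ, hτ, hτ1, hτ2⟩ : ∃ τ : ℝ, 0 < τ ∧ τ < 1 ∧ C * τ^(β/2) ≤ ε/2 := by
    have h1 : Tendsto (fun τ : ℝ => C * τ^(β/2)) (nhdsWithin 0 (Ioi 0)) (nhds 0) := by
      have : ContinuousAt (fun τ : ℝ => C * τ^(β/2)) 0 := by
        refine continuousAt_const.mul (Real.continuousAt_rpow_const _ _ (Or.inr (by positivity)))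
      have h := this.tendsto
      rw [Real.zero_rpow (by positivity), mul_zero] at h
      exact h.mono_left nhdsWithin_le_nhds
    have h2 := h1.eventually_le_const (show (0:ℝ) < ε/2 by linarith)
    obtain ⟨τ, h3, h4⟩ := (h2.and (Ioo_mem_nhdsGT (show (0:ℝ) < 1 by norm_num))).exists
    exact ⟨τ, h4.1, h4.2, h3⟩
  set ν := ε*τ/(2*C) with hν
  have hν0 : 0 < ν := by positivity
  have hCν : C * (ν/τ) = ε/2 := by rw [hν]; field_simp
  obtain ⟨S, hS, hSf, hcov⟩ := (isCompact_Icc (a := (-1:ℝ)) (b := 1)).finite_cover_balls (show 0 < ν/(8*(C+H)) by positivity)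
  have hev : ∀ᶠ k in atTop, ∀ y ∈ S, |w (φ k) (-τ) y - W (-τ) y| < ν/8 := by
    rw [eventually_all_finite hSf]
    intro y _
    have := (hW (-τ) (by linarith) y).eventually (Metric.ball_mem_nhds _ (show 0 < ν/8 by positivity))
    exact this
  obtain ⟨k, hk1, hk2⟩ := (hev.and (hNφ.eventually_gt_atTop 3)).exists
  refine ⟨φ k, ?_⟩
  have hτm : -τ ∈ Ioo (-N' (φ k)) (1/2) := ⟨by linarith, by linarith⟩
  have hclose : ∀ y ∈ Icc (-1:ℝ) 1, |w (φ k) (-τ) y - W (-τ) 0| ≤ ν/2 := by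
    intro y hy
    have := hcov hy
    rw [mem_iUnion₂] at this
    obtain ⟨y', hy', hyy⟩ := this
    rw [Metric.mem_ball, Real.dist_eq, lt_div_iff₀ (by positivity)] at hyy
    have hy'1 := hS hy'
    have a1 := hxl (φ k) (-τ) hτm y ⟨by linarith [hy.1], by linarith [hy.2]⟩ y' ⟨by linarith [hy'1.1], by linarith [hy'1.2]⟩
    have a2 := hk1 y' hy'
    rw [hflat (-τ) (by linarith) y' 0] at a2
    have a3 : C * |y-y'| ≤ (C+H) * |y-y'| := mul_le_mul_of_nonneg_right (by linarith) (abs_nonneg _)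
    have := abs_lt.1 a2
    have := abs_le.1 a1
    rw [abs_le]; constructor <;> linarith
  have hfin := (hreg _ _ _ _ _ _ _ _ (hG (φ k)) (hP (φ k)) (nn (φ k))).2.1 0 τ 0 ν hτ hτ1 (by simp only [hN'] at hk2; linarith) (by norm_num)
    ⟨by simp only [hN'] at hk2; linarith, by simp only [hN'] at hk2; linarith⟩ (by
      intro y hy
      rw [zero_sub, abs_neg] at hy
      rw [zero_sub]
      have b1 := abs_le.1 (hclose y (abs_le.1 hy))
      have b2 := abs_le.1 (hclose 0 ⟨by norm_num, by norm_num⟩)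
      rw [abs_le]; constructor <;> linarith)
  rw [mul_add] at hfin
  linarith

end

section

lemma PS_of_GB {g u u1 u2 : ℝ → ℝ → ℝ} {t0 t1 x0 x1 K H Λ β : ℝ} (hβ : 0 < β) (G : GB g x0 x1 K H Λ β)
    (ht : ∀ t ∈ Ioo t0 t1, ∀ x ∈ Ioo x0 x1, HasDerivAt (fun s => u s x) (u2 t x + g x (u t x)) t)
    (hx : ∀ t ∈ Ioo t0 t1, ∀ x ∈ Ioo x0 x1, HasDerivAt (u t) (u1 t x) x)
    (hxx : ∀ t ∈ Ioo t0 t1, ∀ x ∈ Ioo x0 x1, HasDerivAt (u1 t) (u2 t x) x)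
    (cxx : ∀ t ∈ Ioo t0 t1, ContinuousOn (u2 t) (Ioo x0 x1))
    (hb : ∀ t ∈ Ioo t0 t1, ∀ x ∈ Ioo x0 x1, u t x ∈ Icc 0 K) :
    PS u u1 u2 (fun t x => g x (u t x)) t0 t1 x0 x1 K H where
  ht := ht
  hx := hx
  hxx := hxx
  cxx := cxx
  hhx := by
    intro t t' x x'
    have h0 : Tendsto (fun y => Λ * (|y-x|^β + |u t y - u t x|)) (nhdsWithin x (Ioo x0 x1)) (nhds 0) := by
      have c : ContinuousAt (fun y => Λ * (|y-x|^β + |u t y - u t x|)) x := by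
        refine continuousAt_const.mul (ContinuousAt.add ?_ ?_)
        · exact ContinuousAt.rpow_const (by fun_prop) (Or.inr hβ.le)
        · exact ((hx t t' x x').continuousAt.sub continuousAt_const).abs
      have := c.tendsto
      simp only [sub_self, abs_zero, Real.zero_rpow hβ.ne', add_zero, mul_zero] at this
      exact this.mono_left nhdsWithin_le_nhds
    unfold ContinuousWithinAt
    rw [tendsto_iff_dist_tendsto_zero]
    refine squeeze_zero' (Eventually.of_forall fun _ => dist_nonneg) ?_ h0
    filter_upwards [self_mem_nhdsWithin] with y hy
    rw [Real.dist_eq]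
    exact G.lip y hy x x' _ (hb t t' y hy) _ (hb t t' x x')
  hht := by
    intro x x' t t'
    have h0 : Tendsto (fun s => Λ * (|x-x|^β + |u s x - u t x|)) (nhdsWithin t (Ioo t0 t1)) (nhds 0) := by
      have c : ContinuousAt (fun s => Λ * (|x-x|^β + |u s x - u t x|)) t :=
        continuousAt_const.mul (continuousAt_const.add (((ht t t' x x').continuousAt.sub continuousAt_const).abs))
      have := c.tendsto
      simp only [sub_self, abs_zero, Real.zero_rpow hβ.ne', add_zero, mul_zero] at this
      simp only [sub_self, abs_zero, Real.zero_rpow hβ.ne']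
      exact this.mono_left nhdsWithin_le_nhds
    unfold ContinuousWithinAt
    rw [tendsto_iff_dist_tendsto_zero]
    refine squeeze_zero' (Eventually.of_forall fun _ => dist_nonneg) ?_ h0
    filter_upwards [self_mem_nhdsWithin] with s hs
    rw [Real.dist_eq]
    exact G.lip x x' x x' _ (hb s hs x x') _ (hb t t' x x')
  bu := fun t t' x x' => by rw [abs_of_nonneg (hb t t' x x').1]; exact (hb t t' x x').2
  bh := fun t t' x x' => G.bd x x' _ (hb t t' x x')

structure GD (G : ℝ → ℝ → ℝ) (q : ℝ → ℝ) (a b p β CG : ℝ) : Prop where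
  g1 : ∀ x ∈ Ioo a b, ∀ z, 0 ≤ z → |G x z| ≤ CG * (1 + z^p)
  g2 : ∀ x ∈ Ioo a b, ∀ x' ∈ Ioo a b, ∀ z z', 0 ≤ z → 0 ≤ z' →
    |G x z - G x' z'| ≤ CG * ((1 + z^p + z'^p) * |x-x'|^β + (1 + z^(p-1) + z'^(p-1)) * |z-z'|)
  g3 : ∀ η > 0, ∃ C ≥ 0, ∀ x ∈ Ioo a b, ∀ z, 0 ≤ z → |G x z - q x * z^p| ≤ η * z^p + C
  qc : ContinuousOn q (Ioo a b)
  q0 : ∀ x ∈ Ioo a b, 0 ≤ q x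
  c0 : 0 ≤ CG
  b0 : 0 < β
  b1 : β ≤ 1
  hp : 1 < p

structure OD (v v1 v2 G : ℝ → ℝ → ℝ) (T0 T a b p M : ℝ) : Prop where
  vt : ∀ t ∈ Ioo T0 T, ∀ x ∈ Ioo a b, HasDerivAt (fun s => v s x) (v2 t x + G x (v t x)) t
  vx : ∀ t ∈ Ioo T0 T, ∀ x ∈ Ioo a b, HasDerivAt (v t) (v1 t x) x
  vxx : ∀ t ∈ Ioo T0 T, ∀ x ∈ Ioo a b, HasDerivAt (v1 t) (v2 t x) x
  cxx : ∀ t ∈ Ioo T0 T, ContinuousOn (v2 t) (Ioo a b)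
  nn : ∀ t ∈ Ioo T0 T, ∀ x ∈ Ioo a b, 0 ≤ v t x
  ub : ∀ t ∈ Ioo T0 T, ∀ x ∈ Ioo a b, v t x ≤ M * (T - t)^(-(1/(p-1)))

/-- rescaled function -/
def rs (v : ℝ → ℝ → ℝ) (m l lam tc xc : ℝ) (s y : ℝ) : ℝ := m * v (tc + l * s) (xc + lam * y)
/-- rescaled nonlinearity -/
noncomputable def rg (G : ℝ → ℝ → ℝ) (m l lam xc : ℝ) (y z : ℝ) : ℝ := m * l * G (xc + lam * y) (z / m)

/-- scaling parameters -/
structure SP (m l lam p : ℝ) : Prop where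
  m0 : 0 < m
  m1 : m ≤ 1
  l0 : 0 < l
  l1 : l ≤ 1
  lam0 : 0 < lam
  lam1 : lam ≤ 1
  ll : lam * lam = l
  mp : m ^ p = m * l
  mp1 : m ^ (p-1) = l

lemma SP_of {l p : ℝ} (hp : 1 < p) (h0 : 0 < l) (h1 : l ≤ 1) : SP (l^(1/(p-1))) l (√l) p := by
  have hp1 : 0 < p - 1 := by linarith
  have e1 : (l^(1/(p-1)))^(p-1) = l := by
    rw [← Real.rpow_mul h0.le, one_div, inv_mul_cancel₀ hp1.ne', Real.rpow_one]
  have m0 : 0 < l^(1/(p-1)) := Real.rpow_pos_of_pos h0 _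
  refine ⟨m0, Real.rpow_le_one h0.le h1 (by positivity), h0, h1, Real.sqrt_pos.2 h0, Real.sqrt_le_one.2 h1, Real.mul_self_sqrt h0.le, ?_, e1⟩
  have h := Real.rpow_add m0 1 (p-1)
  rw [e1, Real.rpow_one, show 1 + (p-1) = p by ring] at h
  exact h

variable {v v1 v2 G : ℝ → ℝ → ℝ} {q : ℝ → ℝ} {a b p β CG T0 T M m l lam tc xc K t0 t1 x0 x1 : ℝ}

lemma SP.zp (S : SP m l lam p) {z : ℝ} (hz : 0 ≤ z) : m * l * (z/m)^p = z^p := by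
  have := S.m0
  rw [← S.mp, Real.div_rpow hz S.m0.le, mul_div_cancel₀ _ (Real.rpow_pos_of_pos S.m0 _).ne']

lemma GD.rgb (D : GD G q a b p β CG) (S : SP m l lam p) (hK : 0 ≤ K) (hx : ∀ y ∈ Ioo x0 x1, xc + lam * y ∈ Ioo a b) :
    GB (rg G m l lam xc) x0 x1 K (CG * (1 + K^p)) (CG * (2 + 2 * K^p + 2 * K^(p-1))) β where
  bd := by
    intro y hy z hz
    have hp := D.hp
    have hm := S.m0
    have hc := D.c0
    have hl := S.l0
    have hml : m * l ≤ 1 := mul_le_one₀ S.m1 S.l0.le S.l1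
    have h1 := D.g1 _ (hx y hy) (z/m) (div_nonneg hz.1 hm.le)
    unfold rg
    rw [abs_mul, abs_of_pos (by positivity : 0 < m*l)]
    have h2 := mul_le_mul_of_nonneg_left h1 (by positivity : 0 ≤ m*l)
    have e : m*l*(CG*(1+(z/m)^p)) = CG*(m*l + z^p) := by rw [← S.zp hz.1]; ring
    rw [e] at h2
    refine h2.trans (mul_le_mul_of_nonneg_left ?_ hc)
    exact add_le_add hml (Real.rpow_le_rpow hz.1 hz.2 (by linarith))
  lip := by
    intro y hy y' hy' z hz z' hz'
    have hp := D.hp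
    have hm := S.m0
    have hc := D.c0
    have hl := S.l0
    have hml : m * l ≤ 1 := mul_le_one₀ S.m1 S.l0.le S.l1
    have h1 := D.g2 _ (hx y hy) _ (hx y' hy') (z/m) (z'/m) (div_nonneg hz.1 hm.le) (div_nonneg hz'.1 hm.le)
    unfold rg
    rw [← mul_sub, abs_mul, abs_of_pos (by positivity : 0 < m*l)]
    have h2 := mul_le_mul_of_nonneg_left h1 (by positivity : 0 ≤ m*l)
    have e0 : |xc + lam*y - (xc + lam*y')| = lam * |y-y'| := by
      rw [show xc + lam*y - (xc + lam*y') = lam*(y-y') by ring, abs_mul, abs_of_pos S.lam0]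
    have e1 : |z/m - z'/m| = |z-z'|/m := by rw [← sub_div, abs_div, abs_of_pos hm]
    have e2 : ∀ z : ℝ, 0 ≤ z → l * (z/m)^(p-1) = z^(p-1) := by
      intro z hz
      rw [← S.mp1, Real.div_rpow hz hm.le, mul_div_cancel₀ _ (Real.rpow_pos_of_pos hm _).ne']
    rw [e0, e1] at h2
    have e : m*l*(CG*((1 + (z/m)^p + (z'/m)^p) * (lam * |y-y'|)^β + (1 + (z/m)^(p-1) + (z'/m)^(p-1)) * (|z-z'|/m)))
        = CG * ((m*l + z^p + z'^p) * (lam * |y-y'|)^β + (l + z^(p-1) + z'^(p-1)) * |z-z'|) := by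
      rw [← S.zp hz.1, ← S.zp hz'.1, ← e2 z hz.1, ← e2 z' hz'.1]
      field_simp
    rw [e] at h2
    refine h2.trans ?_
    rw [mul_assoc]
    refine mul_le_mul_of_nonneg_left ?_ hc
    have i1 := Real.rpow_le_rpow hz.1 hz.2 (by linarith : 0 ≤ p)
    have i2 := Real.rpow_le_rpow hz'.1 hz'.2 (by linarith : 0 ≤ p)
    have i3 := Real.rpow_le_rpow hz.1 hz.2 (by linarith : 0 ≤ p-1)
    have i4 := Real.rpow_le_rpow hz'.1 hz'.2 (by linarith : 0 ≤ p-1)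
    have i5 : (lam * |y-y'|)^β ≤ |y-y'|^β := Real.rpow_le_rpow (mul_nonneg S.lam0.le (abs_nonneg _)) (mul_le_of_le_one_left (abs_nonneg _) S.lam1) D.b0.le
    have i6 : 0 ≤ (lam * |y-y'|)^β := Real.rpow_nonneg (mul_nonneg S.lam0.le (abs_nonneg _)) _
    have k1 : 0 ≤ K^p := Real.rpow_nonneg hK _
    have k2 : 0 ≤ K^(p-1) := Real.rpow_nonneg hK _
    have z1 : 0 ≤ z^p := Real.rpow_nonneg hz.1 _
    have z2 : 0 ≤ z'^p := Real.rpow_nonneg hz'.1 _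
    rw [mul_add]
    have hl1 := S.l1
    refine add_le_add (mul_le_mul ?_ i5 i6 (by positivity)) (mul_le_mul_of_nonneg_right ?_ (abs_nonneg _)) <;> linarith

lemma OD.resc (O : OD v v1 v2 G T0 T a b p M) (D : GD G q a b p β CG) (S : SP m l lam p) (hK : 0 ≤ K)
    (ht : ∀ s ∈ Ioo t0 t1, tc + l * s ∈ Ioo T0 T) (hx : ∀ y ∈ Ioo x0 x1, xc + lam * y ∈ Ioo a b)
    (hb : ∀ s ∈ Ioo t0 t1, ∀ y ∈ Ioo x0 x1, rs v m l lam tc xc s y ≤ K) :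
    PS (rs v m l lam tc xc) (rs v1 (m*lam) l lam tc xc) (rs v2 (m*l) l lam tc xc)
      (fun s y => rg G m l lam xc y (rs v m l lam tc xc s y)) t0 t1 x0 x1 K (CG * (1 + K^p)) := by
  have hm := S.m0
  refine PS_of_GB D.b0 (D.rgb S hK hx) ?_ ?_ ?_ ?_ ?_
  · intro s hs y hy
    have h1 := O.vt _ (ht s hs) _ (hx y hy)
    have h2 := (h1.comp_const_add tc (l*s)).comp s ((hasDerivAt_id s).const_mul l)
    refine (h2.const_mul m).congr_deriv ?_
    unfold rs rg
    rw [mul_div_cancel_left₀ _ hm.ne']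
    ring
  · intro s hs y hy
    have h1 := O.vx _ (ht s hs) _ (hx y hy)
    have h2 := (h1.comp_const_add xc (lam*y)).comp y ((hasDerivAt_id y).const_mul lam)
    refine (h2.const_mul m).congr_deriv ?_
    unfold rs
    ring
  · intro s hs y hy
    have h1 := O.vxx _ (ht s hs) _ (hx y hy)
    have h2 := (h1.comp_const_add xc (lam*y)).comp y ((hasDerivAt_id y).const_mul lam)
    refine (h2.const_mul (m*lam)).congr_deriv ?_
    unfold rs
    rw [← S.ll]
    ring
  · intro s hs
    have h1 := O.cxx _ (ht s hs)
    exact continuousOn_const.mul (h1.comp (by fun_prop) hx)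
  · intro s hs y hy
    exact ⟨mul_nonneg hm.le (O.nn _ (ht s hs) _ (hx y hy)), hb s hs y hy⟩

end

section
variable {v v1 v2 G : ℝ → ℝ → ℝ} {q : ℝ → ℝ} {a b p β CG T0 T M m l lam tc xc K t0 t1 x0 x1 : ℝ}

lemma OD.rb (O : OD v v1 v2 G T0 T a b p M) (hl : 0 < T - tc) {s y : ℝ} (hs : s < 1)
    (ht : tc + (T-tc) * s ∈ Ioo T0 T) (hx : xc + lam * y ∈ Ioo a b) :
    rs v ((T-tc)^(1/(p-1))) (T-tc) lam tc xc s y ≤ M * (1-s)^(-(1/(p-1))) := by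
  have h1 := O.ub _ ht _ hx
  have h2 := mul_le_mul_of_nonneg_left h1 (Real.rpow_nonneg hl.le (1/(p-1)))
  unfold rs
  refine h2.trans (le_of_eq ?_)
  rw [show T - (tc + (T-tc)*s) = (T-tc)*(1-s) by ring, Real.mul_rpow hl.le (by linarith), Real.rpow_neg hl.le]
  have := Real.rpow_pos_of_pos hl (1/(p-1))
  field_simp

lemma rg_lim (D : GD G q a b p β CG) {l x : ℕ → ℝ} {X : ℝ} (hl0 : ∀ k, 0 < l k) (hl1 : ∀ k, l k ≤ 1) (hl : Tendsto l atTop (nhds 0))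
    (hx : Tendsto x atTop (nhds X)) (hX : X ∈ Ioo a b) (y z : ℝ) (hz : 0 ≤ z) :
    Tendsto (fun k => rg G ((l k)^(1/(p-1))) (l k) (√(l k)) (x k) y z) atTop (nhds (q X * z^p)) := by
  have hs : Tendsto (fun k => √(l k)) atTop (nhds 0) := by
    have := (Real.continuous_sqrt.tendsto 0).comp hl
    rw [Real.sqrt_zero] at this
    exact this
  have hxx : Tendsto (fun k => x k + √(l k) * y) atTop (nhds X) := by
    have := hx.add (hs.mul_const y)
    simpa using this
  have hev : ∀ᶠ k in atTop, x k + √(l k) * y ∈ Ioo a b := hxx.eventually (Ioo_mem_nhds hX.1 hX.2)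
  have hq : Tendsto (fun k => q (x k + √(l k) * y) * z^p) atTop (nhds (q X * z^p)) :=
    (((D.qc X hX).continuousAt (Ioo_mem_nhds hX.1 hX.2)).tendsto.comp hxx).mul_const _
  have hd : Tendsto (fun k => rg G ((l k)^(1/(p-1))) (l k) (√(l k)) (x k) y z - q (x k + √(l k) * y) * z^p) atTop (nhds 0) := by
    rw [Metric.tendsto_nhds]
    intro ε hε
    have hzp : 0 ≤ z^p := Real.rpow_nonneg hz p
    obtain ⟨C, hC, hg⟩ := D.g3 (ε/(2*(1+z^p))) (by positivity)
    have hlc : ∀ᶠ k in atTop, l k < ε/(2*(C+1)) := hl.eventually_lt_const (by positivity)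
    filter_upwards [hev, hlc] with k k1 k2
    have S := SP_of D.hp (hl0 k) (hl1 k)
    set m := (l k)^(1/(p-1)) with hm
    have hm0 := S.m0
    have hl0' := hl0 k
    have h1 := hg _ k1 (z/m) (div_nonneg hz hm0.le)
    rw [dist_zero_right, Real.norm_eq_abs]
    unfold rg
    have e : m * l k * G (x k + √(l k) * y) (z/m) - q (x k + √(l k)*y) * z^p
        = m * l k * (G (x k + √(l k) * y) (z/m) - q (x k + √(l k)*y) * (z/m)^p) := by
      rw [← S.zp hz]; ring
    rw [e, abs_mul, abs_of_pos (by positivity : 0 < m * l k)]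
    have h2 := mul_le_mul_of_nonneg_left h1 (by positivity : 0 ≤ m * l k)
    have e2 : m * l k * (ε/(2*(1+z^p)) * (z/m)^p + C) = ε/(2*(1+z^p)) * z^p + m * l k * C := by
      rw [← S.zp hz]; ring
    rw [e2] at h2
    refine h2.trans_lt ?_
    have h3 : ε/(2*(1+z^p)) * z^p ≤ ε/2 := by
      rw [div_mul_eq_mul_div, div_le_div_iff₀ (by positivity) (by norm_num)]
      linarith
    rw [lt_div_iff₀ (by positivity)] at k2
    have h4 : m * l k * C ≤ l k * C := by
      refine mul_le_mul_of_nonneg_right (mul_le_of_le_one_left hl0'.le S.m1) hC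
    linarith
  have := hd.add hq
  simpa using this

lemma flatE (O : OD v v1 v2 G T0 T a b p M) (D : GD G q a b p β CG) (hM : 0 ≤ M) (hT : T0 < T) {a' b' : ℝ} (ha : a < a') (hb : b' < b) :
    ∀ η > 0, ∃ tη ∈ Ioo T0 T, ∀ t ∈ Ico tη T, ∀ x ∈ Icc a' b', (T-t)^(1/(p-1)) * (T-t) * |v2 t x| ≤ η := by
  intro η hη
  by_contra hcon
  push Not at hcon
  set δ := min ((T-T0)/2) 1 with hδ
  have hδ0 : 0 < δ := lt_min (by linarith) one_pos
  have hδ1 : δ ≤ (T-T0)/2 := min_le_left _ _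
  have hδ2 : δ ≤ 1 := min_le_right _ _
  have hdk : ∀ k : ℕ, 0 < δ/((k:ℝ)+1) ∧ δ/((k:ℝ)+1) ≤ δ := by
    intro k
    have : (0:ℝ) ≤ k := Nat.cast_nonneg k
    exact ⟨by positivity, div_le_self hδ0.le (by linarith)⟩
  have hex : ∀ k : ℕ, ∃ t x, t ∈ Ico (T - δ/((k:ℝ)+1)) T ∧ x ∈ Icc a' b' ∧ η < (T-t)^(1/(p-1)) * (T-t) * |v2 t x| := by
    intro k
    obtain ⟨h1, h2⟩ := hdk k
    obtain ⟨t, ht, x, hx, h⟩ := hcon (T - δ/((k:ℝ)+1)) ⟨by linarith, by linarith⟩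
    exact ⟨t, x, ht, hx, h⟩
  choose t x ht hx hbig using hex
  obtain ⟨X, hX, φ, hφ, hxφ⟩ := isCompact_Icc.tendsto_subseq hx
  set l : ℕ → ℝ := fun k => T - t (φ k) with hl
  have hl0 : ∀ k, 0 < l k := fun k => by have := (ht (φ k)).2; simp only [hl]; linarith
  have hlδ : ∀ k, l k ≤ δ := fun k => by have := (ht (φ k)).1; have := (hdk (φ k)).2; simp only [hl]; linarith
  have hl1 : ∀ k, l k ≤ 1 := fun k => (hlδ k).trans hδ2
  have hlt : Tendsto l atTop (nhds 0) := by
    have h0 : Tendsto (fun k : ℕ => δ/(((φ k : ℕ):ℝ)+1)) atTop (nhds 0) := by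
      have h1 : Tendsto (fun k : ℕ => ((φ k : ℕ):ℝ)+1) atTop atTop :=
        tendsto_atTop_add_const_right _ _ (tendsto_natCast_atTop_atTop.comp hφ.tendsto_atTop)
      exact h1.const_div_atTop δ
    refine squeeze_zero (fun k => (hl0 k).le) (fun k => ?_) h0
    have := (ht (φ k)).1; simp only [hl]; linarith
  have hst : Tendsto (fun k => √(l k)) atTop (nhdsWithin 0 (Ioi 0)) := by
    rw [tendsto_nhdsWithin_iff]
    refine ⟨?_, Eventually.of_forall fun k => Real.sqrt_pos.2 (hl0 k)⟩
    have := (Real.continuous_sqrt.tendsto 0).comp hlt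
    rw [Real.sqrt_zero] at this
    exact this
  have hXm : X ∈ Ioo a b := ⟨by linarith [hX.1], by linarith [hX.2]⟩
  set d := min ((T-T0)/2) (min (a'-a) (b-b')) with hd
  have hd0 : 0 < d := lt_min (by linarith) (lt_min (by linarith) (by linarith))
  have hd1 : d ≤ (T-T0)/2 := min_le_left _ _
  have hd2 : d ≤ a' - a := (min_le_right _ _).trans (min_le_left _ _)
  have hd3 : d ≤ b - b' := (min_le_right _ _).trans (min_le_right _ _)
  set N : ℕ → ℝ := fun k => d / √(l k) with hN
  have hNt : Tendsto N atTop atTop := (tendsto_inv_nhdsGT_zero.comp hst).const_mul_atTop hd0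
  have S := fun k => SP_of D.hp (hl0 k) (hl1 k)
  have hNl : ∀ k, √(l k) * N k = d := fun k => by
    have := (S k).lam0; simp only [hN]; field_simp
  have hNl2 : ∀ k, l k * N k ≤ d := fun k => by
    have h1 := hNl k
    have h2 := (S k).ll
    have h3 := (S k).lam1
    calc l k * N k = √(l k) * (√(l k) * N k) := by rw [← mul_assoc, h2]
      _ = √(l k) * d := by rw [h1]
      _ ≤ 1 * d := mul_le_mul_of_nonneg_right h3 hd0.le
      _ = d := one_mul d
  have htm : ∀ k, ∀ s ∈ Ioo (-N k) (1/2), t (φ k) + l k * s ∈ Ioo T0 T := by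
    intro k s hs
    have h1 := hNl2 k
    have h2 := mul_lt_mul_of_pos_left hs.1 (hl0 k)
    have h3 := mul_lt_mul_of_pos_left hs.2 (hl0 k)
    have h4 := hlδ k
    have h5 := hl0 k
    have h6 : t (φ k) = T - l k := by simp only [hl]; ring
    rw [h6]
    constructor
    · linarith
    · linarith
  have hxm : ∀ k, ∀ y ∈ Ioo (-N k) (N k), x (φ k) + √(l k) * y ∈ Ioo a b := by
    intro k y hy
    have h1 := hNl k
    have h2 := mul_lt_mul_of_pos_left hy.1 (S k).lam0
    have h3 := mul_lt_mul_of_pos_left hy.2 (S k).lam0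
    have := hx (φ k)
    exact ⟨by linarith [this.1], by linarith [this.2]⟩
  have hp := D.hp
  have hp1 : 0 < p - 1 := by linarith
  set K := M * (1/2:ℝ)^(-(1/(p-1))) with hK
  have hK0 : 0 ≤ K := by positivity
  have hbd : ∀ k, ∀ s ∈ Ioo (-N k) (1/2), ∀ y ∈ Ioo (-N k) (N k), rs v ((l k)^(1/(p-1))) (l k) (√(l k)) (t (φ k)) (x (φ k)) s y ≤ K := by
    intro k s hs y hy
    refine (O.rb (hl0 k) (by linarith [hs.2]) (htm k s hs) (hxm k y hy)).trans ?_
    refine mul_le_mul_of_nonneg_left ?_ hM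
    exact Real.rpow_le_rpow_of_nonpos (by norm_num) (by linarith [hs.2]) (by rw [neg_nonpos]; positivity)
  have hK2 : 0 ≤ K^p := Real.rpow_nonneg hK0 _
  have hK3 : 0 ≤ K^(p-1) := Real.rpow_nonneg hK0 _
  have hc := D.c0
  obtain ⟨k, hk⟩ := flat_limit (w := fun k => rs v ((l k)^(1/(p-1))) (l k) (√(l k)) (t (φ k)) (x (φ k)))
    (w1 := fun k => rs v1 ((l k)^(1/(p-1)) * √(l k)) (l k) (√(l k)) (t (φ k)) (x (φ k)))
    (w2 := fun k => rs v2 ((l k)^(1/(p-1)) * l k) (l k) (√(l k)) (t (φ k)) (x (φ k)))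
    (g := fun k => rg G ((l k)^(1/(p-1))) (l k) (√(l k)) (x (φ k))) (N := N) hK0 (H := CG * (1 + K^p)) (by positivity)
    (Λ := CG * (2 + 2 * K^p + 2 * K^(p-1))) (by positivity) D.b0 D.b1 (D.q0 X hXm) hp hNt
    (fun k => D.rgb (S k) hK0 (hxm k)) (fun k => O.resc D (S k) hK0 (htm k) (hxm k) (hbd k))
    (fun k s hs y hy => mul_nonneg (S k).m0.le (O.nn _ (htm k s hs) _ (hxm k y hy)))
    (fun y z hz => rg_lim D hl0 hl1 hlt hxφ hXm y z hz.1) η hη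
  have := hbig (φ k)
  simp only [rs, mul_zero, add_zero, abs_mul, abs_of_pos (S k).m0, abs_of_pos (hl0 k)] at hk
  simp only [hl] at hk
  linarith

end

section

lemma flat_osc {f f1 f2 : ℝ → ℝ} {c R M η : ℝ} (hR : 0 < R) (h1 : ∀ y ∈ Icc (c-R) (c+R), HasDerivAt f (f1 y) y)
    (h2 : ∀ y ∈ Icc (c-R) (c+R), HasDerivAt f1 (f2 y) y) (h3 : ∀ y ∈ Icc (c-R) (c+R), |f2 y| ≤ η)
    (h4 : ∀ y ∈ Icc (c-R) (c+R), f y ∈ Icc 0 M) :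
    ∀ y ∈ Icc (c-R) (c+R), |f y - f c| ≤ (M/R + 2*η*R) * |y-c| := by
  have hc : c ∈ Icc (c-R) (c+R) := ⟨by linarith, by linarith⟩
  have hη : 0 ≤ η := (abs_nonneg _).trans (h3 c hc)
  obtain ⟨ξ, hξ, hs⟩ := exists_hasDerivAt_eq_slope f f1 (show c < c + R by linarith)
    (fun y hy => (h1 y ⟨by linarith [hy.1], hy.2⟩).continuousAt.continuousWithinAt) (fun y hy => h1 y ⟨by linarith [hy.1], hy.2.le⟩)
  have hξ' : ξ ∈ Icc (c-R) (c+R) := ⟨by linarith [hξ.1], hξ.2.le⟩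
  have hf1ξ : |f1 ξ| ≤ M/R := by
    rw [hs, show c + R - c = R by ring, abs_div, abs_of_pos hR]
    refine div_le_div_of_nonneg_right ?_ hR.le
    have e1 := h4 c hc
    have e2 := h4 (c+R) ⟨by linarith, le_rfl⟩
    rw [abs_le]; constructor <;> linarith [e1.1, e1.2, e2.1, e2.2]
  have hf1 : ∀ y ∈ Icc (c-R) (c+R), |f1 y| ≤ M/R + 2*η*R := by
    intro y hy
    have := (convex_Icc (c-R) (c+R)).norm_image_sub_le_of_norm_hasDerivWithin_le (fun x hx => (h2 x hx).hasDerivWithinAt) (C := η)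
      (fun x hx => h3 x hx) hξ' hy
    rw [Real.norm_eq_abs, Real.norm_eq_abs] at this
    have h5 : |y - ξ| ≤ 2*R := by rw [abs_le]; constructor <;> linarith [hy.1, hy.2, hξ'.1, hξ'.2]
    have h6 := mul_le_mul_of_nonneg_left h5 hη
    have := abs_le.1 this
    have := abs_le.1 hf1ξ
    rw [abs_le]; constructor <;> linarith
  intro y hy
  have := (convex_Icc (c-R) (c+R)).norm_image_sub_le_of_norm_hasDerivWithin_le (fun x hx => (h1 x hx).hasDerivWithinAt) (C := M/R + 2*η*R)
      (fun x hx => hf1 x hx) hc hy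
  rwa [Real.norm_eq_abs, Real.norm_eq_abs] at this

lemma jcont_of_lip {u : ℝ → ℝ → ℝ} {t0 t1 x0 x1 C : ℝ}
    (h1 : ∀ s ∈ Ioo t0 t1, ∀ x ∈ Ioo x0 x1, ∀ x' ∈ Ioo x0 x1, |u s x - u s x'| ≤ C * |x-x'|)
    (h2 : ∀ x ∈ Ioo x0 x1, ContinuousOn (fun t => u t x) (Ioo t0 t1)) :
    ContinuousOn (fun q : ℝ × ℝ => u q.1 q.2) (Ioo t0 t1 ×ˢ Ioo x0 x1) := by
  rintro ⟨t, x⟩ ⟨ht, hx⟩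
  simp only at ht hx
  have c1 : ContinuousAt (fun s => u s x) t := (h2 x hx).continuousAt (Ioo_mem_nhds ht.1 ht.2)
  have h0 : Tendsto (fun q : ℝ × ℝ => C * |q.2 - x| + |u q.1 x - u t x|) (nhdsWithin (t,x) (Ioo t0 t1 ×ˢ Ioo x0 x1)) (nhds 0) := by
    have c2 : ContinuousAt (fun q : ℝ × ℝ => u q.1 x) (t,x) := ContinuousAt.comp (f := Prod.fst) (g := fun s => u s x) c1 continuousAt_fst
    have c3 : ContinuousAt (fun q : ℝ × ℝ => C * |q.2 - x| + |u q.1 x - u t x|) (t,x) :=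
      ContinuousAt.add (by fun_prop) (c2.sub continuousAt_const).abs
    have := c3.tendsto
    simp only [sub_self, abs_zero, add_zero, mul_zero] at this
    exact this.mono_left nhdsWithin_le_nhds
  unfold ContinuousWithinAt
  rw [tendsto_iff_dist_tendsto_zero]
  refine squeeze_zero' (Eventually.of_forall fun _ => dist_nonneg) ?_ h0
  filter_upwards [self_mem_nhdsWithin] with q hq
  rw [Real.dist_eq]
  have a1 := h1 q.1 hq.1 q.2 hq.2 x hx
  have a2 := abs_sub_le (u q.1 q.2) (u q.1 x) (u t x)
  linarith

structure RW (w w1 w2 g : ℝ → ℝ → ℝ) (p α β CG M η R : ℝ) : Prop where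
  hp : 1 < p
  hα : α = 1/(p-1)
  b0 : 0 < β
  b1 : β ≤ 1
  c0 : 0 ≤ CG
  hM : 0 ≤ M
  ht : ∀ t ∈ Ioo (-1) 1, ∀ x ∈ Ioo (-R) R, HasDerivAt (fun s => w s x) (w2 t x + g x (w t x)) t
  hx : ∀ t ∈ Ioo (-1) 1, ∀ x ∈ Ioo (-R) R, HasDerivAt (w t) (w1 t x) x
  hxx : ∀ t ∈ Ioo (-1) 1, ∀ x ∈ Ioo (-R) R, HasDerivAt (w1 t) (w2 t x) x
  cxx : ∀ t ∈ Ioo (-1) 1, ContinuousOn (w2 t) (Ioo (-R) R)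
  nn : ∀ t ∈ Ioo (-1) 1, ∀ x ∈ Ioo (-R) R, 0 ≤ w t x
  ub : ∀ t ∈ Ioo (-1) 1, ∀ x ∈ Ioo (-R) R, w t x ≤ M * (1-t)^(-α)
  fl : ∀ t ∈ Ioo (-1) 1, ∀ x ∈ Ioo (-R) R, (1-t)^α * (1-t) * |w2 t x| ≤ η
  gb : ∀ K, 0 ≤ K → GB g (-R) R K (CG * (1 + K^p)) (CG * (2 + 2 * K^p + 2 * K^(p-1))) β
  gu : ∀ y ∈ Ioo (-R) R, ∀ z, 0 ≤ z → g y z ≤ CG * (η + z^p)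
  gl : ∀ y ∈ Ioo (-R) R, ∀ z, 0 ≤ z → -(η * (1 + z^p)) ≤ g y z

variable {w w1 w2 g : ℝ → ℝ → ℝ} {p α β CG M η R : ℝ}

lemma RW.α0 (r : RW w w1 w2 g p α β CG M η R) : 0 < α := by
  rw [r.hα]; have := r.hp; exact one_div_pos.2 (by linarith)

lemma RW.αp (r : RW w w1 w2 g p α β CG M η R) : α * p = α + 1 := by
  rw [r.hα]; have := r.hp; have : p - 1 ≠ 0 := by linarith
  field_simp; ring

lemma RW.ode (r : RW w w1 w2 g p α β CG M η R) {y κ : ℝ} (hy : y ∈ Ioo (-R) R) (hκ0 : 0 ≤ κ) (h0 : w 0 y ≤ κ) (hη : 0 ≤ η)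
    (hκ : -(α*κ) + η + CG*(η + κ^p) < 0) : ∀ s ∈ Ico (0:ℝ) 1, (1-s)^α * w s y ≤ κ := by
  intro s hs
  have hα := r.α0
  have hc := r.c0
  have hd : ∀ σ ∈ Icc 0 s, HasDerivAt (fun σ => (1-σ)^α * w σ y) (-1 * α * (1-σ)^(α-1) * w σ y + (1-σ)^α * (w2 σ y + g y (w σ y))) σ := by
    intro σ hσ
    have h1 : HasDerivAt (fun σ : ℝ => 1 - σ) (-1) σ := by simpa using (hasDerivAt_id σ).const_sub 1
    have h2 := h1.rpow_const (p := α) (Or.inl (by linarith [hσ.2, hs.2]))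
    exact h2.mul (r.ht σ ⟨by linarith [hσ.1], by linarith [hσ.2, hs.2]⟩ y hy)
  refine image_le_of_deriv_right_lt_deriv_boundary (f := fun σ => (1-σ)^α * w σ y) (a := 0) (b := s)
    (f' := fun σ => -1 * α * (1-σ)^(α-1) * w σ y + (1-σ)^α * (w2 σ y + g y (w σ y))) (B := fun _ => κ) (B' := fun _ => 0)
    (fun σ hσ => (hd σ hσ).continuousAt.continuousWithinAt) (fun σ hσ => (hd σ ⟨hσ.1, hσ.2.le⟩).hasDerivWithinAt) ?_ (fun σ => hasDerivAt_const σ κ) ?_ ⟨hs.1, le_rfl⟩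
  · simp only [sub_zero, Real.one_rpow, one_mul]; exact h0
  · intro σ hσ he
    have hσ1 : σ ∈ Ioo (-1:ℝ) 1 := ⟨by linarith [hσ.1], by linarith [hσ.2, hs.2]⟩
    have hx : 0 < 1 - σ := by linarith [hσ1.2]
    set x := 1 - σ with hxd
    have hxα : 0 < x^α := Real.rpow_pos_of_pos hx _
    have hx1 : x ≤ 1 := by linarith [hσ.1]
    have hxα1 : x^α ≤ 1 := Real.rpow_le_one hx.le hx1 hα.le
    have hfl := r.fl σ hσ1 y hy
    have hgu := r.gu y hy (w σ y) (r.nn σ hσ1 y hy)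
    have hw : w σ y = κ / x^α := by field_simp; linarith
    have hwp : x^α * x * (w σ y)^p = κ^p := by
      rw [hw, Real.div_rpow hκ0 hxα.le, ← Real.rpow_mul hx.le, r.αp, Real.rpow_add hx, Real.rpow_one]
      field_simp
    have e1 : x^(α-1) * x = x^α := by
      rw [← Real.rpow_add_one hx.ne']; congr 1; ring
    have hmul : (-1 * α * x^(α-1) * w σ y + x^α * (w2 σ y + g y (w σ y))) * x < 0 := by
      have e2 : (-1 * α * x^(α-1) * w σ y + x^α * (w2 σ y + g y (w σ y))) * x = -(α * (x^(α-1) * x * w σ y)) + x^α * x * w2 σ y + x^α * x * g y (w σ y) := by ring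
      rw [e2, e1, he]
      have i1 : x^α * x * w2 σ y ≤ η := (mul_le_mul_of_nonneg_left (le_abs_self _) (by positivity)).trans hfl
      have i2 := mul_le_mul_of_nonneg_left hgu (by positivity : 0 ≤ x^α * x)
      have i3 : x^α * x * (CG * (η + w σ y ^ p)) = CG * (x^α * x * η + κ^p) := by rw [← hwp]; ring
      have i4 : x^α * x * η ≤ η := mul_le_of_le_one_left hη (mul_le_one₀ hxα1 hx.le hx1)
      have i5 : CG * (x^α * x * η + κ^p) ≤ CG * (η + κ^p) := mul_le_mul_of_nonneg_left (by linarith) hc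
      linarith
    by_contra hneg
    push Not at hneg
    have := mul_nonneg hneg hx.le
    linarith

end

section
variable {w w1 w2 g : ℝ → ℝ → ℝ} {p α β CG M η R : ℝ}

lemma RW.ps (r : RW w w1 w2 g p α β CG M η R) {s1 K : ℝ} (hs1 : s1 < 1) (hK : M * (1-s1)^(-α) ≤ K) :
    PS w w1 w2 (fun t x => g x (w t x)) (-1) s1 (-R) R K (CG * (1 + K^p)) := by
  have hα := r.α0
  have hM := r.hM
  have h1 : 0 < 1 - s1 := by linarith
  have hI : ∀ t ∈ Ioo (-1) s1, t ∈ Ioo (-1:ℝ) 1 := fun t ht => ⟨ht.1, by linarith [ht.2]⟩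
  have hK0 : 0 ≤ K := le_trans (by positivity) hK
  refine PS_of_GB r.b0 (r.gb K hK0) (fun t ht => r.ht t (hI t ht)) (fun t ht => r.hx t (hI t ht)) (fun t ht => r.hxx t (hI t ht))
    (fun t ht => r.cxx t (hI t ht)) ?_
  intro t ht x hx
  refine ⟨r.nn t (hI t ht) x hx, (r.ub t (hI t ht) x hx).trans (le_trans ?_ hK)⟩
  refine mul_le_mul_of_nonneg_left ?_ hM
  exact Real.rpow_le_rpow_of_nonpos h1 (by linarith [ht.2]) (by linarith)

lemma RW.jc (r : RW w w1 w2 g p α β CG M η R) {s1 : ℝ} (hs1 : s1 < 1) :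
    ContinuousOn (fun q : ℝ × ℝ => w q.1 q.2) (Ioo (-1/2) s1 ×ˢ Ioo (-(R-1)) (R-1)) := by
  have hα := r.α0
  have hM := r.hM
  have hc := r.c0
  have h1 : 0 < 1 - s1 := by linarith
  set K := M * (1-s1)^(-α) with hK
  have hK0 : 0 ≤ K := by positivity
  have hK1 : 0 ≤ K^p := Real.rpow_nonneg hK0 _
  have hK2 : 0 ≤ K^(p-1) := Real.rpow_nonneg hK0 _
  obtain ⟨C, hC, hreg⟩ := reg β K (CG * (1 + K^p)) (CG * (2 + 2 * K^p + 2 * K^(p-1))) 1 (1/2) r.b0 r.b1 hK0 (by positivity) (by positivity) one_pos le_rfl (by norm_num) (by norm_num)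
  have P := r.ps hs1 (le_refl K)
  have h2 := (hreg _ _ _ _ _ _ _ _ (r.gb K hK0) P (fun t ht x hx => r.nn t ⟨ht.1, by linarith [ht.2]⟩ x hx)).1
  refine jcont_of_lip (C := C) ?_ ?_
  · intro s hs x hx x' hx'
    exact h2 s ⟨by linarith [hs.1], hs.2⟩ x ⟨by linarith [hx.1], hx.2⟩ x' ⟨by linarith [hx'.1], hx'.2⟩
  · intro x hx
    exact (P.ct x ⟨by linarith [hx.1], by linarith [hx.2]⟩).mono (Ioo_subset_Ioo (by norm_num) le_rfl)

set_option maxHeartbeats 1600000 in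
lemma RW.barrier (r : RW w w1 w2 g p α β CG M η R) (hR : 2 < R) {k e : ℝ} (he0 : 0 < e) (he1 : e ≤ 1) (he : 16*e*(α+1) + 4*e ≤ 1/4)
    (hk0 : 0 < k) (hk1 : CG * k^p ≤ k*α/4) (hη : CG * η < k*α/4 * 2^(-α-1))
    (hi : ∀ y ∈ Icc (-1:ℝ) 1, w 0 y ≤ k * 2^(-α)) (hb1 : ∀ s ∈ Ico (0:ℝ) 1, w s (-1) ≤ k*(1-s)^(-α)) (hb2 : ∀ s ∈ Ico (0:ℝ) 1, w s 1 ≤ k*(1-s)^(-α)) :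
    ∀ s ∈ Ico (0:ℝ) 1, ∀ y ∈ Icc (-1:ℝ) 1, w s y ≤ k * ((1-s) + e*(1-y^2)^2)^(-α) := by
  intro s1 hs1 y1 hy1
  have hα := r.α0
  have hM := r.hM
  have hc := r.c0
  have hs1' : 0 < 1 - s1 := by linarith [hs1.2]
  set K := max (M * (1-s1)^(-α)) (k * (1-s1)^(-α)) with hK
  have hK0 : 0 ≤ K := le_max_of_le_left (by positivity)
  have hK1 : 0 ≤ K^p := Real.rpow_nonneg hK0 _
  have hK2 : 0 ≤ K^(p-1) := Real.rpow_nonneg hK0 _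
  set Λ := CG * (2 + 2 * K^p + 2 * K^(p-1)) with hΛ
  have hΛ0 : 0 ≤ Λ := by positivity
  have hI : ∀ s ∈ Icc 0 s1, s ∈ Ioo (-1:ℝ) 1 := fun s hs => ⟨by linarith [hs.1], by linarith [hs.2, hs1.2]⟩
  have hJ : ∀ y ∈ Icc (-1:ℝ) 1, y ∈ Ioo (-R) R := fun y hy => ⟨by linarith [hy.1], by linarith [hy.2]⟩
  have hθ : ∀ s ∈ Icc 0 s1, ∀ y : ℝ, 1 - s ≤ (1-s) + e*(1-y^2)^2 ∧ 0 < (1-s) + e*(1-y^2)^2 := by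
    intro s hs y
    have : 0 ≤ e*(1-y^2)^2 := by positivity
    exact ⟨by linarith, by linarith [hs.2]⟩
  have hθ2 : ∀ s ∈ Icc 0 s1, ∀ y ∈ Icc (-1:ℝ) 1, (1-s) + e*(1-y^2)^2 ≤ 2 := by
    intro s hs y hy
    have h1 : 0 ≤ 1 - y^2 := by nlinarith [hy.1, hy.2]
    have h2 : (1-y^2)^2 ≤ 1 := by
      have : 1 - y^2 ≤ 1 := by nlinarith [sq_nonneg y]
      exact pow_le_one₀ h1 this
    have h3 : e*(1-y^2)^2 ≤ 1 := mul_le_one₀ he1 (by positivity) h2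
    linarith [hs.1]
  have hds : ∀ s ∈ Icc 0 s1, ∀ y : ℝ, HasDerivAt (fun σ => k * ((1-σ) + e*(1-y^2)^2)^(-α)) (k*α*((1-s) + e*(1-y^2)^2)^(-α-1)) s := by
    intro s hs y
    have h1 : HasDerivAt (fun σ : ℝ => (1-σ) + e*(1-y^2)^2) (-1) s := by
      simpa using ((hasDerivAt_id s).const_sub 1).add_const (e*(1-y^2)^2)
    have h2 := (h1.rpow_const (p := -α) (Or.inl (hθ s hs y).2.ne')).const_mul k
    exact h2.congr_deriv (by ring)
  have hdθ : ∀ s y : ℝ, HasDerivAt (fun y => (1-s) + e*(1-y^2)^2) (-(4*e*(y*(1-y^2)))) y := by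
    intro s y
    have h1 : HasDerivAt (fun y : ℝ => 1 - y^2) (-(2*y)) y := by simpa using ((hasDerivAt_id y).pow 2).const_sub 1
    have h2 := ((h1.pow 2).const_mul e).const_add (1-s)
    exact h2.congr_deriv (by simp; ring)
  have hd1 : ∀ s ∈ Icc 0 s1, ∀ y : ℝ, HasDerivAt (fun y => k * ((1-s) + e*(1-y^2)^2)^(-α)) (k*α*((1-s) + e*(1-y^2)^2)^(-α-1) * (4*e*(y*(1-y^2)))) y := by
    intro s hs y
    have h2 := ((hdθ s y).rpow_const (p := -α) (Or.inl (hθ s hs y).2.ne')).const_mul k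
    exact h2.congr_deriv (by ring)
  have hd2 : ∀ s ∈ Icc 0 s1, ∀ y : ℝ, HasDerivAt (fun y => k*α*((1-s) + e*(1-y^2)^2)^(-α-1) * (4*e*(y*(1-y^2))))
      (k*α*((α+1)*((1-s) + e*(1-y^2)^2)^(-α-1-1) * (4*e*(y*(1-y^2)))^2 + ((1-s) + e*(1-y^2)^2)^(-α-1) * (4*e*(1-3*y^2)))) y := by
    intro s hs y
    have h2 := ((hdθ s y).rpow_const (p := -α-1) (Or.inl (hθ s hs y).2.ne')).const_mul (k*α)
    have h1 : HasDerivAt (fun y : ℝ => 1 - y^2) (-(2*y)) y := by simpa using ((hasDerivAt_id y).pow 2).const_sub 1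
    have h3 := ((hasDerivAt_id y).mul h1).const_mul (4*e)
    exact (h2.mul h3).congr_deriv (by simp only [id_eq, Pi.mul_apply]; ring)
  have hmain := par_min (a := 0) (b := s1) (c := -1) (d := 1)
    (Y := fun s y => Real.exp (-(Λ*s)) * (k * ((1-s) + e*(1-y^2)^2)^(-α) - w s y))
    (Ys := fun s y => Real.exp (-(Λ*s)) * (-Λ) * (k * ((1-s) + e*(1-y^2)^2)^(-α) - w s y) + Real.exp (-(Λ*s)) * (k*α*((1-s) + e*(1-y^2)^2)^(-α-1) - (w2 s y + g y (w s y))))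
    (Y1 := fun s y => Real.exp (-(Λ*s)) * (k*α*((1-s) + e*(1-y^2)^2)^(-α-1) * (4*e*(y*(1-y^2))) - w1 s y))
    (Y2 := fun s y => Real.exp (-(Λ*s)) * (k*α*((α+1)*((1-s) + e*(1-y^2)^2)^(-α-1-1) * (4*e*(y*(1-y^2)))^2 + ((1-s) + e*(1-y^2)^2)^(-α-1) * (4*e*(1-3*y^2))) - w2 s y))
    ?_ ?_ ?_ ?_ ?_ ?_ ?_ ?_ s1 ⟨hs1.1, le_rfl⟩ y1 hy1
  · have := (mul_nonneg_iff_of_pos_left (Real.exp_pos _)).1 hmain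
    linarith
  · refine ContinuousOn.mul (by fun_prop) (ContinuousOn.sub (continuousOn_const.mul ?_) ?_)
    · refine ContinuousOn.rpow_const (by fun_prop) ?_
      intro q hq
      exact Or.inl (hθ q.1 hq.1 q.2).2.ne'
    · refine (r.jc (s1 := (1+s1)/2) (by linarith)).mono ?_
      rintro q ⟨hq1, hq2⟩
      exact ⟨⟨by linarith [hq1.1], by linarith [hq1.2]⟩, ⟨by linarith [hq2.1], by linarith [hq2.2]⟩⟩
  · intro y hy
    refine mul_nonneg (Real.exp_pos _).le (sub_nonneg.2 ((hi y hy).trans (mul_le_mul_of_nonneg_left ?_ hk0.le)))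
    exact Real.rpow_le_rpow_of_nonpos (hθ 0 ⟨le_rfl, hs1.1⟩ y).2 (hθ2 0 ⟨le_rfl, hs1.1⟩ y hy) (by linarith)
  · intro s hs
    refine mul_nonneg (Real.exp_pos _).le (sub_nonneg.2 ((hb1 s ⟨hs.1, by linarith [hs.2]⟩).trans (le_of_eq ?_)))
    norm_num
  · intro s hs
    refine mul_nonneg (Real.exp_pos _).le (sub_nonneg.2 ((hb2 s ⟨hs.1, by linarith [hs.2]⟩).trans (le_of_eq ?_)))
    norm_num
  · intro s hs y hy
    have hs' : s ∈ Icc 0 s1 := ⟨hs.1.le, hs.2⟩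
    have hE : HasDerivAt (fun σ => Real.exp (-(Λ*σ))) (Real.exp (-(Λ*s)) * (-Λ)) s := by
      have := (((hasDerivAt_id s).const_mul Λ).neg).exp
      simpa using this
    exact hE.mul ((hds s hs' y).sub (r.ht s (hI s hs') y (hJ y ⟨hy.1.le, hy.2.le⟩)))
  · intro s hs y hy
    have hs' : s ∈ Icc 0 s1 := ⟨hs.1.le, hs.2⟩
    exact ((hd1 s hs' y).sub (r.hx s (hI s hs') y (hJ y ⟨hy.1.le, hy.2.le⟩))).const_mul _
  · intro s hs y hy
    have hs' : s ∈ Icc 0 s1 := ⟨hs.1.le, hs.2⟩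
    exact ((hd2 s hs' y).sub (r.hxx s (hI s hs') y (hJ y ⟨hy.1.le, hy.2.le⟩))).const_mul _
  · intro s hs y hy hneg hYs _ hY2
    have hs' : s ∈ Icc 0 s1 := ⟨hs.1.le, hs.2⟩
    have hy' : y ∈ Icc (-1:ℝ) 1 := ⟨hy.1.le, hy.2.le⟩
    have hsI := hI s hs'
    have hyJ := hJ y hy'
    have ht0 := (hθ s hs' y).2
    have ht1 := (hθ s hs' y).1
    have ht2 := hθ2 s hs' y hy'
    set θ := (1-s) + e*(1-y^2)^2 with hθd
    set P := θ^(-α-1) with hP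
    set Z := k * θ^(-α) with hZ
    have hP0 : 0 < P := Real.rpow_pos_of_pos ht0 _
    have hZ0 : 0 < Z := mul_pos hk0 (Real.rpow_pos_of_pos ht0 _)
    have hE := Real.exp_pos (-(Λ*s))
    have n1 : Z - w s y < 0 := by
      by_contra h
      push Not at h
      have := mul_nonneg hE.le h
      linarith
    have n2 : k*α*P - (w2 s y + g y (w s y)) - Λ*(Z - w s y) ≤ 0 := by
      have : Real.exp (-(Λ*s)) * (k*α*P - (w2 s y + g y (w s y)) - Λ*(Z - w s y)) ≤ 0 := by
        refine le_trans (le_of_eq ?_) hYs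
        ring
      by_contra h
      push Not at h
      have := mul_pos hE h
      linarith
    have n3 := (mul_nonneg_iff_of_pos_left hE).1 hY2
    have e1 : θ^(-α-1-1) * θ = P := by
      rw [← Real.rpow_add_one ht0.ne']; congr 1; ring
    have e2 : (4*e*(y*(1-y^2)))^2 ≤ 16*e*θ := by
      have i1 : y^2 ≤ 1 := by nlinarith [hy'.1, hy'.2]
      have i2 : e*(1-y^2)^2 ≤ θ := by rw [hθd]; linarith [hs.2]
      have i3 : 0 ≤ e*(1-y^2)^2 := by positivity
      calc (4*e*(y*(1-y^2)))^2 = 16*e*(y^2*(e*(1-y^2)^2)) := by ring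
        _ ≤ 16*e*(1*θ) := by
            refine mul_le_mul_of_nonneg_left ?_ (by positivity)
            exact mul_le_mul i1 i2 i3 (by norm_num)
        _ = 16*e*θ := by ring
    have hT2 : 0 < θ^(-α-1-1) := Real.rpow_pos_of_pos ht0 _
    have e3 : (α+1)*θ^(-α-1-1)*(4*e*(y*(1-y^2)))^2 ≤ (α+1)*(16*e)*P := by
      have := mul_le_mul_of_nonneg_left e2 (by positivity : 0 ≤ (α+1)*θ^(-α-1-1))
      refine this.trans (le_of_eq ?_)
      rw [← e1]; ring
    have e4 : P*(4*e*(1-3*y^2)) ≤ P*(4*e) := by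
      refine mul_le_mul_of_nonneg_left ?_ hP0.le
      nlinarith [sq_nonneg y]
    have e5 : (α+1)*(16*e)*P + P*(4*e) ≤ P*(1/4) := by
      have := mul_le_mul_of_nonneg_left he hP0.le
      linarith
    have hkα : 0 < k*α := by positivity
    have e6 : w2 s y ≤ k*α*(P*(1/4)) := by
      have := mul_le_mul_of_nonneg_left ((add_le_add e3 e4).trans e5) hkα.le
      linarith only [this, n3]
    have hP2 : (2:ℝ)^(-α-1) ≤ P := Real.rpow_le_rpow_of_nonpos ht0 ht2 (by linarith)
    have hwK : w s y ≤ K := by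
      refine (r.ub s hsI y hyJ).trans (le_trans ?_ (le_max_left _ _))
      refine mul_le_mul_of_nonneg_left ?_ hM
      exact Real.rpow_le_rpow_of_nonpos hs1' (by linarith [hs.2]) (by linarith)
    have hL := (r.gb K hK0).lip y hyJ y hyJ (w s y) ⟨r.nn s hsI y hyJ, hwK⟩ Z ⟨hZ0.le, by linarith⟩
    rw [sub_self, abs_zero, Real.zero_rpow r.b0.ne', zero_add, abs_of_pos (by linarith : 0 < w s y - Z)] at hL
    have hL1 := (abs_le.1 hL).2
    have hg := r.gu y hyJ Z hZ0.le
    have hZp : Z^p = k^p * P := by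
      rw [hZ, Real.mul_rpow hk0.le (Real.rpow_nonneg ht0.le _), ← Real.rpow_mul ht0.le, hP]
      congr 2
      have := r.αp
      linarith
    rw [hZp] at hg
    have i1 := mul_le_mul_of_nonneg_right hk1 hP0.le
    have i2 : k*α/4*2^(-α-1) ≤ k*α/4*P := mul_le_mul_of_nonneg_left hP2 (by positivity)
    linarith only [n2, hL1, hg, e6, i1, i2, hη, mul_pos hkα hP0]

end

section

lemma small_tau {C ε β : ℝ} (hβ : 0 < β) (hε : 0 < ε) : ∃ τ : ℝ, 0 < τ ∧ τ < 1/2 ∧ C * τ^(β/2) ≤ ε := by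
  have h1 : Tendsto (fun τ : ℝ => C * τ^(β/2)) (nhdsWithin 0 (Ioi 0)) (nhds 0) := by
    have : ContinuousAt (fun τ : ℝ => C * τ^(β/2)) 0 := by
      refine continuousAt_const.mul (Real.continuousAt_rpow_const _ _ (Or.inr (by positivity)))
    have h := this.tendsto
    rw [Real.zero_rpow (by positivity), mul_zero] at h
    exact h.mono_left nhdsWithin_le_nhds
  have h2 := h1.eventually_le_const hε
  obtain ⟨τ, h3, h4⟩ := (h2.and (Ioo_mem_nhdsGT (show (0:ℝ) < 1/2 by norm_num))).exists
  exact ⟨τ, h4.1, h4.2, h3⟩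

set_option maxHeartbeats 2000000 in
lemma core (p α β CG M : ℝ) (hp : 1 < p) (hα : α = 1/(p-1)) (b0 : 0 < β) (b1 : β ≤ 1) (c0 : 0 ≤ CG) (hM : 0 ≤ M) :
    ∃ k0 > 0, ∀ ε > 0, ∃ η > 0, ∃ R > 0, ∀ w w1 w2 g : ℝ → ℝ → ℝ, RW w w1 w2 g p α β CG M η R → w 0 0 ≤ k0 →
      (∀ s ∈ Ico (0:ℝ) 1, |w2 s 0| ≤ ε) ∧ (w 0 0 = k0 → 4*ε ≤ k0 → ∀ s ∈ Ico (0:ℝ) 1, k0/2 ≤ w s 0) := by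
  have hp1 : 0 < p - 1 := by linarith
  have α0 : 0 < α := by rw [hα]; positivity
  have hαp : α * (p-1) = 1 := by rw [hα]; field_simp
  set B := α/(4*(CG+1)) with hB
  have hB0 : 0 < B := by positivity
  set k := B^α with hk
  have hk0 : 0 < k := Real.rpow_pos_of_pos hB0 _
  have hkp : k^p = k * B := by
    have h1 := Real.rpow_add hk0 1 (p-1)
    rw [show 1 + (p-1) = p by ring, Real.rpow_one] at h1
    rw [h1]
    congr 1
    rw [hk, ← Real.rpow_mul hB0.le, hαp, Real.rpow_one]
  have hk1 : CG * k^p ≤ k*α/4 := by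
    rw [hkp]
    have : CG * B ≤ α/4 := by
      rw [hB, mul_div_assoc', div_le_div_iff₀ (by positivity) (by norm_num)]
      have := mul_nonneg c0 α0.le
      linarith
    have := mul_le_mul_of_nonneg_left this hk0.le
    linarith
  have h2α : (0:ℝ) < 2^(-α) := Real.rpow_pos_of_pos (by norm_num) _
  have h2α1 : (2:ℝ)^(-α) ≤ 1 := Real.rpow_le_one_of_one_le_of_nonpos (by norm_num) (by linarith)
  have h2β : (0:ℝ) < 2^(-α-1) := Real.rpow_pos_of_pos (by norm_num) _
  have h2β1 : (2:ℝ)^(-α-1) ≤ 1 := Real.rpow_le_one_of_one_le_of_nonpos (by norm_num) (by linarith)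
  set k0 := k * 2^(-α) / 4 with hk0d
  have hk00 : 0 < k0 := by positivity
  refine ⟨k0, hk00, ?_⟩
  intro ε hε
  set e := 1/(4*(16*(α+1)+4)) with he
  have he0 : 0 < e := by positivity
  have he1 : e ≤ 1 := by rw [he, div_le_one (by positivity)]; linarith
  have hee : 16*e*(α+1) + 4*e ≤ 1/4 := by
    have : e*(16*(α+1)+4) = 1/4 := by rw [he]; field_simp
    linarith
  have hE : 0 < (e*(9/16))^(-α) := Real.rpow_pos_of_pos (by positivity) _
  set K := max M (k * (e*(9/16))^(-α)) with hK
  have hK0 : 0 ≤ K := le_max_of_le_left hM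
  have hK1 : 0 ≤ K^p := Real.rpow_nonneg hK0 _
  have hK2 : 0 ≤ K^(p-1) := Real.rpow_nonneg hK0 _
  obtain ⟨C, hC, hreg⟩ := reg β K (CG * (1 + K^p)) (CG * (2 + 2 * K^p + 2 * K^(p-1))) (1/8) (1/4) b0 b1 hK0 (by positivity) (by positivity) (by norm_num) (by norm_num) (by norm_num) (by norm_num)
  obtain ⟨τ, hτ, hτ1, hτ2⟩ := small_tau (C := C) b0 (half_pos hε)
  set ν := min (ε*τ/(2*C)) k0 with hν
  have hν0 : 0 < ν := lt_min (by positivity) hk00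
  have hνk : ν ≤ k0 := min_le_right _ _
  have hCν : C * (ν/τ) ≤ ε/2 := by
    have : ν ≤ ε*τ/(2*C) := min_le_left _ _
    rw [le_div_iff₀ (by positivity)] at this
    rw [mul_div_assoc', div_le_div_iff₀ hτ (by norm_num)]
    linarith
  have hτα : 0 < τ^(-α) := Real.rpow_pos_of_pos hτ _
  have hτα1 : 1 ≤ τ^(-α) := Real.one_le_rpow_of_pos_of_le_one_of_nonpos hτ (by linarith) (by linarith)
  have hτβ : 0 < τ^α := Real.rpow_pos_of_pos hτ _
  have hτβ1 : τ^α ≤ 1 := Real.rpow_le_one hτ.le (by linarith) α0.le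
  set M' := M * τ^(-α) with hM'
  have hM'0 : 0 ≤ M' := by positivity
  have hMM' : M ≤ M' := le_mul_of_one_le_right hM hτα1
  set R' := 2 + 2*M'/ν with hR'
  have hR'0 : 2 ≤ R' := by have : 0 ≤ 2*M'/ν := by positivity
                           linarith
  have hMR : M'/R' ≤ ν/2 := by
    rw [div_le_div_iff₀ (by linarith) (by norm_num)]
    have : ν * R' = 2*ν + 2*M' := by rw [hR']; field_simp
    linarith
  set η := min (ν*(τ^α*τ)/(4*R')) (min (ε/(1+K^p)) (k*α/4*2^(-α-1)/(2*(1+CG)))) with hη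
  have hη0 : 0 < η := lt_min (by positivity) (lt_min (by positivity) (by positivity))
  have hη1 : η * (4*R') ≤ ν*(τ^α*τ) := by
    rw [← le_div_iff₀ (by linarith)]; exact min_le_left _ _
  have hη2 : η * (1+K^p) ≤ ε := by
    rw [← le_div_iff₀ (by linarith)]; exact (min_le_right _ _).trans (min_le_left _ _)
  have hη3 : η * (2*(1+CG)) ≤ k*α/4*2^(-α-1) := by
    rw [← le_div_iff₀ (by linarith)]; exact (min_le_right _ _).trans (min_le_right _ _)
  have hCη : 0 ≤ CG*η := by positivity
  refine ⟨η, hη0, R'+1, by linarith, ?_⟩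
  intro w w1 w2 g r hw00
  have hJ : ∀ y ∈ Icc (0-R') (0+R'), y ∈ Ioo (-(R'+1)) (R'+1) := fun y hy => ⟨by linarith [hy.1], by linarith [hy.2]⟩
  -- flatness
  have hflat : ∀ s ∈ Ioc (-1:ℝ) (1-τ), s ≠ -1 → ∀ y : ℝ, |y| ≤ 1 → |w s y - w s 0| ≤ ν := by
    intro s hs _ y hy
    have hs1 : s ∈ Ioo (-1:ℝ) 1 := ⟨hs.1, by linarith [hs.2]⟩
    have hx : τ ≤ 1 - s := by linarith [hs.2]
    have hxα : τ^α ≤ (1-s)^α := Real.rpow_le_rpow hτ.le hx α0.le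
    have h1 := flat_osc (f := w s) (f1 := w1 s) (f2 := w2 s) (c := 0) (R := R') (M := M') (η := η/(τ^α*τ)) (by linarith)
      (fun y hy => r.hx s hs1 y (hJ y hy)) (fun y hy => r.hxx s hs1 y (hJ y hy)) (fun y hy => by
        rw [le_div_iff₀ (by positivity)]
        refine le_trans ?_ (r.fl s hs1 y (hJ y hy))
        rw [mul_comm]
        exact mul_le_mul_of_nonneg_right (mul_le_mul hxα hx hτ.le (by linarith)) (abs_nonneg _))
      (fun y hy => ⟨r.nn s hs1 y (hJ y hy), (r.ub s hs1 y (hJ y hy)).trans (mul_le_mul_of_nonneg_left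
        (Real.rpow_le_rpow_of_nonpos hτ hx (by linarith)) hM)⟩) y (by have := abs_le.1 hy; exact ⟨by linarith [this.1], by linarith [this.2]⟩)
    rw [sub_zero] at h1
    have h2 : 2*(η/(τ^α*τ))*R' ≤ ν/2 := by
      rw [show 2*(η/(τ^α*τ))*R' = (2*η*R')/(τ^α*τ) by ring, div_le_div_iff₀ (by positivity) (by norm_num)]
      linarith
    have h3 : 0 ≤ M'/R' + 2*(η/(τ^α*τ))*R' := by positivity
    refine h1.trans ((mul_le_of_le_one_right h3 hy).trans (by linarith))
  have hw0 : ∀ y : ℝ, |y| ≤ 1 → w 0 y ≤ 2*k0 := by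
    intro y hy
    have := (abs_le.1 (hflat 0 ⟨by norm_num, by linarith⟩ (by norm_num) y hy)).2
    linarith
  have h2k : 2*k0 ≤ k := by
    have := mul_le_mul_of_nonneg_left h2α1 hk0.le
    rw [hk0d]; linarith
  have hode : ∀ y : ℝ, |y| ≤ 1 → ∀ s ∈ Ico (0:ℝ) 1, w s y ≤ k*(1-s)^(-α) := by
    intro y hy s hs
    have hyR : y ∈ Ioo (-(R'+1)) (R'+1) := by have := abs_le.1 hy; exact ⟨by linarith [this.1], by linarith [this.2]⟩
    have hkα : 0 < k*α := by positivity
    have h5 : k*α/4*2^(-α-1) ≤ k*α/4 := mul_le_of_le_one_right (by positivity) h2β1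
    have := r.ode hyR hk0.le ((hw0 y hy).trans h2k) hη0.le (by linarith) s hs
    have hx : 0 < 1 - s := by linarith [hs.2]
    rw [Real.rpow_neg hx.le, ← div_eq_mul_inv, le_div_iff₀ (Real.rpow_pos_of_pos hx _)]
    linarith
  have hbar := r.barrier (by linarith) he0 he1 hee hk0 hk1 (by linarith)
    (fun y hy => (hw0 y (abs_le.2 hy)).trans (by rw [hk0d]; nlinarith)) (hode (-1) (by norm_num)) (hode 1 (by norm_num))
  have hbd : ∀ s ∈ Ioo (-1:ℝ) 1, ∀ y ∈ Ioo (-(1/2):ℝ) (1/2), w s y ∈ Icc 0 K := by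
    intro s hs y hy
    have hyR : y ∈ Ioo (-(R'+1)) (R'+1) := ⟨by linarith [hy.1], by linarith [hy.2]⟩
    refine ⟨r.nn s hs y hyR, ?_⟩
    rcases le_total 0 s with h | h
    · refine (hbar s ⟨h, hs.2⟩ y ⟨by linarith [hy.1], by linarith [hy.2]⟩).trans (le_trans ?_ (le_max_right _ _))
      refine mul_le_mul_of_nonneg_left ?_ hk0.le
      refine Real.rpow_le_rpow_of_nonpos (by positivity) ?_ (by linarith)
      have h1 : y^2 ≤ 1/4 := by nlinarith [hy.1, hy.2]
      have h2 : (9/16:ℝ) ≤ (1-y^2)^2 := by nlinarith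
      have := mul_le_mul_of_nonneg_left h2 he0.le
      linarith [hs.2]
    · refine (r.ub s hs y hyR).trans (le_trans ?_ (le_max_left _ _))
      exact mul_le_of_le_one_right hM (Real.rpow_le_one_of_one_le_of_nonpos (by linarith) (by linarith))
  have hsub : ∀ y ∈ Ioo (-(1/2):ℝ) (1/2), y ∈ Ioo (-(R'+1)) (R'+1) := fun y hy => ⟨by linarith [hy.1], by linarith [hy.2]⟩
  have hGB := (r.gb K hK0).mono (a' := -(1/2)) (b' := 1/2) (by linarith) (by linarith)
  have hPS : PS w w1 w2 (fun t x => g x (w t x)) (-1) 1 (-(1/2)) (1/2) K (CG * (1 + K^p)) :=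
    PS_of_GB b0 hGB (fun t ht x hx => r.ht t ht x (hsub x hx)) (fun t ht x hx => r.hx t ht x (hsub x hx)) (fun t ht x hx => r.hxx t ht x (hsub x hx))
      (fun t ht => (r.cxx t ht).mono hsub) hbd
  have hr2 := (hreg _ _ _ _ _ _ _ _ hGB hPS (fun t ht x hx => (hbd t ht x hx).1)).2.1
  have hfin : ∀ s ∈ Ico (0:ℝ) 1, |w2 s 0| ≤ ε := by
    intro s hs
    have h1 := hr2 s τ 0 ν hτ (by linarith) (by linarith [hs.1]) hs.2 ⟨by norm_num, by norm_num⟩ (by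
      intro y hy
      rw [zero_sub, abs_neg] at hy
      exact hflat (s-τ) ⟨by linarith [hs.1], by linarith [hs.2]⟩ (by linarith [hs.1]) y (by linarith))
    rw [mul_add] at h1
    linarith
  refine ⟨hfin, ?_⟩
  intro hw0k hεk s hs
  rcases eq_or_lt_of_le hs.1 with h | h
  · rw [← h, hw0k]; linarith
  · have h0 : (0:ℝ) ∈ Ioo (-(1/2):ℝ) (1/2) := ⟨by norm_num, by norm_num⟩
    have hd : ∀ σ ∈ Icc 0 s, HasDerivAt (fun t => w t 0) (w2 σ 0 + g 0 (w σ 0)) σ := fun σ hσ => r.ht σ ⟨by linarith [hσ.1], by linarith [hσ.2, hs.2]⟩ 0 (hsub 0 h0)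
    obtain ⟨ξ, hξ, hsl⟩ := exists_hasDerivAt_eq_slope (fun t => w t 0) (fun σ => w2 σ 0 + g 0 (w σ 0)) h
      (fun σ hσ => (hd σ hσ).continuousAt.continuousWithinAt) (fun σ hσ => hd σ ⟨hσ.1.le, hσ.2.le⟩)
    have hξ1 : ξ < 1 := by linarith [hξ.2, hs.2]
    have i1 := (abs_le.1 (hfin ξ ⟨hξ.1.le, hξ1⟩)).1
    have hbξ := hbd ξ ⟨by linarith [hξ.1], hξ1⟩ 0 h0
    have i2 := r.gl 0 (hsub 0 h0) (w ξ 0) hbξ.1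
    have i3 : (w ξ 0)^p ≤ K^p := Real.rpow_le_rpow hbξ.1 hbξ.2 (by linarith)
    have i4 : η * (1 + (w ξ 0)^p) ≤ η * (1 + K^p) := mul_le_mul_of_nonneg_left (by linarith) hη0.le
    have i5 : -(2*ε) ≤ (w s 0 - w 0 0)/(s-0) := by rw [← hsl]; linarith
    rw [sub_zero, le_div_iff₀ h, hw0k] at i5
    have i6 : 2*ε*s ≤ 2*ε*1 := mul_le_mul_of_nonneg_left hs.2.le (by linarith)
    linarith

end

section
variable {v v1 v2 G : ℝ → ℝ → ℝ} {q : ℝ → ℝ} {a b p β CG T0 T M : ℝ}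

lemma OD.stepA (O : OD v v1 v2 G T0 T a b p M) (D : GD G q a b p β CG) (hM : 0 ≤ M) {T1 T2 a' b' : ℝ}
    (h1 : T0 < T1) (h2 : T2 < T) (ha : a < a') (hb : b' < b) :
    ∃ C > 0, ∀ t ∈ Ico T1 T2, ∀ x ∈ Icc a' b', |v2 t x| ≤ C := by
  have hp := D.hp
  have hc := D.c0
  have hα : 0 < 1/(p-1) := one_div_pos.2 (by linarith)
  have hT2 : 0 < T - T2 := by linarith
  set K := M * (T-T2)^(-(1/(p-1))) with hK
  have hK0 : 0 ≤ K := mul_nonneg hM (Real.rpow_nonneg hT2.le _)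
  have hK1 : 0 ≤ K^p := Real.rpow_nonneg hK0 _
  have hK2 : 0 ≤ K^(p-1) := Real.rpow_nonneg hK0 _
  set τ0 := min ((T1-T0)/4) (1/2) with hτ
  have hτ0 : 0 < τ0 := lt_min (by linarith) (by norm_num)
  have hτ1 : τ0 ≤ (T1-T0)/4 := min_le_left _ _
  have hτ2 : τ0 ≤ 1/2 := min_le_right _ _
  set ρ := min 1 (min ((a'-a)/4) ((b-b')/4)) with hρ
  have hρ0 : 0 < ρ := lt_min one_pos (lt_min (by linarith) (by linarith))
  have hρ1 : ρ ≤ 1 := min_le_left _ _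
  have hρ2 : ρ ≤ (a'-a)/4 := (min_le_right _ _).trans (min_le_left _ _)
  have hρ3 : ρ ≤ (b-b')/4 := (min_le_right _ _).trans (min_le_right _ _)
  obtain ⟨C, hC, hreg⟩ := reg β K (CG * (1 + K^p)) (CG * (2 + 2 * K^p + 2 * K^(p-1))) ρ τ0 D.b0 D.b1 hK0 (by positivity) (by positivity) hρ0 hρ1 hτ0 (by linarith)
  refine ⟨C, hC, ?_⟩
  have S : SP 1 1 1 p := ⟨one_pos, le_rfl, one_pos, le_rfl, one_pos, le_rfl, by norm_num, by simp, by simp⟩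
  have hGB : GB G a b K (CG * (1 + K^p)) (CG * (2 + 2 * K^p + 2 * K^(p-1))) β := by
    have h := D.rgb (xc := 0) (x0 := a) (x1 := b) S hK0 (fun y hy => by simpa using hy)
    have e : rg G 1 1 1 0 = G := by
      funext y z
      simp [rg]
    rwa [e] at h
  have hI : ∀ t ∈ Ioo T0 T2, t ∈ Ioo T0 T := fun t ht => ⟨ht.1, by linarith [ht.2]⟩
  have hPS : PS v v1 v2 (fun t x => G x (v t x)) T0 T2 a b K (CG * (1 + K^p)) := by
    refine PS_of_GB D.b0 hGB (fun t ht => O.vt t (hI t ht)) (fun t ht => O.vx t (hI t ht)) (fun t ht => O.vxx t (hI t ht)) (fun t ht => O.cxx t (hI t ht)) ?_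
    intro t ht x hx
    refine ⟨O.nn t (hI t ht) x hx, (O.ub t (hI t ht) x hx).trans (mul_le_mul_of_nonneg_left ?_ hM)⟩
    exact Real.rpow_le_rpow_of_nonpos hT2 (by linarith [ht.2]) (by linarith)
  have h3 := (hreg _ _ _ _ _ _ _ _ hGB hPS (fun t ht => O.nn t (hI t ht))).2.2
  intro t ht x hx
  exact h3 t ⟨by linarith [ht.1], ht.2⟩ x ⟨by linarith [hx.1], by linarith [hx.2]⟩

lemma OD.toRW (O : OD v v1 v2 G T0 T a b p M) (D : GD G q a b p β CG) (hM : 0 ≤ M) {η R a' b' t' Cη xc tc : ℝ}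
    (hη : 0 < η) (ha : a < a') (hb : b' < b) (ht' : T0 < t')
    (fl : ∀ t ∈ Ico t' T, ∀ x ∈ Icc a' b', (T-t)^(1/(p-1)) * (T-t) * |v2 t x| ≤ η)
    (hg : ∀ x ∈ Ioo a b, ∀ z, 0 ≤ z → |G x z - q x * z^p| ≤ η * z^p + Cη) (hC : 0 ≤ Cη)
    (htc : tc < T) (h1 : T - tc ≤ 1) (h2 : 2*(T-tc) ≤ T - t') (h3 : T - tc ≤ η) (h4 : Cη*(T-tc) ≤ η)
    (hx : ∀ y ∈ Ioo (-R) R, xc + √(T-tc) * y ∈ Icc a' b') :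
    RW (rs v ((T-tc)^(1/(p-1))) (T-tc) √(T-tc) tc xc) (rs v1 ((T-tc)^(1/(p-1)) * √(T-tc)) (T-tc) √(T-tc) tc xc)
      (rs v2 ((T-tc)^(1/(p-1)) * (T-tc)) (T-tc) √(T-tc) tc xc) (rg G ((T-tc)^(1/(p-1))) (T-tc) √(T-tc) xc) p (1/(p-1)) β CG M η R := by
  have hl : 0 < T - tc := by linarith
  have S := SP_of D.hp hl h1
  have hts : ∀ s ∈ Ioo (-1:ℝ) 1, tc + (T-tc)*s ∈ Ico t' T := by
    intro s hs
    have i1 := mul_lt_mul_of_pos_left hs.1 hl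
    have i2 := mul_lt_mul_of_pos_left hs.2 hl
    exact ⟨by linarith, by linarith⟩
  have hts' : ∀ s ∈ Ioo (-1:ℝ) 1, tc + (T-tc)*s ∈ Ioo T0 T := fun s hs => ⟨by linarith [(hts s hs).1], (hts s hs).2⟩
  have hx' : ∀ y ∈ Ioo (-R) R, xc + √(T-tc) * y ∈ Ioo a b := fun y hy => ⟨by linarith [(hx y hy).1], by linarith [(hx y hy).2]⟩
  have hcg := D.c0
  have hm := S.m0
  have hm1 := S.m1
  have hb' : ∀ s1 < (1:ℝ), PS _ _ _ _ _ _ _ _ _ _ := fun s1 hs1 => O.resc D S (t0 := -1) (t1 := s1) (x0 := -R) (x1 := R) (K := M * (1-s1)^(-(1/(p-1))))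
    (mul_nonneg hM (Real.rpow_nonneg (by linarith) _)) (fun s hs => hts' s ⟨hs.1, by linarith [hs.2]⟩) hx' (fun s hs y hy => by
      refine (O.rb hl (by linarith [hs.2]) (hts' s ⟨hs.1, by linarith [hs.2]⟩) (hx' y hy)).trans (mul_le_mul_of_nonneg_left ?_ hM)
      have : 0 < 1/(p-1) := one_div_pos.2 (by linarith [D.hp])
      exact Real.rpow_le_rpow_of_nonpos (by linarith) (by linarith [hs.2]) (by linarith))
  have hmid : ∀ s ∈ Ioo (-1:ℝ) 1, s ∈ Ioo (-1:ℝ) ((1+s)/2) ∧ (1+s)/2 < 1 := fun s hs => ⟨⟨hs.1, by linarith [hs.2]⟩, by linarith [hs.2]⟩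
  set m := (T-tc)^(1/(p-1)) with hmd
  have hml : m * (T-tc) ≤ T - tc := mul_le_of_le_one_left hl.le hm1
  have hml0 : 0 < m * (T-tc) := mul_pos hm hl
  refine ⟨D.hp, rfl, D.b0, D.b1, D.c0, hM, fun s hs => (hb' _ (hmid s hs).2).ht s (hmid s hs).1, fun s hs => (hb' _ (hmid s hs).2).hx s (hmid s hs).1,
    fun s hs => (hb' _ (hmid s hs).2).hxx s (hmid s hs).1, fun s hs => (hb' _ (hmid s hs).2).cxx s (hmid s hs).1, ?_, ?_, ?_, ?_, ?_, ?_⟩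
  · intro s hs y hy
    exact mul_nonneg hm.le (O.nn _ (hts' s hs) _ (hx' y hy))
  · intro s hs y hy
    exact O.rb hl hs.2 (hts' s hs) (hx' y hy)
  · intro s hs y hy
    have h := fl _ (hts s hs) _ (hx y hy)
    have h1s : 0 < 1 - s := by linarith [hs.2]
    rw [show T - (tc + (T-tc)*s) = (T-tc)*(1-s) by ring, Real.mul_rpow hl.le h1s.le] at h
    unfold rs
    rw [abs_mul, abs_of_pos hml0]
    refine le_trans (le_of_eq ?_) h
    rw [← hmd]; ring
  · intro K hK
    exact D.rgb S hK hx'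
  · intro y hy z hz
    have h := D.g1 _ (hx' y hy) (z/m) (div_nonneg hz hm.le)
    have h' := mul_le_mul_of_nonneg_left ((le_abs_self _).trans h) hml0.le
    unfold rg
    refine h'.trans ?_
    have e : m*(T-tc)*(CG*(1+(z/m)^p)) = CG*(m*(T-tc) + z^p) := by rw [← S.zp hz]; ring
    rw [e]
    exact mul_le_mul_of_nonneg_left (by linarith) hcg
  · intro y hy z hz
    have h := (abs_le.1 (hg _ (hx' y hy) (z/m) (div_nonneg hz hm.le))).1
    have hq := mul_nonneg (D.q0 _ (hx' y hy)) (Real.rpow_nonneg (div_nonneg hz hm.le) p)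
    have h' := mul_le_mul_of_nonneg_left (show -(η*(z/m)^p + Cη) ≤ G (xc + √(T-tc)*y) (z/m) by linarith) hml0.le
    unfold rg
    refine le_trans ?_ h'
    have e : m*(T-tc)*(-(η*(z/m)^p + Cη)) = -(η*z^p + Cη*(m*(T-tc))) := by rw [← S.zp hz]; ring
    rw [e]
    have := mul_le_mul_of_nonneg_left hml hC
    linarith

lemma fin_div {m l A ε V B p : ℝ} (hm : 0 < m) (hl : 0 < l) (mp : m^p = m*l) (hV : 0 ≤ V) (hε : 0 ≤ ε) (hB : 0 ≤ B) (hp : 0 < p)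
    (h1 : m*l*A ≤ ε*B^p) (h2 : B ≤ m*V) : A ≤ ε*V^p := by
  have h3 : B^p ≤ m*l*V^p := by
    rw [← mp, ← Real.mul_rpow hm.le hV]
    exact Real.rpow_le_rpow hB h2 hp.le
  have h4 := mul_le_mul_of_nonneg_left h3 hε
  have h5 : m*l*A ≤ m*l*(ε*V^p) := by linarith
  exact le_of_mul_le_mul_left h5 (mul_pos hm hl)

set_option maxHeartbeats 1000000 in
lemma main1d (O : OD v v1 v2 G T0 T a b p M) (D : GD G q a b p β CG) (hM : 0 ≤ M) {T1 a' b' : ℝ}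
    (hT1 : T0 < T1) (hT : T1 < T) (ha : a < a') (hb : b' < b) :
    ∀ ε > 0, ∃ C > 0, ∀ t ∈ Ico T1 T, ∀ x ∈ Icc a' b', |v2 t x| ≤ ε * (v t x)^p + C := by
  intro ε hε
  have hp := D.hp
  obtain ⟨k0, hk0, hcore⟩ := core p (1/(p-1)) β CG M hp rfl D.b0 D.b1 D.c0 hM
  have hkp : 0 < k0^p := Real.rpow_pos_of_pos hk0 _
  have hkp2 : 0 < (k0/2)^p := Real.rpow_pos_of_pos (by linarith) _
  set ε1 := min (k0/4) (ε*(k0/2)^p) with hε1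
  have hε10 : 0 < ε1 := lt_min (by linarith) (by positivity)
  have hε11 : 4*ε1 ≤ k0 := by have := min_le_left (k0/4) (ε*(k0/2)^p); linarith
  have hε12 : ε1 ≤ ε*(k0/2)^p := min_le_right _ _
  obtain ⟨η, hη, R, hR, hc⟩ := hcore ε1 hε10
  obtain ⟨t', ht', hfl⟩ := flatE O D hM (hT1.trans hT) (a' := (a+a')/2) (b' := (b+b')/2) (by linarith) (by linarith) (min η (ε*k0^p)) (lt_min hη (by positivity))
  obtain ⟨Cη, hCη, hg⟩ := D.g3 η hη
  set ρ0 := min ((a'-a)/2) ((b-b')/2) with hρ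
  have hρ0 : 0 < ρ0 := lt_min (by linarith) (by linarith)
  have hρ1 : ρ0 ≤ (a'-a)/2 := min_le_left _ _
  have hρ2 : ρ0 ≤ (b-b')/2 := min_le_right _ _
  obtain ⟨δ, hδ0, hδ1, hδ2, hδ3, hδ4, hδ5⟩ : ∃ δ > 0, δ ≤ 1 ∧ 2*δ ≤ T - t' ∧ δ ≤ η ∧ Cη*δ ≤ η ∧ √δ * R ≤ ρ0 := by
    refine ⟨min (min 1 ((T-t')/2)) (min (min η (η/(Cη+1))) ((ρ0/R)^2)), ?_, ?_, ?_, ?_, ?_, ?_⟩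
    · have := ht'.2
      exact lt_min (lt_min one_pos (by linarith)) (lt_min (lt_min hη (by positivity)) (by positivity))
    · exact (min_le_left _ _).trans (min_le_left _ _)
    · have := (min_le_left (min 1 ((T-t')/2)) (min (min η (η/(Cη+1))) ((ρ0/R)^2))).trans (min_le_right _ _)
      linarith
    · exact (min_le_right _ _).trans ((min_le_left _ _).trans (min_le_left _ _))
    · have := (min_le_right (min 1 ((T-t')/2)) (min (min η (η/(Cη+1))) ((ρ0/R)^2))).trans ((min_le_left _ _).trans (min_le_right _ _))
      refine (mul_le_mul_of_nonneg_left this hCη).trans ?_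
      rw [mul_div_assoc', div_le_iff₀ (by linarith)]
      linarith
    · have := (min_le_right (min 1 ((T-t')/2)) (min (min η (η/(Cη+1))) ((ρ0/R)^2))).trans (min_le_right _ _)
      have h := Real.sqrt_le_sqrt this
      rw [Real.sqrt_sq (by positivity), le_div_iff₀ hR] at h
      exact h
  have key : ∀ tc ∈ Ico (T-δ) T, ∀ x ∈ Icc a' b', (T-tc)^(1/(p-1)) * v tc x ≤ k0 → ∀ t ∈ Ico tc T,
      (T-tc)^(1/(p-1)) * (T-tc) * |v2 t x| ≤ ε1 ∧ ((T-tc)^(1/(p-1)) * v tc x = k0 → k0/2 ≤ (T-tc)^(1/(p-1)) * v t x) := by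
    intro tc htc x hx hk t ht
    have hl : 0 < T - tc := by linarith [htc.2]
    have hlδ : T - tc ≤ δ := by linarith [htc.1]
    have hrw := O.toRW D hM (η := η) (R := R) (a' := (a+a')/2) (b' := (b+b')/2) (t' := t') (Cη := Cη) (xc := x) (tc := tc) hη (by linarith) (by linarith) ht'.1
      (fun t ht x hx => (hfl t ht x hx).trans (min_le_left _ _)) hg hCη htc.2 (by linarith) (by linarith) (by linarith)
      ((mul_le_mul_of_nonneg_left hlδ hCη).trans hδ4) (fun y hy => by
        have i0 : √(T-tc) * |y| ≤ √δ * R := mul_le_mul (Real.sqrt_le_sqrt hlδ) (abs_le.2 ⟨hy.1.le, hy.2.le⟩) (abs_nonneg _) (Real.sqrt_nonneg _)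
        rw [← abs_of_nonneg (Real.sqrt_nonneg (T-tc)), ← abs_mul] at i0
        have i1 := abs_le.1 (i0.trans hδ5)
        exact ⟨by linarith [hx.1, i1.1], by linarith [hx.2, i1.2]⟩)
    have hs : (t-tc)/(T-tc) ∈ Ico (0:ℝ) 1 := ⟨div_nonneg (by linarith [ht.1]) hl.le, by rw [div_lt_one hl]; linarith [ht.2]⟩
    have e1 : tc + (T-tc)*((t-tc)/(T-tc)) = t := by field_simp; ring
    have e0 : rs v ((T-tc)^(1/(p-1))) (T-tc) √(T-tc) tc x 0 0 = (T-tc)^(1/(p-1)) * v tc x := by simp [rs]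
    have hcc := hc _ _ _ _ hrw (by rw [e0]; exact hk)
    have hml0 : 0 < (T-tc)^(1/(p-1)) * (T-tc) := mul_pos (Real.rpow_pos_of_pos hl _) hl
    constructor
    · have h := hcc.1 _ hs
      unfold rs at h
      rw [e1, mul_zero, add_zero, abs_mul, abs_of_pos hml0] at h
      exact h
    · intro heq
      have h := hcc.2 (by rw [e0]; exact heq) hε11 _ hs
      unfold rs at h
      rw [e1, mul_zero, add_zero] at h
      exact h
  obtain ⟨CA, hCA, hA⟩ := O.stepA D hM (T1 := T1) (T2 := T-δ) hT1 (by linarith) ha hb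
  have hδm : 0 < δ^(1/(p-1)) * δ := mul_pos (Real.rpow_pos_of_pos hδ0 _) hδ0
  have hCB : 0 < ε1/(δ^(1/(p-1)) * δ) := div_pos hε10 hδm
  refine ⟨CA + ε1/(δ^(1/(p-1)) * δ), by linarith, ?_⟩
  intro t ht x hx
  have htO : t ∈ Ioo T0 T := ⟨by linarith [ht.1], ht.2⟩
  have hxO : x ∈ Ioo a b := ⟨by linarith [hx.1], by linarith [hx.2]⟩
  have hv0 := O.nn t htO x hxO
  have hvp : 0 ≤ ε * (v t x)^p := mul_nonneg hε.le (Real.rpow_nonneg hv0 _)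
  rcases lt_or_ge t (T-δ) with h | h
  · have := hA t ⟨ht.1, h⟩ x hx
    linarith
  have hl : 0 < T - t := by linarith [ht.2]
  have S := SP_of hp hl (by linarith)
  rcases le_total k0 ((T-t)^(1/(p-1)) * v t x) with hW | hW
  · have h1 := (hfl t ⟨by linarith, ht.2⟩ x ⟨by linarith [hx.1], by linarith [hx.2]⟩).trans (min_le_right _ _)
    have := fin_div S.m0 hl S.mp hv0 hε.le hk0.le (by linarith) h1 hW
    linarith
  · rcases le_total ((T-(T-δ))^(1/(p-1)) * v (T-δ) x) k0 with h1 | h1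
    · have h2 := (key (T-δ) ⟨le_rfl, by linarith⟩ x hx h1 t ⟨h, ht.2⟩).1
      rw [sub_sub_cancel] at h2
      have h3 : |v2 t x| ≤ ε1/(δ^(1/(p-1)) * δ) := by rw [le_div_iff₀ hδm]; linarith
      linarith
    · have hcont : ContinuousOn (fun σ => (T-σ)^(1/(p-1)) * v σ x) (Icc (T-δ) t) := by
        refine ContinuousOn.mul ?_ ?_
        · refine ContinuousOn.rpow_const (by fun_prop) ?_
          intro σ hσ
          exact Or.inl (by have : 0 < T - σ := by linarith [hσ.2, ht.2]
                           exact this.ne')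
        · intro σ hσ
          exact (O.vt σ ⟨by linarith [hσ.1, ht'.1], by linarith [hσ.2, ht.2]⟩ x hxO).continuousAt.continuousWithinAt
      obtain ⟨tc, htc, hWtc⟩ := intermediate_value_Icc' h hcont ⟨hW, h1⟩
      simp only at hWtc
      have h2 := key tc ⟨htc.1, by linarith [htc.2, ht.2]⟩ x hx hWtc.le t ⟨htc.2, ht.2⟩
      have hl' : 0 < T - tc := by linarith [htc.2, ht.2]
      have S' := SP_of hp hl' (by linarith [htc.1])
      have := fin_div S'.m0 hl' S'.mp hv0 hε.le (by linarith : 0 ≤ k0/2) (by linarith) (h2.1.trans hε12) (h2.2 hWtc)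
      linarith

end

section

/-- bounded Hölder functions -/
def HBd (A : ℝ → ℝ) (a b β : ℝ) : Prop :=
  ∃ L : ℝ, 1 ≤ L ∧ (∀ x ∈ Ioo a b, |A x| ≤ L) ∧ ∀ x ∈ Ioo a b, ∀ x' ∈ Ioo a b, |A x - A x'| ≤ L * |x - x'|^β

lemma HBd.mul {A B : ℝ → ℝ} {a b β : ℝ} (hA : HBd A a b β) (hB : HBd B a b β) : HBd (fun x => A x * B x) a b β := by
  obtain ⟨L, hL, h1, h2⟩ := hA
  obtain ⟨K, hK, k1, k2⟩ := hB
  have hLK : 1 ≤ L*K := one_le_mul_of_one_le_of_one_le hL hK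
  refine ⟨2*(L*K), by linarith, ?_, ?_⟩
  · intro x hx
    rw [abs_mul]
    have := mul_le_mul (h1 x hx) (k1 x hx) (abs_nonneg _) (by linarith)
    linarith
  · intro x hx x' hx'
    have e : A x * B x - A x' * B x' = (A x - A x') * B x + A x' * (B x - B x') := by ring
    have hh : 0 ≤ |x-x'|^β := Real.rpow_nonneg (abs_nonneg _) _
    rw [e]
    refine (abs_add_le _ _).trans ?_
    rw [abs_mul, abs_mul]
    have i1 := mul_le_mul (h2 x hx x' hx') (k1 x hx) (abs_nonneg _) (mul_nonneg (by linarith) hh)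
    have i2 := mul_le_mul (h1 x' hx') (k2 x hx x' hx') (abs_nonneg _) (by linarith)
    linarith

lemma HBd_rpow {a b β : ℝ} (ha : 0 < a) (hab : a < b) (hβ : 0 < β) (hβ1 : β ≤ 1) (σ : ℝ) : HBd (fun r => r^σ) a b β := by
  obtain ⟨K, hK⟩ : ∃ K : ℝ, ∀ x ∈ Icc a b, |σ * x^(σ-1)| ≤ K := by
    have hc : ContinuousOn (fun x : ℝ => σ * x^(σ-1)) (Icc a b) :=
      continuousOn_const.mul (ContinuousOn.rpow_const continuousOn_id (fun x hx => Or.inl (by have := hx.1; exact ne_of_gt (lt_of_lt_of_le ha this))))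
    obtain ⟨K, hK⟩ := isCompact_Icc.exists_bound_of_continuousOn hc
    exact ⟨K, hK⟩
  obtain ⟨K2, hK2⟩ : ∃ K : ℝ, ∀ x ∈ Icc a b, |x^σ| ≤ K := by
    have hc : ContinuousOn (fun x : ℝ => x^σ) (Icc a b) :=
      (ContinuousOn.rpow_const continuousOn_id (fun x hx => Or.inl (by have := hx.1; exact ne_of_gt (lt_of_lt_of_le ha this))))
    obtain ⟨K, hK⟩ := isCompact_Icc.exists_bound_of_continuousOn hc
    exact ⟨K, hK⟩
  have hK0 : 0 ≤ K := (abs_nonneg _).trans (hK a ⟨le_rfl, hab.le⟩)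
  have hK20 : 0 ≤ K2 := (abs_nonneg _).trans (hK2 a ⟨le_rfl, hab.le⟩)
  have hW : 0 ≤ (b-a)^(1-β) := Real.rpow_nonneg (by linarith) _
  have hKW := mul_nonneg hK0 hW
  refine ⟨1 + K2 + K * (b-a)^(1-β), by linarith, ?_, ?_⟩
  · intro x hx
    have := hK2 x ⟨hx.1.le, hx.2.le⟩
    linarith
  · intro x hx x' hx'
    have h1 : |x^σ - x'^σ| ≤ K * |x-x'| := by
      have := Convex.norm_image_sub_le_of_norm_hasDerivWithin_le (f := fun r : ℝ => r^σ) (f' := fun x => σ * x^(σ-1)) (s := Ioo a b) (C := K)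
        (fun y hy => (Real.hasDerivAt_rpow_const (Or.inl (by have := hy.1; linarith))).hasDerivWithinAt)
        (fun y hy => hK y ⟨hy.1.le, hy.2.le⟩) (convex_Ioo a b) hx' hx
      exact this
    have hd : |x-x'| ≤ b - a := abs_le.2 ⟨by linarith [hx.1, hx'.2], by linarith [hx.2, hx'.1]⟩
    have h2 : |x-x'| ≤ (b-a)^(1-β) * |x-x'|^β := by
      rcases eq_or_lt_of_le (abs_nonneg (x-x')) with h | h
      · rw [← h]; exact mul_nonneg hW (Real.rpow_nonneg le_rfl _)
      · have e : |x-x'| = |x-x'|^(1-β) * |x-x'|^β := by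
          rw [← Real.rpow_add h]; simp
        calc |x-x'| = |x-x'|^(1-β) * |x-x'|^β := e
          _ ≤ _ := mul_le_mul_of_nonneg_right (Real.rpow_le_rpow h.le hd (by linarith)) (Real.rpow_nonneg h.le _)
    have hh : 0 ≤ |x-x'|^β := Real.rpow_nonneg (abs_nonneg _) _
    have i1 := mul_le_mul_of_nonneg_left h2 hK0
    have i2 := mul_nonneg hK20 hh
    refine h1.trans (i1.trans ?_)
    linarith

lemma le_eps_pow {p : ℝ} (hp : 1 < p) : ∀ η > 0, ∃ C ≥ 0, ∀ z : ℝ, 0 ≤ z → z ≤ η * z^p + C := by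
  intro η hη
  have hp1 : 0 < p - 1 := by linarith
  have h0 : 0 < (1/η)^(1/(p-1)) := Real.rpow_pos_of_pos (by positivity) _
  refine ⟨(1/η)^(1/(p-1)), h0.le, ?_⟩
  intro z hz
  rcases le_total z ((1/η)^(1/(p-1))) with h | h
  · have := mul_nonneg hη.le (Real.rpow_nonneg hz p)
    linarith
  · have hz0 : 0 < z := h0.trans_le h
    have h1 : 1/η ≤ z^(p-1) := by
      have := Real.rpow_le_rpow h0.le h hp1.le
      rwa [← Real.rpow_mul (by positivity), one_div_mul_cancel hp1.ne', Real.rpow_one] at this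
    have h2 : z^p = z^(p-1) * z := by rw [← Real.rpow_add_one hz0.ne']; simp
    rw [div_le_iff₀ hη] at h1
    have := mul_le_mul_of_nonneg_right h1 hz
    rw [h2]
    linarith

/-- growth data of the nonlinearity -/
structure FD (f : ℝ → ℝ) (p L : ℝ) : Prop where
  L1 : 1 ≤ L
  f1 : ∀ s, 0 ≤ s → |f s| ≤ L * (1 + s^p)
  f2 : ∀ s s', 0 ≤ s → 0 ≤ s' → |f s - f s'| ≤ L * (1 + s^(p-1) + s'^(p-1)) * |s - s'|
  f3 : ∀ η > 0, ∃ C ≥ 0, ∀ s, 0 ≤ s → |f s - s^p| ≤ η * s^p + C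

lemma FD_of {f : ℝ → ℝ} {p C0 : ℝ} (hp : 1 < p) (hf_C1 : ContDiffOn ℝ 1 f (Ici 0))
    (hf_lim : Tendsto (fun s : ℝ => s ^ (-p) * f s) atTop (nhds 1)) (hC0 : 0 < C0)
    (hf_deriv : ∀ s ≥ (0:ℝ), |deriv f s| ≤ C0 * (1 + s ^ (p - 1))) : ∃ L, FD f p L := by
  have hp1 : 0 < p - 1 := by linarith
  have hcf := hf_C1.continuousOn
  have hlip : ∀ s s', 0 ≤ s → s < s' → |f s' - f s| ≤ C0 * (1 + s'^(p-1)) * |s' - s| := by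
    intro s s' hs hss
    have hd : ∀ x ∈ Ioo s s', HasDerivAt f (deriv f x) x := by
      intro x hx
      have hx0 : 0 < x := by linarith [hx.1]
      have := (hf_C1.contDiffAt (Ici_mem_nhds hx0)).differentiableAt (by norm_num)
      exact this.hasDerivAt
    obtain ⟨c, hc, hsl⟩ := exists_hasDerivAt_eq_slope f (deriv f) hss (hcf.mono (fun x hx => by have := hx.1; simp only [mem_Ici]; linarith)) hd
    have hpos : 0 < s' - s := by linarith
    rw [eq_div_iff hpos.ne'] at hsl
    rw [← hsl, abs_mul]
    refine mul_le_mul_of_nonneg_right ?_ (abs_nonneg _)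
    refine (hf_deriv c (by linarith [hc.1])).trans (mul_le_mul_of_nonneg_left ?_ hC0.le)
    have := Real.rpow_le_rpow (by linarith [hc.1] : 0 ≤ c) hc.2.le hp1.le
    linarith
  have hf3 : ∀ η > 0, ∃ C ≥ 0, ∀ s, 0 ≤ s → |f s - s^p| ≤ η * s^p + C := by
    intro η hη
    have h1 := (Metric.tendsto_atTop.1 hf_lim) η hη
    obtain ⟨S, hS⟩ := h1
    obtain ⟨K, hK⟩ := (isCompact_Icc (a := (0:ℝ)) (b := max S 1)).exists_bound_of_continuousOn
      (f := fun s => f s - s^p) ((hcf.mono (fun x hx => hx.1)).sub (Real.continuous_rpow_const (by linarith) |>.continuousOn))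
    have hK0 : 0 ≤ K := (norm_nonneg _).trans (hK 0 ⟨le_rfl, by positivity⟩)
    refine ⟨K, hK0, ?_⟩
    intro s hs
    have hsp : 0 ≤ s^p := Real.rpow_nonneg hs _
    rcases le_total s (max S 1) with h | h
    · have := hK s ⟨hs, h⟩
      rw [Real.norm_eq_abs] at this
      have := mul_nonneg hη.le hsp
      linarith
    · have h2 := hS s ((le_max_left _ _).trans h)
      have hs0 : 0 < s := lt_of_lt_of_le one_pos ((le_max_right _ _).trans h)
      have hsp' : 0 < s^p := Real.rpow_pos_of_pos hs0 _
      rw [Real.dist_eq, Real.rpow_neg hs] at h2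
      have e : f s - s^p = s^p * ((s^p)⁻¹ * f s - 1) := by field_simp
      rw [e, abs_mul, abs_of_pos hsp']
      have := mul_le_mul_of_nonneg_left h2.le hsp
      linarith
  obtain ⟨C1, hC1, h31⟩ := hf3 1 one_pos
  refine ⟨1 + C0 + 2 + C1, by linarith, ?_, ?_, hf3⟩
  · intro s hs
    have h := h31 s hs
    have hsp : 0 ≤ s^p := Real.rpow_nonneg hs _
    have h' : |f s| ≤ |f s - s^p| + |s^p| := by
      have := abs_add_le (f s - s^p) (s^p)
      rwa [sub_add_cancel] at this
    rw [abs_of_nonneg hsp] at h'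
    have i1 := mul_nonneg hC0.le hsp
    have i2 := mul_nonneg hC1 hsp
    linarith
  · intro s s' hs hs'
    have a1 := Real.rpow_nonneg hs (p-1)
    have a2 := Real.rpow_nonneg hs' (p-1)
    have hd := abs_nonneg (s-s')
    have gen : ∀ X, 0 ≤ X → X ≤ 1 + s^(p-1) + s'^(p-1) → C0 * X * |s-s'| ≤ (1 + C0 + 2 + C1) * (1 + s^(p-1) + s'^(p-1)) * |s-s'| := by
      intro X hX0 hX
      refine mul_le_mul_of_nonneg_right ?_ hd
      exact mul_le_mul (by linarith) hX hX0 (by linarith)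
    rcases lt_trichotomy s s' with h | h | h
    · rw [abs_sub_comm (f s)]
      refine (hlip s s' hs h).trans ?_
      rw [abs_sub_comm s' s]
      exact gen _ (by linarith) (by linarith)
    · rw [h]; simp
    · exact (hlip s' s hs' h).trans (gen _ (by linarith) (by linarith))

lemma GD_of {f A B Cc : ℝ → ℝ} {p L0 a b β : ℝ} (hp : 1 < p) (F : FD f p L0) (hβ : 0 < β) (hβ1 : β ≤ 1)
    (hA : HBd A a b β) (hB : HBd B a b β) (hC : HBd Cc a b β) (hB0 : ∀ x ∈ Ioo a b, 0 ≤ B x) (hC0 : ∀ x ∈ Ioo a b, 0 < Cc x) :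
    ∃ CG, GD (fun x z => A x * z + B x * f (Cc x * z)) (fun x => B x * (Cc x)^p) a b p β CG := by
  obtain ⟨LA, hLA, hA1, hA2⟩ := hA
  obtain ⟨LB, hLB, hB1, hB2⟩ := hB
  obtain ⟨LC, hLC, hC1, hC2⟩ := hC
  have hL0 := F.L1
  obtain ⟨L, hL1, l1, l2, l3, l4⟩ : ∃ L : ℝ, 1 ≤ L ∧ LA ≤ L ∧ LB ≤ L ∧ LC ≤ L ∧ L0 ≤ L := ⟨LA+LB+LC+L0, by linarith, by linarith, by linarith, by linarith, by linarith⟩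
  have hp1 : 0 < p - 1 := by linarith
  have hL00 : 0 ≤ L := by linarith
  set Q := L^p with hQ
  have hQ1 : 1 ≤ Q := Real.one_le_rpow hL1 (by linarith)
  have hQ0 : 0 ≤ Q := by linarith
  have hQ2 : L^(p-1) ≤ Q := Real.rpow_le_rpow_of_exponent_le hL1 (by linarith)
  have hL2 : 1 ≤ L^2 := one_le_pow₀ hL1
  have hLL2 : L ≤ L^2 := by nlinarith
  have hLL3 : L^2 ≤ L^3 := by nlinarith
  have hL3Q : L^3 ≤ L^3*Q := le_mul_of_one_le_right (by positivity) hQ1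
  have hL2Q : L^2*Q ≤ L^3*Q := mul_le_mul_of_nonneg_right hLL3 hQ0
  have hL3Q0 : 0 ≤ L^3*Q := by positivity
  have hz1 : ∀ z : ℝ, 0 ≤ z → z ≤ 1 + z^p := by
    intro z hz
    rcases le_total z 1 with h | h
    · have := Real.rpow_nonneg hz p; linarith
    · have := Real.rpow_le_rpow_of_exponent_le h hp.le
      rw [Real.rpow_one] at this; linarith
  have hC0' : ∀ x ∈ Ioo a b, ∀ z : ℝ, 0 ≤ z → 0 ≤ Cc x * z := fun x hx z hz => mul_nonneg (hC0 x hx).le hz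
  have hCL : ∀ x ∈ Ioo a b, Cc x ≤ L := fun x hx => ((le_abs_self _).trans (hC1 x hx)).trans l3
  have hCp : ∀ x ∈ Ioo a b, ∀ z : ℝ, 0 ≤ z → (Cc x * z)^p ≤ Q * z^p := by
    intro x hx z hz
    rw [Real.mul_rpow (hC0 x hx).le hz]
    exact mul_le_mul_of_nonneg_right (Real.rpow_le_rpow (hC0 x hx).le (hCL x hx) (by linarith)) (Real.rpow_nonneg hz _)
  have hCp1 : ∀ x ∈ Ioo a b, ∀ z : ℝ, 0 ≤ z → (Cc x * z)^(p-1) ≤ Q * z^(p-1) := by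
    intro x hx z hz
    rw [Real.mul_rpow (hC0 x hx).le hz]
    exact mul_le_mul_of_nonneg_right ((Real.rpow_le_rpow (hC0 x hx).le (hCL x hx) hp1.le).trans hQ2) (Real.rpow_nonneg hz _)
  have hfb : ∀ x ∈ Ioo a b, ∀ z : ℝ, 0 ≤ z → |f (Cc x * z)| ≤ L * Q * (1 + z^p) := by
    intro x hx z hz
    refine (F.f1 _ (hC0' x hx z hz)).trans ?_
    rw [mul_assoc]
    have := hCp x hx z hz
    exact mul_le_mul l4 (by linarith) (by have := Real.rpow_nonneg (hC0' x hx z hz) p; linarith) hL00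
  refine ⟨5*(L^3*Q), ?_, ?_, ?_, ?_, ?_, by linarith, hβ, hβ1, hp⟩
  · intro x hx z hz
    have hzp := Real.rpow_nonneg hz p
    refine (abs_add_le _ _).trans ?_
    rw [abs_mul, abs_mul, abs_of_nonneg hz]
    have i1 := mul_le_mul ((hA1 x hx).trans l1) (hz1 z hz) hz hL00
    have i2 := mul_le_mul ((hB1 x hx).trans l2) (hfb x hx z hz) (abs_nonneg _) hL00
    have i3 : L*(1+z^p) ≤ (L^3*Q)*(1+z^p) := mul_le_mul_of_nonneg_right (by linarith) (by linarith)
    have i4 : (L^2*Q)*(1+z^p) ≤ (L^3*Q)*(1+z^p) := mul_le_mul_of_nonneg_right hL2Q (by linarith)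
    have i5 : 0 ≤ (L^3*Q)*(1+z^p) := mul_nonneg hL3Q0 (by linarith)
    linarith
  · intro x hx x' hx' z z' hz hz'
    have hzp := Real.rpow_nonneg hz p
    have hzp' := Real.rpow_nonneg hz' p
    have hzq := Real.rpow_nonneg hz (p-1)
    have hzq' := Real.rpow_nonneg hz' (p-1)
    have hh : 0 ≤ |x-x'|^β := Real.rpow_nonneg (abs_nonneg _) _
    have hd := abs_nonneg (z-z')
    have hA2' : |A x - A x'| ≤ L*|x-x'|^β := (hA2 x hx x' hx').trans (mul_le_mul_of_nonneg_right l1 hh)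
    have hB2' : |B x - B x'| ≤ L*|x-x'|^β := (hB2 x hx x' hx').trans (mul_le_mul_of_nonneg_right l2 hh)
    have hC2' : |Cc x - Cc x'| ≤ L*|x-x'|^β := (hC2 x hx x' hx').trans (mul_le_mul_of_nonneg_right l3 hh)
    set h := |x-x'|^β with hhd
    set d := |z-z'| with hdd
    set P := 1 + z^p + z'^p with hP
    set N := 1 + z^(p-1) + z'^(p-1) with hN
    have hP1 : 1 ≤ P := by rw [hP]; linarith
    have hN1 : 1 ≤ N := by rw [hN]; linarith
    have hhP : 0 ≤ h*P := mul_nonneg hh (by linarith)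
    have hNd : 0 ≤ N*d := mul_nonneg (by linarith) hd
    have hzP : z ≤ P := (hz1 z hz).trans (by rw [hP]; linarith)
    have hNz : N*z ≤ 3*P := by
      have e1 : z^(p-1)*z = z^p := by
        rcases eq_or_lt_of_le hz with h | h
        · rw [← h, mul_zero, Real.zero_rpow (by linarith)]
        · rw [← Real.rpow_add_one h.ne']; simp
      have e2 : z'^(p-1)*z ≤ z^p + z'^p := by
        rcases le_total z z' with h | h
        · have : z'^(p-1)*z' = z'^p := by
            rcases eq_or_lt_of_le hz' with h | h
            · rw [← h, mul_zero, Real.zero_rpow (by linarith)]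
            · rw [← Real.rpow_add_one h.ne']; simp
          have := mul_le_mul_of_nonneg_left h hzq'
          linarith
        · have := mul_le_mul_of_nonneg_right (Real.rpow_le_rpow hz' h hp1.le) hz
          linarith
      have := hz1 z hz
      rw [hN, hP]
      linarith
    have i1 : |A x * z - A x' * z'| ≤ L*(h*P) + L*(N*d) := by
      have e : A x * z - A x' * z' = (A x - A x') * z + A x' * (z - z') := by ring
      rw [e]
      refine (abs_add_le _ _).trans ?_
      rw [abs_mul, abs_mul, abs_of_nonneg hz]
      have j1 := mul_le_mul hA2' hzP hz (mul_nonneg hL00 hh)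
      have j2 := mul_le_mul_of_nonneg_right ((hA1 x' hx').trans l1) hd
      have j3 : d ≤ N*d := le_mul_of_one_le_left hd hN1
      have j4 := mul_le_mul_of_nonneg_left j3 hL00
      linarith
    have i2 : |B x * f (Cc x * z) - B x' * f (Cc x' * z')| ≤ L^2*Q*(h*P) + (3*(L^3*Q)*(h*P) + L^3*Q*(N*d)) := by
      have e : B x * f (Cc x * z) - B x' * f (Cc x' * z') = (B x - B x') * f (Cc x * z) + B x' * (f (Cc x * z) - f (Cc x' * z')) := by ring
      rw [e]
      refine (abs_add_le _ _).trans ?_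
      rw [abs_mul, abs_mul]
      have j1 := mul_le_mul hB2' ((hfb x hx z hz).trans (mul_le_mul_of_nonneg_left (show 1+z^p ≤ P by rw [hP]; linarith) (mul_nonneg hL00 hQ0))) (abs_nonneg _) (mul_nonneg hL00 hh)
      have j2 := F.f2 _ _ (hC0' x hx z hz) (hC0' x' hx' z' hz')
      have j3 : |Cc x * z - Cc x' * z'| ≤ L*h*z + L*d := by
        have e : Cc x * z - Cc x' * z' = (Cc x - Cc x') * z + Cc x' * (z - z') := by ring
        rw [e]
        refine (abs_add_le _ _).trans ?_
        rw [abs_mul, abs_mul, abs_of_nonneg hz]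
        exact add_le_add (mul_le_mul_of_nonneg_right hC2' hz) (mul_le_mul_of_nonneg_right ((hC1 x' hx').trans l3) hd)
      have a1 := hCp1 x hx z hz
      have a2 := hCp1 x' hx' z' hz'
      have a3 := Real.rpow_nonneg (hC0' x hx z hz) (p-1)
      have a4 := Real.rpow_nonneg (hC0' x' hx' z' hz') (p-1)
      have j4 : L0 * (1 + (Cc x * z)^(p-1) + (Cc x' * z')^(p-1)) ≤ L*(Q*N) := by
        refine mul_le_mul l4 ?_ (by linarith) hL00
        rw [hN]; linarith
      have j5 := j2.trans (mul_le_mul j4 j3 (abs_nonneg _) (mul_nonneg hL00 (mul_nonneg hQ0 (by linarith))))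
      have j6 := mul_le_mul ((hB1 x' hx').trans l2) j5 (abs_nonneg _) hL00
      have j7 := mul_le_mul_of_nonneg_left hNz (mul_nonneg hL3Q0 hh)
      have e6 : L*(L*(Q*N)*(L*h*z+L*d)) = L^3*Q*h*(N*z) + L^3*Q*(N*d) := by ring
      rw [e6] at j6
      have e1 : L*h*(L*Q*P) = L^2*Q*(h*P) := by ring
      rw [e1] at j1
      linarith
    have e : A x * z + B x * f (Cc x * z) - (A x' * z' + B x' * f (Cc x' * z')) = (A x * z - A x' * z') + (B x * f (Cc x * z) - B x' * f (Cc x' * z')) := by ring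
    rw [e]
    refine (abs_add_le _ _).trans ?_
    have k1 : L*(h*P) ≤ L^3*Q*(h*P) := mul_le_mul_of_nonneg_right (by linarith) hhP
    have k2 : L*(N*d) ≤ L^3*Q*(N*d) := mul_le_mul_of_nonneg_right (by linarith) hNd
    have k3 : L^2*Q*(h*P) ≤ L^3*Q*(h*P) := mul_le_mul_of_nonneg_right hL2Q hhP
    have k4 : 0 ≤ L^3*Q*(N*d) := mul_nonneg hL3Q0 hNd
    have k5 : 5*(L^3*Q)*(P*h+N*d) = 5*(L^3*Q*(h*P)) + 5*(L^3*Q*(N*d)) := by ring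
    rw [k5]
    linarith
  · intro η hη
    obtain ⟨C1, hC1', h1⟩ := le_eps_pow hp (η/(2*L)) (by positivity)
    obtain ⟨C2, hC2', h2⟩ := F.f3 (η/(2*(L*Q))) (by positivity)
    refine ⟨L*C1 + L*C2, by positivity, ?_⟩
    intro x hx z hz
    have hzp := Real.rpow_nonneg hz p
    have e : A x * z + B x * f (Cc x * z) - B x * (Cc x)^p * z^p = A x * z + B x * (f (Cc x * z) - (Cc x * z)^p) := by
      rw [Real.mul_rpow (hC0 x hx).le hz]; ring
    simp only [e]
    refine (abs_add_le _ _).trans ?_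
    rw [abs_mul, abs_mul, abs_of_nonneg hz]
    have j1 := mul_le_mul ((hA1 x hx).trans l1) (h1 z hz) hz hL00
    have j2 := h2 _ (hC0' x hx z hz)
    have j3 := mul_le_mul_of_nonneg_left (hCp x hx z hz) (by positivity : 0 ≤ η/(2*(L*Q)))
    have j4 := mul_le_mul ((hB1 x hx).trans l2) (j2.trans (add_le_add_left j3 C2)) (abs_nonneg _) hL00
    have e1 : L*(η/(2*L)*z^p+C1) = η/2*z^p + L*C1 := by field_simp
    have e2 : L*(η/(2*(L*Q))*(Q*z^p)+C2) = η/2*z^p + L*C2 := by field_simp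
    rw [e1] at j1
    rw [e2] at j4
    linarith
  · have hcont : ∀ (A : ℝ → ℝ) (K : ℝ), (∀ x ∈ Ioo a b, ∀ x' ∈ Ioo a b, |A x - A x'| ≤ K * |x - x'|^β) → ContinuousOn A (Ioo a b) := by
      intro A K hA x hx
      have h1 : Tendsto (fun y : ℝ => K * |y - x|^β) (nhdsWithin x (Ioo a b)) (nhds 0) := by
        have : Continuous (fun y : ℝ => K * |y-x|^β) := by
          have := Real.continuous_rpow_const hβ.le
          exact continuous_const.mul (this.comp (by fun_prop))
        have h := (this.tendsto x).mono_left (nhdsWithin_le_nhds (s := Ioo a b))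
        simpa [Real.zero_rpow hβ.ne'] using h
      refine tendsto_iff_dist_tendsto_zero.2 (squeeze_zero' (Eventually.of_forall fun y => dist_nonneg) ?_ h1)
      filter_upwards [self_mem_nhdsWithin] with y hy
      exact hA y hy x hx
    exact (hcont B LB hB2).mul ((hcont Cc LC hC2).rpow_const (fun x hx => Or.inl (hC0 x hx).ne'))
  · intro x hx
    exact mul_nonneg (hB0 x hx) (Real.rpow_nonneg (hC0 x hx).le _)

end

section
variable {n : ℕ}

lemma dir_deriv {F : EuclideanSpace ℝ (Fin n) → ℝ} {x d : EuclideanSpace ℝ (Fin n)} {s : ℝ} (h : ContDiffAt ℝ 2 F (x + s • d)) :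
    HasDerivAt (fun s : ℝ => F (x + s • d)) (fderiv ℝ F (x + s • d) d) s ∧
    HasDerivAt (fun s : ℝ => fderiv ℝ F (x + s • d) d) (fderiv ℝ (fun y => fderiv ℝ F y d) (x + s • d) d) s := by
  have hl : HasDerivAt (fun s : ℝ => x + s • d) d s := by
    have := ((hasDerivAt_id s).smul_const d).const_add x
    simpa using this
  have h1 := (h.differentiableAt (by norm_num)).hasFDerivAt
  have h2 : ContDiffAt ℝ 1 (fun y => fderiv ℝ F y d) (x + s • d) :=
    (h.fderiv_right (m := 1) (by norm_num)).clm_apply contDiffAt_const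
  have h3 := (h2.differentiableAt (by norm_num)).hasFDerivAt
  refine ⟨?_, ?_⟩
  · have h4 := h1.comp_hasDerivAt s hl
    exact h4
  · have h4 := h3.comp_hasDerivAt s hl
    exact h4

lemma dir_cont {F : EuclideanSpace ℝ (Fin n) → ℝ} {x d : EuclideanSpace ℝ (Fin n)} (h : ContDiffAt ℝ 2 F x) :
    ContinuousAt (fun z => fderiv ℝ (fun y => fderiv ℝ F y d) z d) x := by
  have h2 : ContDiffAt ℝ 1 (fun y => fderiv ℝ F y d) x :=
    (h.fderiv_right (m := 1) (by norm_num)).clm_apply contDiffAt_const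
  have h3 : ContDiffAt ℝ 0 (fun z => fderiv ℝ (fun y => fderiv ℝ F y d) z d) x :=
    (h2.fderiv_right (m := 0) (by norm_num)).clm_apply contDiffAt_const
  exact h3.continuousAt

lemma norm_re (i0 : Fin n) {r : ℝ} (hr : 0 ≤ r) : ‖r • (EuclideanSpace.single i0 (1:ℝ) : EuclideanSpace ℝ (Fin n))‖ = r := by
  rw [norm_smul, PiLp.norm_single]; simp [abs_of_nonneg hr]

lemma norm_re_add (i0 i : Fin n) (hi : i ≠ i0) (r s : ℝ) :
    ‖r • (EuclideanSpace.single i0 (1:ℝ) : EuclideanSpace ℝ (Fin n)) + s • EuclideanSpace.single i (1:ℝ)‖ = √(r^2 + s^2) := by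
  have h := norm_add_sq_real (r • (EuclideanSpace.single i0 (1:ℝ) : EuclideanSpace ℝ (Fin n))) (s • EuclideanSpace.single i (1:ℝ))
  have h0 : inner ℝ (r • (EuclideanSpace.single i0 (1:ℝ) : EuclideanSpace ℝ (Fin n))) (s • EuclideanSpace.single i (1:ℝ)) = 0 := by
    rw [real_inner_smul_left, real_inner_smul_right, EuclideanSpace.inner_single_left]
    simp [hi.symm]
  rw [h0, norm_smul, norm_smul, PiLp.norm_single, PiLp.norm_single] at h
  simp only [norm_one, mul_one, Real.norm_eq_abs, sq_abs, mul_zero, add_zero] at h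
  rw [← h, Real.sqrt_sq (norm_nonneg _)]

lemma lap_rad {F : EuclideanSpace ℝ (Fin n) → ℝ} {r1 r2 : ℝ} (hr1 : 0 < r1) (i0 : Fin n)
    (hF : ∀ x : EuclideanSpace ℝ (Fin n), r1 < ‖x‖ → ‖x‖ < r2 → ContDiffAt ℝ 2 F x)
    (hrad : ∀ x y : EuclideanSpace ℝ (Fin n), r1 < ‖x‖ → ‖x‖ < r2 → ‖x‖ = ‖y‖ → F x = F y) {r : ℝ} (hr : r ∈ Ioo r1 r2) :
    lap F (r • EuclideanSpace.single i0 (1:ℝ)) =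
      fderiv ℝ (fun y => fderiv ℝ F y (EuclideanSpace.single i0 1)) (r • EuclideanSpace.single i0 (1:ℝ)) (EuclideanSpace.single i0 1)
      + ((n:ℝ)-1) * (fderiv ℝ F (r • EuclideanSpace.single i0 (1:ℝ)) (EuclideanSpace.single i0 1) / r) := by
  set e : EuclideanSpace ℝ (Fin n) := EuclideanSpace.single i0 (1:ℝ) with he
  have hr0 : 0 < r := hr1.trans hr.1
  have hU : ∀ ρ ∈ Ioo r1 r2, HasDerivAt (fun ρ : ℝ => F (ρ • e)) (fderiv ℝ F (ρ • e) e) ρ ∧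
      HasDerivAt (fun ρ : ℝ => fderiv ℝ F (ρ • e) e) (fderiv ℝ (fun y => fderiv ℝ F y e) (ρ • e) e) ρ := by
    intro ρ hρ
    have hn : ‖ρ • e‖ = ρ := norm_re i0 (hr1.trans hρ.1).le
    have := dir_deriv (F := F) (x := 0) (d := e) (s := ρ) (by rw [zero_add]; exact hF _ (by rw [hn]; exact hρ.1) (by rw [hn]; exact hρ.2))
    simpa using this
  have hi : ∀ i : Fin n, i ≠ i0 → fderiv ℝ (fun y => fderiv ℝ F y (EuclideanSpace.single i 1)) (r • e) (EuclideanSpace.single i 1) = fderiv ℝ F (r • e) e / r := by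
    intro i hi
    set d : EuclideanSpace ℝ (Fin n) := EuclideanSpace.single i (1:ℝ) with hd
    have hsq : ContinuousAt (fun s : ℝ => √(r^2+s^2)) 0 := by fun_prop
    have hsq0 : √(r^2+(0:ℝ)^2) = r := by simp [Real.sqrt_sq hr0.le]
    have hev : ∀ᶠ s in nhds (0:ℝ), √(r^2+s^2) ∈ Ioo r1 r2 := by
      refine hsq.eventually (Ioo_mem_nhds ?_ ?_)
      · show r1 < √(r^2+(0:ℝ)^2)
        rw [hsq0]; exact hr.1
      · show √(r^2+(0:ℝ)^2) < r2
        rw [hsq0]; exact hr.2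
    have hC : ∀ s : ℝ, √(r^2+s^2) ∈ Ioo r1 r2 → ContDiffAt ℝ 2 F (r • e + s • d) := by
      intro s hs
      have hn := norm_re_add i0 i hi r s
      exact hF _ (by rw [hn]; exact hs.1) (by rw [hn]; exact hs.2)
    have hfs : ∀ᶠ s in nhds (0:ℝ), fderiv ℝ F (r • e + s • d) d = (fderiv ℝ F (√(r^2+s^2) • e) e / √(r^2+s^2)) * s := by
      filter_upwards [hev.eventually_nhds] with s hs
      have hs0 := hs.self_of_nhds
      have h1 := (dir_deriv (hC s hs0)).1
      have hpos : 0 < r^2 + s^2 := by positivity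
      have h2 : HasDerivAt (fun s : ℝ => √(r^2+s^2)) (s/√(r^2+s^2)) s := by
        have h3 : HasDerivAt (fun s : ℝ => r^2+s^2) (2*s) s := by
          simpa using ((hasDerivAt_id s).pow 2).const_add (r^2)
        refine (h3.sqrt hpos.ne').congr_deriv ?_
        have := Real.sqrt_pos.2 hpos
        field_simp
      have h4 : HasDerivAt (fun s : ℝ => F (√(r^2+s^2) • e)) (fderiv ℝ F (√(r^2+s^2) • e) e * (s/√(r^2+s^2))) s := by
        have h6 := HasDerivAt.comp (h₂ := fun ρ : ℝ => F (ρ • e)) s (hU _ hs0).1 h2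
        exact h6
      have h5 : (fun s : ℝ => F (r • e + s • d)) =ᶠ[nhds s] (fun s : ℝ => F (√(r^2+s^2) • e)) := by
        filter_upwards [hs] with σ hσ
        have hn := norm_re_add i0 i hi r σ
        refine hrad _ _ (by rw [hn]; exact hσ.1) (by rw [hn]; exact hσ.2) ?_
        rw [hn, norm_re i0 (Real.sqrt_nonneg _)]
      rw [h1.unique (h4.congr_of_eventuallyEq h5)]
      ring
    have h0 : √(r^2+(0:ℝ)^2) ∈ Ioo r1 r2 := hev.self_of_nhds
    have h1 := (dir_deriv (hC 0 h0)).2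
    have hk : ContinuousAt (fun s : ℝ => fderiv ℝ F (√(r^2+s^2) • e) e / √(r^2+s^2)) 0 := by
      refine ContinuousAt.div ?_ hsq (by rw [hsq0]; exact hr0.ne')
      have h6 := (hU _ h0).2.continuousAt
      exact ContinuousAt.comp (g := fun ρ : ℝ => fderiv ℝ F (ρ • e) e) h6 hsq
    have h7 : HasDerivAt (fun s : ℝ => (fderiv ℝ F (√(r^2+s^2) • e) e / √(r^2+s^2)) * s) (fderiv ℝ F (r • e) e / r) 0 := by
      rw [hasDerivAt_iff_tendsto_slope]
      have h8 := hk.tendsto.mono_left (nhdsWithin_le_nhds (s := {0}ᶜ))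
      simp only [hsq0] at h8
      refine h8.congr' ?_
      filter_upwards [self_mem_nhdsWithin] with s hs
      have hs' : s ≠ 0 := hs
      rw [slope_def_field]
      simp only [mul_zero, sub_zero]
      field_simp
    have h9 := h1.unique (h7.congr_of_eventuallyEq hfs)
    rwa [zero_smul, add_zero] at h9
  unfold lap
  have hsum : ∀ i : Fin n, fderiv ℝ (fun y => fderiv ℝ F y (EuclideanSpace.single i 1)) (r • e) (EuclideanSpace.single i 1)
      = fderiv ℝ F (r • e) e / r + (if i = i0 then fderiv ℝ (fun y => fderiv ℝ F y e) (r • e) e - fderiv ℝ F (r • e) e / r else 0) := by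
    intro i
    by_cases h : i = i0
    · rw [if_pos h, h, ← he]; ring
    · rw [if_neg h, hi i h, add_zero]
  rw [Finset.sum_congr rfl (fun i _ => hsum i), Finset.sum_add_distrib, Finset.sum_const, Finset.sum_ite_eq']
  simp
  ring

end

set_option maxHeartbeats 2000000 in
theorem stmt3
    (n : ℕ) (hn : 1 ≤ n)
    (Ω : Set (EuclideanSpace ℝ (Fin n)))
    (hΩ_open : IsOpen Ω) (hΩ_conn : IsConnected Ω)
    (p : ℝ) (hp : 1 < p)
    (f : ℝ → ℝ)
    (hf_nonneg : ∀ s ≥ (0:ℝ), 0 ≤ f s)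
    (hf_C1 : ContDiffOn ℝ 1 f (Ici 0))
    (hf_lim : Tendsto (fun s : ℝ => s ^ (-p) * f s) atTop (nhds 1))
    (hf_deriv : ∃ C₀ > 0, ∀ s ≥ (0:ℝ), |deriv f s| ≤ C₀ * (1 + s ^ (p - 1)))
    (V : EuclideanSpace ℝ (Fin n) → ℝ)
    (hV_nonneg : ∀ x ∈ closure Ω, 0 ≤ V x)
    (hV_holder : ∃ C β : ℝ, 0 < β ∧ β ≤ 1 ∧ 0 ≤ C ∧
      ∀ x ∈ closure Ω, ∀ y ∈ closure Ω, |V x - V y| ≤ C * ‖x - y‖ ^ β)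
    (ω D : Set (EuclideanSpace ℝ (Fin n)))
    (hωD : IsCompact (closure ω) ∧ closure ω ⊆ D)
    (hDΩ : IsCompact (closure D) ∧ closure D ⊆ Ω)
    (c₀ : ℝ) (hc₀ : 0 < c₀) (hVD : ∀ x ∈ D, c₀ ≤ V x)
    (r₁ r₂ : ℝ) (hr₁ : 0 < r₁) (hr₁₂ : r₁ < r₂)
    (hD : D = {x : EuclideanSpace ℝ (Fin n) | r₁ < ‖x‖ ∧ ‖x‖ < r₂})
    (T : ℝ) (hT : 0 < T)
    (u : ℝ → EuclideanSpace ℝ (Fin n) → ℝ)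
    (hu_nonneg : ∀ t ∈ Ioo 0 T, ∀ x ∈ Ω, 0 ≤ u t x)
    (hu_t : ∀ t ∈ Ioo 0 T, ∀ x ∈ Ω, DifferentiableAt ℝ (fun s => u s x) t)
    (hu_x : ∀ t ∈ Ioo 0 T, ∀ x ∈ Ω, ContDiffAt ℝ 2 (fun y => u t y) x)
    (heq : ∀ t ∈ Ioo 0 T, ∀ x ∈ Ω,
      deriv (fun s => u s x) t = lap (fun y => u t y) x + V x * f (u t x))
    (hV_rad : ∀ x ∈ closure Ω, ∀ y ∈ closure Ω, ‖x‖ = ‖y‖ → V x = V y)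
    (hu_rad : ∀ t ∈ Ioo 0 T, ∀ x ∈ Ω, ∀ y ∈ Ω, ‖x‖ = ‖y‖ → u t x = u t y)
    (M : ℝ) (hM : 0 < M)
    (hTypeI : ∀ t ∈ Ioo (T / 4) T, ∀ x ∈ D, u t x ≤ M * (T - t) ^ (-(1 / (p - 1))))
    :
    ∀ ε > 0, ∃ C > 0, ∀ t ∈ Ico (T / 2) T, ∀ x ∈ ω,
      |deriv (fun s => u s x) t - V x * f (u t x)| ≤ ε * u t x ^ p + C := by
  intro ε hε
  rcases ω.eq_empty_or_nonempty with hω0 | hωne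
  · refine ⟨1, one_pos, ?_⟩
    intro t ht x hx
    rw [hω0] at hx
    exact absurd hx (notMem_empty x)
  have hDsub : ∀ x ∈ D, x ∈ Ω := fun x hx => hDΩ.2 (subset_closure hx)
  have hcl : ∀ x ∈ Ω, x ∈ closure Ω := fun x hx => subset_closure hx
  have hmemD : ∀ x : EuclideanSpace ℝ (Fin n), r₁ < ‖x‖ → ‖x‖ < r₂ → x ∈ D := by
    intro x h1 h2
    rw [hD]; exact ⟨h1, h2⟩
  -- bounds for the norm on ω
  obtain ⟨a', b', ha', hb', hab⟩ : ∃ a' b' : ℝ, r₁ < a' ∧ b' < r₂ ∧ ∀ x ∈ ω, ‖x‖ ∈ Icc a' b' := by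
    obtain ⟨x1, hx1, h1⟩ := hωD.1.exists_isMinOn hωne.closure continuous_norm.continuousOn
    obtain ⟨x2, hx2, h2⟩ := hωD.1.exists_isMaxOn hωne.closure continuous_norm.continuousOn
    have k1 := hωD.2 hx1
    have k2 := hωD.2 hx2
    rw [hD] at k1 k2
    exact ⟨‖x1‖, ‖x2‖, k1.1, k2.2, fun x hx => ⟨h1 (subset_closure hx), h2 (subset_closure hx)⟩⟩
  set i0 : Fin n := ⟨0, hn⟩ with hi0
  set e : EuclideanSpace ℝ (Fin n) := EuclideanSpace.single i0 (1:ℝ) with he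
  have hne : ∀ r : ℝ, 0 ≤ r → ‖r • e‖ = r := fun r hr => norm_re i0 hr
  have hr0 : ∀ r ∈ Ioo r₁ r₂, 0 < r := fun r hr => hr₁.trans hr.1
  have hreD : ∀ r ∈ Ioo r₁ r₂, r • e ∈ D := by
    intro r hr
    exact hmemD _ (by rw [hne r (hr0 r hr).le]; exact hr.1) (by rw [hne r (hr0 r hr).le]; exact hr.2)
  have hreΩ : ∀ r ∈ Ioo r₁ r₂, r • e ∈ Ω := fun r hr => hDsub _ (hreD r hr)
  obtain ⟨C₀, hC₀, hfd⟩ := hf_deriv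
  obtain ⟨LF, F⟩ := FD_of hp hf_C1 hf_lim hC₀ hfd
  obtain ⟨CV, β, hβ, hβ1, hCV, hVh⟩ := hV_holder
  set μ : ℝ := ((n:ℝ)-1)/2 with hμ
  have hn1 : (1:ℝ) ≤ n := by exact_mod_cast hn
  have hμ0 : 0 ≤ μ := by rw [hμ]; linarith
  -- coefficient functions
  have hHV : HBd (fun r => V (r • e)) r₁ r₂ β := by
    set rm := (r₁+r₂)/2 with hrm
    have hrmI : rm ∈ Ioo r₁ r₂ := ⟨by rw [hrm]; linarith, by rw [hrm]; linarith⟩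
    have hh : ∀ x ∈ Ioo r₁ r₂, ∀ x' ∈ Ioo r₁ r₂, |V (x • e) - V (x' • e)| ≤ CV * |x-x'|^β := by
      intro x hx x' hx'
      have h := hVh _ (hcl _ (hreΩ x hx)) _ (hcl _ (hreΩ x' hx'))
      rw [← sub_smul, norm_smul, he, PiLp.norm_single, norm_one, mul_one, Real.norm_eq_abs] at h
      exact h
    have hW : 0 ≤ (r₂-r₁)^β := Real.rpow_nonneg (by linarith) _
    have hCW := mul_nonneg hCV hW
    refine ⟨1 + |V (rm • e)| + CV * (r₂-r₁)^β + CV, by linarith [abs_nonneg (V (rm • e))], ?_, ?_⟩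
    · intro x hx
      have h1 := hh x hx rm hrmI
      have h2 : |x-rm| ≤ r₂ - r₁ := abs_le.2 ⟨by linarith [hx.1, hrmI.2], by linarith [hx.2, hrmI.1]⟩
      have h3 := mul_le_mul_of_nonneg_left (Real.rpow_le_rpow (abs_nonneg _) h2 hβ.le) hCV
      have h4 := abs_add_le (V (x • e) - V (rm • e)) (V (rm • e))
      rw [sub_add_cancel] at h4
      linarith
    · intro x hx x' hx'
      refine (hh x hx x' hx').trans (mul_le_mul_of_nonneg_right ?_ (Real.rpow_nonneg (abs_nonneg _) _))
      linarith [abs_nonneg (V (rm • e))]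
  have hHc : HBd (fun _ => -(μ*(μ-1))) r₁ r₂ β := by
    refine ⟨1 + |-(μ*(μ-1))|, by linarith [abs_nonneg (-(μ*(μ-1)))], fun x _ => by linarith, ?_⟩
    intro x _ x' _
    rw [sub_self, abs_zero]
    exact mul_nonneg (by linarith [abs_nonneg (-(μ*(μ-1)))]) (Real.rpow_nonneg (abs_nonneg _) _)
  have hHA := hHc.mul (HBd_rpow hr₁ hr₁₂ hβ hβ1 (-2))
  have hHB := (HBd_rpow hr₁ hr₁₂ hβ hβ1 μ).mul hHV
  have hHC := HBd_rpow hr₁ hr₁₂ hβ hβ1 (-μ)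
  obtain ⟨CG, GG⟩ := GD_of hp F hβ hβ1 hHA hHB hHC
    (fun r hr => mul_nonneg (Real.rpow_nonneg (hr0 r hr).le _) (hV_nonneg _ (hcl _ (hreΩ r hr)))) (fun r hr => Real.rpow_pos_of_pos (hr0 r hr) _)
  -- radial derivatives
  have hI : ∀ t ∈ Ioo (T/4) T, t ∈ Ioo 0 T := fun t ht => ⟨by linarith [ht.1], ht.2⟩
  have hU : ∀ t ∈ Ioo 0 T, ∀ r ∈ Ioo r₁ r₂, HasDerivAt (fun ρ : ℝ => u t (ρ • e)) (fderiv ℝ (u t) (r • e) e) r ∧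
      HasDerivAt (fun ρ : ℝ => fderiv ℝ (u t) (ρ • e) e) (fderiv ℝ (fun y => fderiv ℝ (u t) y e) (r • e) e) r := by
    intro t ht r hr
    have := dir_deriv (F := u t) (x := 0) (d := e) (s := r) (by rw [zero_add]; exact hu_x t ht _ (hreΩ r hr))
    simpa using this
  have hU2c : ∀ t ∈ Ioo 0 T, ContinuousOn (fun r : ℝ => fderiv ℝ (fun y => fderiv ℝ (u t) y e) (r • e) e) (Ioo r₁ r₂) := by
    intro t ht r hr
    have h1 := dir_cont (F := u t) (d := e) (hu_x t ht _ (hreΩ r hr))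
    have h2 : ContinuousAt (fun r : ℝ => r • e) r := by fun_prop
    have h3 : ContinuousAt ((fun z => fderiv ℝ (fun y => fderiv ℝ (u t) y e) z e) ∘ (fun r : ℝ => r • e)) r :=
      ContinuousAt.comp (x := r) (f := fun r : ℝ => r • e) h1 h2
    exact h3.continuousWithinAt
  have hlap : ∀ t ∈ Ioo 0 T, ∀ r ∈ Ioo r₁ r₂, lap (u t) (r • e) = fderiv ℝ (fun y => fderiv ℝ (u t) y e) (r • e) e
      + ((n:ℝ)-1) * (fderiv ℝ (u t) (r • e) e / r) := by
    intro t ht r hr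
    exact lap_rad hr₁ i0 (fun x h1 h2 => hu_x t ht x (hDsub _ (hmemD x h1 h2)))
      (fun x y h1 h2 h3 => hu_rad t ht x (hDsub _ (hmemD x h1 h2)) y (hDsub _ (hmemD y (h3 ▸ h1) (h3 ▸ h2))) h3) hr
  have hn2 : (n:ℝ) - 1 = 2*μ := by rw [hμ]; ring
  have hpw : ∀ r ∈ Ioo r₁ r₂, r^(μ-1) = r^μ/r ∧ r^(μ-1-1) = r^μ/r/r ∧ r^(-2:ℝ) = 1/(r*r) := by
    intro r hr
    have h0 := (hr0 r hr).ne'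
    refine ⟨Real.rpow_sub_one h0 _, ?_, ?_⟩
    · rw [Real.rpow_sub_one h0, Real.rpow_sub_one h0]
    · rw [Real.rpow_neg (hr0 r hr).le, Real.rpow_two, sq, one_div]
  have hOD : OD (fun t r => r^μ * u t (r • e))
      (fun t r => μ * r^(μ-1) * u t (r • e) + r^μ * fderiv ℝ (u t) (r • e) e)
      (fun t r => (μ * ((μ-1) * r^(μ-1-1)) * u t (r • e) + μ * r^(μ-1) * fderiv ℝ (u t) (r • e) e)
        + (μ * r^(μ-1) * fderiv ℝ (u t) (r • e) e + r^μ * fderiv ℝ (fun y => fderiv ℝ (u t) y e) (r • e) e))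
      (fun r z => -(μ*(μ-1)) * r^(-2:ℝ) * z + r^μ * V (r • e) * f (r^(-μ) * z)) (T/4) T r₁ r₂ p (r₂^μ * M) := by
    refine ⟨?_, ?_, ?_, ?_, ?_, ?_⟩
    · intro t ht r hr
      have h1 := (hu_t t (hI t ht) _ (hreΩ r hr)).hasDerivAt
      rw [heq t (hI t ht) _ (hreΩ r hr)] at h1
      have h2 := h1.const_mul (r^μ)
      refine h2.congr_deriv ?_
      have h3 := hlap t (hI t ht) r hr
      have h3' : lap (fun y => u t y) (r • e) = lap (u t) (r • e) := rfl
      rw [h3', h3, hn2]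
      have hrp := hr0 r hr
      have h4 : r^(-μ) * (r^μ * u t (r • e)) = u t (r • e) := by
        rw [← mul_assoc, ← Real.rpow_add hrp]; simp
      obtain ⟨p1, p2, p3⟩ := hpw r hr
      simp only [h4, p1, p2, p3]
      field_simp
      ring
    · intro t ht r hr
      have h1 := Real.hasDerivAt_rpow_const (x := r) (p := μ) (Or.inl (hr0 r hr).ne')
      exact h1.mul (hU t (hI t ht) r hr).1
    · intro t ht r hr
      have h1 := Real.hasDerivAt_rpow_const (x := r) (p := μ) (Or.inl (hr0 r hr).ne')
      have h2 := (Real.hasDerivAt_rpow_const (x := r) (p := μ-1) (Or.inl (hr0 r hr).ne')).const_mul μ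
      exact (h2.mul (hU t (hI t ht) r hr).1).add (h1.mul (hU t (hI t ht) r hr).2)
    · intro t ht
      have c0 : ContinuousOn (fun r : ℝ => u t (r • e)) (Ioo r₁ r₂) := fun r hr => (hU t (hI t ht) r hr).1.continuousAt.continuousWithinAt
      have c1 : ContinuousOn (fun r : ℝ => fderiv ℝ (u t) (r • e) e) (Ioo r₁ r₂) := fun r hr => (hU t (hI t ht) r hr).2.continuousAt.continuousWithinAt
      have c2 := hU2c t (hI t ht)
      have cp : ∀ σ : ℝ, ContinuousOn (fun r : ℝ => r^σ) (Ioo r₁ r₂) := fun σ =>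
        ContinuousOn.rpow_const continuousOn_id (fun r hr => Or.inl (hr0 r hr).ne')
      exact (((continuousOn_const.mul (continuousOn_const.mul (cp _))).mul c0).add ((continuousOn_const.mul (cp _)).mul c1)).add
        (((continuousOn_const.mul (cp _)).mul c1).add ((cp _).mul c2))
    · intro t ht r hr
      exact mul_nonneg (Real.rpow_nonneg (hr0 r hr).le _) (hu_nonneg t (hI t ht) _ (hreΩ r hr))
    · intro t ht r hr
      have h1 := hTypeI t ht _ (hreD r hr)
      have h2 := Real.rpow_le_rpow (hr0 r hr).le hr.2.le hμ0
      have h3 := mul_le_mul h2 h1 (hu_nonneg t (hI t ht) _ (hreΩ r hr)) (Real.rpow_nonneg (by linarith) _)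
      refine h3.trans (le_of_eq ?_)
      ring
  -- constants
  have hr2 : 0 < r₂ := hr₁.trans hr₁₂
  have hP1 : 0 < r₁^(-μ) := Real.rpow_pos_of_pos hr₁ _
  have hP2 : 0 < (r₂^μ)^p := Real.rpow_pos_of_pos (Real.rpow_pos_of_pos hr2 _) _
  obtain ⟨C1, hC1, hmain⟩ := main1d hOD GG (mul_nonneg (Real.rpow_nonneg hr2.le _) hM.le) (T1 := T/2) (by linarith) (by linarith) ha' hb'
    (ε/(2*(r₁^(-μ) * (r₂^μ)^p))) (by positivity)
  set κ := |μ*(μ-1)| * (1/(r₁*r₁)) with hκ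
  have hκ0 : 0 ≤ κ := by positivity
  obtain ⟨C2, hC2, hlow⟩ := le_eps_pow hp (ε/(2*(κ+1))) (by positivity)
  refine ⟨r₁^(-μ)*C1 + κ*C2, by positivity, ?_⟩
  intro t ht x hx
  have htI : t ∈ Ioo 0 T := ⟨by linarith [ht.1], ht.2⟩
  set r := ‖x‖ with hr
  have hrab := hab x hx
  have hrI : r ∈ Ioo r₁ r₂ := ⟨by linarith [hrab.1], by linarith [hrab.2]⟩
  have hrp := hr0 r hrI
  have hxΩ : x ∈ Ω := hDsub _ (hωD.2 (subset_closure hx))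
  have hnr : ‖x‖ = ‖r • e‖ := by rw [hne r hrp.le]
  have e1 : u t x = u t (r • e) := hu_rad t htI x hxΩ _ (hreΩ r hrI) hnr
  have e3 : deriv (fun s => u s x) t = deriv (fun s => u s (r • e)) t := by
    refine Filter.EventuallyEq.deriv_eq ?_
    filter_upwards [Ioo_mem_nhds htI.1 htI.2] with s hs
    exact hu_rad s hs x hxΩ _ (hreΩ r hrI) hnr
  have e2 : V x = V (r • e) := hV_rad x (hcl _ hxΩ) _ (hcl _ (hreΩ r hrI)) hnr
  rw [e1, e2, e3, heq t htI _ (hreΩ r hrI), add_sub_cancel_right]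
  have hm := hmain t ht r hrab
  have h3 := hlap t htI r hrI
  have h3' : lap (fun y => u t y) (r • e) = lap (u t) (r • e) := rfl
  rw [h3']
  have hu0 := hu_nonneg t htI _ (hreΩ r hrI)
  obtain ⟨p1, p2, p3⟩ := hpw r hrI
  set W := (μ * ((μ-1) * r^(μ-1-1)) * u t (r • e) + μ * r^(μ-1) * fderiv ℝ (u t) (r • e) e)
        + (μ * r^(μ-1) * fderiv ℝ (u t) (r • e) e + r^μ * fderiv ℝ (fun y => fderiv ℝ (u t) y e) (r • e) e) with hW
  have hrm : r^(-μ) * r^μ = 1 := by rw [← Real.rpow_add hrp]; simp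
  have hlW : lap (u t) (r • e) = r^(-μ) * W - μ*(μ-1) * (1/(r*r)) * u t (r • e) := by
    rw [h3, hn2, hW, p1, p2]
    have hrμ : 0 < r^μ := Real.rpow_pos_of_pos hrp _
    have : r^(-μ) = 1/r^μ := by rw [Real.rpow_neg hrp.le, one_div]
    rw [this]
    field_simp
    ring
  rw [hlW]
  have hup : 0 ≤ u t (r • e)^p := Real.rpow_nonneg hu0 _
  have hq1 : r^(-μ) ≤ r₁^(-μ) := Real.rpow_le_rpow_of_nonpos hr₁ hrI.1.le (by linarith)
  have hq0 : 0 ≤ r^(-μ) := Real.rpow_nonneg hrp.le _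
  have hvp : (r^μ * u t (r • e))^p ≤ (r₂^μ)^p * u t (r • e)^p := by
    rw [Real.mul_rpow (Real.rpow_nonneg hrp.le _) hu0]
    refine mul_le_mul_of_nonneg_right ?_ hup
    exact Real.rpow_le_rpow (Real.rpow_nonneg hrp.le _) (Real.rpow_le_rpow hrp.le hrI.2.le hμ0) (by linarith)
  set δ := ε/(2*(r₁^(-μ) * (r₂^μ)^p)) with hδ
  have hδ0 : 0 ≤ δ := by positivity
  have k1 : |r^(-μ) * W| ≤ ε/2 * u t (r • e)^p + r₁^(-μ)*C1 := by
    rw [abs_mul, abs_of_nonneg hq0]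
    have j1 := mul_le_mul hq1 (hm.trans (add_le_add_left (mul_le_mul_of_nonneg_left hvp hδ0) C1)) (abs_nonneg _) hP1.le
    refine j1.trans (le_of_eq ?_)
    have : r₁^(-μ) * (δ * ((r₂^μ)^p * u t (r • e)^p) + C1) = (δ * (r₁^(-μ) * (r₂^μ)^p)) * u t (r • e)^p + r₁^(-μ)*C1 := by ring
    rw [this]
    have : δ * (r₁^(-μ) * (r₂^μ)^p) = ε/2 := by rw [hδ]; field_simp
    rw [this]
  have k2 : |μ*(μ-1) * (1/(r*r)) * u t (r • e)| ≤ ε/2 * u t (r • e)^p + κ*C2 := by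
    rw [abs_mul, abs_mul, abs_of_nonneg hu0, abs_of_pos (by positivity : 0 < 1/(r*r))]
    have j1 : 1/(r*r) ≤ 1/(r₁*r₁) := one_div_le_one_div_of_le (by positivity) (mul_le_mul hrI.1.le hrI.1.le hr₁.le hrp.le)
    have j2 := mul_le_mul_of_nonneg_left j1 (abs_nonneg (μ*(μ-1)))
    have j3 := mul_le_mul j2 (hlow _ hu0) hu0 hκ0
    refine j3.trans ?_
    have j4 : κ * (ε/(2*(κ+1))) ≤ ε/2 := by
      rw [mul_div_assoc', div_le_div_iff₀ (by positivity) (by norm_num)]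
      linarith
    have j5 := mul_le_mul_of_nonneg_right j4 hup
    rw [← hκ]
    linarith
  have k3 := abs_sub (r^(-μ) * W) (μ*(μ-1) * (1/(r*r)) * u t (r • e))
  linarith
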